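/- Let k be a positive integer. Let D > 1 be a squarefree fundamental discriminant and let ψ be the associated primitive quadratic character modulo D. Let q be a prime with q ∤ D. Then | Σ⁺_{χ mod q} (ε(χ)·ε(χψ))^k | ≤ 1/q^k + 2k·φ(q)/q^{1/2}. -/

import Mathlib

open Complex DirichletCharacter Finset

/-- `e(x) = exp(2πix)`. -/
noncomputable def eFun (x : ℝ) : ℂ := Complex.exp (2 * Real.pi * Complex.I * x)

/-- The root number `ε(χ) = τ(χ)/N^{1/2}` of a Dirichlet character mod `N`
(the terms with `(a, N) > 1` vanish since `χ a = 0` there). -/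
noncomputable def epsChar {N : ℕ} [NeZero N] (χ : DirichletCharacter ℂ N) : ℂ :=
  (Real.sqrt N : ℂ)⁻¹ * ∑ a : ZMod N, χ a * eFun ((a.val : ℝ) / N)

/-- The product of a character mod `q` and a character mod `D`, as a character mod `q * D`. -/
noncomputable def prodChar {q D : ℕ} (χ : DirichletCharacter ℂ q)
    (ψ : DirichletCharacter ℂ D) : DirichletCharacter ℂ (q * D) :=
  changeLevel (dvd_mul_right q D) χ * changeLevel (dvd_mul_left D q) ψ

noncomputable section

namespace HyperKloosterman

open scoped PowerSeries
open Filter (Tendsto atTop eventually_atTop eventually_ge_atTop tendsto_add_atTop_nat)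
open Matrix (add_mulVec algebraMap_eq_diagonal charpolyRev charpoly_natDegree_eq_dim cramer_apply
  cramer_eq_adjugate_mulVec det detRowAlternating det_apply' det_diagonal det_mul det_one diagonal fromBlocks
  fromBlocks_one fromRows_mul_fromCols map_apply mulVec mulVecLin_apply mulVec_mulVec mulVec_single_one mulVec_zero
  mul_nonsing_inv of of_apply one_apply_eq one_apply_ne one_mulVec reverse_charpoly smul_mul trace)
open Polynomial (C_mul aeval_X coeToPowerSeries coeff_eq_zero_of_natDegree_lt coeff_zero_eq_eval_zero cyclotomic
  eval eval_C eval_X eval_mul eval_one eval_prod eval_sub finsetSum_coeff mem_nthRootsFinset nthRootsFinset)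
open PowerSeries (coeff_mk coeff_succ_X_mul coeff_zero_eq_constantCoeff_apply rescale)
open Fintype (piFinset mem_piFinset piFinset_univ)
open IsUltrametricDist (norm_add_le_max norm_natCast_le_one norm_sum_le_of_forall_le_of_nonneg
  norm_tsum_le_of_forall_le_of_nonneg)

section LogDerivative

open Polynomial

/-- Jacobi's formula for the formal derivative of a determinant. -/
theorem derivative_det_eq_trace_adjugate {R ι : Type*} [CommRing R] [Fintype ι] [DecidableEq ι]
    (M : Matrix ι ι R[X]) :
    derivative M.det = (M.adjugate * M.map derivative).trace := by
  have h1 : ∀ i, (M.adjugate * M.map derivative) i i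
      = (M.updateCol i fun j => derivative (M j i)).det := by
    intro i
    rw [← cramer_apply, cramer_eq_adjugate_mulVec]
    rfl
  simp only [trace, Matrix.diag, h1, det_apply', map_sum]
  rw [sum_comm]
  refine sum_congr rfl fun σ _ => ?_
  rw [← mul_sum, ← Polynomial.C_eq_intCast, derivative_C_mul, derivative_prod_finset]
  congr 1
  refine sum_congr rfl fun i _ => ?_
  rw [← prod_erase_mul _ _ (mem_univ i)]
  congr 1
  · refine prod_congr rfl fun j hj => ?_
    rw [Matrix.updateCol_ne (ne_of_mem_erase hj)]
  · simp

/-- Newton's identities for the reversed characteristic polynomial: the logarithmic derivative of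
`det (1 - T A)` is the generating function of the traces of the powers of `A`. -/
theorem nat_mul_coeff_charpolyRev {R ι : Type*} [CommRing R] [Fintype ι] [DecidableEq ι]
    (A : Matrix ι ι R) (s : ℕ) :
    (s : R) * A.charpolyRev.coeff s
      = -∑ r ∈ range s, (A ^ (r + 1)).trace * A.charpolyRev.coeff (s - 1 - r) := by
  set f := A.charpolyRev with hf
  set M : Matrix ι ι R[X] := 1 - (X : R[X]) • A.map C with hM
  have hfM : f = M.det := rfl
  let N : ℕ → Matrix ι ι R := fun t => M.adjugate.map fun P : R[X] => P.coeff t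
  have hadj : M.adjugate - (X : R[X]) • (M.adjugate * A.map C) = f • (1 : Matrix ι ι R[X]) := by
    rw [hfM, ← Matrix.adjugate_mul, hM, mul_sub, mul_one, mul_smul_comm]
  have hmulC : ∀ t, (M.adjugate * A.map C).map (fun P : R[X] => P.coeff t) = N t * A := by
    intro t
    ext i j
    simp [N, Matrix.mul_apply]
  have hN : ∀ t, N t = ∑ r ∈ range (t + 1), f.coeff (t - r) • A ^ r := by
    intro t
    induction t with
    | zero =>
      ext i j
      have := congrArg (fun P : R[X] => P.coeff 0) (congrFun (congrFun hadj i) j)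
      by_cases hij : i = j <;> simp_all [N]
    | succ t ih =>
      have h2 : N (t + 1) = f.coeff (t + 1) • (1 : Matrix ι ι R) + N t * A := by
        rw [← hmulC]
        ext i j
        have := congrArg (fun P : R[X] => P.coeff (t + 1)) (congrFun (congrFun hadj i) j)
        simp only [Matrix.sub_apply, Matrix.smul_apply, smul_eq_mul, coeff_sub, coeff_X_mul,
          sub_eq_iff_eq_add] at this
        change (M.adjugate i j).coeff (t + 1) = (f.coeff (t + 1) • (1 : Matrix ι ι R)) i j
          + ((M.adjugate * A.map C) i j).coeff t
        rw [this]
        by_cases hij : i = j <;> simp [Matrix.one_apply, hij]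
      rw [h2, ih, sum_range_succ' _ (t + 1), sum_mul, add_comm]
      congr 1
      refine sum_congr rfl fun r _ => ?_
      rw [smul_mul, ← pow_succ, Nat.add_sub_add_right]
  cases s with
  | zero => simp
  | succ t =>
    have hder : derivative f = -(M.adjugate * A.map C).trace := by
      rw [hfM, derivative_det_eq_trace_adjugate]
      have : M.map derivative = -A.map C := by
        ext i j : 2
        by_cases hij : i = j <;> simp [hM, hij]
      rw [this, mul_neg, Matrix.trace_neg]
    have h3 := congrArg (fun P : R[X] => P.coeff t) hder
    simp only [coeff_derivative, coeff_neg] at h3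
    have h4 : ((M.adjugate * A.map C).trace).coeff t = (N t * A).trace := by
      rw [← hmulC, trace, trace, finsetSum_coeff]
      rfl
    rw [h4, hN, sum_mul, Matrix.trace_sum] at h3
    push_cast
    rw [mul_comm, h3]
    congr 1
    refine sum_congr rfl fun r _ => ?_
    rw [smul_mul, Matrix.trace_smul, ← pow_succ, smul_eq_mul, mul_comm]

/-- Coefficients determined by power sums through Newton's identities converge when the power
sums do. -/
theorem tendsto_of_newton {k : Type*} [NormedField k] [CharZero k] {α : Type*} {l : Filter α}
    {f p : α → ℕ → k} {g τ : ℕ → k}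
    (hf0 : ∀ a, f a 0 = 1) (hg0 : g 0 = 1)
    (hf : ∀ a (s : ℕ), (s : k) * f a s = -∑ r ∈ range s, p a r * f a (s - 1 - r))
    (hg : ∀ s : ℕ, (s : k) * g s = -∑ r ∈ range s, τ r * g (s - 1 - r))
    (hp : ∀ r, Tendsto (fun a => p a r) l (nhds (τ r))) (s : ℕ) :
    Tendsto (fun a => f a s) l (nhds (g s)) := by
  induction s using Nat.strong_induction_on with
  | _ s ih =>
    rcases Nat.eq_zero_or_pos s with rfl | hs
    · simpa [hf0, hg0] using tendsto_const_nhds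
    have hs' : (s : k) ≠ 0 := by exact_mod_cast hs.ne'
    have h1 : ∀ a, f a s = (s : k)⁻¹ * -∑ r ∈ range s, p a r * f a (s - 1 - r) := fun a => by
      rw [← hf, inv_mul_cancel_left₀ hs']
    have h2 : g s = (s : k)⁻¹ * -∑ r ∈ range s, τ r * g (s - 1 - r) := by
      rw [← hg, inv_mul_cancel_left₀ hs']
    simp only [h1]
    rw [h2]
    refine Tendsto.const_mul _ (Tendsto.neg (tendsto_finsetSum _ fun r hr => ?_))
    exact (hp r).mul (ih _ (by have := mem_range.1 hr; omega))

/-- Newton's identities determine the coefficients. -/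
theorem eq_of_newton {k : Type*} [Field k] [CharZero k] {f g τ : ℕ → k} (h0 : f 0 = g 0)
    (hf : ∀ s : ℕ, (s : k) * f s = -∑ r ∈ range s, τ r * f (s - 1 - r))
    (hg : ∀ s : ℕ, (s : k) * g s = -∑ r ∈ range s, τ r * g (s - 1 - r)) : f = g := by
  funext s
  induction s using Nat.strong_induction_on with
  | _ s ih =>
    rcases Nat.eq_zero_or_pos s with rfl | hs
    · exact h0
    have hs' : (s : k) ≠ 0 := by exact_mod_cast hs.ne'
    refine mul_left_cancel₀ hs' ?_
    rw [hf, hg]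
    congr 1
    refine sum_congr rfl fun r hr => ?_
    rw [ih _ (by have := mem_range.1 hr; omega)]

/-- The sequence attached by Newton's identities to a sequence of power sums `τ r`, where `τ r`
is the power sum of exponent `r + 1`. -/
def newtonSeq {k : Type*} [Field k] (τ : ℕ → k) : ℕ → k
  | 0 => 1
  | s + 1 => ((s + 1 : ℕ) : k)⁻¹ * -∑ r : Fin (s + 1), τ r * newtonSeq τ (s - r)
  decreasing_by omega

theorem newtonSeq_zero {k : Type*} [Field k] (τ : ℕ → k) : newtonSeq τ 0 = 1 := by
  rw [newtonSeq]

theorem nat_mul_newtonSeq {k : Type*} [Field k] [CharZero k] (τ : ℕ → k) (s : ℕ) :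
    (s : k) * newtonSeq τ s = -∑ r ∈ range s, τ r * newtonSeq τ (s - 1 - r) := by
  cases s with
  | zero => simp
  | succ s =>
    rw [newtonSeq, mul_inv_cancel_left₀ (by exact_mod_cast s.succ_ne_zero),
      sum_range fun r => τ r * newtonSeq τ (s + 1 - 1 - r)]
    rfl

theorem charpolyRev_coeff_zero {R ι : Type*} [CommRing R] [Fintype ι] [DecidableEq ι]
    (A : Matrix ι ι R) : A.charpolyRev.coeff 0 = 1 := by
  rw [coeff_zero_eq_eval_zero, Matrix.eval_charpolyRev]

end LogDerivative

section Growth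

open PowerSeries (coeff coeff_mul)

variable {k : Type*} [NormedField k]

/-- The coefficients of the power series `f` grow at most like `c ρ ^ s`. -/
def GrowthLE (ρ c : ℝ) (f : k⟦X⟧) : Prop :=
  ∀ s, ‖coeff s f‖ ≤ c * ρ ^ s

theorem norm_sum_le_of_forall [IsUltrametricDist k] {α : Type*} {s : Finset α} {f : α → k} {c : ℝ} (hc : 0 ≤ c)
    (h : ∀ i ∈ s, ‖f i‖ ≤ c) : ‖∑ i ∈ s, f i‖ ≤ c :=
  norm_sum_le_of_forall_le_of_nonneg hc h

theorem GrowthLE.mul [IsUltrametricDist k] {ρ c c' : ℝ} {f g : k⟦X⟧} (hρ : 0 ≤ ρ) (hc : 0 ≤ c) (hc' : 0 ≤ c')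
    (hf : GrowthLE ρ c f) (hg : GrowthLE ρ c' g) : GrowthLE ρ (c * c') (f * g) := by
  intro s
  rw [coeff_mul]
  refine norm_sum_le_of_forall (by positivity) fun i hi => ?_
  rw [← HasAntidiagonal.mem_antidiagonal.1 hi, norm_mul, pow_add]
  calc _ ≤ (c * ρ ^ i.1) * (c' * ρ ^ i.2) := by
        gcongr
        · exact hf _
        · exact hg _
    _ = _ := by ring

theorem GrowthLE.sum [IsUltrametricDist k] {α : Type*} {s : Finset α} {ρ c : ℝ} {f : α → k⟦X⟧} (hρ : 0 ≤ ρ)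
    (hc : 0 ≤ c) (hf : ∀ i ∈ s, GrowthLE ρ c (f i)) : GrowthLE ρ c (∑ i ∈ s, f i) := by
  intro t
  rw [map_sum]
  exact norm_sum_le_of_forall (by positivity) fun i hi => hf i hi t

theorem GrowthLE.one {ρ : ℝ} (hρ : 0 ≤ ρ) : GrowthLE ρ 1 (1 : k⟦X⟧) := by
  intro s
  rw [PowerSeries.coeff_one]
  split_ifs with h
  · simp [h]
  · simp only [norm_zero, one_mul]
    positivity

theorem GrowthLE.prod [IsUltrametricDist k] {α : Type*} {s : Finset α} {ρ : ℝ} {c : α → ℝ} {f : α → k⟦X⟧}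
    (hρ : 0 ≤ ρ) (hc : ∀ i, 0 ≤ c i) (hf : ∀ i ∈ s, GrowthLE ρ (c i) (f i)) :
    GrowthLE ρ (∏ i ∈ s, c i) (∏ i ∈ s, f i) := by
  classical
  induction s using Finset.induction_on with
  | empty => simpa using GrowthLE.one hρ
  | insert a s ha ih =>
    rw [prod_insert ha, prod_insert ha]
    exact (hf a (by simp)).mul hρ (hc a) (prod_nonneg fun i _ => hc i)
      (ih fun i hi => hf i (by simp [hi]))

theorem GrowthLE.mono {ρ ρ' c c' : ℝ} {f : k⟦X⟧} (hf : GrowthLE ρ c f) (hρ : 0 ≤ ρ)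
    (hc : 0 ≤ c) (hρρ : ρ ≤ ρ') (hcc : c ≤ c') : GrowthLE ρ' c' f := fun s =>
  (hf s).trans (by have := hc.trans hcc; gcongr)

/-- A power series with constant term one and its inverse have the same growth. -/
theorem GrowthLE.of_mul_eq_one [IsUltrametricDist k] {ρ : ℝ} {f g : k⟦X⟧} (hρ : 0 ≤ ρ) (hf : GrowthLE ρ 1 f)
    (hf0 : coeff 0 f = 1) (hfg : f * g = 1) : GrowthLE ρ 1 g := by
  intro s
  induction s using Nat.strong_induction_on with
  | _ s ih =>
    have h := congrArg (coeff s) hfg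
    rw [coeff_mul, Nat.sum_antidiagonal_eq_sum_range_succ_mk,
      sum_range_succ'] at h
    simp only [hf0, one_mul, Nat.sub_zero] at h
    rw [← eq_sub_iff_add_eq'] at h
    rw [h]
    rw [sub_eq_add_neg]
    refine (norm_add_le_max _ _).trans (max_le ?_ (norm_neg _ |>.trans_le ?_))
    · exact GrowthLE.one hρ s
    · refine norm_sum_le_of_forall (by positivity) fun i hi => ?_
      have hi' := mem_range.1 hi
      have h2 := ih (s - (i + 1)) (by omega)
      rw [norm_mul]
      calc _ ≤ (1 * ρ ^ (i + 1)) * (1 * ρ ^ (s - (i + 1))) := by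
            gcongr
            exact hf _
        _ = _ := by
            rw [one_mul, one_mul, one_mul, ← pow_add]
            congr 1
            omega

/-- Hadamard's bound: the reversed characteristic polynomial of a matrix with small rows. -/
theorem growthLE_charpolyRev [IsUltrametricDist k] {κ : Type*} [Fintype κ] [DecidableEq κ] {A : Matrix κ κ k}
    {a : κ → ℝ} (hA : ∀ i j, ‖A i j‖ ≤ a i) {ρ : ℝ} (hρ : 0 < ρ) :
    GrowthLE ρ (∏ i, max 1 (a i / ρ)) (A.charpolyRev : k⟦X⟧) := by
  have hmap : (A.charpolyRev : k⟦X⟧) = ∑ σ : Equiv.Perm κ, Equiv.Perm.sign σ •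
      ∏ i, (((1 - (Polynomial.X : Polynomial k) • A.map Polynomial.C) (σ i) i : Polynomial k) :
        k⟦X⟧) := by
    rw [charpolyRev, Matrix.det_apply, ← coeToPowerSeries.ringHom_apply, map_sum]
    refine sum_congr rfl fun σ _ => ?_
    rw [Units.smul_def, Units.smul_def, map_zsmul, map_prod]
    rfl
  rw [hmap]
  refine GrowthLE.sum hρ.le (by positivity) fun σ _ => ?_
  have key : GrowthLE ρ (∏ i, max 1 (a i / ρ)) (∏ i, (((1 - (Polynomial.X : Polynomial k) •
      A.map Polynomial.C) (σ i) i : Polynomial k) : k⟦X⟧)) := by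
    rw [← Equiv.prod_comp σ fun i => max 1 (a i / ρ)]
    refine GrowthLE.prod hρ.le (fun i => by positivity) fun i _ s => ?_
    rw [Polynomial.coeff_coe, Matrix.sub_apply, Matrix.smul_apply, map_apply, smul_eq_mul,
      Polynomial.coeff_sub]
    have h1 : ((1 : Matrix κ κ (Polynomial k)) (σ i) i).coeff s
        = if s = 0 then (1 : Matrix κ κ k) (σ i) i else 0 := by
      by_cases h : σ i = i <;> simp [Matrix.one_apply, h, Polynomial.coeff_one]
    have h2 : ‖(1 : Matrix κ κ k) (σ i) i‖ ≤ 1 := by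
      by_cases h : σ i = i <;> simp [Matrix.one_apply, h]
    rw [h1]
    rcases s with _ | _ | s
    · simpa using h2.trans (le_max_left _ _)
    · have := (hA (σ i) i).trans (le_of_eq (div_mul_cancel₀ (a (σ i)) hρ.ne').symm)
      simpa using this.trans (by gcongr; exact le_max_right _ _)
    · simp
      positivity
  intro s
  rcases Int.units_eq_one_or (Equiv.Perm.sign σ) with h | h
  · rw [h, one_smul]
    exact key s
  · rw [h, Units.neg_smul, one_smul, map_neg, norm_neg]
    exact key s

end Growth

section FiniteMatrix

open Polynomial

theorem charpolyRev_mul_comm' {R κ κ' : Type*} [CommRing R] [Fintype κ] [DecidableEq κ]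
    [Fintype κ'] [DecidableEq κ'] (A : Matrix κ κ' R) (B : Matrix κ' κ R) :
    (A * B).charpolyRev = (B * A).charpolyRev := by
  rw [charpolyRev, charpolyRev, Matrix.map_mul, Matrix.map_mul, ← smul_mul,
    Matrix.det_one_sub_mul_comm, Matrix.mul_smul]

theorem charpolyRev_fromBlocks {R κ κ' : Type*} [CommRing R] [Fintype κ] [DecidableEq κ]
    [Fintype κ'] [DecidableEq κ'] (A : Matrix κ κ R) (B : Matrix κ κ' R) (D : Matrix κ' κ' R) :
    (fromBlocks A B 0 D).charpolyRev = A.charpolyRev * D.charpolyRev := by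
  have : (1 - (X : R[X]) • (fromBlocks A B 0 D).map C)
      = fromBlocks (1 - (X : R[X]) • A.map C) (-((X : R[X]) • B.map C)) 0
          (1 - (X : R[X]) • D.map C) := by
    rw [Matrix.fromBlocks_map, Matrix.fromBlocks_smul, ← fromBlocks_one,
      sub_eq_add_neg, Matrix.fromBlocks_neg, Matrix.fromBlocks_add]
    simp [sub_eq_add_neg]
  rw [charpolyRev, this, Matrix.det_fromBlocks_zero₂₁]
  rfl

/-- Splitting a matrix along an invariant subspace. -/
theorem exists_block_of_invariant {k κ : Type*} [Field k] [Fintype κ] [DecidableEq κ]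
    (m : Matrix κ κ k) (N : Submodule k (κ → k)) (hN : ∀ x ∈ N, m.mulVec x ∈ N) :
    ∃ (e₁ e₂ : ℕ) (P₁ : Matrix κ (Fin e₁) k) (P₂ : Matrix κ (Fin e₂) k)
      (m₁ : Matrix (Fin e₁) (Fin e₁) k) (m₂ : Matrix (Fin e₂) (Fin e₂) k)
      (Y : Matrix (Fin e₁) (Fin e₂) k) (Q₁ : Matrix (Fin e₁) κ k),
      m * P₁ = P₁ * m₁ ∧ m * P₂ = P₁ * Y + P₂ * m₂ ∧ Q₁ * P₁ = 1 ∧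
      (∀ c, P₁.mulVec c ∈ N) ∧ (∀ c, P₂.mulVec c ∈ N → c = 0) ∧
      m.charpolyRev = m₁.charpolyRev * m₂.charpolyRev := by
  obtain ⟨N', hc⟩ := Submodule.exists_isCompl N
  let b₁ := Module.finBasis k N
  let b₂ := Module.finBasis k N'
  let B := (b₁.prod b₂).map (Submodule.prodEquivOfIsCompl N N' hc)
  let P : Matrix κ (Fin (Module.finrank k N) ⊕ Fin (Module.finrank k N')) k :=
    (Pi.basisFun k κ).toMatrix B
  let Q : Matrix (Fin (Module.finrank k N) ⊕ Fin (Module.finrank k N')) κ k :=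
    B.toMatrix (Pi.basisFun k κ)
  have hPQ : P * Q = 1 := Module.Basis.toMatrix_mul_toMatrix_flip _ _
  have hQP : Q * P = 1 := Module.Basis.toMatrix_mul_toMatrix_flip _ _
  have hP1 : ∀ c, (P.toCols₁).mulVec c ∈ N := by
    intro c
    have : (P.toCols₁).mulVec c = ∑ j, c j • (b₁ j : κ → k) := by
      ext i
      simp [mulVec, dotProduct, P, B, Module.Basis.toMatrix_apply, mul_comm]
    rw [this]
    exact Submodule.sum_mem _ fun j _ => Submodule.smul_mem _ _ (b₁ j).2
  have hP2 : ∀ c, (P.toCols₂).mulVec c ∈ N' := by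
    intro c
    have : (P.toCols₂).mulVec c = ∑ j, c j • (b₂ j : κ → k) := by
      ext i
      simp [mulVec, dotProduct, P, B, Module.Basis.toMatrix_apply, mul_comm]
    rw [this]
    exact Submodule.sum_mem _ fun j _ => Submodule.smul_mem _ _ (b₂ j).2
  have hP : P = Matrix.fromCols P.toCols₁ P.toCols₂ := (Matrix.fromCols_toCols P).symm
  have hQ : Q = Matrix.fromRows Q.toRows₁ Q.toRows₂ := (Matrix.fromRows_toRows Q).symm
  have hblk : fromBlocks (Q.toRows₁ * P.toCols₁) (Q.toRows₁ * P.toCols₂)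
      (Q.toRows₂ * P.toCols₁) (Q.toRows₂ * P.toCols₂) = 1 := by
    rw [← hQP]
    conv_rhs => rw [hP, hQ]
    rw [fromRows_mul_fromCols]
  rw [← fromBlocks_one, Matrix.fromBlocks_inj] at hblk
  obtain ⟨h11, h12, h21, h22⟩ := hblk
  have hN0 : ∀ x ∈ N, Q.toRows₂.mulVec x = 0 := by
    intro x hx
    ext i
    have h1 : Q.mulVec ((Pi.basisFun k κ).repr x) = B.repr x :=
      Module.Basis.toMatrix_mulVec_repr (Pi.basisFun k κ) B x
    have h2 : Q.toRows₂.mulVec x i = (Q.mulVec ((Pi.basisFun k κ).repr x)) (Sum.inr i) := rfl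
    have h3 : (Submodule.prodEquivOfIsCompl N N' hc).symm x = (⟨x, hx⟩, 0) := by
      rw [LinearEquiv.symm_apply_eq]
      simp
    rw [h2, h1, Module.Basis.map_repr, LinearEquiv.trans_apply, h3]
    simp
  have hsum : P.toCols₁ * Q.toRows₁ + P.toCols₂ * Q.toRows₂ = 1 := by
    rw [← hPQ]
    conv_rhs => rw [hP, hQ]
    rw [Matrix.fromCols_mul_fromRows]
  have hzero : Q.toRows₂ * (m * P.toCols₁) = 0 := by
    ext i j
    have := congrFun (hN0 _ (hN _ (hP1 (Pi.single j 1)))) i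
    rw [mulVec_mulVec, mulVec_mulVec] at this
    simpa [Matrix.mul_assoc] using this
  refine ⟨_, _, P.toCols₁, P.toCols₂, Q.toRows₁ * (m * P.toCols₁), Q.toRows₂ * (m * P.toCols₂),
    Q.toRows₁ * (m * P.toCols₂), Q.toRows₁, ?_, ?_, h11, hP1, ?_, ?_⟩
  · conv_lhs => rw [← Matrix.one_mul (m * P.toCols₁), ← hsum, Matrix.add_mul, Matrix.mul_assoc,
      Matrix.mul_assoc, hzero, Matrix.mul_zero, add_zero]
  · conv_lhs => rw [← Matrix.one_mul (m * P.toCols₂), ← hsum, Matrix.add_mul, Matrix.mul_assoc,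
      Matrix.mul_assoc]
  · intro c hcN
    have := hN0 _ hcN
    rwa [mulVec_mulVec, h22, one_mulVec] at this
  · have h1 : m.charpolyRev = (Q * (m * P)).charpolyRev := by
      rw [charpolyRev_mul_comm', Matrix.mul_assoc, hPQ, Matrix.mul_one]
    have h2 : Q * (m * P) = fromBlocks (Q.toRows₁ * (m * P.toCols₁))
        (Q.toRows₁ * (m * P.toCols₂)) 0 (Q.toRows₂ * (m * P.toCols₂)) := by
      conv_lhs => rw [hP, hQ, Matrix.mul_fromCols, fromRows_mul_fromCols, hzero]
    rw [h1, h2, charpolyRev_fromBlocks]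

/-- `x - y` divides `P(x) - P(y)` when `x` and `y` commute. -/
theorem exists_aeval_sub_aeval_eq_mul {R A : Type*} [CommRing R] [Ring A] [Algebra R A] {x y : A}
    (h : Commute x y) (P : R[X]) : ∃ S : A, aeval x P - aeval y P = (x - y) * S := by
  induction P using Polynomial.induction_on' with
  | add P Q hP hQ =>
    obtain ⟨S, hS⟩ := hP
    obtain ⟨S', hS'⟩ := hQ
    exact ⟨S + S', by rw [mul_add, ← hS, ← hS', map_add, map_add]; abel⟩
  | monomial n a =>
    refine ⟨a • ∑ i ∈ range n, x ^ i * y ^ (n - 1 - i), ?_⟩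
    rw [mul_smul_comm, h.mul_geom_sum₂, aeval_monomial, aeval_monomial, smul_sub,
      Algebra.smul_def, Algebra.smul_def]

/-- The characteristic polynomial divides a power of any annihilating polynomial. -/
theorem charpoly_dvd_pow_of_aeval_eq_zero {R κ : Type*} [CommRing R] [Fintype κ] [DecidableEq κ]
    (m : Matrix κ κ R) (P : R[X]) (h : aeval m P = 0) :
    m.charpoly ∣ P ^ Fintype.card κ := by
  have hc : Commute (algebraMap R[X] (Matrix κ κ R[X]) X) (m.map C) :=
    Algebra.commutes _ _
  obtain ⟨S, hS⟩ := exists_aeval_sub_aeval_eq_mul hc P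
  have h1 : aeval (m.map C) P = 0 := by
    have := aeval_algHom_apply (Algebra.ofId R R[X]).mapMatrix m P
    rw [h, map_zero] at this
    exact this
  have h2 : aeval (algebraMap R[X] (Matrix κ κ R[X]) X) P = algebraMap R[X] _ P := by
    rw [aeval_algebraMap_apply, aeval_X_left_apply]
  rw [h1, h2, sub_zero] at hS
  refine ⟨S.det, ?_⟩
  have := congrArg det hS
  rw [det_mul, algebraMap_eq_diagonal, det_diagonal] at this
  simpa [Matrix.charpoly, Matrix.charmatrix, algebraMap_eq_diagonal, Pi.algebraMap_def]
    using this

end FiniteMatrix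

section Slopes

open Polynomial

variable {k : Type*} [NontriviallyNormedField k]

/-- All roots of `P` have absolute value at least `ε`. -/
def RootsGE (ε : ℝ) (P : k[X]) : Prop :=
  ∀ h : k[X], h.Monic → Irreducible h → h ∣ P → ε ^ h.natDegree ≤ ‖h.coeff 0‖

/-- All roots of `P` have absolute value less than `ε`. -/
def RootsLT (ε : ℝ) (P : k[X]) : Prop :=
  ∀ h : k[X], h.Monic → Irreducible h → h ∣ P → ‖h.coeff 0‖ < ε ^ h.natDegree

theorem exists_mul_rootsGE_rootsLT (ε : ℝ) (f : k[X]) (hf : f ≠ 0) :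
    ∃ P R, f = P * R ∧ RootsGE ε P ∧ RootsLT ε R := by
  classical
  induction f using WfDvdMonoid.induction_on_irreducible with
  | zero => exact absurd rfl hf
  | unit u hu =>
    exact ⟨u, 1, (mul_one u).symm, fun h _ hi hd => absurd (isUnit_of_dvd_unit hd hu) hi.not_isUnit,
      fun h _ hi hd => absurd (isUnit_of_dvd_one hd) hi.not_isUnit⟩
  | mul a i ha hi ih =>
    obtain ⟨P, R, rfl, hP, hR⟩ := ih ha
    have key : ∀ h Q : k[X], h.Monic → Irreducible h → h ∣ i * Q → h = normalize i ∨ h ∣ Q := by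
      intro h Q hm hirr hd
      rcases hirr.prime.dvd_or_dvd hd with h1 | h1
      · left
        have h2 := hirr.associated_of_dvd hi h1
        rw [← hm.normalize_eq_self]
        exact normalize_eq_normalize_iff_associated.2 h2
      · exact Or.inr h1
    by_cases hε : ε ^ (normalize i).natDegree ≤ ‖(normalize i).coeff 0‖
    · refine ⟨i * P, R, (mul_assoc _ _ _).symm, fun h hm hirr hd => ?_, hR⟩
      rcases key h P hm hirr hd with rfl | h1
      · exact hε
      · exact hP h hm hirr h1
    · refine ⟨P, i * R, by ring, hP, fun h hm hirr hd => ?_⟩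
      rcases key h R hm hirr hd with rfl | h1
      · exact not_le.1 hε
      · exact hR h hm hirr h1

theorem RootsGE.of_dvd_pow {ε : ℝ} {P f : k[X]} {n : ℕ} (hP : RootsGE ε P) (h : f ∣ P ^ n) :
    RootsGE ε f := fun g hm hi hd => hP g hm hi (hi.prime.dvd_of_dvd_pow (hd.trans h))

theorem RootsLT.of_dvd_pow {ε : ℝ} {P f : k[X]} {n : ℕ} (hP : RootsLT ε P) (h : f ∣ P ^ n) :
    RootsLT ε f := fun g hm hi hd => hP g hm hi (hi.prime.dvd_of_dvd_pow (hd.trans h))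

theorem monic_induction {p : k[X] → Prop} (one : p 1)
    (mul : ∀ h f, h.Monic → Irreducible h → f.Monic → p f → p (h * f)) {f : k[X]}
    (hf : f.Monic) : p f := by
  induction hn : f.natDegree using Nat.strong_induction_on generalizing f with
  | _ n ih =>
    by_cases hu : IsUnit f
    · rw [hf.eq_one_of_isUnit hu]
      exact one
    · obtain ⟨g, hgm, hgi, f', rfl⟩ := exists_monic_irreducible_factor f hu
      have hf' : f'.Monic := hgm.of_mul_monic_left hf
      refine mul g f' hgm hgi hf' (ih _ ?_ hf' rfl)
      rw [← hn, hgm.natDegree_mul hf']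
      have := hgi.natDegree_pos
      omega

theorem RootsGE.pow_le_norm_coeff_zero {ε : ℝ} (hε : 0 ≤ ε) {f : k[X]} (hf : f.Monic)
    (h : RootsGE ε f) : ε ^ f.natDegree ≤ ‖f.coeff 0‖ := by
  revert h
  refine monic_induction (p := fun f => RootsGE ε f → ε ^ f.natDegree ≤ ‖f.coeff 0‖)
    (by simp) (fun g f hgm hgi hfm ih h => ?_) hf
  rw [hgm.natDegree_mul hfm, pow_add, mul_coeff_zero, norm_mul]
  exact mul_le_mul (h g hgm hgi (dvd_mul_right _ _))
    (ih fun g' hm hi hd => h g' hm hi (hd.mul_left _)) (by positivity) (norm_nonneg _)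

theorem norm_coeff_le_of_irreducible [IsUltrametricDist k] [CompleteSpace k] {h : k[X]}
    (hm : h.Monic) (hi : Irreducible h) {ε : ℝ} (hε : 0 < ε) (h0 : ‖h.coeff 0‖ < ε ^ h.natDegree)
    (s : ℕ) (hs : s ≤ h.natDegree) : ‖h.coeff (h.natDegree - s)‖ ≤ ε ^ s := by
  rcases Nat.eq_zero_or_pos s with rfl | hs0
  · simp [hm.coeff_natDegree]
  have : Fact (Irreducible h) := ⟨hi⟩
  have hmin : minpoly k (AdjoinRoot.root h) = h := by
    rw [AdjoinRoot.minpoly_root hi.ne_zero, hm.leadingCoeff, inv_one, map_one, mul_one]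
  have : FiniteDimensional k (AdjoinRoot h) := hm.finite_adjoinRoot
  have h1 := spectralNorm.spectralNorm_eq_norm_coeff_zero_rpow (K := k) (L := AdjoinRoot h) (AdjoinRoot.root h)
  have hd : 0 < h.natDegree := hi.natDegree_pos
  have hdR : (0 : ℝ) < h.natDegree := by exact_mod_cast hd
  rw [hmin] at h1
  have h2 : spectralNorm k (AdjoinRoot h) (AdjoinRoot.root h) ≤ ε := by
    rw [h1]
    calc _ ≤ (ε ^ h.natDegree) ^ (1 / h.natDegree : ℝ) := by gcongr
      _ = ε := by
        rw [← Real.rpow_natCast, ← Real.rpow_mul hε.le, mul_one_div_cancel hdR.ne', Real.rpow_one]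
  rw [spectralNorm, hmin] at h2
  have h3 : spectralValueTerms h (h.natDegree - s) ≤ ε :=
    (le_ciSup (spectralValueTerms_bddAbove h) _).trans h2
  rw [spectralValueTerms_of_lt_natDegree _ (by omega)] at h3
  have h4 : (h.natDegree : ℝ) - ((h.natDegree - s : ℕ) : ℝ) = s := by
    rw [Nat.cast_sub hs]
    ring
  rw [h4] at h3
  have hsR : (0 : ℝ) < s := by exact_mod_cast hs0
  calc _ = (‖h.coeff (h.natDegree - s)‖ ^ (1 / s : ℝ)) ^ s := by
        rw [← Real.rpow_natCast, ← Real.rpow_mul (norm_nonneg _), one_div_mul_cancel hsR.ne',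
          Real.rpow_one]
    _ ≤ ε ^ s := by gcongr

theorem RootsLT.growthLE_reverse [IsUltrametricDist k] [CompleteSpace k] {ε : ℝ} (hε : 0 < ε)
    {f : k[X]} (hf : f.Monic) (h : RootsLT ε f) :
    GrowthLE ε 1 (f.reverse : k⟦X⟧) := by
  revert h
  refine monic_induction (p := fun f => RootsLT ε f → GrowthLE ε 1 (f.reverse : k⟦X⟧))
    (fun _ => ?_) (fun g f hgm hgi hfm ih h => ?_) hf
  · have : (1 : k[X]).reverse = 1 := by
      rw [← C_1, reverse_C]
    rw [this, Polynomial.coe_one]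
    exact GrowthLE.one hε.le
  · rw [reverse_mul_of_domain, Polynomial.coe_mul, ← one_mul (1 : ℝ)]
    refine GrowthLE.mul hε.le zero_le_one zero_le_one (fun s => ?_)
      (ih fun g' hm hi hd => h g' hm hi (hd.mul_left _))
    rw [Polynomial.coeff_coe, coeff_reverse, one_mul]
    by_cases hs : s ≤ g.natDegree
    · rw [revAt_le hs]
      exact norm_coeff_le_of_irreducible hgm hgi hε (h g hgm hgi (dvd_mul_right _ _)) s hs
    · rw [revAt_eq_self_of_lt (not_le.1 hs), coeff_eq_zero_of_natDegree_lt (not_le.1 hs), norm_zero]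
      positivity

theorem aeval_mul_of_mul_eq {R κ κ' : Type*} [CommRing R] [Fintype κ] [DecidableEq κ]
    [Fintype κ'] [DecidableEq κ'] {A : Matrix κ κ R} {B : Matrix κ κ' R} {m : Matrix κ' κ' R}
    (h : A * B = B * m) (P : R[X]) : aeval A P * B = B * aeval m P := by
  induction P using Polynomial.induction_on' with
  | add P Q hP hQ => rw [map_add, map_add, Matrix.add_mul, Matrix.mul_add, hP, hQ]
  | monomial n a =>
    have : A ^ n * B = B * m ^ n := by
      induction n with
      | zero => simp
      | succ n ih => rw [pow_succ, Matrix.mul_assoc, h, ← Matrix.mul_assoc, ih, pow_succ,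
          Matrix.mul_assoc]
    rw [← C_mul_X_pow_eq_monomial, map_mul, map_mul, aeval_C, aeval_C, map_pow, map_pow, aeval_X,
      aeval_X, Algebra.algebraMap_eq_smul_one, Algebra.algebraMap_eq_smul_one, smul_mul_assoc,
      smul_mul_assoc, one_mul, one_mul, smul_mul, Matrix.mul_smul, this]

/-- Splitting a matrix according to the size of its eigenvalues. -/
theorem exists_slope_splitting [IsUltrametricDist k] [CompleteSpace k] {κ : Type*} [Fintype κ]
    [DecidableEq κ] (A : Matrix κ κ k) {ε : ℝ} (hε : 0 < ε) :
    ∃ (e : ℕ) (b : Matrix κ (Fin e) k) (l : Matrix (Fin e) κ k) (m : Matrix (Fin e) (Fin e) k)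
      (u : k[X]), A * b = b * m ∧ l * b = 1 ∧ ε ^ e ≤ ‖m.det‖ ∧
      A.charpolyRev = m.charpolyRev * u ∧ GrowthLE ε 1 (u : k⟦X⟧) ∧ u.coeff 0 = 1 := by
  obtain ⟨P, R, hPR, hP, hR⟩ := exists_mul_rootsGE_rootsLT ε A.charpoly A.charpoly_monic.ne_zero
  let N : Submodule k (κ → k) := LinearMap.ker (aeval A P).mulVecLin
  have hmemN : ∀ x, x ∈ N ↔ (aeval A P).mulVec x = 0 := fun x => by simp [N]
  have hcomm : ∀ Q : k[X], aeval A P * aeval A Q = aeval A Q * aeval A P := fun Q => by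
    rw [← map_mul, mul_comm, map_mul]
  obtain ⟨e₁, e₂, P₁, P₂, m₁, m₂, Y, Q₁, h1, h2, h3, h4, h5, h6⟩ :=
    exists_block_of_invariant A N fun x hx => by
      rw [hmemN] at hx ⊢
      have := hcomm X
      rw [aeval_X] at this
      rw [mulVec_mulVec, this, ← mulVec_mulVec, hx, mulVec_zero]
  have hPm1 : aeval m₁ P = 0 := by
    have h7 : aeval A P * P₁ = 0 := by
      ext i j
      have := congrFun ((hmemN _).1 (h4 (Pi.single j 1))) i
      rw [mulVec_mulVec] at this
      simpa using this
    rw [aeval_mul_of_mul_eq h1] at h7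
    rw [← Matrix.one_mul (aeval m₁ P), ← h3, Matrix.mul_assoc, h7, Matrix.mul_zero]
  have hRm2 : aeval m₂ R = 0 := by
    have h8 : ∀ Q : k[X], ∃ Z : Matrix (Fin e₁) (Fin e₂) k,
        aeval A Q * P₂ = P₁ * Z + P₂ * aeval m₂ Q := by
      intro Q
      induction Q using Polynomial.induction_on with
      | C a => exact ⟨0, by simp [Algebra.algebraMap_eq_smul_one]⟩
      | add Q Q' hQ hQ' =>
        obtain ⟨Z, hZ⟩ := hQ
        obtain ⟨Z', hZ'⟩ := hQ'
        exact ⟨Z + Z', by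
          rw [map_add, map_add, Matrix.add_mul, hZ, hZ', Matrix.mul_add, Matrix.mul_add]; abel⟩
      | monomial n a ih =>
        obtain ⟨Z, hZ⟩ := ih
        refine ⟨m₁ * Z + Y * aeval m₂ (C a * X ^ n), ?_⟩
        have : C a * X ^ (n + 1) = X * (C a * X ^ n) := by ring
        rw [this, map_mul _ X, map_mul _ X, aeval_X, aeval_X, Matrix.mul_assoc, hZ, Matrix.mul_add,
          ← Matrix.mul_assoc, h1, ← Matrix.mul_assoc, h2, Matrix.add_mul, Matrix.mul_add,
          Matrix.mul_assoc, Matrix.mul_assoc, Matrix.mul_assoc, add_assoc]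
    obtain ⟨Z, hZ⟩ := h8 R
    have h9 : ∀ c, (aeval m₂ R).mulVec c = 0 := by
      intro c
      apply h5
      have h10 : P₂.mulVec ((aeval m₂ R).mulVec c)
          = (aeval A R).mulVec (P₂.mulVec c) - P₁.mulVec (Z.mulVec c) := by
        rw [mulVec_mulVec, mulVec_mulVec, hZ, mulVec_mulVec,
          add_mulVec, add_sub_cancel_left]
      rw [h10]
      refine Submodule.sub_mem _ ((hmemN _).2 ?_) (h4 _)
      rw [mulVec_mulVec, ← map_mul, ← hPR, Matrix.aeval_self_charpoly, Matrix.zero_mulVec]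
    ext i j
    have := congrFun (h9 (Pi.single j 1)) i
    simpa using this
  refine ⟨e₁, P₁, Q₁, m₁, m₂.charpolyRev, h1, h3, ?_, h6, ?_, charpolyRev_coeff_zero _⟩
  · have := (hP.of_dvd_pow (charpoly_dvd_pow_of_aeval_eq_zero m₁ P hPm1)).pow_le_norm_coeff_zero
      hε.le m₁.charpoly_monic
    rw [Matrix.det_eq_sign_charpoly_coeff, norm_mul, norm_pow, norm_neg, norm_one, one_pow, one_mul]
    simpa [charpoly_natDegree_eq_dim] using this
  · rw [← reverse_charpoly]
    exact (hR.of_dvd_pow (charpoly_dvd_pow_of_aeval_eq_zero m₂ R hRm2)).growthLE_reverse hε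
      m₂.charpoly_monic

/-- Normalization of a basis by a maximal minor. -/
theorem exists_normalized_basis {κ : Type*} [Fintype κ] {e : ℕ}
    (b : Matrix κ (Fin e) k) (l : Matrix (Fin e) κ k) (hl : l * b = 1) :
    ∃ (J : Fin e → κ) (S S' : Matrix (Fin e) (Fin e) k), S * S' = 1 ∧ S' * S = 1 ∧
      (b * S).submatrix J id = 1 ∧ ∀ i j, ‖(b * S) i j‖ ≤ 1 := by
  classical
  have hex : ∃ J : Fin e → κ, (b.submatrix J id).det ≠ 0 := by
    by_contra! hcon
    have h1 : (l * b).det = 0 := by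
      have h2 : (l * b).det = detRowAlternating (fun i => ∑ j, l i j • b j) := by
        change (l * b).det = det _
        congr 1
        ext i j
        simp [Matrix.mul_apply]
      have h3 := (detRowAlternating (n := Fin e) (R := k)).toMultilinearMap.map_sum
        (fun i (j : κ) => l i j • b j)
      rw [h2]
      refine h3.trans (sum_eq_zero fun J _ => ?_)
      rw [MultilinearMap.map_smul_univ]
      have : (detRowAlternating (n := Fin e) (R := k)).toMultilinearMap (fun i => b (J i))
          = 0 := hcon J
      rw [this, smul_zero]
    rw [hl, det_one] at h1
    exact one_ne_zero h1
  obtain ⟨J₀, hJ₀⟩ := hex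
  have : Nonempty (Fin e → κ) := ⟨J₀⟩
  obtain ⟨J, -, hJ⟩ := exists_max_image (univ : Finset (Fin e → κ))
    (fun J => ‖(b.submatrix J id).det‖) univ_nonempty
  have hdet : (b.submatrix J id).det ≠ 0 := by
    rw [← norm_pos_iff]
    exact (norm_pos_iff.2 hJ₀).trans_le (hJ J₀ (mem_univ _))
  have hunit : IsUnit (b.submatrix J id).det := hdet.isUnit
  refine ⟨J, (b.submatrix J id)⁻¹, b.submatrix J id, Matrix.nonsing_inv_mul _ hunit,
    mul_nonsing_inv _ hunit, ?_, fun i j => ?_⟩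
  · rw [← mul_nonsing_inv _ hunit]
    rfl
  · have h1 : (b * (b.submatrix J id)⁻¹) i j
        = (b.submatrix J id).det⁻¹ * (b.submatrix (Function.update J j i) id).det := by
      have h4 : b.submatrix (Function.update J j i) id = (b.submatrix J id).updateRow j (b i) := by
        ext x y
        by_cases hx : x = j
        · subst hx
          simp
        · simp [hx]
      rw [Matrix.inv_def, Matrix.mul_smul, Matrix.smul_apply, Ring.inverse_eq_inv', smul_eq_mul, h4]
      congr 1
      rw [← Matrix.det_transpose, ← Matrix.updateCol_transpose, ← cramer_apply,
        cramer_eq_adjugate_mulVec, ← Matrix.adjugate_transpose, Matrix.mulVec_transpose]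
      rfl
    rw [h1, norm_mul, norm_inv, inv_mul_le_iff₀ (norm_pos_iff.2 hdet), mul_one]
    exact hJ _ (mem_univ _)

end Slopes

section Kernel

variable {k : Type*} [NontriviallyNormedField k] {ι : Type*} [Fintype ι]

theorem summable_const_mul_pow_fst {c t : ℝ} (ht0 : 0 ≤ t) (ht : t < 1) :
    Summable fun i : ℕ × ι => c * t ^ i.1 := by
  have h := ((summable_geometric_of_lt_one ht0 ht).mul_of_nonneg
    (Summable.of_finite (f := fun _ : ι => (1 : ℝ))) (fun i => by positivity)
    fun _ => zero_le_one).mul_left c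
  simpa using h

theorem summable_of_norm_le_pow_fst [CompleteSpace k] {c t : ℝ} (ht0 : 0 ≤ t) (ht : t < 1)
    {f : ℕ × ι → k} (hf : ∀ i, ‖f i‖ ≤ c * t ^ i.1) : Summable f :=
  Summable.of_norm_bounded (summable_const_mul_pow_fst ht0 ht) hf

/-- The inclusion of the indices of level less than `d`. -/
def levelEmb (d : ℕ) (ι : Type*) (i : Fin d × ι) : ℕ × ι := (i.1, i.2)

theorem sum_levelEmb {M : Type*} [AddCommMonoid M] (d : ℕ) (f : ℕ × ι → M) :
    ∑ i, f (levelEmb d ι i) = ∑ i ∈ range d ×ˢ univ, f i := by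
  rw [Fintype.sum_prod_type, sum_product,
    ← Fin.sum_univ_eq_sum_range fun u => ∑ y, f (u, y)]
  rfl

theorem sum_levelEmb_eq_tsum (d : ℕ) (f : ℕ × ι → k) (hf : ∀ i, d ≤ i.1 → f i = 0) :
    ∑ i, f (levelEmb d ι i) = ∑' i, f i := by
  rw [sum_levelEmb, tsum_eq_sum]
  intro i hi
  refine hf i (not_lt.1 fun h => hi ?_)
  simpa using h

theorem tsum_eq_sum_levelEmb_add [CompleteSpace k] (d : ℕ) {f : ℕ × ι → k} (hf : Summable f) :
    ∑' i, f i = ∑ i, f (levelEmb d ι i) + ∑' i, if i.1 < d then 0 else f i := by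
  have h1 : ∑ i, f (levelEmb d ι i) = ∑' i, if i.1 < d then f i else 0 := by
    rw [← sum_levelEmb_eq_tsum d fun i => if i.1 < d then f i else 0]
    · refine sum_congr rfl fun i _ => ?_
      exact (if_pos (show (levelEmb d ι i).1 < d from i.1.2)).symm
    · intro i hi
      rw [if_neg (not_lt.2 hi)]
  rw [h1, ← Summable.tsum_add]
  · refine tsum_congr fun i => ?_
    split_ifs <;> simp
  · exact (hf.indicator {i | i.1 < d}).congr fun i => by simp [Set.indicator_apply]
  · exact (hf.indicator {i | ¬ i.1 < d}).congr fun i => by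
      by_cases h : i.1 < d <;> simp [Set.indicator_apply, h]

/-- Powers of an infinite matrix; `kernelPow Φ r` is the power of exponent `r + 1`. -/
def kernelPow (Φ : ℕ × ι → ℕ × ι → k) : ℕ → ℕ × ι → ℕ × ι → k
  | 0 => Φ
  | r + 1 => fun i j => ∑' l, kernelPow Φ r i l * Φ l j

theorem kernelPow_succ (Φ : ℕ × ι → ℕ × ι → k) (r : ℕ) (i j : ℕ × ι) :
    kernelPow Φ (r + 1) i j = ∑' l, kernelPow Φ r i l * Φ l j := rfl

/-- The trace of the power of exponent `r + 1` of an infinite matrix. -/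
def kernelTrace (Φ : ℕ × ι → ℕ × ι → k) (r : ℕ) : k := ∑' i, kernelPow Φ r i i

/-- The Fredholm determinant `det (1 - T Φ)`. -/
def fredholm (Φ : ℕ × ι → ℕ × ι → k) : k⟦X⟧ :=
  PowerSeries.mk (newtonSeq (kernelTrace Φ))

/-- The truncation of an infinite matrix to the indices of level less than `d`. -/
def trunc (Φ : ℕ × ι → ℕ × ι → k) (d : ℕ) : Matrix (Fin d × ι) (Fin d × ι) k :=
  fun i j => Φ (levelEmb d ι i) (levelEmb d ι j)

/-- Exponential decay of the entries of an infinite matrix. -/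
structure KernelBound (C t : ℝ) (Φ : ℕ × ι → ℕ × ι → k) : Prop where
  nonneg : 0 ≤ C
  pos : 0 < t
  lt_one : t < 1
  bound : ∀ i j, ‖Φ i j‖ ≤ C * t ^ (i.1 + j.1)

variable {C t : ℝ} {Φ : ℕ × ι → ℕ × ι → k}

theorem KernelBound.le_row (h : KernelBound C t Φ) (i j) : ‖Φ i j‖ ≤ C * t ^ i.1 :=
  (h.bound i j).trans (mul_le_mul_of_nonneg_left
    (pow_le_pow_of_le_one h.pos.le h.lt_one.le (Nat.le_add_right _ _)) h.nonneg)

theorem KernelBound.le_col (h : KernelBound C t Φ) (i j) : ‖Φ i j‖ ≤ C * t ^ j.1 :=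
  (h.bound i j).trans (mul_le_mul_of_nonneg_left
    (pow_le_pow_of_le_one h.pos.le h.lt_one.le (Nat.le_add_left _ _)) h.nonneg)

theorem KernelBound.summable_mul [CompleteSpace k] (h : KernelBound C t Φ) {x : ℕ × ι → k} {B : ℝ}
    (hx : ∀ i, ‖x i‖ ≤ B) (i : ℕ × ι) : Summable fun l => Φ i l * x l :=
  summable_of_norm_le_pow_fst (c := C * B) h.pos.le h.lt_one fun l => by
    rw [norm_mul, mul_right_comm]
    exact mul_le_mul (h.le_col i l) (hx l) (norm_nonneg _)
      (mul_nonneg h.nonneg (pow_nonneg h.pos.le _))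

variable [IsUltrametricDist k]

theorem norm_tsum_le_of_forall {α : Type*} {f : α → k} {c : ℝ} (hc : 0 ≤ c)
    (h : ∀ i, ‖f i‖ ≤ c) : ‖∑' i, f i‖ ≤ c :=
  norm_tsum_le_of_forall_le_of_nonneg hc h

theorem KernelBound.pow (h : KernelBound C t Φ) (r : ℕ) :
    KernelBound (C ^ (r + 1)) t (kernelPow Φ r) := by
  have ht := h.pos
  have hC := h.nonneg
  refine ⟨pow_nonneg h.nonneg _, h.pos, h.lt_one, ?_⟩
  induction r with
  | zero => simpa [kernelPow] using h.bound
  | succ r ih =>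
    intro i j
    refine norm_tsum_le_of_forall (by positivity) fun l => ?_
    rw [norm_mul]
    calc _ ≤ (C ^ (r + 1) * t ^ (i.1 + l.1)) * (C * t ^ (l.1 + j.1)) :=
          mul_le_mul (ih _ _) (h.bound _ _) (norm_nonneg _) (by positivity)
      _ = C ^ (r + 1 + 1) * t ^ (i.1 + j.1 + 2 * l.1) := by ring
      _ ≤ _ := mul_le_mul_of_nonneg_left
          (pow_le_pow_of_le_one h.pos.le h.lt_one.le (Nat.le_add_right _ _)) (by positivity)

variable [CompleteSpace k]

theorem KernelBound.summable_pow_mul (h : KernelBound C t Φ) (r : ℕ) (i j) :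
    Summable fun l => kernelPow Φ r i l * Φ l j :=
  (h.pow r).summable_mul (x := fun l => Φ l j) (B := C) (fun l => (h.le_row l j).trans
    (mul_le_of_le_one_right h.nonneg (pow_le_one₀ h.pos.le h.lt_one.le))) i

variable [DecidableEq ι]

theorem KernelBound.norm_trunc_pow_sub_le (h : KernelBound C t Φ) (d r : ℕ) (i j : Fin d × ι) :
    ‖(trunc Φ d ^ (r + 1)) i j - kernelPow Φ r (levelEmb d ι i) (levelEmb d ι j)‖
      ≤ C ^ (r + 1) * t ^ d := by
  have ht := h.pos
  have hC := h.nonneg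
  induction r generalizing j with
  | zero =>
    simp only [zero_add, pow_one, trunc, kernelPow, sub_self, norm_zero]
    positivity
  | succ r ih =>
    rw [pow_succ, Matrix.mul_apply, kernelPow_succ,
      tsum_eq_sum_levelEmb_add d (h.summable_pow_mul r _ _), ← sub_sub, ← sum_sub_distrib,
      sub_eq_add_neg]
    refine (norm_add_le_max _ _).trans (max_le ?_ ?_)
    · refine norm_sum_le_of_forall (by positivity) fun l _ => ?_
      rw [trunc, ← sub_mul, norm_mul]
      calc _ ≤ (C ^ (r + 1) * t ^ d) * C := mul_le_mul (ih l) ((h.le_row _ _).trans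
            (mul_le_of_le_one_right h.nonneg (pow_le_one₀ h.pos.le h.lt_one.le))) (norm_nonneg _)
            (by positivity)
        _ = _ := by ring
    · rw [norm_neg]
      refine norm_tsum_le_of_forall (by positivity) fun l => ?_
      split_ifs with hl
      · rw [norm_zero]
        positivity
      · rw [norm_mul]
        calc _ ≤ (C ^ (r + 1) * t ^ l.1) * C := mul_le_mul ((h.pow r).le_col _ _)
              ((h.le_row _ _).trans
              (mul_le_of_le_one_right h.nonneg (pow_le_one₀ h.pos.le h.lt_one.le))) (norm_nonneg _)
              (by positivity)
          _ = C ^ (r + 1 + 1) * t ^ l.1 := by ring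
          _ ≤ _ := mul_le_mul_of_nonneg_left
              (pow_le_pow_of_le_one h.pos.le h.lt_one.le (not_lt.1 hl)) (by positivity)

theorem KernelBound.norm_trace_trunc_sub_le (h : KernelBound C t Φ) (d r : ℕ) :
    ‖(trunc Φ d ^ (r + 1)).trace - kernelTrace Φ r‖ ≤ C ^ (r + 1) * t ^ d := by
  have ht := h.pos
  have hC := h.nonneg
  have hs : Summable fun i => kernelPow Φ r i i :=
    summable_of_norm_le_pow_fst (c := C ^ (r + 1)) h.pos.le h.lt_one fun i => (h.pow r).le_row i i
  rw [kernelTrace, tsum_eq_sum_levelEmb_add d hs, trace, ← sub_sub,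
    ← sum_sub_distrib, sub_eq_add_neg]
  refine (norm_add_le_max _ _).trans (max_le ?_ ?_)
  · exact norm_sum_le_of_forall (by positivity) fun l _ => h.norm_trunc_pow_sub_le d r l l
  · rw [norm_neg]
    refine norm_tsum_le_of_forall (by positivity) fun l => ?_
    split_ifs with hl
    · rw [norm_zero]
      positivity
    · exact ((h.pow r).le_row _ _).trans (mul_le_mul_of_nonneg_left
        (pow_le_pow_of_le_one h.pos.le h.lt_one.le (not_lt.1 hl)) (by positivity))

theorem norm_pow_sub_pow_le {κ : Type*} [Fintype κ] [DecidableEq κ] {A A' : Matrix κ κ k}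
    {C δ : ℝ} (hC : 0 ≤ C) (hδ : 0 ≤ δ) (hA : ∀ i j, ‖A i j‖ ≤ C) (hA' : ∀ i j, ‖A' i j‖ ≤ C)
    (hAA : ∀ i j, ‖A i j - A' i j‖ ≤ δ) (r : ℕ) :
    ∀ i j, ‖(A ^ (r + 1)) i j - (A' ^ (r + 1)) i j‖ ≤ δ * C ^ r := by
  have hpow : ∀ r, ∀ i j, ‖(A ^ (r + 1)) i j‖ ≤ C ^ (r + 1) := by
    intro r
    induction r with
    | zero => simpa using hA
    | succ r ih =>
      intro i j
      rw [pow_succ, Matrix.mul_apply]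
      refine norm_sum_le_of_forall (by positivity) fun l _ => ?_
      rw [norm_mul, pow_succ C]
      exact mul_le_mul (ih _ _) (hA _ _) (norm_nonneg _) (by positivity)
  induction r with
  | zero => simpa using hAA
  | succ r ih =>
    intro i j
    have : A ^ (r + 1 + 1) - A' ^ (r + 1 + 1)
        = A ^ (r + 1) * (A - A') + (A ^ (r + 1) - A' ^ (r + 1)) * A' := by
      rw [pow_succ A (r + 1), pow_succ A' (r + 1)]
      noncomm_ring
    rw [← Matrix.sub_apply, this, Matrix.add_apply, Matrix.mul_apply, Matrix.mul_apply]
    refine (norm_add_le_max _ _).trans (max_le ?_ ?_)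
    · refine norm_sum_le_of_forall (by positivity) fun l _ => ?_
      rw [norm_mul, mul_comm δ]
      exact mul_le_mul (hpow _ _ _) (hAA _ _) (norm_nonneg _) (by positivity)
    · refine norm_sum_le_of_forall (by positivity) fun l _ => ?_
      rw [norm_mul, pow_succ C, ← mul_assoc]
      exact mul_le_mul (ih _ _) (hA' _ _) (norm_nonneg _) (by positivity)

/-- The reversed characteristic polynomials of small perturbations of the truncations converge
to the Fredholm determinant. -/
theorem KernelBound.tendsto_coeff_charpolyRev [CharZero k] (h : KernelBound C t Φ) {C' : ℝ}
    (hC' : 0 ≤ C') (A : ∀ d, Matrix (Fin d × ι) (Fin d × ι) k) {d₀ : ℕ}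
    (hA : ∀ d ≥ d₀, ∀ i j, ‖A d i j - trunc Φ d i j‖ ≤ C' * t ^ d) (s : ℕ) :
    Tendsto (fun d => (A d).charpolyRev.coeff s) atTop
      (nhds (PowerSeries.coeff s (fredholm Φ))) := by
  have ht := h.pos
  have hC := h.nonneg
  rw [fredholm, coeff_mk]
  refine tendsto_of_newton (f := fun d s => (A d).charpolyRev.coeff s)
    (p := fun d r => (A d ^ (r + 1)).trace) (τ := kernelTrace Φ)
    (fun d => charpolyRev_coeff_zero _) (newtonSeq_zero _) (fun d s => nat_mul_coeff_charpolyRev _ _)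
    (nat_mul_newtonSeq _) (fun r => ?_) s
  have hlim : Tendsto (fun d : ℕ => (C' * (C + C') ^ r + C ^ (r + 1)) * t ^ d) atTop
      (nhds 0) := by
    simpa using (tendsto_pow_atTop_nhds_zero_of_lt_one h.pos.le h.lt_one).const_mul
      (C' * (C + C') ^ r + C ^ (r + 1))
  rw [tendsto_iff_norm_sub_tendsto_zero]
  refine squeeze_zero' (.of_forall fun _ => norm_nonneg _) ?_ hlim
  filter_upwards [eventually_ge_atTop d₀] with d hd
  have htr : ∀ i j, ‖trunc Φ d i j‖ ≤ C + C' := fun i j => (h.le_row _ _).trans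
    ((mul_le_of_le_one_right h.nonneg (pow_le_one₀ h.pos.le h.lt_one.le)).trans (by linarith))
  have hAb : ∀ i j, ‖A d i j‖ ≤ C + C' := by
    intro i j
    rw [← sub_add_cancel (A d i j) (trunc Φ d i j)]
    refine (norm_add_le_max _ _).trans (max_le ?_ (htr i j))
    exact (hA d hd i j).trans
      ((mul_le_of_le_one_right hC' (pow_le_one₀ h.pos.le h.lt_one.le)).trans (by linarith))
  have h1 := norm_pow_sub_pow_le (by positivity) (by positivity) hAb htr (hA d hd) r
  have h2 : ‖(A d ^ (r + 1)).trace - (trunc Φ d ^ (r + 1)).trace‖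
      ≤ C' * t ^ d * (C + C') ^ r := by
    rw [trace, trace, ← sum_sub_distrib]
    exact norm_sum_le_of_forall (by positivity) fun i _ => h1 i i
  calc _ = ‖((A d ^ (r + 1)).trace - (trunc Φ d ^ (r + 1)).trace)
        + ((trunc Φ d ^ (r + 1)).trace - kernelTrace Φ r)‖ := by rw [sub_add_sub_cancel]
    _ ≤ _ := norm_add_le _ _
    _ ≤ C' * t ^ d * (C + C') ^ r + C ^ (r + 1) * t ^ d :=
        add_le_add h2 (h.norm_trace_trunc_sub_le d r)
    _ = _ := by ring

/-- A uniform growth bound for matrices with exponentially small rows. -/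
theorem exists_growthLE_charpolyRev_of_row (ι : Type*) [Fintype ι] [DecidableEq ι] {C t ρ : ℝ}
    (hC : 0 ≤ C) (ht0 : 0 ≤ t) (ht : t < 1) (hρ : 0 < ρ) :
    ∃ c : ℝ, 0 ≤ c ∧ ∀ (d : ℕ) (A : Matrix (Fin d × ι) (Fin d × ι) k),
      (∀ i j, ‖A i j‖ ≤ C * t ^ (i.1 : ℕ)) →
      GrowthLE ρ c (A.charpolyRev : k⟦X⟧) := by
  have hs := summable_const_mul_pow_fst (ι := ι) (c := C / ρ) ht0 ht
  refine ⟨Real.exp (∑' i : ℕ × ι, C / ρ * t ^ i.1), (Real.exp_pos _).le, fun d A hA => ?_⟩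
  refine (growthLE_charpolyRev (a := fun i => C * t ^ (i.1 : ℕ)) hA hρ).mono hρ.le
    (by positivity) le_rfl ?_
  calc _ ≤ ∏ i : Fin d × ι, Real.exp (C / ρ * t ^ (i.1 : ℕ)) := by
        refine prod_le_prod (fun i _ => by positivity) fun i _ => max_le ?_ ?_
        · exact Real.one_le_exp (by positivity)
        · calc _ = C / ρ * t ^ (i.1 : ℕ) := by ring
            _ ≤ C / ρ * t ^ (i.1 : ℕ) + 1 := by linarith
            _ ≤ _ := Real.add_one_le_exp _
    _ = Real.exp (∑ i : Fin d × ι, C / ρ * t ^ (i.1 : ℕ)) := (Real.exp_sum _ _).symm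
    _ ≤ _ := by
        refine Real.exp_le_exp.2 ?_
        have := sum_levelEmb (ι := ι) d fun i => C / ρ * t ^ i.1
        refine (this.trans_le ?_)
        exact hs.sum_le_tsum _ fun i _ => by positivity

end Kernel

section FiniteSlope

variable {k : Type*} [NontriviallyNormedField k] [IsUltrametricDist k]

theorem norm_det_le_prod {κ : Type*} [Fintype κ] [DecidableEq κ] {m : Matrix κ κ k} {a : κ → ℝ}
    (hm : ∀ i j, ‖m i j‖ ≤ a i) : ‖m.det‖ ≤ ∏ i, a i := by
  by_cases hκ : IsEmpty κ
  · simp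
  rw [not_isEmpty_iff] at hκ
  have ha : ∀ i, 0 ≤ a i := fun i => (norm_nonneg _).trans (hm i hκ.some)
  rw [det_apply']
  refine norm_sum_le_of_forall (prod_nonneg fun i _ => ha i) fun σ _ => ?_
  rw [norm_mul, norm_prod, ← Equiv.prod_comp σ a]
  have h1 : ‖((Equiv.Perm.sign σ : ℤ) : k)‖ = 1 := by
    rcases Int.units_eq_one_or (Equiv.Perm.sign σ) with h | h <;> simp [h]
  rw [h1, one_mul]
  exact prod_le_prod (fun i _ => norm_nonneg _) fun i _ => hm _ _

theorem exists_normalized_slope_splitting [CompleteSpace k] {κ : Type*} [Fintype κ]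
    [DecidableEq κ] (A : Matrix κ κ k) {ε : ℝ} (hε : 0 < ε) {a : κ → ℝ}
    (hA : ∀ i j, ‖A i j‖ ≤ a i) :
    ∃ (e : ℕ) (J : Fin e → κ) (B : Matrix κ (Fin e) k) (m : Matrix (Fin e) (Fin e) k)
      (u : Polynomial k), A * B = B * m ∧ (∀ i j, B (J i) j = (1 : Matrix _ _ k) i j) ∧
      (∀ i j, ‖B i j‖ ≤ 1) ∧ (∀ i j, ‖m i j‖ ≤ a (J i)) ∧ ε ^ e ≤ ‖m.det‖ ∧
      A.charpolyRev = m.charpolyRev * u ∧ GrowthLE ε 1 (u : k⟦X⟧) ∧ u.coeff 0 = 1 := by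
  obtain ⟨e, b, l, m, u, hAb, hl, hdet, hchar, hgr, hu0⟩ := exists_slope_splitting A hε
  obtain ⟨J, S, S', hSS, hSS', hJ, hB⟩ := exists_normalized_basis b l hl
  have hAB : A * (b * S) = b * S * (S' * m * S) := by
    rw [← Matrix.mul_assoc A, hAb]
    simp only [Matrix.mul_assoc]
    rw [← Matrix.mul_assoc S S', hSS, Matrix.one_mul]
  have hJ' : ∀ i j, (b * S) (J i) j = (1 : Matrix _ _ k) i j := fun i j => by rw [← hJ]; rfl
  refine ⟨e, J, b * S, S' * m * S, u, hAB, hJ', hB, ?_, ?_, ?_, hgr, hu0⟩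
  · intro i j
    have h1 : (S' * m * S) i j = (A * (b * S)) (J i) j := by
      rw [hAB, Matrix.mul_apply (M := b * S)]
      simp [hJ', Matrix.one_apply]
    have ha : 0 ≤ a (J i) := (norm_nonneg _).trans (hA (J i) (J i))
    rw [h1, Matrix.mul_apply]
    refine norm_sum_le_of_forall ha fun l _ => ?_
    rw [norm_mul]
    exact (mul_le_of_le_one_right (norm_nonneg _) (hB _ _)).trans (hA _ _)
  · have : (S' * m * S).det = m.det := by
      rw [det_mul, det_mul, mul_right_comm, ← det_mul, hSS', det_one,
        one_mul]
    rwa [this]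
  · rw [hchar, Matrix.mul_assoc, charpolyRev_mul_comm', Matrix.mul_assoc, hSS, Matrix.mul_one]

end FiniteSlope

section Limit

variable {k : Type*} [NontriviallyNormedField k] [IsUltrametricDist k] [ProperSpace k] [CharZero k]
  {ι : Type*} [Fintype ι] [DecidableEq ι] {C t : ℝ} {Φ : ℕ × ι → ℕ × ι → k}

/-- Uniform bounds for the normalised slope decompositions of the truncations. -/
theorem KernelBound.exists_uniform_splitting (h : KernelBound C t Φ) {ε : ℝ} (hε : 0 < ε) :
    ∃ M : ℕ, ∀ d : ℕ, ∃ (e : ℕ) (J : Fin e → Fin M × ι) (x : ℕ × ι → Fin e → k)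
      (m : Matrix (Fin e) (Fin e) k) (u : Polynomial k),
      (∀ i j, ‖x i j‖ ≤ 1) ∧ (∀ i j, d ≤ i.1 → x i j = 0) ∧
      (∀ i j, i.1 < d → ∑' l, Φ i l * x l j = ∑ l, x i l * m l j) ∧
      (∀ i j, x (levelEmb M ι (J i)) j = (1 : Matrix _ _ k) i j) ∧ (∀ i j, ‖m i j‖ ≤ C) ∧
      (trunc Φ d).charpolyRev = m.charpolyRev * u ∧ GrowthLE ε 1 (u : k⟦X⟧) ∧
      u.coeff 0 = 1 := by
  have ht := h.pos
  have hC := h.nonneg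
  have hs := summable_const_mul_pow_fst (ι := ι) (c := C / ε) h.pos.le h.lt_one
  set K : ℝ := Real.exp (∑' i : ℕ × ι, C / ε * t ^ i.1) with hK
  obtain ⟨M, hM⟩ : ∃ M : ℕ, C / ε * K * t ^ M < 1 := by
    have : Tendsto (fun M : ℕ => C / ε * K * t ^ M) atTop (nhds 0) := by
      simpa using (tendsto_pow_atTop_nhds_zero_of_lt_one h.pos.le h.lt_one).const_mul (C / ε * K)
    exact (this.eventually_lt_const zero_lt_one).exists
  refine ⟨M, fun d => ?_⟩
  obtain ⟨e, J, B, m, u, hAB, hJ, hB, hm, hdet, hchar, hgr, hu0⟩ :=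
    exists_normalized_slope_splitting (trunc Φ d) hε (a := fun i => C * t ^ (i.1 : ℕ))
      fun i j => h.le_row _ _
  have hJinj : Function.Injective J := by
    intro i i' hii
    by_contra hne
    have h1 := hJ i i
    rw [hii, hJ i' i, one_apply_eq, one_apply_ne (Ne.symm hne)] at h1
    exact zero_ne_one h1
  have hprod : 1 ≤ ∏ j, (C / ε * t ^ ((J j).1 : ℕ)) := by
    have h1 := hdet.trans (norm_det_le_prod hm)
    have h2 : ∏ j, (C / ε * t ^ ((J j).1 : ℕ)) = (∏ j, C * t ^ ((J j).1 : ℕ)) / ε ^ e := by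
      have : (ε ^ e : ℝ) = ∏ _j : Fin e, ε := by simp
      rw [this, ← prod_div_distrib]
      exact prod_congr rfl fun j _ => by ring
    rw [h2, le_div_iff₀ (by positivity), one_mul]
    exact h1
  have hlev : ∀ j, ((J j).1 : ℕ) < M := by
    intro j
    by_contra hj
    have h1 : ∏ i ∈ univ.erase j, (C / ε * t ^ ((J i).1 : ℕ)) ≤ K := by
      calc _ ≤ ∏ i ∈ univ.erase j, Real.exp (C / ε * t ^ ((J i).1 : ℕ)) :=
            prod_le_prod (fun i _ => by positivity) fun i _ =>
              (le_add_of_nonneg_right zero_le_one).trans (Real.add_one_le_exp _)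
        _ = Real.exp (∑ i ∈ univ.erase j, C / ε * t ^ ((J i).1 : ℕ)) := (Real.exp_sum _ _).symm
        _ ≤ K := by
            refine Real.exp_le_exp.2 ?_
            have h2 := sum_map (univ.erase j)
              ⟨fun i => levelEmb d ι (J i), fun a b hab => hJinj (by
                simp only [levelEmb, Prod.mk.injEq] at hab
                exact Prod.ext (Fin.ext hab.1) hab.2)⟩ fun i => C / ε * t ^ i.1
            refine (h2.symm.trans_le ?_)
            exact hs.sum_le_tsum _ fun i _ => by positivity
    rw [← mul_prod_erase _ _ (mem_univ j)] at hprod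
    have h3 : C / ε * t ^ ((J j).1 : ℕ) ≤ C / ε * t ^ M := mul_le_mul_of_nonneg_left
      (pow_le_pow_of_le_one h.pos.le h.lt_one.le (not_lt.1 hj)) (by positivity)
    have h4 := hprod.trans (mul_le_mul h3 h1 (prod_nonneg fun i _ => by positivity)
      (by positivity))
    linarith [mul_right_comm (C / ε) (t ^ M) K]
  let x : ℕ × ι → Fin e → k := fun i j => if hi : i.1 < d then B (⟨i.1, hi⟩, i.2) j else 0
  have hx : ∀ i j, x (levelEmb d ι i) j = B i j := fun i j => dif_pos i.1.2
  refine ⟨e, fun j => (⟨(J j).1, hlev j⟩, (J j).2), x, m, u, ?_, ?_, ?_, ?_, ?_, hchar, hgr, hu0⟩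
  · intro i j
    by_cases hi : i.1 < d
    · simpa [x, hi] using hB _ _
    · simp [x, hi]
  · intro i j hi
    exact dif_neg (not_lt.2 hi)
  · intro i j hi
    rw [← sum_levelEmb_eq_tsum d fun l => Φ i l * x l j]
    · have h1 := congrFun (congrFun hAB (⟨i.1, hi⟩, i.2)) j
      rw [Matrix.mul_apply, Matrix.mul_apply] at h1
      simp only [hx]
      refine h1.trans (sum_congr rfl fun l _ => ?_)
      rw [← hx]
      rfl
    · intro l hl
      have : x l j = 0 := dif_neg (not_lt.2 hl)
      rw [this, mul_zero]
  · intro i j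
    rw [← hJ i j, ← hx]
    rfl
  · intro i j
    exact (hm i j).trans (mul_le_of_le_one_right h.nonneg (pow_le_one₀ h.pos.le h.lt_one.le))

/-- Finite-dimensional spaces of bounded vectors stable under `Φ` carrying all of the Fredholm
determinant outside slope `ε`. -/
theorem KernelBound.exists_slope_subspace (h : KernelBound C t Φ) {ε : ℝ} (hε : 0 < ε) :
    ∃ (e : ℕ) (b : ℕ × ι → Fin e → k) (m : Matrix (Fin e) (Fin e) k) (u : k⟦X⟧),
      (∀ i j, ‖b i j‖ ≤ 1) ∧ (∀ i j, ∑' l, Φ i l * b l j = ∑ l, b i l * m l j) ∧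
      (∀ c : Fin e → k, (∀ i, ∑ j, b i j * c j = 0) → c = 0) ∧
      fredholm Φ = (m.charpolyRev : k⟦X⟧) * u ∧ GrowthLE ε 1 u ∧
      PowerSeries.coeff 0 u = 1 := by
  obtain ⟨M, hM⟩ := h.exists_uniform_splitting hε
  choose e J x m u hx1 hx0 hΦ hJ hm hchar hgr hu0 using hM
  have he : ∀ d, e d < Fintype.card (Fin M × ι) + 1 := by
    intro d
    have : Function.Injective (J d) := by
      intro i i' hii
      by_contra hne
      have h1 := hJ d i i
      rw [hii, hJ d i' i, one_apply_eq, one_apply_ne (Ne.symm hne)] at h1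
      exact zero_ne_one h1
    have := Fintype.card_le_of_injective _ this
    rw [Fintype.card_fin] at this
    omega
  let F : ℕ → Σ e : Fin (Fintype.card (Fin M × ι) + 1), Fin e → Fin M × ι :=
    fun d => ⟨⟨e d, he d⟩, J d⟩
  obtain ⟨⟨⟨e₀, he₀⟩, J₀⟩, hinf⟩ := Finite.exists_infinite_fiber F
  rw [Set.infinite_coe_iff] at hinf
  obtain ⟨φ, hφ, hφF⟩ := Filter.extraction_of_frequently_atTop
    (Nat.frequently_atTop_iff_infinite.2 hinf)
  have key : ∀ n, ∃ (y : ℕ × ι → Fin e₀ → k) (m' : Matrix (Fin e₀) (Fin e₀) k)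
      (v : Polynomial k), (∀ i j, ‖y i j‖ ≤ 1) ∧
      (∀ i j, i.1 < φ n → ∑' l, Φ i l * y l j = ∑ l, y i l * m' l j) ∧
      (∀ i j, y (levelEmb M ι (J₀ i)) j = (1 : Matrix _ _ k) i j) ∧ (∀ i j, ‖m' i j‖ ≤ C) ∧
      (trunc Φ (φ n)).charpolyRev = m'.charpolyRev * v ∧ GrowthLE ε 1 (v : k⟦X⟧) ∧
      v.coeff 0 = 1 := by
    intro n
    have h1 : F (φ n) = ⟨⟨e₀, he₀⟩, J₀⟩ := hφF n
    have h2 : e (φ n) = e₀ := congrArg (fun z => (z.1 : ℕ)) h1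
    subst h2
    have h3 : J (φ n) = J₀ := by simpa [F] using h1
    subst h3
    exact ⟨x (φ n), m (φ n), u (φ n), hx1 _, hΦ _, hJ _, hm _, hchar _, hgr _, hu0 _⟩
  choose y m' v hy1 hyΦ hyJ hm' hychar hvgr hv0 using key
  have hcompact : IsCompact ((Set.univ.pi fun _ : ℕ × ι => Set.univ.pi fun _ : Fin e₀ =>
      Metric.closedBall (0 : k) 1) ×ˢ ((Set.univ.pi fun _ : Fin e₀ => Set.univ.pi fun _ : Fin e₀ =>
      Metric.closedBall (0 : k) C) ×ˢ (Set.univ.pi fun s : ℕ =>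
      Metric.closedBall (0 : k) (1 * ε ^ s)))) :=
    (isCompact_univ_pi fun _ => isCompact_univ_pi fun _ => isCompact_closedBall _ _).prod
      ((isCompact_univ_pi fun _ => isCompact_univ_pi fun _ => isCompact_closedBall _ _).prod
      (isCompact_univ_pi fun _ => isCompact_closedBall _ _))
  obtain ⟨⟨b, M₀, w⟩, hmem, ψ, hψ, hlim⟩ := hcompact.tendsto_subseq
    (x := fun n => ((y n, (m' n : Fin e₀ → Fin e₀ → k), fun s => (v n).coeff s) :
      (ℕ × ι → Fin e₀ → k) × (Fin e₀ → Fin e₀ → k) × (ℕ → k))) (fun n => by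
      refine ⟨?_, ?_, ?_⟩
      · simpa [Set.mem_univ_pi] using fun i i' j => hy1 n (i, i') j
      · exact fun i _ j _ => mem_closedBall_zero_iff.2 (hm' n i j)
      · intro s _
        have := hvgr n s
        rw [Polynomial.coeff_coe] at this
        simpa using this)
  simp only [Set.mem_prod, Set.mem_univ_pi, mem_closedBall_zero_iff] at hmem
  obtain ⟨hb1, hM₀, hw⟩ := hmem
  rw [Prod.tendsto_iff, Prod.tendsto_iff] at hlim
  obtain ⟨hlb, hlm, hlw⟩ := hlim
  replace hlb : ∀ i j, Tendsto (fun n => y (ψ n) i j) atTop (nhds (b i j)) :=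
    fun i j => tendsto_pi_nhds.1 (tendsto_pi_nhds.1 hlb i) j
  replace hlw : ∀ s, Tendsto (fun n => (v (ψ n)).coeff s) atTop (nhds (w s)) :=
    fun s => tendsto_pi_nhds.1 hlw s
  let M₁ : Matrix (Fin e₀) (Fin e₀) k := M₀
  have hlm' : Tendsto (fun n => m' (ψ n)) atTop
      (nhds M₁) := hlm
  have hcharlim : ∀ s, Tendsto (fun n => (m' (ψ n)).charpolyRev.coeff s) atTop
      (nhds (M₁.charpolyRev.coeff s)) := by
    refine tendsto_of_newton (f := fun n s => (m' (ψ n)).charpolyRev.coeff s)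
      (p := fun n r => (m' (ψ n) ^ (r + 1)).trace)
      (g := fun s => M₁.charpolyRev.coeff s)
      (τ := fun r => (M₁ ^ (r + 1)).trace)
      (fun n => charpolyRev_coeff_zero _) (charpolyRev_coeff_zero _)
      (fun d s => nat_mul_coeff_charpolyRev _ _) (fun s => nat_mul_coeff_charpolyRev _ _)
      (fun r => ?_)
    have hc : Continuous fun A : Matrix (Fin e₀) (Fin e₀) k => (A ^ (r + 1)).trace :=
      (continuous_pow (r + 1)).matrix_trace
    exact (hc.tendsto _).comp hlm'
  have hφψ : Tendsto (fun n => φ (ψ n)) atTop atTop :=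
    hφ.tendsto_atTop.comp hψ.tendsto_atTop
  have hC := h.nonneg
  refine ⟨e₀, b, M₁, PowerSeries.mk w, fun i j => hb1 i j, ?_, ?_, ?_, ?_, ?_⟩
  · intro i j
    have h1 : Tendsto (fun n => ∑' l, Φ i l * y (ψ n) l j) atTop
        (nhds (∑' l, Φ i l * b l j)) := by
      refine tendsto_tsum_of_dominated_convergence
        (summable_const_mul_pow_fst (ι := ι) (c := C) h.pos.le h.lt_one)
        (fun l => (hlb l j).const_mul _) (.of_forall fun n l => ?_)
      rw [norm_mul]
      exact (mul_le_of_le_one_right (norm_nonneg _) (hy1 _ _ _)).trans (h.le_col _ _)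
    have h2 : Tendsto (fun n => ∑ l, y (ψ n) i l * m' (ψ n) l j) atTop
        (nhds (∑ l, b i l * M₀ l j)) :=
      tendsto_finsetSum _ fun l _ => (hlb i l).mul
        (tendsto_pi_nhds.1 (tendsto_pi_nhds.1 hlm l) j)
    refine tendsto_nhds_unique (h1.congr' ?_) h2
    filter_upwards [hφψ.eventually_gt_atTop i.1] with n hn using hyΦ _ _ _ hn
  · intro c hc
    have h1 : ∀ i j, b (levelEmb M ι (J₀ i)) j = (1 : Matrix _ _ k) i j := fun i j =>
      tendsto_nhds_unique (hlb _ _) (by simp only [hyJ]; exact tendsto_const_nhds)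
    funext i
    have h2 := hc (levelEmb M ι (J₀ i))
    simpa [h1, Matrix.one_apply] using h2
  · ext s
    have h1 := (h.tendsto_coeff_charpolyRev le_rfl (fun d => trunc Φ d) (d₀ := 0)
      (fun d _ i j => by simp) s).comp hφψ
    refine tendsto_nhds_unique h1 ?_
    rw [PowerSeries.coeff_mul]
    simp only [Function.comp_def, hychar, Polynomial.coeff_mul, Polynomial.coeff_coe,
      coeff_mk]
    exact tendsto_finsetSum _ fun z _ => (hcharlim _).mul (hlw _)
  · intro s
    simpa using hw s
  · rw [coeff_mk]
    exact tendsto_nhds_unique (hlw 0) (by simp only [hv0]; exact tendsto_const_nhds)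

end Limit

theorem charpolyRev_eq_mul_of_mul_eq {R κ κ' : Type*} [CommRing R] [Fintype κ] [DecidableEq κ]
    [Fintype κ'] [DecidableEq κ'] {A : Matrix κ κ R} {b : Matrix κ κ' R} {l : Matrix κ' κ R}
    {m : Matrix κ' κ' R} (hA : A * b = b * m) (hl : l * b = 1) :
    A.charpolyRev = m.charpolyRev * (A * (1 - b * l)).charpolyRev := by
  have h1 : m.charpolyRev = (A * (b * l)).charpolyRev := by
    rw [← Matrix.mul_assoc, hA, charpolyRev_mul_comm', ← Matrix.mul_assoc, hl, Matrix.one_mul]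
  have h2 : A * (1 - b * l) * (A * (b * l)) = 0 := by
    rw [← Matrix.mul_assoc A b, hA, Matrix.mul_assoc A, Matrix.sub_mul, Matrix.one_mul,
      ← Matrix.mul_assoc (b * l), ← Matrix.mul_assoc (b * l), Matrix.mul_assoc b l b, hl,
      Matrix.mul_one, sub_self, Matrix.mul_zero]
  rw [h1, mul_comm, charpolyRev, charpolyRev, charpolyRev, ← det_mul]
  congr 1
  have h3 : (A * (1 - b * l)).map Polynomial.C * (A * (b * l)).map Polynomial.C = 0 := by
    rw [← Matrix.map_mul, h2, Matrix.map_zero _ Polynomial.C.map_zero]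
  rw [sub_mul, mul_sub, mul_sub, smul_mul _ _ ((Polynomial.X : Polynomial R) • _),
    Matrix.mul_smul (Matrix.map _ _), h3]
  simp only [mul_one, one_mul, smul_zero, sub_zero]
  rw [sub_sub, ← smul_add, ← Matrix.map_add _ (fun a b => Polynomial.C.map_add a b), ← Matrix.mul_add,
    add_sub_cancel, Matrix.mul_one]

theorem exists_finsupp_left_inverse {k I : Type*} [Field k] {e : ℕ} (b : I → Fin e → k)
    (hb : ∀ c : Fin e → k, (∀ i, ∑ j, b i j * c j = 0) → c = 0) :
    ∃ l : Fin e → I →₀ k, ∀ j j', (l j).sum (fun i a => a * b i j') = (1 : Matrix _ _ k) j j' := by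
  have hspan : Submodule.span k (Set.range b) = ⊤ := by
    by_contra hne
    obtain ⟨f, hf0, hf⟩ := Submodule.exists_le_ker_of_lt_top _ (lt_top_iff_ne_top.2 hne)
    refine hf0 (LinearMap.pi_ext' fun j => LinearMap.ext_ring ?_)
    have := hb (fun j => f (Pi.single j 1)) fun i => by
      have h1 : f (b i) = 0 := hf (Submodule.subset_span ⟨i, rfl⟩)
      rw [← univ_sum_single (b i), map_sum] at h1
      rw [← h1]
      refine sum_congr rfl fun j _ => ?_
      rw [← smul_eq_mul, ← map_smul, ← Pi.single_smul, smul_eq_mul, mul_one]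
    simpa using congrFun this j
  have h1 : ∀ j : Fin e, ∃ l : I →₀ k, (l.sum fun i a => a • b i) = Pi.single j 1 := fun j =>
    Finsupp.mem_span_range_iff_exists_finsupp.1 (hspan ▸ Submodule.mem_top)
  choose l hl using h1
  refine ⟨l, fun j j' => ?_⟩
  have := congrFun (hl j) j'
  rw [Finsupp.sum, Finset.sum_apply] at this
  simpa [Finsupp.sum, Matrix.one_apply, Pi.single_apply, eq_comm] using this

section

variable {k : Type*} [NontriviallyNormedField k] [IsUltrametricDist k] [CompleteSpace k]
  [CharZero k] {ι : Type*} [Fintype ι] [DecidableEq ι] {C t : ℝ} {Φ : ℕ × ι → ℕ × ι → k}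

/-- The reversed characteristic polynomial of a finite-dimensional stable subspace divides the
Fredholm determinant, with an entire quotient. -/
theorem KernelBound.exists_fredholm_eq_mul (h : KernelBound C t Φ) {e : ℕ} {b : ℕ × ι → Fin e → k}
    {B : ℝ} (hB : ∀ i j, ‖b i j‖ ≤ B) {m : Matrix (Fin e) (Fin e) k}
    (hΦ : ∀ i j, ∑' l, Φ i l * b l j = ∑ l, b i l * m l j)
    (hb : ∀ c : Fin e → k, (∀ i, ∑ j, b i j * c j = 0) → c = 0) :
    ∃ g : k⟦X⟧, fredholm Φ = (m.charpolyRev : k⟦X⟧) * g ∧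
      ∀ ρ : ℝ, 0 < ρ → ∃ c : ℝ, 0 ≤ c ∧ GrowthLE ρ c g := by
  have ht := h.pos
  have hC := h.nonneg
  wlog hB0 : 0 ≤ B generalizing B
  · exact this (B := max B 0) (fun i j => (hB i j).trans (le_max_left _ _)) (le_max_right _ _)
  obtain ⟨l, hl⟩ := exists_finsupp_left_inverse b hb
  obtain ⟨d₀, hd₀⟩ : ∃ d₀ : ℕ, ∀ j i, l j i ≠ 0 → i.1 < d₀ := by
    refine ⟨(univ.biUnion fun j => (l j).support.image Prod.fst).sup id + 1, fun j i hi => ?_⟩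
    refine Nat.lt_succ_of_le (le_sup (f := id) (mem_biUnion.2
      ⟨j, mem_univ _, mem_image.2 ⟨i, Finsupp.mem_support_iff.2 hi, rfl⟩⟩))
  obtain ⟨Lb, hLb0, hLb⟩ : ∃ Lb : ℝ, 0 ≤ Lb ∧ ∀ j i, ‖l j i‖ ≤ Lb := by
    refine ⟨∑ j, ∑ i ∈ (l j).support, ‖l j i‖, by positivity, fun j i => ?_⟩
    by_cases hi : l j i = 0
    · rw [hi, norm_zero]
      positivity
    · refine le_trans ?_ (single_le_sum (f := fun j => ∑ i ∈ (l j).support, ‖l j i‖)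
        (fun j _ => by positivity) (mem_univ j))
      exact single_le_sum (f := fun i => ‖l j i‖) (fun i _ => norm_nonneg _)
        (Finsupp.mem_support_iff.2 hi)
  let bd : ∀ d, Matrix (Fin d × ι) (Fin e) k := fun d i j => b (levelEmb d ι i) j
  let ld : ∀ d, Matrix (Fin e) (Fin d × ι) k := fun d j i => l j (levelEmb d ι i)
  let η : ∀ d, Matrix (Fin d × ι) (Fin e) k := fun d => bd d * m - trunc Φ d * bd d
  let A : ∀ d, Matrix (Fin d × ι) (Fin d × ι) k := fun d => trunc Φ d + η d * ld d
  have hlb : ∀ d ≥ d₀, ld d * bd d = 1 := by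
    intro d hd
    ext j j'
    rw [← hl j j', Matrix.mul_apply]
    change ∑ i, l j (levelEmb d ι i) * b (levelEmb d ι i) j' = _
    rw [sum_levelEmb d fun i => l j i * b i j', Finsupp.sum]
    symm
    refine sum_subset (fun i hi => ?_) fun i _ hi => ?_
    · have := hd₀ j i (Finsupp.mem_support_iff.1 hi)
      simp only [mem_product, mem_range, mem_univ, and_true]
      omega
    · rw [Finsupp.notMem_support_iff.1 hi, zero_mul]
  have hη : ∀ d i j, ‖η d i j‖ ≤ C * B * t ^ ((i.1 : ℕ) + d) := by
    intro d i j
    have h1 : η d i j = ∑' l, if l.1 < d then 0 else Φ (levelEmb d ι i) l * b l j := by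
      have h2 := tsum_eq_sum_levelEmb_add d
        (h.summable_mul (x := fun l => b l j) (fun l => hB l j) (levelEmb d ι i))
      rw [hΦ] at h2
      change (bd d * m) i j - (trunc Φ d * bd d) i j = _
      rw [Matrix.mul_apply, Matrix.mul_apply, sub_eq_iff_eq_add']
      exact h2
    rw [h1]
    refine norm_tsum_le_of_forall (by positivity) fun l => ?_
    split_ifs with hl
    · rw [norm_zero]
      positivity
    · rw [norm_mul]
      calc _ ≤ C * t ^ ((i.1 : ℕ) + l.1) * B :=
            mul_le_mul (h.bound _ _) (hB _ _) (norm_nonneg _) (by positivity)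
        _ = C * B * t ^ ((i.1 : ℕ) + l.1) := by ring
        _ ≤ _ := mul_le_mul_of_nonneg_left (pow_le_pow_of_le_one h.pos.le h.lt_one.le
            (by omega)) (by positivity)
  have hηl : ∀ d i j, ‖(η d * ld d) i j‖ ≤ C * B * Lb * t ^ ((i.1 : ℕ) + d) := by
    intro d i j
    rw [Matrix.mul_apply]
    refine norm_sum_le_of_forall (by positivity) fun l _ => ?_
    rw [norm_mul, mul_right_comm]
    exact mul_le_mul (hη _ _ _) (hLb _ _) (norm_nonneg _) (by positivity)
  have hA : ∀ d ≥ d₀, ∀ i j, ‖A d i j - trunc Φ d i j‖ ≤ C * B * Lb * t ^ d := by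
    intro d _ i j
    change ‖trunc Φ d i j + (η d * ld d) i j - trunc Φ d i j‖ ≤ _
    rw [add_sub_cancel_left]
    exact (hηl d i j).trans (mul_le_mul_of_nonneg_left
      (pow_le_pow_of_le_one h.pos.le h.lt_one.le (Nat.le_add_left _ _)) (by positivity))
  have hAb : ∀ d ≥ d₀, A d * bd d = bd d * m := by
    intro d hd
    rw [Matrix.add_mul, Matrix.mul_assoc, hlb d hd, Matrix.mul_one, add_sub_cancel]
  have hArow : ∀ d i j, ‖A d i j‖ ≤ (C + C * B * Lb) * t ^ (i.1 : ℕ) := by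
    intro d i j
    change ‖trunc Φ d i j + (η d * ld d) i j‖ ≤ _
    rw [add_mul]
    refine (norm_add_le _ _).trans (add_le_add (h.le_row _ _) ?_)
    exact (hηl d i j).trans (mul_le_mul_of_nonneg_left
      (pow_le_pow_of_le_one h.pos.le h.lt_one.le (Nat.le_add_right _ _)) (by positivity))
  have hrow : ∀ (d : ℕ) (i j : Fin d × ι), ‖(A d * ((1 : Matrix (Fin d × ι) (Fin d × ι) k) - bd d * ld d)) i j‖
      ≤ (C + C * B * Lb) * (1 + B * Lb) * t ^ (i.1 : ℕ) := by
    intro d i j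
    rw [Matrix.mul_apply]
    refine norm_sum_le_of_forall (by positivity) fun l _ => ?_
    rw [norm_mul, mul_right_comm]
    refine mul_le_mul (hArow _ _ _) ?_ (norm_nonneg _) (by positivity)
    rw [Matrix.sub_apply]
    refine (norm_sub_le _ _).trans (add_le_add ?_ ?_)
    · rw [Matrix.one_apply]
      split_ifs <;> simp
    · rw [Matrix.mul_apply]
      refine norm_sum_le_of_forall (by positivity) fun l _ => ?_
      rw [norm_mul]
      exact mul_le_mul (hB _ _) (hLb _ _) (norm_nonneg _) hB0
  set P : k⟦X⟧ := (m.charpolyRev : k⟦X⟧) with hP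
  have hP0 : PowerSeries.constantCoeff P ≠ 0 := by
    rw [hP, ← coeff_zero_eq_constantCoeff_apply, Polynomial.coeff_coe,
      charpolyRev_coeff_zero]
    exact one_ne_zero
  refine ⟨fredholm Φ * P⁻¹, by rw [mul_left_comm, PowerSeries.mul_inv_cancel _ hP0, mul_one],
    fun ρ hρ => ?_⟩
  obtain ⟨c, hc0, hc⟩ := exists_growthLE_charpolyRev_of_row (k := k) ι
    (C := (C + C * B * Lb) * (1 + B * Lb)) (by positivity) h.pos.le h.lt_one hρ
  refine ⟨c, hc0, fun s => ?_⟩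
  have hlim : Tendsto
      (fun d => PowerSeries.coeff s (((A d).charpolyRev : k⟦X⟧) * P⁻¹)) atTop
      (nhds (PowerSeries.coeff s (fredholm Φ * P⁻¹))) := by
    simp only [PowerSeries.coeff_mul, Polynomial.coeff_coe]
    exact tendsto_finsetSum _ fun z _ =>
      (h.tendsto_coeff_charpolyRev (C' := C * B * Lb) (by positivity) A hA _).mul_const _
  refine le_of_tendsto hlim.norm ?_
  filter_upwards [eventually_ge_atTop d₀] with d hd
  rw [charpolyRev_eq_mul_of_mul_eq (hAb d hd) (hlb d hd), Polynomial.coe_mul, ← hP, mul_right_comm,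
    PowerSeries.mul_inv_cancel _ hP0, one_mul]
  exact hc d _ (hrow d) s

end

section Horizontal

variable {k : Type*} [NontriviallyNormedField k] [IsUltrametricDist k] [ProperSpace k]
  [CharZero k] {ι : Type*} [Fintype ι] [DecidableEq ι] {C t : ℝ} {Φ : ℕ × ι → ℕ × ι → k}

/-- The action of an infinite matrix on a vector. -/
def kernelMul (Φ : ℕ × ι → ℕ × ι → k) (x : ℕ × ι → k) (i : ℕ × ι) : k :=
  ∑' l, Φ i l * x l

theorem kernelMul_const_mul (c : k) (Φ : ℕ × ι → ℕ × ι → k) (x : ℕ × ι → k) (i : ℕ × ι) :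
    kernelMul (fun i j => c * Φ i j) x i = c * kernelMul Φ x i := by
  simp only [kernelMul, mul_assoc, tsum_mul_left]

theorem KernelBound.const_mul (h : KernelBound C t Φ) (c : k) :
    KernelBound (‖c‖ * C) t fun i j => c * Φ i j :=
  ⟨mul_nonneg (norm_nonneg _) h.nonneg, h.pos, h.lt_one, fun i j => by
    rw [norm_mul, mul_assoc]
    exact mul_le_mul_of_nonneg_left (h.bound i j) (norm_nonneg _)⟩

theorem fredholm_const_mul (c : k) (Φ : ℕ × ι → ℕ × ι → k) :
    fredholm (fun i j => c * Φ i j) = rescale c (fredholm Φ) := by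
  have hpow : ∀ r, kernelPow (fun i j => c * Φ i j) r = fun i j => c ^ (r + 1) * kernelPow Φ r i j := by
    intro r
    induction r with
    | zero => simp [kernelPow]
    | succ r ih =>
      funext i j
      rw [kernelPow_succ, kernelPow_succ, ih, ← tsum_mul_left]
      exact tsum_congr fun l => by ring
  have htr : ∀ r, kernelTrace (fun i j => c * Φ i j) r = c ^ (r + 1) * kernelTrace Φ r := fun r => by
    simp only [kernelTrace, hpow, tsum_mul_left]
  ext s
  rw [PowerSeries.coeff_rescale, fredholm, fredholm, coeff_mk, coeff_mk]
  refine congrFun (eq_of_newton (τ := kernelTrace fun i j => c * Φ i j)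
    (f := newtonSeq (kernelTrace fun i j => c * Φ i j))
    (g := fun s => c ^ s * newtonSeq (kernelTrace Φ) s) (by simp [newtonSeq_zero])
    (nat_mul_newtonSeq _) fun s => ?_) s
  rw [mul_left_comm, nat_mul_newtonSeq, mul_neg, mul_sum]
  congr 1
  refine sum_congr rfl fun r hr => ?_
  rw [htr]
  have : s = (r + 1) + (s - 1 - r) := by have := mem_range.1 hr; omega
  conv_lhs => rw [this, pow_add]
  have h2 : r + 1 + (s - 1 - r) - 1 - r = s - 1 - r := by omega
  rw [h2]
  ring

theorem norm_mulVec_le {I : Type*} {e : ℕ} {b : Matrix I (Fin e) k} {B : ℝ}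
    (hB : ∀ i j, ‖b i j‖ ≤ B) (c : Fin e → k) : ∃ B' : ℝ, ∀ i, ‖b.mulVec c i‖ ≤ B' := by
  refine ⟨∑ j, B * ‖c j‖, fun i => ?_⟩
  rw [mulVec, dotProduct]
  refine (norm_sum_le _ _).trans (sum_le_sum fun j _ => ?_)
  rw [norm_mul]
  exact mul_le_mul_of_nonneg_right (hB i j) (norm_nonneg _)

theorem KernelBound.kernelMul_mulVec (h : KernelBound C t Φ) {e : ℕ} {b : Matrix (ℕ × ι) (Fin e) k}
    {B : ℝ} (hB : ∀ i j, ‖b i j‖ ≤ B) {m : Matrix (Fin e) (Fin e) k}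
    (hΦ : ∀ i j, ∑' l, Φ i l * b l j = ∑ l, b i l * m l j) (c : Fin e → k) :
    kernelMul Φ (b.mulVec c) = b.mulVec (m.mulVec c) := by
  funext i
  rw [mulVec_mulVec]
  simp only [kernelMul, mulVec, dotProduct, mul_sum, Matrix.mul_apply]
  rw [Summable.tsum_finsetSum]
  · refine sum_congr rfl fun j _ => ?_
    rw [← hΦ, ← tsum_mul_right]
    exact tsum_congr fun l => by ring
  · intro j _
    simpa [mul_assoc] using (h.summable_mul (x := fun l => b l j) (fun l => hB l j) i).mul_right (c j)

/-- The part of the ratio `Λ` of Fredholm determinants outside slope `ε` is carried by the kernel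
of an operator `θ` with `Φ θ = c θ Φ`. -/
theorem KernelBound.exists_horizontal_subspace (h : KernelBound C t Φ) (c : k)
    (θ : (ℕ × ι → k) →ₗ[k] (ℕ × ι → k))
    (hθb : ∀ (x : ℕ × ι → k) (B : ℝ), (∀ i, ‖x i‖ ≤ B) → ∃ B' : ℝ, ∀ i, ‖θ x i‖ ≤ B')
    (hθ : ∀ (x : ℕ × ι → k) (B : ℝ), (∀ i, ‖x i‖ ≤ B) →
      kernelMul Φ (θ x) = c • θ (kernelMul Φ x))
    {Λ : k⟦X⟧} (hΛ : Λ * rescale c (fredholm Φ) = fredholm Φ)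
    {ε : ℝ} (hε : 0 < ε) :
    ∃ (e : ℕ) (b : Matrix (ℕ × ι) (Fin e) k) (m : Matrix (Fin e) (Fin e) k) (B C' : ℝ),
      (∀ i j, ‖b i j‖ ≤ B) ∧ (∀ x, b.mulVec x = 0 → x = 0) ∧
      (∀ x, c • kernelMul Φ (b.mulVec x) = b.mulVec (m.mulVec x)) ∧
      (∀ x, θ (b.mulVec x) = 0) ∧ 0 ≤ C' ∧
      GrowthLE ε C' (Λ * (m.charpolyRev : k⟦X⟧)) := by
  have hΨ := h.const_mul c
  obtain ⟨e, b₀, m, u, hb1, hbm, hinj, hfr, hu, hu0⟩ := hΨ.exists_slope_subspace hε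
  let b : Matrix (ℕ × ι) (Fin e) k := b₀
  rw [fredholm_const_mul] at hfr
  have hact : ∀ x, c • kernelMul Φ (b.mulVec x) = b.mulVec (m.mulVec x) := by
    intro x
    rw [← hΨ.kernelMul_mulVec (b := b) hb1 hbm x]
    funext i
    rw [kernelMul_const_mul]
    rfl
  have hcomm : ∀ x, kernelMul Φ (θ (b.mulVec x)) = θ (b.mulVec (m.mulVec x)) := by
    intro x
    obtain ⟨B', hB'⟩ := norm_mulVec_le (b := b) hb1 x
    rw [hθ _ B' hB', ← map_smul, hact]
  have hk0 : kernelMul Φ 0 = 0 := by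
    funext i
    simp [kernelMul]
  obtain ⟨e₁, e₂, P₁, P₂, m₁, m₂, Y, Q₁, hP₁, hP₂, hQ, hN₁, hN₂, hchar⟩ :=
    exists_block_of_invariant m (LinearMap.ker (θ ∘ₗ b.mulVecLin)) (fun x hx => by
      have hx' : θ (b.mulVec x) = 0 := hx
      have := hcomm x
      rw [hx', hk0] at this
      exact this.symm)
  let L : (Fin e₂ → k) →ₗ[k] (ℕ × ι → k) := θ ∘ₗ b.mulVecLin ∘ₗ P₂.mulVecLin
  let b₂ : Matrix (ℕ × ι) (Fin e₂) k := fun i j => L (Pi.single j 1) i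
  have hL : ∀ x, L x = b₂.mulVec x := by
    intro x
    rw [← univ_sum_single x, map_sum]
    funext i
    rw [Finset.sum_apply]
    simp only [mulVec, dotProduct]
    refine sum_congr rfl fun j _ => ?_
    rw [univ_sum_single, mul_comm]
    have : (Pi.single j (x j) : Fin e₂ → k) = x j • Pi.single j 1 := by
      rw [← Pi.single_smul, smul_eq_mul, mul_one]
    rw [this, map_smul]
    rfl
  have hLm : ∀ x, kernelMul Φ (L x) = L (m₂.mulVec x) := by
    intro x
    change kernelMul Φ (θ (b.mulVec (P₂.mulVec x))) = θ (b.mulVec (P₂.mulVec (m₂.mulVec x)))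
    rw [hcomm, mulVec_mulVec _ m, hP₂, add_mulVec, ← mulVec_mulVec,
      ← mulVec_mulVec, Matrix.mulVec_add, map_add]
    have h0 : θ (b.mulVec (P₁.mulVec (Y.mulVec x))) = 0 := hN₁ _
    rw [h0, zero_add]
  obtain ⟨B₂, hB₂⟩ : ∃ B₂ : ℝ, ∀ i j, ‖b₂ i j‖ ≤ B₂ := by
    have h1 : ∀ j, ∃ B : ℝ, ∀ i, ‖b₂ i j‖ ≤ B := fun j => by
      obtain ⟨B', hB'⟩ := norm_mulVec_le (b := b) hb1 (P₂.mulVec (Pi.single j 1))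
      exact hθb _ B' hB'
    choose B hB using h1
    refine ⟨∑ j, |B j|, fun i j => (hB j i).trans ((le_abs_self _).trans ?_)⟩
    exact single_le_sum (f := fun j => |B j|) (fun j _ => abs_nonneg _) (mem_univ j)
  obtain ⟨g, hg, hgr⟩ := h.exists_fredholm_eq_mul hB₂ (m := m₂) (fun i j => by
      have h1 := congrFun (hLm (Pi.single j 1)) i
      rw [hL (m₂.mulVec _)] at h1
      refine h1.trans ?_
      rw [mulVec_single_one]
      rfl) (fun x hx => hN₂ x (by
      change L x = 0
      rw [hL]
      exact funext hx))
  obtain ⟨C', hC', hgC'⟩ := hgr ε hε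
  have hu1 : PowerSeries.constantCoeff u ≠ 0 := by
    rw [← coeff_zero_eq_constantCoeff_apply, hu0]
    exact one_ne_zero
  have hm₂ : (m₂.charpolyRev : k⟦X⟧) ≠ 0 := by
    intro h0
    have := congrArg (PowerSeries.coeff 0) h0
    rw [Polynomial.coeff_coe, charpolyRev_coeff_zero, map_zero] at this
    exact one_ne_zero this
  have hfin : Λ * (m₁.charpolyRev : k⟦X⟧) = g * u⁻¹ := by
    rw [PowerSeries.eq_mul_inv_iff_mul_eq hu1]
    refine mul_left_cancel₀ hm₂ ?_
    rw [← hg, ← hΛ, hfr, hchar, Polynomial.coe_mul]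
    ring
  obtain ⟨B₁, hB₁⟩ : ∃ B₁ : ℝ, ∀ i j, ‖(b * P₁) i j‖ ≤ B₁ := by
    have h1 : ∀ j, ∃ B : ℝ, ∀ i, ‖(b * P₁) i j‖ ≤ B := fun j =>
      norm_mulVec_le (b := b) hb1 (fun l => P₁ l j)
    choose B hB using h1
    refine ⟨∑ j, |B j|, fun i j => (hB j i).trans ((le_abs_self _).trans ?_)⟩
    exact single_le_sum (f := fun j => |B j|) (fun j _ => abs_nonneg _) (mem_univ j)
  refine ⟨e₁, b * P₁, m₁, B₁, C' * 1, hB₁, ?_, ?_, ?_, by positivity, ?_⟩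
  · intro x hx
    rw [← mulVec_mulVec] at hx
    have h1 : P₁.mulVec x = 0 := hinj _ fun i => congrFun hx i
    rw [← one_mulVec x, ← hQ, ← mulVec_mulVec, h1, mulVec_zero]
  · intro x
    rw [← mulVec_mulVec, hact, mulVec_mulVec _ m, hP₁, ← mulVec_mulVec,
      mulVec_mulVec _ b]
  · intro x
    rw [← mulVec_mulVec]
    exact hN₁ x
  · rw [hfin]
    exact GrowthLE.mul hε.le hC' zero_le_one hgC'
      (GrowthLE.of_mul_eq_one hε.le hu hu0 (PowerSeries.mul_inv_cancel _ hu1))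

end Horizontal

/-- The integers `a_i` with `exp (x + x ^ p / p) = ∑ a_i x ^ i / i!`. -/
def artinHasseNum (p : ℕ) : ℕ → ℕ
  | 0 => 1
  | i + 1 => artinHasseNum p i +
      if p - 1 ≤ i then (i + 2 - p).ascFactorial (p - 1) * artinHasseNum p (i - (p - 1)) else 0

section Divisibility

variable {p : ℕ} [hp : Fact p.Prime]

theorem prime_dvd_ascFactorial {i : ℕ} (hi : ¬ p ∣ i + 1) (hpi : p - 1 ≤ i) :
    p ∣ (i + 2 - p).ascFactorial (p - 1) := by
  have h1 := hp.out.pos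
  have h2 : p ∣ (i + 2 - p).ascFactorial (p - 1 + 1) := by
    rw [Nat.sub_add_cancel h1]
    exact (Nat.dvd_factorial h1 le_rfl).trans (Nat.factorial_dvd_ascFactorial _ _)
  rw [Nat.ascFactorial_succ] at h2
  have h3 : i + 2 - p + (p - 1) = i + 1 := by omega
  rw [h3] at h2
  exact (hp.out.dvd_mul.1 h2).resolve_left hi

theorem prime_dvd_one_add_ascFactorial (m : ℕ) : p ∣ 1 + (p * m + 1).ascFactorial (p - 1) := by
  rw [← ZMod.natCast_eq_zero_iff, Nat.ascFactorial_eq_prod_range]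
  push_cast
  simp only [CharP.cast_eq_zero, zero_mul, zero_add]
  have h := ZMod.wilsons_lemma p
  rw [← prod_range_add_one_eq_factorial] at h
  push_cast at h
  have h2 : ∏ x ∈ range (p - 1), (1 + (x : ZMod p)) = -1 := by
    rw [← h]
    exact prod_congr rfl fun x _ => add_comm _ _
  rw [h2]
  ring

theorem pow_dvd_artinHasseNum (s : ℕ) : ∀ i, 2 * p * s ≤ i + p → p ^ s ∣ artinHasseNum p i := by
  have hp1 := hp.out.pos
  induction s with
  | zero => simp
  | succ s ih =>
    have hstep : ∀ i, 2 * p * s ≤ i + 1 → ¬ p ∣ i + 1 →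
        (artinHasseNum p (i + 1) ≡ artinHasseNum p i [MOD p ^ (s + 1)]) := by
      intro i hi hpi
      rw [artinHasseNum]
      split_ifs with h
      · have h1 : p ^ (s + 1) ∣ (i + 2 - p).ascFactorial (p - 1) * artinHasseNum p (i - (p - 1)) := by
          rw [pow_succ']
          exact Nat.mul_dvd_mul (prime_dvd_ascFactorial hpi h) (ih _ (by omega))
        simpa using (Nat.modEq_zero_iff_dvd.2 h1).add_left (artinHasseNum p i)
      · exact Nat.ModEq.refl _
    have hblock : ∀ m, 2 * s ≤ m → ∀ j, j < p →
        (artinHasseNum p (p * m + j) ≡ artinHasseNum p (p * m) [MOD p ^ (s + 1)]) := by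
      intro m hm j
      have hpm : 2 * p * s ≤ p * m := by nlinarith
      induction j with
      | zero => exact fun _ => Nat.ModEq.refl _
      | succ j ihj =>
        intro hj
        refine (hstep (p * m + j) (by omega) ?_).trans (ihj (by omega))
        rw [add_assoc]
        intro hd
        exact absurd (Nat.le_of_dvd (Nat.succ_pos _) ((Nat.dvd_add_right (dvd_mul_right p m)).1 hd))
          (by omega)
    have hmul : ∀ m, 2 * s ≤ m → p ^ (s + 1) ∣ artinHasseNum p (p * (m + 1)) := by
      intro m hm
      have hpm : 2 * p * s ≤ p * m := by nlinarith
      have h1 : p * (m + 1) = (p * m + (p - 1)) + 1 := by rw [mul_add]; omega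
      rw [h1, artinHasseNum, if_pos (by omega)]
      have h2 : p * m + (p - 1) + 2 - p = p * m + 1 := by omega
      have h3 : p * m + (p - 1) - (p - 1) = p * m := by omega
      rw [h2, h3, ← Nat.modEq_zero_iff_dvd]
      refine ((hblock m hm (p - 1) (by omega)).add_right _).trans ?_
      rw [Nat.modEq_zero_iff_dvd, pow_succ', ← one_add_mul]
      exact Nat.mul_dvd_mul (prime_dvd_one_add_ascFactorial m) (ih _ (by omega))
    intro i hi
    have hdm := Nat.div_add_mod i p
    have hlt := Nat.mod_lt i hp1
    have hge : 2 * s + 1 ≤ i / p := by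
      rw [Nat.le_div_iff_mul_le hp1]
      nlinarith
    obtain ⟨m, hm⟩ : ∃ m, i / p = m + 1 := ⟨i / p - 1, by omega⟩
    rw [← hdm, hm, ← Nat.modEq_zero_iff_dvd]
    exact (hblock (m + 1) (by omega) _ hlt).trans
      (Nat.modEq_zero_iff_dvd.2 (hmul m (by omega)))

end Divisibility

section Theta

variable (p : ℕ) [hp : Fact p.Prime] {K : Type*} [NontriviallyNormedField K]
  [NormedAlgebra ℚ_[p] K] [CharZero K] {π : K}

theorem norm_natCast_eq (m : ℕ) : ‖(m : K)‖ = ‖(m : ℚ_[p])‖ := by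
  rw [← norm_algebraMap' K (m : ℚ_[p]), map_natCast]

theorem norm_prime_eq : ‖(p : K)‖ = (p : ℝ)⁻¹ := by
  rw [norm_natCast_eq p, Padic.norm_p]

theorem norm_natCast_le_one' (p : ℕ) [Fact p.Prime] {K : Type*} [NontriviallyNormedField K]
    [NormedAlgebra ℚ_[p] K] [CharZero K] (m : ℕ) : ‖(m : K)‖ ≤ 1 := by
  rw [norm_natCast_eq p]
  exact_mod_cast Padic.norm_int_le_one (p := p) (m : ℤ)

theorem norm_natCast_eq_one {m : ℕ} (hm : ¬ p ∣ m) : ‖(m : K)‖ = 1 := by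
  rw [norm_natCast_eq p]
  refine le_antisymm (by exact_mod_cast Padic.norm_int_le_one (p := p) (m : ℤ)) ?_
  by_contra! h
  have h1 := (Padic.norm_intCast_lt_one_iff (p := p) (k := (m : ℤ))).1 (by exact_mod_cast h)
  exact hm (by exact_mod_cast h1)

variable {p}

theorem norm_uniformizer_pow (hπ : π ^ (p - 1) = -p) : ‖π‖ ^ (p - 1) = (p : ℝ)⁻¹ := by
  rw [← norm_pow, hπ, norm_neg, norm_prime_eq]

theorem norm_uniformizer_lt_one (hπ : π ^ (p - 1) = -p) : ‖π‖ < 1 := by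
  by_contra! h
  have h1 := one_le_pow₀ h (n := p - 1)
  rw [norm_uniformizer_pow hπ] at h1
  have := inv_lt_one_of_one_lt₀ (Nat.one_lt_cast (α := ℝ).2 hp.out.one_lt)
  linarith

theorem uniformizer_ne_zero (hπ : π ^ (p - 1) = -p) : π ≠ 0 := by
  rintro rfl
  have h1 : (p : K) = 0 := by
    rw [zero_pow (Nat.sub_ne_zero_of_lt hp.out.one_lt)] at hπ
    simpa using hπ.symm
  exact hp.out.ne_zero (by exact_mod_cast h1)

theorem norm_uniformizer_pow_le_factorial (hπ : π ^ (p - 1) = -p) (i : ℕ) :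
    ‖π‖ ^ i ≤ ‖(i.factorial : K)‖ := by
  have hp1 : p - 1 ≠ 0 := Nat.sub_ne_zero_of_lt hp.out.one_lt
  refine le_of_pow_le_pow_left₀ hp1 (norm_nonneg _) ?_
  have h0 : ((i.factorial : ℚ_[p])) ≠ 0 := by exact_mod_cast i.factorial_ne_zero
  have hp0 : (0 : ℝ) < p := by exact_mod_cast hp.out.pos
  rw [norm_natCast_eq p, Padic.norm_eq_zpow_neg_valuation h0, Padic.valuation_natCast, ← pow_mul,
    mul_comm, pow_mul, norm_uniformizer_pow hπ, inv_pow, zpow_neg, inv_pow, zpow_natCast, ← pow_mul]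
  refine inv_anti₀ (by positivity) ?_
  refine pow_le_pow_right₀ (by exact_mod_cast hp.out.one_le) ?_
  rw [mul_comm, sub_one_mul_padicValNat_factorial]
  omega

/-- The coefficients of the Dwork exponential `exp (π (x - x ^ p))`. -/
def dworkCoeff (p : ℕ) (π : K) (i : ℕ) : K :=
  artinHasseNum p i * π ^ i / i.factorial

theorem dworkCoeff_zero : dworkCoeff p π 0 = 1 := by
  simp [dworkCoeff, artinHasseNum]

theorem dworkCoeff_one (hp2 : 2 < p) : dworkCoeff p π 1 = π := by
  simp [dworkCoeff, artinHasseNum, show p - 1 ≠ 0 by omega]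

theorem dworkCoeff_succ (hπ : π ^ (p - 1) = -p) (i : ℕ) :
    ((i + 1 : ℕ) : K) * dworkCoeff p π (i + 1) = π * dworkCoeff p π i -
      if p - 1 ≤ i then p * π * dworkCoeff p π (i - (p - 1)) else 0 := by
  have hf : ∀ j : ℕ, (j.factorial : K) ≠ 0 := fun j => by exact_mod_cast j.factorial_ne_zero
  have hi : ((i + 1 : ℕ) : K) ≠ 0 := by exact_mod_cast i.succ_ne_zero
  unfold dworkCoeff
  rw [artinHasseNum, Nat.factorial_succ]
  split_ifs with h
  · obtain ⟨j, rfl⟩ := Nat.exists_eq_add_of_le' h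
    have h1 : j + (p - 1) + 2 - p = j + 1 := by have := hp.out.pos; omega
    rw [Nat.add_sub_cancel, h1]
    have h2 := Nat.factorial_mul_ascFactorial j (p - 1)
    have h3 : ((j + (p - 1)).factorial : K) = j.factorial * ((j + 1).ascFactorial (p - 1) : ℕ) := by
      exact_mod_cast h2.symm
    have h4 := hf (j + (p - 1))
    have h5 := hf j
    have hp3 : (p : K) = - π ^ (p - 1) := by rw [hπ, neg_neg]
    rw [hp3]
    push_cast at hi ⊢
    rw [h3] at h4 ⊢
    have h6 := right_ne_zero_of_mul h4
    field_simp
    ring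
  · have h4 := hf i
    push_cast at hi ⊢
    field_simp
    ring

theorem norm_dworkCoeff_le_num (hπ : π ^ (p - 1) = -p) (i : ℕ) :
    ‖dworkCoeff p π i‖ ≤ ‖(artinHasseNum p i : K)‖ := by
  have hf : 0 < ‖(i.factorial : K)‖ := norm_pos_iff.2 (by exact_mod_cast i.factorial_ne_zero)
  rw [dworkCoeff, norm_div, norm_mul, norm_pow, div_le_iff₀ hf]
  gcongr
  exact norm_uniformizer_pow_le_factorial hπ i

theorem norm_dworkCoeff_le (hπ : π ^ (p - 1) = -p) {i s : ℕ} (h : 2 * p * s ≤ i + p) :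
    ‖dworkCoeff p π i‖ ≤ ‖π‖ ^ ((p - 1) * s) := by
  refine (norm_dworkCoeff_le_num hπ i).trans ?_
  obtain ⟨c, hc⟩ := pow_dvd_artinHasseNum s i h
  rw [hc, pow_mul, norm_uniformizer_pow hπ, Nat.cast_mul, norm_mul, Nat.cast_pow, norm_pow,
    norm_prime_eq]
  exact mul_le_of_le_one_right (by positivity) (norm_natCast_le_one' p c)

theorem norm_dworkCoeff_le_sq (hp2 : 2 < p) (hπ : π ^ (p - 1) = -p) {i : ℕ} (hi : 2 ≤ i) :
    ‖dworkCoeff p π i‖ ≤ ‖π‖ ^ 2 := by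
  have hlt := (norm_uniformizer_lt_one hπ).le
  rcases lt_or_ge i p with h | h
  · have hf : ‖(i.factorial : K)‖ = 1 :=
      norm_natCast_eq_one p (fun hd => absurd ((Nat.Prime.dvd_factorial hp.out).1 hd) (by omega))
    rw [dworkCoeff, norm_div, norm_mul, norm_pow, hf, div_one]
    calc _ ≤ 1 * ‖π‖ ^ 2 := mul_le_mul (norm_natCast_le_one' p _)
          (pow_le_pow_of_le_one (norm_nonneg _) hlt hi) (by positivity) zero_le_one
      _ = _ := one_mul _
  · refine (norm_dworkCoeff_le hπ (s := 1) (by omega)).trans ?_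
    exact pow_le_pow_of_le_one (norm_nonneg _) hlt (by omega)

end Theta

section PolyLE

open Polynomial

variable {K : Type*} [NontriviallyNormedField K] [IsUltrametricDist K] {ρ c d : ℝ} {P Q : K[X]}

/-- `P` is bounded by `c` in the Gauss norm of radius `ρ⁻¹`. -/
def PolyLE (ρ c : ℝ) (P : K[X]) : Prop := ∀ s, ‖P.coeff s‖ ≤ c * ρ ^ s

theorem PolyLE.growthLE (h : PolyLE ρ c P) : GrowthLE ρ c (P : K⟦X⟧) := fun s => by
  rw [Polynomial.coeff_coe]
  exact h s

theorem PolyLE.nonneg (h : PolyLE ρ c P) : 0 ≤ c := by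
  simpa using (norm_nonneg _).trans (h 0)

theorem PolyLE.mono (h : PolyLE ρ c P) (hρ : 0 < ρ) (hcd : c ≤ d) : PolyLE ρ d P := fun s =>
  (h s).trans (by gcongr)

theorem PolyLE.mul (hρ : 0 < ρ) (hP : PolyLE ρ c P) (hQ : PolyLE ρ d Q) :
    PolyLE ρ (c * d) (P * Q) := fun s => by
  rw [← Polynomial.coeff_coe, Polynomial.coe_mul]
  exact hP.growthLE.mul hρ.le hP.nonneg hQ.nonneg hQ.growthLE s

theorem PolyLE.add (hρ : 0 < ρ) (hP : PolyLE ρ c P) (hQ : PolyLE ρ c Q) : PolyLE ρ c (P + Q) :=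
  fun s => by
    rw [coeff_add]
    exact (norm_add_le_max _ _).trans (max_le (hP s) (hQ s))

theorem PolyLE.neg (hP : PolyLE ρ c P) : PolyLE ρ c (-P) := fun s => by
  rw [coeff_neg, norm_neg]
  exact hP s

theorem PolyLE.sub (hρ : 0 < ρ) (hP : PolyLE ρ c P) (hQ : PolyLE ρ c Q) : PolyLE ρ c (P - Q) := by
  rw [sub_eq_add_neg]
  exact hP.add hρ hQ.neg

theorem polyLE_C (a : K) (hρ : 0 < ρ) : PolyLE ρ ‖a‖ (C a) := fun s => by
  rw [coeff_C]
  split_ifs with h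
  · simp [h]
  · simp only [norm_zero]
    positivity

theorem polyLE_one (hρ : 0 < ρ) : PolyLE ρ 1 (1 : K[X]) := by
  simpa using polyLE_C (1 : K) hρ

theorem polyLE_zero : PolyLE ρ 0 (0 : K[X]) := fun s => by simp

theorem polyLE_X (hρ : 0 < ρ) : PolyLE ρ ρ⁻¹ (X : K[X]) := fun s => by
  rw [coeff_X]
  split_ifs with h
  · simp [← h, hρ.ne']
  · simp only [norm_zero]
    positivity

theorem PolyLE.pow (hρ : 0 < ρ) (hP : PolyLE ρ c P) (i : ℕ) : PolyLE ρ (c ^ i) (P ^ i) := by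
  induction i with
  | zero => simpa using polyLE_one hρ
  | succ i ih =>
    rw [pow_succ, pow_succ]
    exact ih.mul hρ hP

theorem PolyLE.C_mul (hρ : 0 < ρ) (hP : PolyLE ρ c P) (a : K) : PolyLE ρ (‖a‖ * c) (C a * P) :=
  (polyLE_C a hρ).mul hρ hP

theorem PolyLE.sum {α : Type*} {s : Finset α} {f : α → K[X]} (hc : 0 ≤ c) (hρ : 0 < ρ)
    (h : ∀ i ∈ s, PolyLE ρ c (f i)) : PolyLE ρ c (∑ i ∈ s, f i) := fun t => by
  rw [finsetSum_coeff]
  exact norm_sum_le_of_forall (by positivity) fun i hi => h i hi t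

theorem PolyLE.comp (hρ : 0 < ρ) (hP : PolyLE ρ c P) (hQ : PolyLE ρ ρ⁻¹ Q) :
    PolyLE ρ c (P.comp Q) := by
  rw [comp_eq_sum_left, Polynomial.sum]
  refine PolyLE.sum hP.nonneg hρ fun i _ => ?_
  refine (((hQ.pow hρ i).C_mul hρ (P.coeff i))).mono hρ ?_
  refine (mul_le_mul_of_nonneg_right (hP i) (by positivity)).trans_eq ?_
  rw [mul_assoc, ← mul_pow, mul_inv_cancel₀ hρ.ne', one_pow, mul_one]

theorem polyLE_C_mul_X_add_C (hρ : 0 < ρ) (a b : K) (ha : ‖a‖ ≤ c * ρ) (hb : ‖b‖ ≤ c) :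
    PolyLE ρ c (C a * X + C b) := by
  refine PolyLE.add hρ (((polyLE_X hρ).C_mul hρ a).mono hρ ?_) ((polyLE_C b hρ).mono hρ hb)
  rwa [← div_eq_mul_inv, div_le_iff₀ hρ]

/-- A sequence of polynomials tending to zero in the Gauss norm of radius `ρ⁻¹`. -/
def GaussNull (ρ : ℝ) (f : ℕ → K[X]) : Prop := ∀ ε > 0, ∀ᶠ N in atTop, PolyLE ρ ε (f N)

variable {f g : ℕ → K[X]}

theorem GaussNull.of_le {b : ℕ → ℝ} (hρ : 0 < ρ) (hb : Tendsto b atTop (nhds 0))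
    (h : ∀ᶠ N in atTop, PolyLE ρ (b N) (f N)) : GaussNull ρ f := fun ε hε => by
  filter_upwards [h, hb.eventually_lt_const hε] with N h1 h2
  exact h1.mono hρ h2.le

theorem GaussNull.add (hρ : 0 < ρ) (hf : GaussNull ρ f) (hg : GaussNull ρ g) :
    GaussNull ρ fun N => f N + g N := fun ε hε => by
  filter_upwards [hf ε hε, hg ε hε] with N h1 h2
  exact h1.add hρ h2

theorem GaussNull.mul (hρ : 0 < ρ) (hf : GaussNull ρ f) (hg : ∀ᶠ N in atTop, PolyLE ρ c (g N)) :
    GaussNull ρ fun N => f N * g N := fun ε hε => by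
  filter_upwards [hf (ε / (|c| + 1)) (by positivity), hg] with N h1 h2
  refine (h1.mul hρ h2).mono hρ ?_
  rw [div_mul_eq_mul_div, div_le_iff₀ (by positivity)]
  have := le_abs_self c
  gcongr
  linarith

theorem GaussNull.congr (hf : GaussNull ρ f) (h : ∀ N, f N = g N) : GaussNull ρ g := by
  rwa [← funext h]

theorem GaussNull.pow_sub_pow (hρ : 0 < ρ) (h : GaussNull ρ fun N => f N - g N)
    (hf : ∀ᶠ N in atTop, PolyLE ρ c (f N)) (hg : ∀ᶠ N in atTop, PolyLE ρ c (g N))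
    (n : ℕ) : GaussNull ρ fun N => f N ^ n - g N ^ n := by
  refine (h.mul hρ (g := fun N => ∑ i ∈ range n, f N ^ i * g N ^ (n - 1 - i)) (c := c ^ (n - 1))
    ?_).congr fun N => by
      rw [mul_comm]
      exact (Commute.all _ _).geom_sum₂_mul n
  filter_upwards [hf, hg] with N h1 h2
  refine PolyLE.sum (pow_nonneg h1.nonneg _) hρ fun i hi => ?_
  have h3 := (h1.pow hρ i).mul hρ (h2.pow hρ (n - 1 - i))
  rwa [← pow_add, show i + (n - 1 - i) = n - 1 by have := mem_range.1 hi; omega] at h3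

/-- Removing the constant coefficient and dividing by `X`, as a linear map. -/
def divXLin : K[X] →ₗ[K] K[X] where
  toFun := divX
  map_add' _ _ := divX_add
  map_smul' a P := by ext; simp [coeff_divX]

theorem coeff_divXLin_pow (n : ℕ) : ∀ (P : K[X]) (s : ℕ),
    ((divXLin ^ n : Module.End K K[X]) P).coeff s = P.coeff (s + n) := by
  induction n with
  | zero => simp
  | succ n ih =>
    intro P s
    rw [pow_succ, Module.End.mul_apply, ih]
    change (divX P).coeff (s + n) = _
    rw [coeff_divX, add_assoc]

/-- The operator with `P = ∑_{l<n} c_l X ^ l + X ^ n * (next P)(X - 1)`. -/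
def nextPoly (n : ℕ) : Module.End K K[X] := taylor (1 : K) ∘ₗ divXLin ^ n

theorem nextPoly_apply (n : ℕ) (P : K[X]) :
    nextPoly n P = ((divXLin ^ n : Module.End K K[X]) P).comp (X + 1) := by
  simp [nextPoly, taylor_apply]

/-- The coefficient of `desc_u ^ n * (X - u) ^ l` in the expansion of a polynomial. -/
def expCoeff (n u l : ℕ) : K[X] →ₗ[K] K := lcoeff K l ∘ₗ nextPoly n ^ u

theorem expCoeff_apply (n u l : ℕ) (P : K[X]) : expCoeff n u l P = ((nextPoly n ^ u) P).coeff l := rfl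

theorem expCoeff_zero_left (n l : ℕ) (P : K[X]) : expCoeff n 0 l P = P.coeff l := rfl

theorem expCoeff_succ_left (n u l : ℕ) (P : K[X]) :
    expCoeff n (u + 1) l P = expCoeff n u l (nextPoly n P) := by
  rw [expCoeff_apply, pow_succ, Module.End.mul_apply, expCoeff_apply]

theorem PolyLE.nextPoly (hρ : 0 < ρ) (hρ1 : ρ ≤ 1) (hP : PolyLE ρ c P) (n : ℕ) :
    PolyLE ρ (c * ρ ^ n) (nextPoly n P) := by
  rw [nextPoly_apply]
  refine PolyLE.comp hρ (fun s => ?_) ?_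
  · rw [coeff_divXLin_pow]
    refine (hP _).trans_eq ?_
    rw [pow_add]
    ring
  · refine (polyLE_X hρ).add hρ ((polyLE_one hρ).mono hρ ?_)
    exact (one_le_inv₀ hρ).2 hρ1

theorem PolyLE.norm_expCoeff_le (hρ : 0 < ρ) (hρ1 : ρ ≤ 1) (n u : ℕ) :
    ∀ {c : ℝ} {P : K[X]}, PolyLE ρ c P → ∀ l, ‖expCoeff n u l P‖ ≤ c * (ρ ^ n) ^ u * ρ ^ l := by
  induction u with
  | zero =>
    intro c P hP l
    simpa [expCoeff_zero_left] using hP l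
  | succ u ih =>
    intro c P hP l
    rw [expCoeff_succ_left]
    refine (ih (hP.nextPoly hρ hρ1 n) l).trans_eq ?_
    ring

theorem nextPoly_C {n : ℕ} (hn : 0 < n) (a : K) : nextPoly n (C a) = 0 := by
  rw [nextPoly_apply]
  have : (divXLin ^ n : Module.End K K[X]) (C a) = 0 := by
    ext s
    rw [coeff_divXLin_pow, coeff_C, if_neg (by omega), coeff_zero]
  rw [this, zero_comp]

theorem nextPoly_X_mul {n : ℕ} (hn : 0 < n) (P : K[X]) :
    nextPoly n (X * P) = (X + 1) * nextPoly n P + C (P.coeff (n - 1)) := by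
  have : (divXLin ^ n : Module.End K K[X]) (X * P) =
      X * (divXLin ^ n : Module.End K K[X]) P + C (P.coeff (n - 1)) := by
    ext s
    rw [coeff_divXLin_pow, coeff_add, show s + n = (s + n - 1) + 1 by omega, coeff_X_mul]
    rcases s with _ | s
    · simp
    · rw [coeff_X_mul, coeff_divXLin_pow, coeff_C, if_neg (by omega), add_zero]
      congr 1
      omega
  rw [nextPoly_apply, this]
  simp [nextPoly_apply]

theorem nextPoly_pow_X_mul {n : ℕ} (hn : 0 < n) (P : K[X]) (u : ℕ) :
    (nextPoly n ^ (u + 1)) (X * P) =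
      (X + ((u + 1 : ℕ) : K[X])) * (nextPoly n ^ (u + 1)) P + C (expCoeff n u (n - 1) P) := by
  induction u with
  | zero => simp [nextPoly_X_mul hn, expCoeff_zero_left]
  | succ u ih =>
    rw [pow_succ' _ (u + 1), Module.End.mul_apply, ih, map_add, nextPoly_C hn, add_mul, map_add,
      nextPoly_X_mul hn, Module.End.mul_apply, expCoeff_apply, ← nsmul_eq_mul, map_nsmul,
      nsmul_eq_mul]
    push_cast
    ring

theorem expCoeff_X_mul {n : ℕ} (hn : 0 < n) (P : K[X]) (u l : ℕ) :
    expCoeff n u l (X * P) = u * expCoeff n u l P + (if l = 0 then 0 else expCoeff n u (l - 1) P) +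
      if l = 0 ∧ u ≠ 0 then expCoeff n (u - 1) (n - 1) P else 0 := by
  rcases u with _ | u
  · rcases l with _ | l
    · simp [expCoeff_zero_left]
    · simp [expCoeff_zero_left]
  · rw [expCoeff_apply, nextPoly_pow_X_mul hn, add_mul, ← C_eq_natCast, coeff_add, coeff_add,
      coeff_C_mul, coeff_C]
    rcases l with _ | l
    · simp [expCoeff_apply]
    · simp [expCoeff_apply]
      ring

/-- Multiplication by the variable of the twisted coordinate. -/
theorem nextPoly_X_pow_mul_comp (n : ℕ) (P : K[X]) : nextPoly n (X ^ n * P.comp (X - 1)) = P := by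
  have : (divXLin ^ n : Module.End K K[X]) (X ^ n * P.comp (X - 1)) = P.comp (X - 1) := by
    ext s
    rw [coeff_divXLin_pow, add_comm, add_comm n s, coeff_X_pow_mul]
  rw [nextPoly_apply, this, comp_assoc]
  simp

theorem GaussNull.tendsto_expCoeff (hρ : 0 < ρ) (hρ1 : ρ ≤ 1) {f : ℕ → K[X]} (hf : GaussNull ρ f)
    (n u l : ℕ) : Tendsto (fun N => expCoeff n u l (f N)) atTop (nhds 0) := by
  rw [Metric.tendsto_atTop']
  intro ε hε
  have h := hf (ε / 2) (by positivity)
  rw [eventually_atTop] at h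
  obtain ⟨N, hN⟩ := h
  refine ⟨N, fun m hm => ?_⟩
  rw [dist_zero_right]
  have h1 := (hN m hm.le).norm_expCoeff_le hρ hρ1 n u l
  have h2 : (ρ ^ n) ^ u * ρ ^ l ≤ 1 := mul_le_one₀ (pow_le_one₀ (by positivity)
    (pow_le_one₀ hρ.le hρ1)) (by positivity) (pow_le_one₀ hρ.le hρ1)
  rw [mul_assoc] at h1
  nlinarith

/-- In a complete ultrametric field a sequence with vanishing increments converges. -/
theorem exists_tendsto_of_sub_tendsto_zero [CompleteSpace K] {f : ℕ → K}
    (h : Tendsto (fun N => f (N + 1) - f N) atTop (nhds 0)) :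
    ∃ a, Tendsto f atTop (nhds a) := by
  refine cauchySeq_tendsto_of_complete ?_
  rw [Metric.cauchySeq_iff']
  intro ε hε
  rw [Metric.tendsto_atTop'] at h
  obtain ⟨N, hN⟩ := h (ε / 2) (by positivity)
  refine ⟨N + 1, fun m hm => ?_⟩
  obtain ⟨j, rfl⟩ := Nat.exists_eq_add_of_le hm
  rw [dist_eq_norm]
  refine lt_of_le_of_lt ?_ (half_lt_self hε)
  induction j with
  | zero => simp; positivity
  | succ j ih =>
    have h1 := (hN (N + 1 + j) (by omega)).le
    rw [dist_zero_right] at h1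
    have h2 := norm_add_le_max (f (N + 1 + j + 1) - f (N + 1 + j))
      (f (N + 1 + j) - f (N + 1))
    rw [sub_add_sub_cancel] at h2
    exact h2.trans (max_le h1 (ih (by omega)))

end PolyLE

section Dwork

variable {p : ℕ} [hp : Fact p.Prime] {K : Type*} [NontriviallyNormedField K]
  [NormedAlgebra ℚ_[p] K] [CharZero K] [IsUltrametricDist K] {π : K}

section Gamma

open Polynomial

/-- The coefficients of the Dwork exponential, extended by zero to negative indices. -/
def dworkCoeffInt (p : ℕ) (π : K) (i : ℤ) : K :=
  if 0 ≤ i then dworkCoeff p π i.toNat else 0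

theorem dworkCoeffInt_natCast (i : ℕ) : dworkCoeffInt p π i = dworkCoeff p π i := by
  simp [dworkCoeffInt]

theorem dworkCoeffInt_of_neg {i : ℤ} (hi : i < 0) : dworkCoeffInt p π i = 0 :=
  if_neg (by omega)

theorem intCast_mul_dworkCoeffInt (hπ : π ^ (p - 1) = -p) (i : ℤ) :
    (i : K) * dworkCoeffInt p π i =
      π * dworkCoeffInt p π (i - 1) - p * π * dworkCoeffInt p π (i - p) := by
  have hp1 := hp.out.pos
  rcases lt_trichotomy i 0 with h | rfl | h
  · rw [dworkCoeffInt_of_neg h, dworkCoeffInt_of_neg (by omega), dworkCoeffInt_of_neg (by omega)]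
    ring
  · rw [dworkCoeffInt_of_neg (i := 0 - 1) (by omega), dworkCoeffInt_of_neg (i := 0 - p) (by omega)]
    simp
  · obtain ⟨m, rfl⟩ : ∃ m : ℕ, i = (m + 1 : ℕ) := ⟨(i - 1).toNat, by omega⟩
    have h1 := dworkCoeff_succ hπ m
    rw [show ((m + 1 : ℕ) : ℤ) - 1 = (m : ℕ) by push_cast; ring, dworkCoeffInt_natCast,
      dworkCoeffInt_natCast, Int.cast_natCast, h1]
    split_ifs with h2
    · rw [show ((m + 1 : ℕ) : ℤ) - p = (m - (p - 1) : ℕ) by omega, dworkCoeffInt_natCast]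
    · rw [dworkCoeffInt_of_neg (by omega)]
      ring

theorem norm_dworkCoeffInt_mul_le (hp17 : 17 ≤ p) (hπ : π ^ (p - 1) = -p) (u : ℕ) {v : ℤ} (hv : v ≤ p) :
    ‖dworkCoeffInt p π (p * u - v)‖ * ‖π‖ ^ 8 ≤ ‖π‖ ^ (8 * u) := by
  have hlt := (norm_uniformizer_lt_one hπ).le
  rcases lt_or_ge ((p : ℤ) * u - v) 0 with h | h
  · rw [dworkCoeffInt_of_neg h]
    simp
  · obtain ⟨m, hm⟩ := Int.eq_ofNat_of_zero_le h
    rw [hm, dworkCoeffInt_natCast]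
    have h1 : 2 * p * (u / 2) ≤ m + p := by
      have : 2 * (u / 2) ≤ u := by omega
      have : (p : ℤ) * (2 * (u / 2) : ℕ) ≤ p * u := by gcongr
      zify
      push_cast at this
      linarith
    refine (mul_le_mul_of_nonneg_right (norm_dworkCoeff_le hπ h1) (by positivity)).trans ?_
    rw [← pow_add]
    refine pow_le_pow_of_le_one (norm_nonneg _) hlt ?_
    have : 16 * (u / 2) ≤ (p - 1) * (u / 2) := Nat.mul_le_mul_right _ (by omega)
    omega

theorem norm_dworkCoeff_prime_mul_le (hp17 : 17 ≤ p) (hπ : π ^ (p - 1) = -p) (u : ℕ) :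
    ‖dworkCoeff p π (p * u)‖ ≤ ‖π‖ ^ (8 * u) := by
  have hlt := (norm_uniformizer_lt_one hπ).le
  have h1 : 2 * p * ((u + 1) / 2) ≤ p * u + p := by
    have : 2 * ((u + 1) / 2) ≤ u + 1 := by omega
    have := Nat.mul_le_mul_left p this
    linarith
  refine (norm_dworkCoeff_le hπ h1).trans (pow_le_pow_of_le_one (norm_nonneg _) hlt ?_)
  have : 16 * ((u + 1) / 2) ≤ (p - 1) * ((u + 1) / 2) := Nat.mul_le_mul_right _ (by omega)
  omega

theorem polyLE_X_sub_natCast {ρ : ℝ} (p : ℕ) [Fact p.Prime] {K : Type*} [NontriviallyNormedField K]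
    [NormedAlgebra ℚ_[p] K] [CharZero K] [IsUltrametricDist K] (hρ : 0 < ρ) (hρ1 : ρ ≤ 1) (u : ℕ) :
    PolyLE ρ ρ⁻¹ (X - (u : K[X])) := by
  have h1 : 1 ≤ ρ⁻¹ := (one_le_inv₀ hρ).2 hρ1
  refine (polyLE_X hρ).sub hρ ?_
  rw [← C_eq_natCast]
  exact (polyLE_C _ hρ).mono hρ ((norm_natCast_le_one' p u).trans h1)

theorem polyLE_descPochhammer {ρ : ℝ} (p : ℕ) [Fact p.Prime] {K : Type*} [NontriviallyNormedField K]
    [NormedAlgebra ℚ_[p] K] [CharZero K] [IsUltrametricDist K] (hρ : 0 < ρ) (hρ1 : ρ ≤ 1) (u : ℕ) :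
    PolyLE ρ (ρ⁻¹ ^ u) (descPochhammer K u) := by
  induction u with
  | zero => simpa using polyLE_one hρ
  | succ u ih =>
    rw [descPochhammer_succ_right, pow_succ]
    exact ih.mul hρ (polyLE_X_sub_natCast p hρ hρ1 u)

/-- The partial sums of the twisted `p`-adic gamma factor. -/
def gammaPoly (p : ℕ) (π : K) (v N : ℕ) : K[X] :=
  ∑ u ∈ range (N + 1), C (dworkCoeffInt p π (p * u - v) * π⁻¹ ^ u) * descPochhammer K u

theorem norm_pos_of_uniformizer (hπ : π ^ (p - 1) = -p) : 0 < ‖π‖ :=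
  norm_pos_iff.2 (uniformizer_ne_zero hπ)

theorem sq_norm_uniformizer_pos (hπ : π ^ (p - 1) = -p) : 0 < ‖π‖ ^ 2 :=
  pow_pos (norm_pos_of_uniformizer hπ) 2

theorem sq_norm_uniformizer_le_one (hπ : π ^ (p - 1) = -p) : ‖π‖ ^ 2 ≤ 1 :=
  pow_le_one₀ (norm_nonneg _) (norm_uniformizer_lt_one hπ).le

theorem polyLE_gammaPoly_term (hp17 : 17 ≤ p) (hπ : π ^ (p - 1) = -p) {v : ℕ} (hv : v ≤ p) (u : ℕ) :
    PolyLE (‖π‖ ^ 2) (‖π‖⁻¹ ^ 8 * (‖π‖ ^ 5) ^ u)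
      (C (dworkCoeffInt p π (p * u - v) * π⁻¹ ^ u) * descPochhammer K u) := by
  have h0 := norm_pos_of_uniformizer hπ
  refine ((polyLE_descPochhammer p (sq_norm_uniformizer_pos hπ) (sq_norm_uniformizer_le_one hπ)
    u).C_mul (sq_norm_uniformizer_pos hπ) _).mono (sq_norm_uniformizer_pos hπ) ?_
  have h1 := norm_dworkCoeffInt_mul_le hp17 hπ u (v := v) (by exact_mod_cast hv)
  rw [norm_mul, norm_pow, norm_inv]
  have h2 : ‖dworkCoeffInt p π (p * u - v)‖ ≤ ‖π‖⁻¹ ^ 8 * ‖π‖ ^ (8 * u) := by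
    rwa [inv_pow, inv_mul_eq_div, le_div_iff₀ (by positivity)]
  calc _ ≤ ‖π‖⁻¹ ^ 8 * ‖π‖ ^ (8 * u) * ‖π‖⁻¹ ^ u * (‖π‖ ^ 2)⁻¹ ^ u := by gcongr
    _ = _ := by
      rw [show 8 * u = 5 * u + u + 2 * u by ring, pow_add, pow_add, pow_mul, pow_mul, inv_pow _ u, inv_pow _ u]
      field_simp

theorem polyLE_gammaPoly (hp17 : 17 ≤ p) (hπ : π ^ (p - 1) = -p) (N : ℕ) :
    PolyLE (‖π‖ ^ 2) 1 (gammaPoly p π 0 N) := by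
  have h0 := norm_pos_of_uniformizer hπ
  have hlt := (norm_uniformizer_lt_one hπ).le
  refine PolyLE.sum zero_le_one (sq_norm_uniformizer_pos hπ) fun u _ => ?_
  refine ((polyLE_descPochhammer p (sq_norm_uniformizer_pos hπ) (sq_norm_uniformizer_le_one hπ)
    u).C_mul (sq_norm_uniformizer_pos hπ) _).mono (sq_norm_uniformizer_pos hπ) ?_
  rw [norm_mul, norm_pow, norm_inv]
  have h2 : ‖dworkCoeffInt p π (p * u - (0 : ℕ))‖ ≤ ‖π‖ ^ (8 * u) := by
    rw [Nat.cast_zero, sub_zero, ← Nat.cast_mul, dworkCoeffInt_natCast]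
    exact norm_dworkCoeff_prime_mul_le hp17 hπ u
  calc _ ≤ ‖π‖ ^ (8 * u) * ‖π‖⁻¹ ^ u * (‖π‖ ^ 2)⁻¹ ^ u := by gcongr
    _ = ‖π‖ ^ (5 * u) := by
      rw [show 8 * u = 5 * u + u + 2 * u by ring, pow_add, pow_add, pow_mul _ 2, inv_pow _ u, inv_pow _ u]
      field_simp
    _ ≤ 1 := pow_le_one₀ h0.le hlt

theorem gaussNull_gammaPoly_succ_sub (hp17 : 17 ≤ p) (hπ : π ^ (p - 1) = -p) {v : ℕ} (hv : v ≤ p) :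
    GaussNull (‖π‖ ^ 2) fun N => gammaPoly p π v (N + 1) - gammaPoly p π v N := by
  have h0 := norm_pos_of_uniformizer hπ
  have h5 : ‖π‖ ^ 5 < 1 := pow_lt_one₀ h0.le (norm_uniformizer_lt_one hπ) (by norm_num)
  refine GaussNull.of_le (sq_norm_uniformizer_pos hπ)
    (b := fun N => ‖π‖⁻¹ ^ 8 * (‖π‖ ^ 5) ^ (N + 1)) ?_ (.of_forall fun N => ?_)
  · have := ((tendsto_pow_atTop_nhds_zero_of_lt_one (by positivity) h5).comp
      (tendsto_add_atTop_nat 1)).const_mul (‖π‖⁻¹ ^ 8)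
    simpa using this
  · rw [gammaPoly, sum_range_succ, gammaPoly, add_sub_cancel_left]
    exact polyLE_gammaPoly_term hp17 hπ hv (N + 1)

theorem gammaPoly_step (hπ : π ^ (p - 1) = -p) (v N : ℕ) :
    C π⁻¹ * ((C (p : K) * X - C (v : K)) * gammaPoly p π v N) = gammaPoly p π (v + 1) N +
      C (p * dworkCoeffInt p π (p * N - v) * π⁻¹ ^ (N + 1)) * descPochhammer K (N + 1) := by
  have hπ0 := uniformizer_ne_zero hπ
  have hstep : ∀ u : ℕ, C π⁻¹ * ((C (p : K) * X - C (v : K)) *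
      (C (dworkCoeffInt p π (p * u - v) * π⁻¹ ^ u) * descPochhammer K u)) =
      C (dworkCoeffInt p π (p * u - (v + 1 : ℕ)) * π⁻¹ ^ u) * descPochhammer K u +
      (C (p * dworkCoeffInt p π (p * u - v) * π⁻¹ ^ (u + 1)) * descPochhammer K (u + 1) -
        C (p * dworkCoeffInt p π (p * u - v - p) * π⁻¹ ^ u) * descPochhammer K u) := by
    intro u
    have h := intCast_mul_dworkCoeffInt hπ (p * u - v)
    have h2 : dworkCoeffInt p π (p * u - (v + 1 : ℕ)) = π⁻¹ * (((p : K) * u - v) *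
        dworkCoeffInt p π (p * u - v)) + p * dworkCoeffInt p π (p * u - v - p) := by
      push_cast at h ⊢
      rw [h, ← sub_sub]
      field_simp
      ring
    rw [h2, descPochhammer_succ_right, ← C_eq_natCast u]
    simp only [map_add, map_mul, map_sub, map_pow, C_eq_natCast]
    ring
  induction N with
  | zero =>
    rw [gammaPoly, gammaPoly]
    simp only [zero_add, sum_range_one]
    rw [hstep 0, dworkCoeffInt_of_neg (i := (p : ℤ) * (0 : ℕ) - v - p)]
    · simp
    · have := hp.out.pos
      push_cast
      omega
  | succ N ih =>
    rw [gammaPoly, sum_range_succ, ← gammaPoly, mul_add, mul_add, ih, hstep, gammaPoly,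
      gammaPoly, sum_range_succ _ (N + 1)]
    rw [show (p : ℤ) * (N + 1 : ℕ) - v - p = p * N - v by push_cast; ring]
    ring

theorem norm_prime_eq_pow (hπ : π ^ (p - 1) = -p) : ‖(p : K)‖ = ‖π‖ ^ (p - 1) := by
  rw [norm_prime_eq, norm_uniformizer_pow hπ]

theorem polyLE_prime_mul_X_sub (hp17 : 17 ≤ p) (hπ : π ^ (p - 1) = -p) (v : ℕ) :
    PolyLE (‖π‖ ^ 2) 1 (C (p : K) * X - C (v : K)) := by
  have hlt := (norm_uniformizer_lt_one hπ).le
  rw [sub_eq_add_neg, ← C_neg]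
  refine polyLE_C_mul_X_add_C (sq_norm_uniformizer_pos hπ) _ _ ?_ ?_
  · rw [norm_prime_eq_pow hπ, one_mul]
    exact pow_le_pow_of_le_one (norm_nonneg _) hlt (by omega)
  · rw [norm_neg]
    exact norm_natCast_le_one' p v

theorem gaussNull_gammaPoly_step (hp17 : 17 ≤ p) (hπ : π ^ (p - 1) = -p) {v : ℕ} (hv : v ≤ p) :
    GaussNull (‖π‖ ^ 2) fun N => gammaPoly p π (v + 1) N -
      C π⁻¹ * ((C (p : K) * X - C (v : K)) * gammaPoly p π v N) := by
  have h0 := norm_pos_of_uniformizer hπ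
  have h5 : ‖π‖ ^ 5 < 1 := pow_lt_one₀ h0.le (norm_uniformizer_lt_one hπ) (by norm_num)
  refine GaussNull.of_le (sq_norm_uniformizer_pos hπ)
    (b := fun N => ‖(p : K)‖ * ‖π‖⁻¹ ^ 11 * (‖π‖ ^ 5) ^ N) ?_
    (.of_forall fun N => ?_)
  · have := (tendsto_pow_atTop_nhds_zero_of_lt_one (by positivity) h5).const_mul
      (‖(p : K)‖ * ‖π‖⁻¹ ^ 11)
    rwa [mul_zero] at this
  · rw [gammaPoly_step hπ, sub_add_cancel_left]
    refine (((polyLE_descPochhammer p (sq_norm_uniformizer_pos hπ) (sq_norm_uniformizer_le_one hπ)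
      (N + 1)).C_mul (sq_norm_uniformizer_pos hπ) _).mono (sq_norm_uniformizer_pos hπ) ?_).neg
    have h1 := norm_dworkCoeffInt_mul_le hp17 hπ N (v := v) (by exact_mod_cast hv)
    rw [norm_mul, norm_mul, norm_pow, norm_inv]
    have h2 : ‖dworkCoeffInt p π (p * N - v)‖ ≤ ‖π‖⁻¹ ^ 8 * ‖π‖ ^ (8 * N) := by
      rwa [inv_pow, inv_mul_eq_div, le_div_iff₀ (by positivity)]
    calc _ ≤ ‖(p : K)‖ * (‖π‖⁻¹ ^ 8 * ‖π‖ ^ (8 * N)) * ‖π‖⁻¹ ^ (N + 1) * (‖π‖ ^ 2)⁻¹ ^ (N + 1) := by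
          gcongr
      _ = _ := by
        rw [show 8 * N = 5 * N + N + 2 * N by ring, pow_add, pow_add, pow_mul, pow_mul, inv_pow _ (N + 1),
          inv_pow _ (N + 1), inv_pow, inv_pow]
        field_simp
        ring

theorem gaussNull_gammaPoly_sub_mul_desc (hp17 : 17 ≤ p) (hπ : π ^ (p - 1) = -p) {v : ℕ} (hv : v ≤ p) :
    GaussNull (‖π‖ ^ 2) fun N => gammaPoly p π v N -
      gammaPoly p π 0 N * (C (π⁻¹ ^ v) * (descPochhammer K v).comp (C (p : K) * X)) := by
  induction v with
  | zero =>
    intro ε hε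
    refine .of_forall fun N => ?_
    simpa using polyLE_zero.mono (sq_norm_uniformizer_pos hπ) hε.le
  | succ v ih =>
    have h1 := gaussNull_gammaPoly_step hp17 hπ (v := v) (by omega)
    have h2 := (ih (by omega)).mul (sq_norm_uniformizer_pos hπ)
      (.of_forall fun N => (polyLE_prime_mul_X_sub hp17 hπ v).C_mul
        (sq_norm_uniformizer_pos hπ) π⁻¹)
    refine (h1.add (sq_norm_uniformizer_pos hπ) h2).congr fun N => ?_
    rw [descPochhammer_succ_right, pow_succ]
    simp only [mul_comp, sub_comp, X_comp, natCast_comp, C_mul, C_eq_natCast]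
    ring

theorem C_mul_X_mul_gammaPoly_comp (N : ℕ) :
    C π⁻¹ * (X * (gammaPoly p π 0 N).comp (X - 1)) = gammaPoly p π p (N + 1) := by
  have hp0 := hp.out.pos
  rw [gammaPoly, gammaPoly, sum_range_succ' _ (N + 1), dworkCoeffInt_of_neg (by push_cast; omega)]
  simp only [Polynomial.sum_comp, mul_sum, zero_mul, map_zero, add_zero]
  refine sum_congr rfl fun u _ => ?_
  rw [descPochhammer_succ_left, show (p : ℤ) * (u + 1 : ℕ) - p = p * u - (0 : ℕ) by push_cast; ring,
    pow_succ]
  simp only [mul_comp, C_comp, C_mul]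
  ring

theorem gaussNull_gammaPoly_functional (hp17 : 17 ≤ p) (hπ : π ^ (p - 1) = -p) :
    GaussNull (‖π‖ ^ 2) fun N => C π⁻¹ * (X * (gammaPoly p π 0 N).comp (X - 1)) -
      gammaPoly p π 0 N * (C (π⁻¹ ^ p) * (descPochhammer K p).comp (C (p : K) * X)) := by
  have h1 := gaussNull_gammaPoly_sub_mul_desc hp17 hπ le_rfl
  have h2 := gaussNull_gammaPoly_succ_sub hp17 hπ (v := p) le_rfl
  refine (h1.add (sq_norm_uniformizer_pos hπ) h2).congr fun N => ?_
  rw [C_mul_X_mul_gammaPoly_comp]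
  ring

/-- The polynomials `π ^ (-n v) desc_v ^ n (X - v) ^ j`, a basis for `j < n`. -/
def basisPoly (π : K) (n v j : ℕ) : K[X] :=
  C (π⁻¹ ^ (n * v)) * descPochhammer K v ^ n * (X - C (v : K)) ^ j

theorem X_mul_basisPoly (n v j : ℕ) :
    X * basisPoly π n v j = C (v : K) * basisPoly π n v j + basisPoly π n v (j + 1) := by
  simp only [basisPoly]
  ring

theorem basisPoly_self (hπ0 : π ≠ 0) (n v : ℕ) :
    basisPoly π n v n = C (π ^ n) * basisPoly π n (v + 1) 0 := by
  simp only [basisPoly]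
  rw [mul_assoc, ← mul_pow, descPochhammer_succ_right, C_eq_natCast, pow_zero, mul_one, ← mul_assoc,
    ← C_mul]
  congr 2
  rw [mul_add, pow_add, mul_one, mul_left_comm, ← mul_pow, mul_inv_cancel₀ hπ0, one_pow, mul_one]

theorem basisPoly_succ (n v j : ℕ) :
    C (π⁻¹ ^ n) * (X ^ n * (basisPoly π n v j).comp (X - 1)) = basisPoly π n (v + 1) j := by
  simp only [basisPoly, mul_comp, pow_comp, sub_comp, X_comp, C_comp]
  rw [descPochhammer_succ_left, mul_add, mul_one, pow_add, C_mul, mul_pow]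
  push_cast
  rw [map_add, map_one]
  ring

theorem polyLE_basisPoly_comp (hπ : π ^ (p - 1) = -p) {q : K} (hq : ‖q‖ ≤ ‖π‖ ^ 2) (n v j : ℕ) :
    PolyLE (‖π‖ ^ 2) (‖π‖⁻¹ ^ (n * v)) ((basisPoly π n v j).comp (C q * X)) := by
  have h0 := sq_norm_uniformizer_pos hπ
  have h1 : ∀ v : ℕ, PolyLE (‖π‖ ^ 2) 1 (C q * X - C (v : K)) := by
    intro v
    rw [sub_eq_add_neg, ← C_neg]
    refine polyLE_C_mul_X_add_C h0 _ _ (by rwa [one_mul]) ?_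
    rw [norm_neg]
    exact norm_natCast_le_one' p v
  have h2 : ∀ v : ℕ, PolyLE (‖π‖ ^ 2) 1 ((descPochhammer K v).comp (C q * X)) := by
    intro v
    induction v with
    | zero => simpa using polyLE_one h0
    | succ v ih =>
      rw [descPochhammer_succ_right, mul_comp, sub_comp, X_comp, natCast_comp, ← C_eq_natCast]
      simpa using ih.mul h0 (h1 v)
  simp only [basisPoly, mul_comp, pow_comp, sub_comp, X_comp, C_comp]
  have h3 := (((h2 v).pow h0 n).C_mul h0 (π⁻¹ ^ (n * v))).mul h0 ((h1 v).pow h0 j)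
  simpa using h3

/-- The images of the basis polynomials under the approximate Frobenius. -/
def frobPoly (p : ℕ) (π : K) (n v j N : ℕ) : K[X] :=
  gammaPoly p π 0 N ^ n * (basisPoly π n v j).comp (C (p : K) * X)

theorem norm_prime_le_sq (hp17 : 17 ≤ p) (hπ : π ^ (p - 1) = -p) : ‖(p : K)‖ ≤ ‖π‖ ^ 2 := by
  rw [norm_prime_eq_pow hπ]
  exact pow_le_pow_of_le_one (norm_nonneg _) (norm_uniformizer_lt_one hπ).le (by omega)

theorem polyLE_frobPoly (hp17 : 17 ≤ p) (hπ : π ^ (p - 1) = -p) (n v j N : ℕ) :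
    PolyLE (‖π‖ ^ 2) (‖π‖⁻¹ ^ (n * v)) (frobPoly p π n v j N) := by
  have h0 := sq_norm_uniformizer_pos hπ
  have := ((polyLE_gammaPoly hp17 hπ N).pow h0 n).mul h0
    (polyLE_basisPoly_comp hπ (norm_prime_le_sq hp17 hπ) n v j)
  rwa [one_pow, one_mul] at this

theorem gaussNull_frobPoly_succ_sub (hp17 : 17 ≤ p) (hπ : π ^ (p - 1) = -p) (n v j : ℕ) :
    GaussNull (‖π‖ ^ 2) fun N => frobPoly p π n v j (N + 1) - frobPoly p π n v j N := by
  have h0 := sq_norm_uniformizer_pos hπ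
  have h1 := (gaussNull_gammaPoly_succ_sub hp17 hπ (Nat.zero_le p)).pow_sub_pow h0
    (.of_forall fun N => polyLE_gammaPoly hp17 hπ (N + 1))
    (.of_forall fun N => polyLE_gammaPoly hp17 hπ N) n
  refine (h1.mul h0 (.of_forall fun N =>
    polyLE_basisPoly_comp hπ (norm_prime_le_sq hp17 hπ) n v j)).congr fun N => ?_
  simp only [frobPoly]
  ring

theorem gaussNull_frobPoly_shift (hp17 : 17 ≤ p) (hπ : π ^ (p - 1) = -p) (n v j : ℕ) :
    GaussNull (‖π‖ ^ 2) fun N => C (π⁻¹ ^ n) * (X ^ n * (frobPoly p π n v j N).comp (X - 1)) -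
      frobPoly p π n (v + p) j N := by
  have h0 := sq_norm_uniformizer_pos hπ
  have h00 := norm_pos_of_uniformizer hπ
  have hlt := (norm_uniformizer_lt_one hπ).le
  have hX : PolyLE (‖π‖ ^ 2) (‖π‖ ^ 2)⁻¹ (X - 1 : K[X]) := by
    simpa using polyLE_X_sub_natCast (K := K) p h0 (sq_norm_uniformizer_le_one hπ) 1
  have hb1 : ∀ N, PolyLE (‖π‖ ^ 2) (‖π‖⁻¹ ^ (p + 3))
      (C π⁻¹ * (X * (gammaPoly p π 0 N).comp (X - 1))) := by
    intro N
    refine (((polyLE_X h0).mul h0 ((polyLE_gammaPoly hp17 hπ N).comp h0 hX)).C_mul h0 π⁻¹).mono h0 ?_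
    rw [norm_inv, mul_one, ← inv_pow, ← pow_succ']
    exact pow_le_pow_right₀ ((one_le_inv₀ h00).2 hlt) (by omega)
  have hb2 : ∀ N, PolyLE (‖π‖ ^ 2) (‖π‖⁻¹ ^ (p + 3))
      (gammaPoly p π 0 N * (C (π⁻¹ ^ p) * (descPochhammer K p).comp (C (p : K) * X))) := by
    intro N
    have h1 := polyLE_basisPoly_comp hπ (norm_prime_le_sq hp17 hπ) 1 p 0
    simp only [basisPoly, mul_comp, C_comp, pow_zero, mul_one, one_mul,
      pow_one] at h1
    refine ((polyLE_gammaPoly hp17 hπ N).mul h0 h1).mono h0 ?_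
    rw [one_mul]
    exact pow_le_pow_right₀ ((one_le_inv₀ h00).2 hlt) (by omega)
  have h1 := (gaussNull_gammaPoly_functional hp17 hπ).pow_sub_pow h0
    (.of_forall hb1) (.of_forall hb2) n
  refine (h1.mul h0 (.of_forall fun N =>
    (polyLE_basisPoly_comp hπ (norm_prime_le_sq hp17 hπ) n v j).comp h0 hX)).congr fun N => ?_
  simp only [frobPoly, basisPoly, mul_comp, pow_comp, sub_comp, X_comp, C_comp, comp_assoc]
  rw [add_comm v p, ← descPochhammer_mul, mul_add, pow_add, C_mul]
  simp only [mul_comp, sub_comp, X_comp, natCast_comp, comp_assoc, mul_pow, C_pow, pow_mul]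
  push_cast
  simp only [C_add, C_eq_natCast]
  have e1 : (p : K[X]) * X - (p + v : K[X]) = (p : K[X]) * (X - 1) - (v : K[X]) := by ring
  have e2 : (p : K[X]) * X - (p : K[X]) = (p : K[X]) * (X - 1) := by ring
  rw [e1, e2]
  generalize (descPochhammer K v).comp ((p : K[X]) * (X - 1)) = d1
  generalize (descPochhammer K p).comp ((p : K[X]) * X) = d2
  generalize (gammaPoly p π 0 N).comp (X - 1) = d3
  generalize C π⁻¹ = d4
  ring

/-- The matrix entries of the approximate Frobenius. -/
def frobEntry (p : ℕ) (π : K) (n u l v j N : ℕ) : K :=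
  π ^ (n * u) * expCoeff n u l (frobPoly p π n v j N)

/-- The limit of the matrix entries of the approximate Frobenius. -/
def frobLim (p : ℕ) (π : K) (n u l v j : ℕ) : K :=
  Filter.limUnder atTop fun N => frobEntry p π n u l v j N

section Complete

variable [CompleteSpace K]

theorem tendsto_frobEntry (hp17 : 17 ≤ p) (hπ : π ^ (p - 1) = -p) (n u l v j : ℕ) :
    Tendsto (fun N => frobEntry p π n u l v j N) atTop
      (nhds (frobLim p π n u l v j)) := by
  refine tendsto_nhds_limUnder (exists_tendsto_of_sub_tendsto_zero ?_)
  have h1 := ((gaussNull_frobPoly_succ_sub hp17 hπ n v j).tendsto_expCoeff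
    (sq_norm_uniformizer_pos hπ) (sq_norm_uniformizer_le_one hπ) n u l).const_mul (π ^ (n * u))
  simpa [frobEntry, mul_sub] using h1

theorem frobLim_succ (hp17 : 17 ≤ p) (hπ : π ^ (p - 1) = -p) (n u l v j : ℕ) :
    frobLim p π n (u + 1) l (v + p) j = frobLim p π n u l v j := by
  have hπ0 := uniformizer_ne_zero hπ
  have h1 := ((gaussNull_frobPoly_shift hp17 hπ n v j).tendsto_expCoeff
    (sq_norm_uniformizer_pos hπ) (sq_norm_uniformizer_le_one hπ) n (u + 1) l).const_mul
      (π ^ (n * (u + 1)))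
  have h2 := (tendsto_frobEntry hp17 hπ n u l v j).sub
    (tendsto_frobEntry hp17 hπ n (u + 1) l (v + p) j)
  refine (sub_eq_zero.1 (tendsto_nhds_unique h2 ?_)).symm
  rw [mul_zero] at h1
  refine h1.congr fun N => ?_
  rw [map_sub, ← smul_eq_C_mul, map_smul, expCoeff_succ_left, nextPoly_X_pow_mul_comp, smul_eq_mul,
    frobEntry, frobEntry, mul_sub, mul_add, mul_one, pow_add, mul_assoc (π ^ (n * u)), ← mul_assoc (π ^ n),
    ← mul_pow, mul_inv_cancel₀ hπ0, one_pow, one_mul]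

theorem frobLim_add (hp17 : 17 ≤ p) (hπ : π ^ (p - 1) = -p) (n u l v j m : ℕ) :
    frobLim p π n (u + m) l (v + p * m) j = frobLim p π n u l v j := by
  induction m with
  | zero => rfl
  | succ m ih =>
    rw [← ih, ← frobLim_succ hp17 hπ n (u + m) l (v + p * m) j, mul_add, mul_one, ← add_assoc,
      ← add_assoc]

theorem X_pow_dvd_frobPoly {n v : ℕ} (hv : 0 < v) (j N : ℕ) :
    (X : K[X]) ^ n ∣ frobPoly p π n v j N := by
  obtain ⟨v, rfl⟩ := Nat.exists_eq_add_of_le' hv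
  rw [frobPoly, basisPoly, descPochhammer_succ_left]
  simp only [mul_comp, pow_comp, X_comp, C_comp, mul_pow]
  refine Dvd.intro (gammaPoly p π 0 N ^ n * (C (π⁻¹ ^ (n * (v + 1))) * (C (p : K) ^ n *
    ((descPochhammer K v).comp (X - 1)).comp (C (p : K) * X) ^ n) *
      (X - C ((v + 1 : ℕ) : K)).comp (C (p : K) * X) ^ j)) ?_
  ring

theorem frobLim_of_lt (hp17 : 17 ≤ p) (hπ : π ^ (p - 1) = -p) {n u l v : ℕ} (hl : l < n)
    (huv : p * u < v) (j : ℕ) : frobLim p π n u l v j = 0 := by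
  obtain ⟨w, rfl⟩ := Nat.exists_eq_add_of_le' huv.le
  have h := frobLim_add hp17 hπ n 0 l w j u
  rw [zero_add] at h
  rw [h]
  refine tendsto_nhds_unique (tendsto_frobEntry hp17 hπ n 0 l w j) ?_
  refine tendsto_const_nhds.congr fun N => ?_
  rw [frobEntry, expCoeff_zero_left]
  obtain ⟨Q, hQ⟩ := X_pow_dvd_frobPoly (p := p) (π := π) (n := n) (v := w) (by omega) j N
  rw [hQ, coeff_X_pow_mul', if_neg (by omega), mul_zero]

/-- The coefficients of the Frobenius matrix. -/
def frobMat (p : ℕ) (π : K) (n i : ℕ) : Matrix (Fin n) (Fin n) K :=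
  of fun l j => frobLim p π n i l ((p - 1) * i) j

theorem frobLim_eq_frobMat (hp17 : 17 ≤ p) (hπ : π ^ (p - 1) = -p) {n u v : ℕ} (huv : v ≤ p * u)
    (l j : Fin n) : frobLim p π n u l v j = frobMat p π n (p * u - v) l j := by
  have hp1 := hp.out.pos
  have h1 : (p - 1) * (p * u - v) + (p * u - v) = p * (p * u - v) := by
    rw [← Nat.succ_mul, Nat.succ_eq_add_one, Nat.sub_add_cancel hp1]
  rw [frobMat, of_apply]
  set i := p * u - v
  rcases le_total u i with h | h
  · obtain ⟨m, hm⟩ := Nat.exists_eq_add_of_le h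
    rw [← frobLim_add hp17 hπ n u l v j m, ← hm]
    congr 1
    have : p * i = p * u + p * m := by rw [hm, mul_add]
    omega
  · obtain ⟨m, hm⟩ := Nat.exists_eq_add_of_le h
    rw [← frobLim_add hp17 hπ n i l _ j m, ← hm]
    congr 1
    have : p * u = p * i + p * m := by rw [hm, mul_add]
    omega

theorem norm_frobEntry_le (hp17 : 17 ≤ p) (hπ : π ^ (p - 1) = -p) (n u l v j N : ℕ) :
    ‖frobEntry p π n u l v j N‖ ≤ ‖π‖⁻¹ ^ (n * v) * (‖π‖ ^ (3 * n)) ^ u := by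
  have h0 := norm_pos_of_uniformizer hπ
  have hlt := (norm_uniformizer_lt_one hπ).le
  have h1 := (polyLE_frobPoly hp17 hπ n v j N).norm_expCoeff_le (sq_norm_uniformizer_pos hπ)
    (sq_norm_uniformizer_le_one hπ) n u l
  rw [frobEntry, norm_mul, norm_pow]
  have h2 : (‖π‖ ^ 2) ^ l ≤ 1 := pow_le_one₀ (by positivity) (sq_norm_uniformizer_le_one hπ)
  calc _ ≤ ‖π‖ ^ (n * u) * (‖π‖⁻¹ ^ (n * v) * ((‖π‖ ^ 2) ^ n) ^ u * 1) := by
        gcongr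
        exact h1.trans (by gcongr)
    _ = _ := by ring

theorem norm_frobMat_le (hp17 : 17 ≤ p) (hπ : π ^ (p - 1) = -p) {n i u : ℕ} (hu : i ≤ p * u)
    (hu' : p * u < i + p) (l j : Fin n) :
    ‖frobMat p π n i l j‖ ≤ ‖π‖⁻¹ ^ (n * p) * (‖π‖ ^ (3 * n)) ^ u := by
  have h0 := norm_pos_of_uniformizer hπ
  have hlt := (norm_uniformizer_lt_one hπ).le
  have h1 := frobLim_eq_frobMat hp17 hπ (n := n) (u := u) (v := p * u - i) (by omega) l j
  rw [Nat.sub_sub_self hu] at h1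
  rw [← h1]
  refine le_of_tendsto (tendsto_frobEntry hp17 hπ n u l (p * u - i) j).norm
    (.of_forall fun N => ?_)
  refine (norm_frobEntry_le hp17 hπ n u l (p * u - i) j N).trans ?_
  have : 1 ≤ ‖π‖⁻¹ := (one_le_inv₀ h0).2 hlt
  gcongr
  omega

theorem exists_norm_frobMat_le (hp17 : 17 ≤ p) (hπ : π ^ (p - 1) = -p) (n : ℕ) {t : ℝ} (ht0 : 0 ≤ t) (ht1 : t ≤ 1)
    (ht : t ^ p = ‖π‖ ^ (3 * n)) :
    ∃ C : ℝ, 0 ≤ C ∧ ∀ i (l j : Fin n), ‖frobMat p π n i l j‖ ≤ C * t ^ i := by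
  have hp1 := hp.out.pos
  refine ⟨‖π‖⁻¹ ^ (n * p), by positivity, fun i l j => ?_⟩
  have h1 := Nat.div_add_mod (i + p - 1) p
  have h2 := Nat.mod_lt (i + p - 1) hp1
  refine (norm_frobMat_le hp17 hπ (u := (i + p - 1) / p) (by omega) (by omega) l j).trans ?_
  rw [← ht, ← pow_mul]
  gcongr ?_ * ?_
  exact pow_le_pow_of_le_one ht0 ht1 (by omega)

theorem C_mul_X_mul_frobPoly (n v j N : ℕ) : C (p : K) * (X * frobPoly p π n v j N) =
    C (v : K) * frobPoly p π n v j N + frobPoly p π n v (j + 1) N := by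
  have h := congrArg (fun P : K[X] => P.comp (C (p : K) * X)) (X_mul_basisPoly (π := π) n v j)
  simp only [mul_comp, add_comp, C_comp, X_comp] at h
  simp only [frobPoly]
  linear_combination gammaPoly p π 0 N ^ n * h

theorem frobLim_self (hp17 : 17 ≤ p) (hπ : π ^ (p - 1) = -p) (n u l v : ℕ) :
    frobLim p π n u l v n = π ^ n * frobLim p π n u l (v + 1) 0 := by
  refine tendsto_nhds_unique (tendsto_frobEntry hp17 hπ n u l v n) ?_
  refine ((tendsto_frobEntry hp17 hπ n u l (v + 1) 0).const_mul (π ^ n)).congr fun N => ?_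
  rw [frobEntry, frobEntry, frobPoly, frobPoly, basisPoly_self (uniformizer_ne_zero hπ), mul_comp, C_comp,
    mul_left_comm _ (C _), ← smul_eq_C_mul (π ^ n), map_smul, smul_eq_mul]
  ring

theorem frobLim_relation (hp17 : 17 ≤ p) (hπ : π ^ (p - 1) = -p) {n : ℕ} (hn : 0 < n) (u l v j : ℕ) :
    p * (u * frobLim p π n u l v j + (if l = 0 then 0 else frobLim p π n u (l - 1) v j) +
      if l = 0 ∧ u ≠ 0 then π ^ n * frobLim p π n (u - 1) (n - 1) v j else 0) =
    v * frobLim p π n u l v j + frobLim p π n u l v (j + 1) := by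
  have hT := fun u l j => tendsto_frobEntry hp17 hπ n u l v j
  refine tendsto_nhds_unique ?_ (((hT u l j).const_mul (v : K)).add (hT u l (j + 1)))
  have h1 : Tendsto (fun N => if l = 0 then (0 : K) else frobEntry p π n u (l - 1) v j N)
      atTop (nhds (if l = 0 then 0 else frobLim p π n u (l - 1) v j)) := by
    split_ifs
    · exact tendsto_const_nhds
    · exact hT _ _ _
  have h2 : Tendsto (fun N => if l = 0 ∧ u ≠ 0 then π ^ n * frobEntry p π n (u - 1) (n - 1) v j N
      else (0 : K)) atTop
      (nhds (if l = 0 ∧ u ≠ 0 then π ^ n * frobLim p π n (u - 1) (n - 1) v j else 0)) := by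
    split_ifs
    · exact (hT _ _ _).const_mul _
    · exact tendsto_const_nhds
  refine (((((hT u l j).const_mul (u : K)).add h1).add h2).const_mul (p : K)).congr fun N => ?_
  have h3 := congrArg (fun P => π ^ (n * u) * expCoeff n u l P)
    (C_mul_X_mul_frobPoly (p := p) (π := π) n v j N)
  simp only [← smul_eq_C_mul, map_add, map_smul, smul_eq_mul, expCoeff_X_mul hn] at h3
  simp only [frobEntry]
  rw [← mul_left_comm, mul_left_comm, ← mul_assoc, mul_assoc _ _ (_ + _), mul_left_comm] at h3
  have h4 : (if l = 0 ∧ u ≠ 0 then π ^ n * (π ^ (n * (u - 1)) *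
      expCoeff n (u - 1) (n - 1) (frobPoly p π n v j N)) else 0) =
      π ^ (n * u) * if l = 0 ∧ u ≠ 0 then expCoeff n (u - 1) (n - 1) (frobPoly p π n v j N) else 0 := by
    split_ifs with h
    · obtain ⟨w, rfl⟩ := Nat.exists_eq_succ_of_ne_zero h.2
      rw [Nat.succ_sub_one, Nat.succ_eq_add_one]
      ring
    · simp
  have h5 : (if l = 0 then 0 else π ^ (n * u) * expCoeff n u (l - 1) (frobPoly p π n v j N)) =
      π ^ (n * u) * if l = 0 then 0 else expCoeff n u (l - 1) (frobPoly p π n v j N) := by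
    split_ifs <;> simp
  rw [h4, h5]
  linear_combination h3

/-- The nilpotent matrix sending `e_j` to `e_{j+1}`. -/
def shiftMat (K : Type*) [Zero K] [One K] (n : ℕ) : Matrix (Fin n) (Fin n) K :=
  of fun a b => if (a : ℕ) = b + 1 then 1 else 0

/-- The matrix sending `e_{n-1}` to `e_0`. -/
def cornerMat (K : Type*) [Zero K] [One K] (n : ℕ) : Matrix (Fin n) (Fin n) K :=
  of fun a b => if (a : ℕ) = 0 ∧ (b : ℕ) + 1 = n then 1 else 0

theorem shiftMat_mul_apply {n : ℕ} (M : Matrix (Fin n) (Fin n) K) (l j : Fin n) :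
    (shiftMat K n * M) l j = if h : (l : ℕ) = 0 then 0 else M ⟨l - 1, by omega⟩ j := by
  rw [Matrix.mul_apply]
  split_ifs with h
  · exact sum_eq_zero fun b _ => by simp [shiftMat, h]
  · rw [sum_eq_single ⟨l - 1, by omega⟩]
    · have : (l : ℕ) = l - 1 + 1 := by omega
      simp [shiftMat, ← this]
    · intro b _ hb
      have : (l : ℕ) ≠ b + 1 := fun h' => hb (Fin.ext (by simp [h']))
      simp [shiftMat, this]
    · simp

theorem mul_shiftMat_apply {n : ℕ} (M : Matrix (Fin n) (Fin n) K) (l j : Fin n) :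
    (M * shiftMat K n) l j = if h : (j : ℕ) + 1 < n then M l ⟨j + 1, h⟩ else 0 := by
  rw [Matrix.mul_apply]
  split_ifs with h
  · rw [sum_eq_single ⟨j + 1, h⟩]
    · simp [shiftMat]
    · intro b _ hb
      have : (b : ℕ) ≠ j + 1 := fun h' => hb (Fin.ext h')
      simp [shiftMat, this]
    · simp
  · refine sum_eq_zero fun b _ => ?_
    have : (b : ℕ) ≠ j + 1 := by omega
    simp [shiftMat, this]

theorem cornerMat_mul_apply {n : ℕ} (M : Matrix (Fin n) (Fin n) K) (l j : Fin n) :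
    (cornerMat K n * M) l j = if (l : ℕ) = 0 then M ⟨n - 1, by have := l.2; omega⟩ j else 0 := by
  have hn := l.2
  rw [Matrix.mul_apply]
  split_ifs with h
  · rw [sum_eq_single ⟨n - 1, by omega⟩]
    · simp [cornerMat, h, show n - 1 + 1 = n by omega]
    · intro b _ hb
      have : (b : ℕ) + 1 ≠ n := fun h' => hb (Fin.ext (by simp [← h']))
      simp [cornerMat, this]
    · simp
  · exact sum_eq_zero fun b _ => by simp [cornerMat, h]

theorem mul_cornerMat_apply {n : ℕ} (M : Matrix (Fin n) (Fin n) K) (l j : Fin n) :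
    (M * cornerMat K n) l j = if (j : ℕ) + 1 = n then M l ⟨0, by have := l.2; omega⟩ else 0 := by
  have hn := l.2
  rw [Matrix.mul_apply]
  split_ifs with h
  · rw [sum_eq_single ⟨0, by omega⟩]
    · simp [cornerMat, h]
    · intro b _ hb
      have : (b : ℕ) ≠ 0 := fun h' => hb (Fin.ext h')
      simp [cornerMat, this]
    · simp
  · exact sum_eq_zero fun b _ => by simp [cornerMat, h]

/-- The differential equation of the Frobenius matrix. -/
theorem frobMat_relation (hp17 : 17 ≤ p) (hπ : π ^ (p - 1) = -p) (n i : ℕ) :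
    (i : K) • frobMat p π n i + (p : K) • (shiftMat K n * frobMat p π n i) +
      (p * π ^ n : K) • (cornerMat K n * if p ≤ i then frobMat p π n (i - p) else 0) =
    frobMat p π n i * shiftMat K n +
      π ^ n • ((if i = 0 then 0 else frobMat p π n (i - 1)) * cornerMat K n) := by
  have hp1 := hp.out.pos
  ext l j
  have hl := l.2
  have hj := j.2
  have hi : (p - 1) * i + i = p * i := by
    rw [← Nat.succ_mul, Nat.succ_eq_add_one, Nat.sub_add_cancel hp1]
  have h := frobLim_relation hp17 hπ (n := n) (by omega) i l ((p - 1) * i) j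
  have hG : ∀ l j : Fin n, frobLim p π n i l ((p - 1) * i) j = frobMat p π n i l j := fun l j => rfl
  have e1 : (shiftMat K n * frobMat p π n i) l j =
      if (l : ℕ) = 0 then 0 else frobLim p π n i (l - 1) ((p - 1) * i) j := by
    rw [shiftMat_mul_apply]
    split_ifs with h0
    · rfl
    · exact (hG ⟨l - 1, by omega⟩ j).symm
  have e2 : π ^ n * (cornerMat K n * if p ≤ i then frobMat p π n (i - p) else 0) l j =
      if (l : ℕ) = 0 ∧ i ≠ 0 then π ^ n * frobLim p π n (i - 1) (n - 1) ((p - 1) * i) j else 0 := by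
    rw [cornerMat_mul_apply]
    by_cases h0 : (l : ℕ) = 0
    · by_cases hi0 : i = 0
      · simp [h0, hi0, hp1.ne']
      · rw [if_pos (show (l : ℕ) = 0 ∧ i ≠ 0 from ⟨h0, hi0⟩)]
        simp only [h0, if_true]
        congr 1
        have hpi : p * (i - 1) + p = p * i := by
          nth_rw 2 [← mul_one p]
          rw [← mul_add, Nat.sub_add_cancel (by omega)]
        clear h hG e1
        generalize (p - 1) * i = w at *
        split_ifs with hle
        · have := frobLim_eq_frobMat hp17 hπ (n := n) (u := i - 1) (v := w) (by omega)
            ⟨n - 1, by omega⟩ j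
          rw [this]
          congr 1
          omega
        · rw [frobLim_of_lt hp17 hπ (by omega) (by omega)]
          rfl
    · simp [h0]
  have e3 : (frobMat p π n i * shiftMat K n) l j +
      π ^ n * ((if i = 0 then 0 else frobMat p π n (i - 1)) * cornerMat K n) l j =
      frobLim p π n i l ((p - 1) * i) (j + 1) := by
    rw [mul_shiftMat_apply, mul_cornerMat_apply]
    by_cases hjn : (j : ℕ) + 1 < n
    · rw [dif_pos hjn, if_neg (by omega), mul_zero, add_zero]
      exact (hG l ⟨j + 1, hjn⟩).symm
    · have hjn' : (j : ℕ) + 1 = n := by omega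
      rw [dif_neg hjn, if_pos hjn', zero_add, hjn', frobLim_self hp17 hπ]
      congr 1
      split_ifs with hi0
      · rw [frobLim_of_lt hp17 hπ hl (by simp [hi0])]
        rfl
      · have := frobLim_eq_frobMat hp17 hπ (n := n) (u := i) (v := (p - 1) * i + 1) (by omega)
            l ⟨0, by omega⟩
        rw [this]
        congr 1
        omega
  simp only [Matrix.add_apply, Matrix.smul_apply, smul_eq_mul]
  rw [e3, e1, mul_assoc, e2, ← hG]
  have hcast : ((p - 1 : ℕ) : K) * i + i = p * i := by exact_mod_cast hi
  push_cast at h hcast ⊢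
  linear_combination h + frobLim p π n i l ((p - 1) * i) j * hcast

theorem gammaPoly_coeff_zero (N : ℕ) : (gammaPoly p π 0 N).coeff 0 = 1 := by
  rw [gammaPoly, sum_range_succ', coeff_add, finsetSum_coeff,
    sum_eq_zero fun u _ => by rw [descPochhammer_succ_left, mul_left_comm, mul_coeff_zero]; simp]
  have : dworkCoeffInt p π (p * (0 : ℕ) - (0 : ℕ)) = 1 := by
    have := dworkCoeffInt_natCast (p := p) (π := π) 0
    simpa [dworkCoeff_zero] using this
  rw [this]
  simp

theorem frobMat_zero_apply (hp17 : 17 ≤ p) (hπ : π ^ (p - 1) = -p) {n : ℕ} (l j : Fin n) (hlj : l ≤ j) :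
    frobMat p π n 0 l j = if l = j then (p : K) ^ (j : ℕ) else 0 := by
  refine tendsto_nhds_unique (tendsto_frobEntry hp17 hπ n 0 l ((p - 1) * 0) j) ?_
  refine tendsto_const_nhds.congr fun N => ?_
  rw [frobEntry, expCoeff_zero_left, frobPoly, basisPoly]
  simp only [mul_zero, pow_zero, one_mul, descPochhammer_zero, one_pow, map_one, Nat.cast_zero,
    map_zero, sub_zero, pow_comp, X_comp]
  rw [mul_pow, mul_left_comm, ← C_pow, coeff_C_mul, coeff_mul_X_pow']
  rcases hlj.eq_or_lt with rfl | h
  · rw [if_pos rfl, if_pos le_rfl, Nat.sub_self, coeff_zero_eq_eval_zero, eval_pow,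
      ← coeff_zero_eq_eval_zero, gammaPoly_coeff_zero, one_pow, mul_one]
  · rw [if_neg h.ne, if_neg (by simpa using h), mul_zero]

end Complete

theorem eq_sum_coeff_add_X_pow_mul (n : ℕ) (P : K[X]) :
    P = ∑ l : Fin n, C (P.coeff l) * X ^ (l : ℕ) + X ^ n * (nextPoly n P).comp (X - 1) := by
  rw [nextPoly_apply, comp_assoc]
  simp only [add_comp, X_comp, one_comp, sub_add_cancel, comp_X]
  rw [Fin.sum_univ_eq_sum_range (fun l => C (P.coeff l) * X ^ l)]
  ext s
  rw [coeff_add, finsetSum_coeff, coeff_X_pow_mul', coeff_divXLin_pow]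
  simp only [coeff_C_mul, coeff_X_pow, mul_ite, mul_one, mul_zero]
  rw [sum_ite_eq]
  by_cases h : n ≤ s
  · rw [if_pos h, if_neg (by simpa using h), zero_add, Nat.sub_add_cancel h]
  · rw [if_neg h, if_pos (by simpa using h), add_zero]

theorem natDegree_nextPoly_lt {n : ℕ} (hn : 0 < n) {P : K[X]} {d : ℕ} (hP : P.natDegree ≤ d + 1) :
    (nextPoly n P).natDegree ≤ d := by
  rw [nextPoly_apply]
  refine natDegree_comp_le.trans ?_
  have h1 : (X + 1 : K[X]).natDegree ≤ 1 := by compute_degree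
  have h2 : ((divXLin ^ n : Module.End K K[X]) P).natDegree ≤ d := by
    rw [natDegree_le_iff_coeff_eq_zero]
    intro s hs
    rw [coeff_divXLin_pow]
    exact coeff_eq_zero_of_natDegree_lt (by omega)
  calc _ ≤ d * 1 := by gcongr
    _ = d := mul_one d

theorem nextPoly_of_natDegree_lt {n : ℕ} {P : K[X]} (hP : P.natDegree < n) : nextPoly n P = 0 := by
  rw [nextPoly_apply]
  have : (divXLin ^ n : Module.End K K[X]) P = 0 := by
    ext s
    rw [coeff_divXLin_pow, coeff_zero]
    exact coeff_eq_zero_of_natDegree_lt (by omega)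
  rw [this, zero_comp]

theorem expCoeff_of_natDegree_lt {n : ℕ} (hn : 0 < n) (u : ℕ) : ∀ {P : K[X]} (_ : P.natDegree < u) (l : ℕ),
    expCoeff n u l P = 0 := by
  induction u with
  | zero => intro P h; simp at h
  | succ u ih =>
    intro P h l
    rw [expCoeff_succ_left]
    rcases u with _ | u
    · rw [nextPoly_of_natDegree_lt (by omega), map_zero]
    · exact ih (Nat.lt_succ_of_le (natDegree_nextPoly_lt hn (by omega))) l

theorem eq_sum_expCoeff_mul_basisPoly (hπ0 : π ≠ 0) {n : ℕ} (hn : 0 < n) (U : ℕ) : ∀ {P : K[X]}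
    (_ : P.natDegree < U), P = ∑ u ∈ range U, ∑ l : Fin n,
      C (π ^ (n * u) * expCoeff n u l P) * basisPoly π n u l := by
  induction U with
  | zero => intro P h; simp at h
  | succ U ih =>
    intro P h
    have h0 : (nextPoly n P) = ∑ u ∈ range U, ∑ l : Fin n,
      C (π ^ (n * u) * expCoeff n u l (nextPoly n P)) * basisPoly π n u l := by
      rcases U with _ | U
      · rw [nextPoly_of_natDegree_lt (by omega)]
        simp
      · exact ih (Nat.lt_succ_of_le (natDegree_nextPoly_lt hn (by omega)))
    conv_lhs => rw [eq_sum_coeff_add_X_pow_mul n P, h0]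
    rw [sum_range_succ', add_comm]
    congr 1
    · simp only [Polynomial.sum_comp, mul_comp, C_comp, mul_sum]
      refine sum_congr rfl fun u _ => sum_congr rfl fun l _ => ?_
      rw [← basisPoly_succ, expCoeff_succ_left, mul_add, mul_one, pow_add, C_mul, C_mul, C_mul]
      have : C (π ^ n) * C (π⁻¹ ^ n) = (1 : K[X]) := by
        rw [← C_mul, ← mul_pow, mul_inv_cancel₀ hπ0, one_pow, C_1]
      linear_combination (-(C (π ^ (n * u)) * C (expCoeff n u (↑l) (nextPoly n P)) * X ^ n *
        (basisPoly π n u l).comp (X - 1))) * this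
    · refine sum_congr rfl fun l _ => ?_
      simp [basisPoly, expCoeff_zero_left]

theorem map_eq_tsum_expCoeff (hπ0 : π ≠ 0) {n : ℕ} (hn : 0 < n) (f : K[X] →ₗ[K] K) (P : K[X]) :
    f P = ∑' z : ℕ × Fin n, f (basisPoly π n z.1 z.2) * (π ^ (n * z.1) * expCoeff n z.1 z.2 P) := by
  rw [tsum_eq_sum (s := range (P.natDegree + 1) ×ˢ univ)]
  · conv_lhs => rw [eq_sum_expCoeff_mul_basisPoly hπ0 hn _ (Nat.lt_succ_self P.natDegree)]
    rw [sum_product, map_sum]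
    refine sum_congr rfl fun u _ => ?_
    rw [map_sum]
    refine sum_congr rfl fun l _ => ?_
    rw [← smul_eq_C_mul, map_smul, smul_eq_mul, mul_comm]
  · intro z hz
    rw [expCoeff_of_natDegree_lt hn, mul_zero, mul_zero]
    simp only [mem_product, mem_range, mem_univ, and_true] at hz
    omega

/-- The approximate Frobenius operator. -/
def frobOp (p : ℕ) (π : K) (n N : ℕ) : Module.End K K[X] where
  toFun P := gammaPoly p π 0 N ^ n * P.comp (C (p : K) * X)
  map_add' P Q := by rw [add_comp, mul_add]
  map_smul' a P := by rw [smul_comp, mul_smul_comm, RingHom.id_apply]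

theorem frobOp_apply (n N : ℕ) (P : K[X]) :
    frobOp p π n N P = gammaPoly p π 0 N ^ n * P.comp (C (p : K) * X) := rfl

theorem frobOp_pow_apply (n N r : ℕ) (P : K[X]) : (frobOp p π n N ^ r) P =
    (∏ i ∈ range r, (gammaPoly p π 0 N).comp (C ((p : K) ^ i) * X)) ^ n *
      P.comp (C ((p : K) ^ r) * X) := by
  induction r generalizing P with
  | zero => simp
  | succ r ih =>
    rw [pow_succ, Module.End.mul_apply, ih, frobOp_apply, prod_range_succ, mul_pow, mul_comp,
      pow_comp, comp_assoc, mul_comp, C_comp, X_comp, ← mul_assoc (C (p : K)), ← C_mul, pow_succ' (p : K),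
      mul_assoc]

theorem PolyLE.frobOp (hp17 : 17 ≤ p) (hπ : π ^ (p - 1) = -p) {c : ℝ} {P : K[X]}
    (hP : PolyLE (‖π‖ ^ 2) c P) (n N : ℕ) : PolyLE (‖π‖ ^ 2) c (frobOp p π n N P) := by
  have h0 := sq_norm_uniformizer_pos hπ
  have := ((polyLE_gammaPoly hp17 hπ N).pow h0 n).mul h0 (hP.comp h0 (Q := C (p : K) * X) ?_)
  · rwa [one_pow, one_mul] at this
  · refine ((polyLE_X h0).C_mul h0 (p : K)).mono h0 (mul_le_of_le_one_left (by positivity) ?_)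
    exact norm_natCast_le_one' p p

theorem polyLE_frobOp_pow_basisPoly (hp17 : 17 ≤ p) (hπ : π ^ (p - 1) = -p) (n N r v j : ℕ) :
    PolyLE (‖π‖ ^ 2) (‖π‖⁻¹ ^ (n * v)) ((frobOp p π n N ^ (r + 1)) (basisPoly π n v j)) := by
  induction r with
  | zero =>
    rw [zero_add, pow_one]
    exact polyLE_frobPoly hp17 hπ n v j N
  | succ r ih =>
    rw [pow_succ' (frobOp p π n N), Module.End.mul_apply]
    exact ih.frobOp hp17 hπ n N

/-- The matrix of the power of exponent `r + 1` of the approximate Frobenius. -/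
def frobOpEntry (p : ℕ) (π : K) (n r : ℕ) (x y : ℕ × Fin n) (N : ℕ) : K :=
  π ^ (n * x.1) * expCoeff n x.1 x.2 ((frobOp p π n N ^ (r + 1)) (basisPoly π n y.1 y.2))

theorem norm_frobOpEntry_le (hp17 : 17 ≤ p) (hπ : π ^ (p - 1) = -p) (n r : ℕ) (x y : ℕ × Fin n) (N : ℕ) :
    ‖frobOpEntry p π n r x y N‖ ≤ ‖π‖⁻¹ ^ (n * y.1) * (‖π‖ ^ (3 * n)) ^ x.1 := by
  have h0 := sq_norm_uniformizer_pos hπ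
  have h1 := sq_norm_uniformizer_le_one hπ
  have h := (polyLE_frobOp_pow_basisPoly hp17 hπ n N r y.1 y.2).norm_expCoeff_le h0 h1 n x.1 x.2
  rw [frobOpEntry, norm_mul, norm_pow]
  calc _ ≤ ‖π‖ ^ (n * x.1) * (‖π‖⁻¹ ^ (n * y.1) * ((‖π‖ ^ 2) ^ n) ^ x.1 * 1) := by
        gcongr
        refine h.trans ?_
        gcongr
        exact pow_le_one₀ h0.le h1
    _ = _ := by ring

theorem frobOpEntry_succ (hπ0 : π ≠ 0) {n : ℕ} (hn : 0 < n) (r : ℕ) (x y : ℕ × Fin n) (N : ℕ) :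
    frobOpEntry p π n (r + 1) x y N =
      ∑' z, frobOpEntry p π n r x z N * frobOpEntry p π n 0 z y N := by
  rw [frobOpEntry, pow_succ, Module.End.mul_apply]
  refine (map_eq_tsum_expCoeff hπ0 hn ((π ^ (n * x.1)) • ((expCoeff n x.1 x.2) ∘ₗ
    (frobOp p π n N ^ (r + 1)))) _).trans ?_
  simp [frobOpEntry]

/-- The infinite matrix of the Cartier type operator attached to a matrix power series. -/
def frobKernel {k ι : Type*} [Zero k] (p : ℕ) (G : ℕ → Matrix ι ι k) (x y : ℕ × ι) : k :=
  if y.1 ≤ p * x.1 then G (p * x.1 - y.1) x.2 y.2 else 0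

theorem tendsto_frobOpEntry [CompleteSpace K] (hp17 : 17 ≤ p) (hπ : π ^ (p - 1) = -p) {n : ℕ} (hn : 0 < n)
    (r : ℕ) (x y : ℕ × Fin n) : Tendsto (frobOpEntry p π n r x y) atTop
      (nhds (kernelPow (frobKernel p (frobMat p π n)) r x y)) := by
  have hzero : ∀ x y : ℕ × Fin n, Tendsto (frobOpEntry p π n 0 x y) atTop
      (nhds (frobKernel p (frobMat p π n) x y)) := by
    intro x y
    have h : Tendsto (frobOpEntry p π n 0 x y) atTop _ :=
      tendsto_frobEntry hp17 hπ n x.1 x.2 y.1 y.2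
    rw [frobKernel]
    split_ifs with hle
    · rwa [frobLim_eq_frobMat hp17 hπ hle] at h
    · rwa [frobLim_of_lt hp17 hπ x.2.2 (by omega)] at h
  induction r generalizing x y with
  | zero => exact hzero x y
  | succ r ih =>
    have hπ0 := uniformizer_ne_zero hπ
    have h00 := norm_pos_of_uniformizer hπ
    have hlt := norm_uniformizer_lt_one hπ
    rw [kernelPow_succ]
    simp only [funext (frobOpEntry_succ (p := p) hπ0 hn r x y)]
    refine tendsto_tsum_of_dominated_convergence
      (bound := fun z => (‖π‖ ^ (3 * n)) ^ x.1 * ‖π‖⁻¹ ^ (n * y.1) * (‖π‖ ^ (2 * n)) ^ z.1) ?_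
      (fun z => (ih x z).mul (hzero z y)) (.of_forall fun N z => ?_)
    · exact summable_const_mul_pow_fst (by positivity) (pow_lt_one₀ h00.le hlt (by omega))
    · rw [norm_mul]
      refine (mul_le_mul (norm_frobOpEntry_le hp17 hπ n r x z N) (norm_frobOpEntry_le hp17 hπ n 0 z y N)
        (norm_nonneg _) (by positivity)).trans_eq ?_
      have : ‖π‖⁻¹ ^ (n * z.1) * (‖π‖ ^ (3 * n)) ^ z.1 = (‖π‖ ^ (2 * n)) ^ z.1 := by
        rw [← pow_mul, ← pow_mul, show 3 * n * z.1 = n * z.1 + 2 * n * z.1 by ring, pow_add, ← mul_assoc,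
          ← mul_pow, inv_mul_cancel₀ h00.ne', one_pow, one_mul]
      rw [← this]
      ring

end Gamma

section TraceLemma

open Polynomial

variable {K : Type*} [NontriviallyNormedField K] [IsUltrametricDist K]

/-- The monic polynomials `desc_{d / n} ^ n (X - d / n) ^ (d % n)`. -/
def monicBasis (K : Type*) [Field K] (n d : ℕ) : K[X] :=
  descPochhammer K (d / n) ^ n * (X - C ((d / n : ℕ) : K)) ^ (d % n)

theorem X_mul_monicBasis {n : ℕ} (hn : 0 < n) (d : ℕ) : X * monicBasis K n d =
    monicBasis K n (d + 1) + C ((d / n : ℕ) : K) * monicBasis K n d := by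
  simp only [monicBasis]
  have h1 := Nat.div_add_mod d n
  have h2 := Nat.mod_lt d hn
  by_cases h : d % n + 1 < n
  · have e1 : (d + 1) / n = d / n := by
      rw [Nat.div_eq_iff hn]
      rw [mul_comm] at h1
      omega
    have e2 : (d + 1) % n = d % n + 1 := by
      rw [Nat.add_mod, Nat.mod_eq_of_lt (a := 1) (by omega), Nat.mod_eq_of_lt h]
    rw [e1, e2]
    ring
  · have h3 : d % n = n - 1 := by omega
    have h4 : d + 1 = n * (d / n + 1) := by
      rw [mul_add]
      omega
    have e1 : (d + 1) / n = d / n + 1 := by rw [h4, Nat.mul_div_cancel_left _ hn]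
    have e2 : (d + 1) % n = 0 := by rw [h4, Nat.mul_mod_right]
    rw [e1, e2, h3, descPochhammer_succ_right, pow_zero, mul_one, mul_pow, ← C_eq_natCast]
    obtain ⟨m, rfl⟩ := Nat.exists_eq_succ_of_ne_zero hn.ne'
    rw [Nat.succ_sub_one, Nat.succ_eq_add_one]
    ring

/-- The coefficient of `monicBasis K n d` in the expansion of a polynomial. -/
def monicCoeff (n d : ℕ) : K[X] →ₗ[K] K := expCoeff n (d / n) (d % n)

theorem monicCoeff_X_mul {n : ℕ} (hn : 0 < n) (d : ℕ) (P : K[X]) : monicCoeff n d (X * P) =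
    (d / n : ℕ) * monicCoeff n d P + if d = 0 then 0 else monicCoeff n (d - 1) P := by
  rw [monicCoeff, expCoeff_X_mul hn, add_assoc]
  congr 1
  have h1 := Nat.div_add_mod d n
  have h2 := Nat.mod_lt d hn
  by_cases h : d % n = 0
  · rw [if_pos h, zero_add]
    by_cases hd : d = 0
    · simp [hd]
    · have h3 : d / n ≠ 0 := by
        intro h0
        rw [h0] at h1
        omega
      rw [if_pos ⟨h, h3⟩, if_neg hd]
      obtain ⟨w, hw⟩ := Nat.exists_eq_succ_of_ne_zero h3
      have h4 : d - 1 = n - 1 + n * w := by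
        rw [hw, Nat.succ_eq_add_one, mul_add] at h1
        omega
      rw [monicCoeff, hw, h4, Nat.add_mul_div_left _ _ hn, Nat.add_mul_mod_self_left,
        Nat.div_eq_of_lt (by omega), Nat.mod_eq_of_lt (by omega), zero_add, Nat.succ_sub_one]
  · have h4 : d - 1 = d % n - 1 + n * (d / n) := by omega
    rw [if_neg h, if_neg (fun hh => h hh.1), if_neg (fun hd => h (by simp [hd])), add_zero]
    rw [monicCoeff, h4, Nat.add_mul_div_left _ _ hn, Nat.add_mul_mod_self_left,
        Nat.div_eq_of_lt (a := d % n - 1) (by omega), Nat.mod_eq_of_lt (a := d % n - 1) (by omega), zero_add]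

theorem monicCoeff_one {n : ℕ} (hn : 0 < n) (d : ℕ) :
    monicCoeff n d (1 : K[X]) = if d = 0 then 1 else 0 := by
  have h1 := Nat.div_add_mod d n
  rw [monicCoeff]
  rcases hu : d / n with _ | u
  · rw [expCoeff_zero_left, coeff_one]
    congr 1
    rw [hu] at h1
    rw [← h1]
    simp
  · have hd : d ≠ 0 := by rintro rfl; simp at hu
    rw [expCoeff_succ_left, ← C_1, nextPoly_C hn, map_zero, if_neg hd]

theorem PolyLE.norm_monicCoeff_le {ρ c : ℝ} {P : K[X]} (hρ : 0 < ρ) (hρ1 : ρ ≤ 1) (hP : PolyLE ρ c P)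
    (n d : ℕ) : ‖monicCoeff n d P‖ ≤ c * ρ ^ d := by
  refine (hP.norm_expCoeff_le hρ hρ1 n (d / n) (d % n)).trans_eq ?_
  rw [mul_assoc, ← pow_mul, ← pow_add, Nat.div_add_mod]

theorem exists_polyLE {ρ : ℝ} (hρ : 0 < ρ) (P : K[X]) : ∃ c, PolyLE ρ c P := by
  induction P using Polynomial.induction_on' with
  | add P Q hP hQ =>
    obtain ⟨c, hc⟩ := hP
    obtain ⟨d, hd⟩ := hQ
    exact ⟨max c d, (hc.mono hρ (le_max_left _ _)).add hρ (hd.mono hρ (le_max_right _ _))⟩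
  | monomial i a =>
    rw [← C_mul_X_pow_eq_monomial]
    exact ⟨_, ((polyLE_X hρ).pow hρ i).C_mul hρ a⟩

section

variable {q : K} (hq0 : q ≠ 0) (hq1 : ‖q‖ < 1) {n : ℕ} (hn : 0 < n) (j : ℕ)

theorem polyLE_monicBasis_comp (hq0 : q ≠ 0) (j d : ℕ) :
    PolyLE ‖q‖ 1 ((monicBasis K n d).comp (C q * X - C (j : K))) := by
  have h0 : 0 < ‖q‖ := norm_pos_iff.2 hq0
  have h1 : ∀ v : ℕ, PolyLE ‖q‖ 1 (C q * X - C (j : K) - C (v : K)) := by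
    intro v
    rw [sub_sub, ← C_add, sub_eq_add_neg, ← C_neg, ← Nat.cast_add]
    refine polyLE_C_mul_X_add_C h0 _ _ (by rw [one_mul]) ?_
    rw [norm_neg]
    exact norm_natCast_le_one K _
  have h2 : ∀ v : ℕ, PolyLE ‖q‖ 1 ((descPochhammer K v).comp (C q * X - C (j : K))) := by
    intro v
    induction v with
    | zero => simpa using polyLE_one h0
    | succ v ih =>
      rw [descPochhammer_succ_right, mul_comp, sub_comp, X_comp, natCast_comp, ← C_eq_natCast]
      simpa using ih.mul h0 (h1 v)
  simp only [monicBasis, mul_comp, pow_comp, sub_comp, X_comp, C_comp]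
  simpa using ((h2 (d / n)).pow h0 n).mul h0 ((h1 (d / n)).pow h0 (d % n))

theorem C_mul_X_mul_monicBasis_comp (hn : 0 < n) (j d : ℕ) :
    C q * (X * (monicBasis K n d).comp (C q * X - C (j : K))) =
      (monicBasis K n (d + 1)).comp (C q * X - C (j : K)) +
        C ((j + d / n : ℕ) : K) * (monicBasis K n d).comp (C q * X - C (j : K)) := by
  have h := congrArg (fun P : K[X] => P.comp (C q * X - C (j : K))) (X_mul_monicBasis (K := K) hn d)
  simp only [mul_comp, add_comp, C_comp, X_comp] at h
  rw [Nat.cast_add, C_add]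
  linear_combination h

theorem monicCoeff_monicBasis_comp (hn : 0 < n) (j d : ℕ) : ∀ c, d ≤ c →
    monicCoeff n c ((monicBasis K n d).comp (C q * X - C (j : K))) = if c = d then q ^ d else 0 := by
  induction d with
  | zero =>
    intro c _
    have : monicBasis K n 0 = 1 := by simp [monicBasis]
    rw [this, one_comp, monicCoeff_one hn, pow_zero]
  | succ d ih =>
    intro c hc
    have h := congrArg (monicCoeff n c) (C_mul_X_mul_monicBasis_comp (q := q) hn j d)
    rw [← smul_eq_C_mul q, map_smul, map_add, ← smul_eq_C_mul (((j + d / n : ℕ) : K)), map_smul,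
      monicCoeff_X_mul hn, ih c (by omega), if_neg (by omega), if_neg (by omega), ih (c - 1) (by omega)] at h
    simp only [smul_eq_mul, mul_zero, zero_add, add_zero] at h
    rw [← h]
    by_cases hcd : c = d + 1
    · rw [if_pos (by omega), if_pos hcd, pow_succ']
    · rw [if_neg (by omega), if_neg hcd, mul_zero]

theorem tsum_monicCoeff_comp [CompleteSpace K] (hq0 : q ≠ 0) (hq1 : ‖q‖ < 1) (hn : 0 < n) (j : ℕ) (w : K[X]) :
    HasSum (fun d => monicCoeff n d (w * (monicBasis K n d).comp (C q * X - C (j : K))))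
      (w.eval (j / (q - 1)) / (1 - q)) := by
  have h0 : 0 < ‖q‖ := norm_pos_iff.2 hq0
  have hq : q - 1 ≠ 0 := by
    intro h
    rw [sub_eq_zero.1 h] at hq1
    simp at hq1
  set s := (j : K) / (q - 1) with hs
  have hs' : q * s = s + j := by
    rw [hs]
    field_simp
    ring
  obtain ⟨v, hv⟩ := X_sub_C_dvd_sub_C_eval (a := s) (p := w)
  obtain ⟨c, hc⟩ := exists_polyLE h0 v
  set A : ℕ → ℕ → K := fun d e => monicCoeff n d (v * (monicBasis K n e).comp (C q * X - C (j : K))) with hA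
  have hAle : ∀ d e, ‖A d e‖ ≤ c * ‖q‖ ^ d := by
    intro d e
    have := (hc.mul h0 (polyLE_monicBasis_comp (n := n) hq0 j e)).norm_monicCoeff_le h0 hq1.le n d
    rwa [mul_one] at this
  set a : ℕ → K := fun d => if d = 0 then 0 else A (d - 1) d with ha
  have ht : ∀ d, (q - 1) * monicCoeff n d ((X - C s) * v * (monicBasis K n d).comp (C q * X - C (j : K))) =
      a (d + 1) - a d := by
    intro d
    have e1 : monicCoeff n d ((X - C s) * v * (monicBasis K n d).comp (C q * X - C (j : K))) =
        ((d / n : ℕ) - s) * A d d + a d := by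
      rw [mul_assoc, sub_mul, map_sub, monicCoeff_X_mul hn, ← smul_eq_C_mul s, map_smul, smul_eq_mul]
      simp only [hA, ha]
      ring
    have e2 : q * monicCoeff n d ((X - C s) * v * (monicBasis K n d).comp (C q * X - C (j : K))) =
        a (d + 1) + ((d / n : ℕ) - s) * A d d := by
      rw [← smul_eq_mul, ← map_smul, smul_eq_C_mul]
      have e3 : C q * ((X - C s) * v * (monicBasis K n d).comp (C q * X - C (j : K))) =
          v * (monicBasis K n (d + 1)).comp (C q * X - C (j : K)) +
            C ((d / n : ℕ) - s) * (v * (monicBasis K n d).comp (C q * X - C (j : K))) := by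
        have h1 := C_mul_X_mul_monicBasis_comp (K := K) (q := q) hn j d
        have h2 := congrArg (C : K → K[X]) hs'
        rw [C_mul, C_add] at h2
        rw [Nat.cast_add, C_add] at h1
        rw [C_sub]
        linear_combination v * h1 - v * (monicBasis K n d).comp (C q * X - C (j : K)) * h2
      rw [e3, map_add, ← smul_eq_C_mul ((d / n : ℕ) - s), map_smul, smul_eq_mul]
      simp [hA, ha]
    rw [sub_mul, e2, one_mul, e1]
    ring
  obtain ⟨c', hc'⟩ := exists_polyLE h0 w
  have hsum : Summable fun d => monicCoeff n d (w * (monicBasis K n d).comp (C q * X - C (j : K))) := by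
    refine Summable.of_norm_bounded (g := fun d => c' * ‖q‖ ^ d)
      ((summable_geometric_of_lt_one h0.le hq1).mul_left _) fun d => ?_
    have := (hc'.mul h0 (polyLE_monicBasis_comp (n := n) hq0 j d)).norm_monicCoeff_le h0 hq1.le n d
    rwa [mul_one] at this
  have hgeo := (hasSum_geometric_of_norm_lt_one hq1).mul_left (w.eval s)
  rw [← div_eq_mul_inv] at hgeo
  have hw : ∀ d, monicCoeff n d (w * (monicBasis K n d).comp (C q * X - C (j : K))) =
      w.eval s * q ^ d + (q - 1)⁻¹ * (a (d + 1) - a d) := by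
    intro d
    have hw : w = C (w.eval s) + (X - C s) * v := by rw [← hv]; ring
    conv_lhs => rw [hw]
    rw [add_mul, map_add, ← smul_eq_C_mul (w.eval s), map_smul, monicCoeff_monicBasis_comp hn j d d le_rfl,
      if_pos rfl, smul_eq_mul, ← ht, ← mul_assoc (q - 1)⁻¹, inv_mul_cancel₀ hq, one_mul]
  refine hsum.hasSum_iff_tendsto_nat.2 ?_
  have hlim : Tendsto (fun M => ∑ d ∈ range M, w.eval s * q ^ d + (q - 1)⁻¹ * a M) atTop
      (nhds (w.eval s / (1 - q) + (q - 1)⁻¹ * 0)) := by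
    refine hgeo.tendsto_sum_nat.add (Tendsto.const_mul _ ?_)
    rw [← Filter.tendsto_add_atTop_iff_nat 1]
    refine squeeze_zero_norm (a := fun d => c * ‖q‖ ^ d) (fun d => ?_) ?_
    · simpa [ha] using hAle d (d + 1)
    · simpa using (tendsto_pow_atTop_nhds_zero_of_lt_one h0.le hq1).const_mul c
  rw [mul_zero, add_zero] at hlim
  refine hlim.congr fun M => ?_
  rw [sum_congr rfl fun d _ => hw d, sum_add_distrib, ← mul_sum (range M) _ (q - 1)⁻¹,
    sum_range_sub]
  simp [ha]

end

end TraceLemma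

section TraceLimit

open Polynomial

/-- The approximation of a Gauss sum. -/
def gaussApprox (p : ℕ) (π : K) (r j N : ℕ) : K :=
  ((∏ i ∈ range (r + 1), (gammaPoly p π 0 N).comp (C ((p : K) ^ i) * X)) *
    (C (π⁻¹ ^ j) * (descPochhammer K j).comp (C ((p : K) ^ (r + 1)) * X))).eval (j / ((p : K) ^ (r + 1) - 1))

theorem tsum_frobOpEntry_add [CompleteSpace K] (hπ : π ^ (p - 1) = -p) {n : ℕ} (hn : 0 < n) (r j N : ℕ) :
    ∑' x : ℕ × Fin n, frobOpEntry p π n r x (x.1 + j, x.2) N =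
      gaussApprox p π r j N ^ n / (1 - (p : K) ^ (r + 1)) := by
  have hπ0 := uniformizer_ne_zero hπ
  have hq0 : (p : K) ^ (r + 1) ≠ 0 := pow_ne_zero _ (Nat.cast_ne_zero.2 hp.out.ne_zero)
  have hq1 : ‖(p : K) ^ (r + 1)‖ < 1 := by
    rw [norm_pow]
    refine pow_lt_one₀ (norm_nonneg _) ?_ (by omega)
    rw [norm_prime_eq p]
    exact inv_lt_one_of_one_lt₀ (by exact_mod_cast hp.out.one_lt)
  have h := tsum_monicCoeff_comp hq0 hq1 hn j
    (((∏ i ∈ range (r + 1), (gammaPoly p π 0 N).comp (C ((p : K) ^ i) * X)) *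
    (C (π⁻¹ ^ j) * (descPochhammer K j).comp (C ((p : K) ^ (r + 1)) * X))) ^ n)
  rw [eval_pow] at h
  have : NeZero n := ⟨hn.ne'⟩
  refine Eq.trans ?_ h.tsum_eq
  rw [← (Nat.divModEquiv n).tsum_eq]
  refine tsum_congr fun d => ?_
  have e1 : (Nat.divModEquiv n d).1 = d / n := rfl
  have e2 : ((Nat.divModEquiv n d).2 : ℕ) = d % n := rfl
  rw [frobOpEntry, monicCoeff, e1, e2, ← smul_eq_mul, ← map_smul, smul_eq_C_mul, frobOp_pow_apply]
  congr 1
  generalize (∏ i ∈ range (r + 1), (gammaPoly p π 0 N).comp (C ((p : K) ^ i) * X)) = W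
  simp only [basisPoly, monicBasis]
  generalize d / n = u
  generalize d % n = l
  generalize (p : K) ^ (r + 1) = q
  rw [add_comm u j, ← descPochhammer_mul]
  simp only [mul_comp, pow_comp, sub_comp, X_comp, C_comp, comp_assoc, natCast_comp]
  have e3 : C (π ^ (n * u)) * C (π⁻¹ ^ (n * (j + u))) = (C (π⁻¹ ^ j) ^ n : K[X]) := by
    rw [← C_mul, ← C_pow, ← pow_mul, mul_add, add_comm (n * j), pow_add, ← mul_assoc, ← mul_pow,
      mul_inv_cancel₀ hπ0, one_pow, one_mul, mul_comm j]
  rw [Nat.cast_add, C_add, ← sub_sub, mul_pow W, mul_pow (C (π⁻¹ ^ j)), ← e3, C_eq_natCast]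
  ring

theorem pow_tsum_kernelPow_add [CompleteSpace K] (hp17 : 17 ≤ p) (hπ : π ^ (p - 1) = -p) {n : ℕ} (hn : 0 < n)
    (r j : ℕ) : (1 - (p : K) ^ (r + 1)) *
      ∑' x : ℕ × Fin n, kernelPow (frobKernel p (frobMat p π n)) r x (x.1 + j, x.2) =
    ((1 - (p : K) ^ (r + 1)) *
      ∑' x : ℕ × Fin 1, kernelPow (frobKernel p (frobMat p π 1)) r x (x.1 + j, x.2)) ^ n := by
  have h00 := norm_pos_of_uniformizer hπ
  have hlt := norm_uniformizer_lt_one hπ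
  have hq : (1 - (p : K) ^ (r + 1)) ≠ 0 := by
    rw [sub_ne_zero]
    intro h
    have := (Nat.one_lt_pow (Nat.succ_ne_zero r) hp.out.one_lt).ne
    exact this (by exact_mod_cast h)
  have key : ∀ {n : ℕ}, 0 < n → Tendsto (fun N => gaussApprox p π r j N ^ n) atTop
      (nhds ((1 - (p : K) ^ (r + 1)) *
        ∑' x : ℕ × Fin n, kernelPow (frobKernel p (frobMat p π n)) r x (x.1 + j, x.2))) := by
    intro n hn
    have h : Tendsto (fun N => ∑' x : ℕ × Fin n, frobOpEntry p π n r x (x.1 + j, x.2) N) atTop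
        (nhds (∑' x : ℕ × Fin n, kernelPow (frobKernel p (frobMat p π n)) r x (x.1 + j, x.2))) := by
      refine tendsto_tsum_of_dominated_convergence
        (bound := fun x => ‖π‖⁻¹ ^ (n * j) * (‖π‖ ^ (2 * n)) ^ x.1)
        (summable_const_mul_pow_fst (by positivity) (pow_lt_one₀ h00.le hlt (by omega)))
        (fun x => tendsto_frobOpEntry hp17 hπ hn r x _) (.of_forall fun N x => ?_)
      refine (norm_frobOpEntry_le hp17 hπ n r x _ N).trans_eq ?_
      have : ‖π‖⁻¹ ^ (n * x.1) * (‖π‖ ^ (3 * n)) ^ x.1 = (‖π‖ ^ (2 * n)) ^ x.1 := by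
        rw [← pow_mul, ← pow_mul, show 3 * n * x.1 = n * x.1 + 2 * n * x.1 by ring, pow_add, ← mul_assoc,
          ← mul_pow, inv_mul_cancel₀ h00.ne', one_pow, one_mul]
      rw [← this, mul_add, pow_add]
      ring
    refine (h.const_mul _).congr fun N => ?_
    rw [tsum_frobOpEntry_add hπ hn, mul_div_cancel₀ _ hq]
  refine tendsto_nhds_unique (key hn) ?_
  have h1 := (key one_pos).pow n
  simpa using h1

end TraceLimit

section Overconvergent

open PowerSeries (coeff coeff_expand coeff_expand_mul coeff_mul expand)

variable {K : Type*} [NontriviallyNormedField K] [IsUltrametricDist K]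
  {L : Type*} [NormedField L] [NormedAlgebra K L]

/-- Power series converging on a disc of radius larger than one. -/
def Overconv (f : K⟦X⟧) : Prop := ∃ ρ c : ℝ, 0 ≤ ρ ∧ ρ < 1 ∧ 0 ≤ c ∧ GrowthLE ρ c f

/-- The value of a power series. -/
def evalSeries (f : K⟦X⟧) (t : L) : L :=
  ∑' i, algebraMap K L (coeff i f) * t ^ i

theorem Overconv.mul {f g : K⟦X⟧} (hf : Overconv f) (hg : Overconv g) : Overconv (f * g) := by
  obtain ⟨ρ, c, h0, h1, hc, h⟩ := hf
  obtain ⟨ρ', c', h0', h1', hc', h'⟩ := hg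
  exact ⟨max ρ ρ', c * c', h0.trans (le_max_left _ _), max_lt h1 h1', mul_nonneg hc hc',
    (h.mono h0 hc (le_max_left _ _) le_rfl).mul (h0.trans (le_max_left _ _)) hc hc'
      (h'.mono h0' hc' (le_max_right _ _) le_rfl)⟩

theorem Overconv.add {f g : K⟦X⟧} (hf : Overconv f) (hg : Overconv g) : Overconv (f + g) := by
  obtain ⟨ρ, c, h0, h1, hc, h⟩ := hf
  obtain ⟨ρ', c', h0', h1', hc', h'⟩ := hg
  refine ⟨max ρ ρ', max c c', h0.trans (le_max_left _ _), max_lt h1 h1', hc.trans (le_max_left _ _), ?_⟩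
  intro s
  rw [map_add]
  exact (norm_add_le_max _ _).trans (max_le
    (h.mono h0 hc (le_max_left _ _) (le_max_left _ _) s) (h'.mono h0' hc' (le_max_right _ _) (le_max_right _ _) s))

theorem Overconv.sum {α : Type*} (s : Finset α) {f : α → K⟦X⟧} (hf : ∀ i, Overconv (f i)) :
    Overconv (∑ i ∈ s, f i) := by
  classical
  induction s using Finset.induction_on with
  | empty => exact ⟨0, 0, le_rfl, one_pos, le_rfl, fun s => by simp⟩
  | insert a s ha ih => rw [sum_insert ha]; exact (hf a).add ih

theorem Overconv.prod {α : Type*} (s : Finset α) {f : α → K⟦X⟧} (hf : ∀ i, Overconv (f i)) :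
    Overconv (∏ i ∈ s, f i) := by
  classical
  induction s using Finset.induction_on with
  | empty => exact ⟨0, 1, le_rfl, one_pos, zero_le_one, GrowthLE.one le_rfl⟩
  | insert a s ha ih => rw [prod_insert ha]; exact (hf a).mul ih

theorem Overconv.expand {f : K⟦X⟧} (hf : Overconv f) {m : ℕ} (hm : m ≠ 0) :
    Overconv (expand m hm f) := by
  obtain ⟨ρ, c, h0, h1, hc, h⟩ := hf
  refine ⟨ρ ^ ((m : ℝ)⁻¹), c, by positivity, Real.rpow_lt_one h0 h1 (by positivity), hc, fun s => ?_⟩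
  rw [coeff_expand]
  split_ifs with hs
  · obtain ⟨d, rfl⟩ := hs
    rw [Nat.mul_div_cancel_left _ (Nat.pos_of_ne_zero hm), pow_mul, Real.rpow_inv_natCast_pow h0 hm]
    exact h d
  · rw [norm_zero]
    positivity

theorem Overconv.summable {f : K⟦X⟧} (hf : Overconv f) {t : L} (ht : ‖t‖ ≤ 1) :
    Summable fun i => ‖algebraMap K L (coeff i f) * t ^ i‖ := by
  obtain ⟨ρ, c, h0, h1, hc, h⟩ := hf
  refine Summable.of_nonneg_of_le (fun i => norm_nonneg _) (fun i => ?_)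
    ((summable_geometric_of_lt_one h0 h1).mul_left c)
  rw [norm_mul, norm_algebraMap', norm_pow]
  exact (mul_le_of_le_one_right (norm_nonneg _) (pow_le_one₀ (norm_nonneg _) ht)).trans (h i)

variable [CompleteSpace L]

theorem evalSeries_mul {f g : K⟦X⟧} (hf : Overconv f) (hg : Overconv g) {t : L} (ht : ‖t‖ ≤ 1) :
    evalSeries (f * g) t = evalSeries f t * evalSeries g t := by
  have h := tsum_mul_tsum_eq_tsum_sum_antidiagonal_of_summable_norm
    (f := fun i => algebraMap K L (coeff i f) * t ^ i)
    (g := fun i => algebraMap K L (coeff i g) * t ^ i) (hf.summable ht) (hg.summable ht)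
  refine Eq.trans ?_ h.symm
  refine tsum_congr fun i => ?_
  rw [coeff_mul, map_sum, sum_mul]
  refine sum_congr rfl fun x hx => ?_
  have hx' : x.1 + x.2 = i := HasAntidiagonal.mem_antidiagonal.1 hx
  rw [← hx', pow_add, map_mul]
  ring

theorem evalSeries_sum {α : Type*} (s : Finset α) {f : α → K⟦X⟧} (hf : ∀ i, Overconv (f i)) {t : L}
    (ht : ‖t‖ ≤ 1) : evalSeries (∑ i ∈ s, f i) t = ∑ i ∈ s, evalSeries (f i) t := by
  simp only [evalSeries, map_sum, sum_mul]
  exact Summable.tsum_finsetSum fun i _ => ((hf i).summable ht).of_norm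

theorem evalSeries_one (t : L) : evalSeries (1 : K⟦X⟧) t = 1 := by
  rw [evalSeries, tsum_eq_single 0]
  · simp
  · intro i hi
    simp [PowerSeries.coeff_one, hi]

theorem evalSeries_prod {α : Type*} (s : Finset α) {f : α → K⟦X⟧} (hf : ∀ i, Overconv (f i)) {t : L}
    (ht : ‖t‖ ≤ 1) : evalSeries (∏ i ∈ s, f i) t = ∏ i ∈ s, evalSeries (f i) t := by
  classical
  induction s using Finset.induction_on with
  | empty => simp [evalSeries_one]
  | insert a s ha ih =>
    rw [prod_insert ha, prod_insert ha, evalSeries_mul (hf a) (Overconv.prod s hf) ht, ih]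

theorem evalSeries_expand (f : K⟦X⟧) {m : ℕ} (hm : m ≠ 0) (t : L) :
    evalSeries (expand m hm f) t = evalSeries f (t ^ m) := by
  have hinj : Function.Injective fun i : ℕ => m * i := fun a b h =>
    Nat.eq_of_mul_eq_mul_left (Nat.pos_of_ne_zero hm) h
  rw [evalSeries, evalSeries, ← hinj.tsum_eq]
  · refine tsum_congr fun i => ?_
    rw [coeff_expand_mul, pow_mul]
  · intro i hi
    rw [Function.mem_support, coeff_expand] at hi
    split_ifs at hi with h
    · obtain ⟨d, rfl⟩ := h
      exact ⟨d, rfl⟩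
    · simp at hi

variable {ι : Type*} [Fintype ι]

/-- The iterates `G(a ^ (p ^ r)) ⋯ G(a ^ p) G(a)`. -/
def frobIter {p : ℕ} (hp : p ≠ 0) (G : Matrix ι ι K⟦X⟧) : ℕ → Matrix ι ι K⟦X⟧
  | 0 => G
  | r + 1 => (frobIter hp G r).map (expand p hp) * G

/-- The value of a matrix of power series. -/
def evalMat (G : Matrix ι ι K⟦X⟧) (t : L) : Matrix ι ι L := G.map (evalSeries · t)

theorem overconv_frobIter {p : ℕ} (hp : p ≠ 0) {G : Matrix ι ι K⟦X⟧} (hG : ∀ i j, Overconv (G i j))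
    (r : ℕ) : ∀ i j, Overconv (frobIter hp G r i j) := by
  induction r with
  | zero => exact hG
  | succ r ih =>
    intro i j
    rw [frobIter, Matrix.mul_apply]
    exact Overconv.sum _ fun l => ((ih i l).expand hp).mul (hG l j)

theorem evalMat_mul {F G : Matrix ι ι K⟦X⟧} (hF : ∀ i j, Overconv (F i j))
    (hG : ∀ i j, Overconv (G i j)) {t : L} (ht : ‖t‖ ≤ 1) : evalMat (F * G) t = evalMat F t * evalMat G t := by
  ext i j
  rw [evalMat, map_apply, Matrix.mul_apply, Matrix.mul_apply,
    evalSeries_sum _ (fun l => (hF i l).mul (hG l j)) ht]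
  exact sum_congr rfl fun l _ => evalSeries_mul (hF i l) (hG l j) ht

theorem evalMat_frobIter_succ {p : ℕ} (hp : p ≠ 0) {G : Matrix ι ι K⟦X⟧} (hG : ∀ i j, Overconv (G i j))
    (r : ℕ) {t : L} (ht : ‖t‖ ≤ 1) :
    evalMat (frobIter hp G (r + 1)) t = evalMat (frobIter hp G r) (t ^ p) * evalMat G t := by
  rw [frobIter, evalMat_mul (F := (frobIter hp G r).map (expand p hp)) (fun i j => (overconv_frobIter hp hG r i j).expand hp) hG ht]
  congr 1
  ext i j
  exact evalSeries_expand _ hp t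

theorem kernelPow_frobKernel {p : ℕ} (hp : p ≠ 0) (G : Matrix ι ι K⟦X⟧) (r : ℕ) (x y : ℕ × ι) :
    kernelPow (frobKernel p fun i => G.map (coeff i)) r x y =
      if y.1 ≤ p ^ (r + 1) * x.1 then
        coeff (p ^ (r + 1) * x.1 - y.1) (frobIter hp G r x.2 y.2) else 0 := by
  have hp0 := Nat.pos_of_ne_zero hp
  induction r generalizing y with
  | zero => simp [kernelPow, frobKernel, frobIter]
  | succ r ih =>
    rw [kernelPow_succ, tsum_eq_sum (s := range (p ^ (r + 1) * x.1 + 1) ×ˢ univ)]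
    swap
    · intro z hz
      rw [ih, if_neg, zero_mul]
      simp only [mem_product, mem_range, mem_univ, and_true] at hz
      omega
    rw [sum_product_right]
    simp only [ih, frobKernel, map_apply]
    rw [frobIter, Matrix.mul_apply, map_sum]
    have hpow : p ^ (r + 1 + 1) * x.1 = p * (p ^ (r + 1) * x.1) := by ring
    rw [hpow]
    generalize p ^ (r + 1) * x.1 = A
    split_ifs with hy
    · refine sum_congr rfl fun l _ => ?_
      rw [coeff_mul]
      rw [← sum_filter_add_sum_filter_not (range (A + 1)) (fun w => y.1 ≤ p * w)]
      rw [sum_eq_zero (s := (range (A + 1)).filter fun w => ¬ y.1 ≤ p * w), add_zero]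
      swap
      · intro w hw
        rw [if_neg (c := y.1 ≤ _) (mem_filter.1 hw).2, mul_zero]
      refine sum_of_injOn (fun w => (p * (A - w), p * w - y.1)) ?_ ?_ ?_ ?_
      · intro w hw w' hw' h
        simp only [coe_filter, mem_range, Set.mem_ofPred_eq] at hw hw'
        have := Nat.eq_of_mul_eq_mul_left hp0 (Prod.mk.inj h).1
        omega
      · intro w hw
        simp only [coe_filter, mem_range, Set.mem_ofPred_eq] at hw
        simp only [mem_coe, HasAntidiagonal.mem_antidiagonal]
        have : p * (A - w) + p * w = p * A := by rw [← mul_add, Nat.sub_add_cancel (by omega)]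
        omega
      · intro z hz hzn
        rw [map_apply, coeff_expand]
        split_ifs with hd
        · exfalso
          obtain ⟨b, hb⟩ := hd
          have hz' := HasAntidiagonal.mem_antidiagonal.1 hz
          have hbA : b ≤ A := by
            by_contra hcon
            have : p * A < p * b := Nat.mul_lt_mul_of_pos_left (by omega) hp0
            omega
          have e : p * (A - b) + p * b = p * A := by rw [← mul_add, Nat.sub_add_cancel (by omega)]
          refine hzn ⟨A - b, ?_, ?_⟩
          · simp only [coe_filter, mem_range, Set.mem_ofPred_eq]
            omega
          · refine Prod.ext ?_ ?_
            · change p * (A - (A - b)) = z.1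
              rw [Nat.sub_sub_self hbA, hb]
            · change p * (A - b) - y.1 = z.2
              omega
        · rw [zero_mul]
      · intro w hw
        simp only [mem_filter, mem_range] at hw
        rw [if_pos (by omega), if_pos hw.2, map_apply, coeff_expand_mul]
    · refine sum_eq_zero fun l _ => sum_eq_zero fun w hw => ?_
      rw [if_neg (c := y.1 ≤ p * _), mul_zero]
      simp only [mem_range] at hw
      intro h
      have : p * w ≤ p * A := Nat.mul_le_mul_left p (by omega)
      omega

end Overconvergent

section RootsOfUnity

variable {K : Type*} [NontriviallyNormedField K] [IsUltrametricDist K]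
  {L : Type*} [NormedField L] [NormedAlgebra K L] {N : ℕ} [NeZero N]

theorem norm_eq_one_of_mem_nthRootsFinset {t : L} (ht : t ∈ nthRootsFinset N (1 : L)) : ‖t‖ = 1 :=
  (pow_eq_one_iff_of_nonneg (norm_nonneg t) (NeZero.ne N)).1 (by
    rw [← norm_pow, (mem_nthRootsFinset (NeZero.pos N) 1).1 ht, norm_one])

theorem ne_zero_of_mem_nthRootsFinset {t : L} (ht : t ∈ nthRootsFinset N (1 : L)) : t ≠ 0 := by
  rw [← norm_ne_zero_iff, norm_eq_one_of_mem_nthRootsFinset ht]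
  exact one_ne_zero

variable [HasEnoughRootsOfUnity L N]

theorem card_nthRootsFinset_one : #(nthRootsFinset N (1 : L)) = N := by
  obtain ⟨ζ, hζ⟩ := HasEnoughRootsOfUnity.exists_primitiveRoot L N
  exact hζ.card_nthRootsFinset

theorem sum_nthRootsFinset_pow (m : ℕ) :
    ∑ t ∈ nthRootsFinset N (1 : L), t ^ m = if N ∣ m then (N : L) else 0 := by
  have hN := NeZero.pos N
  split_ifs with h
  · obtain ⟨d, rfl⟩ := h
    rw [sum_congr rfl fun t ht => by
      rw [pow_mul, (mem_nthRootsFinset hN 1).1 ht, one_pow]]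
    rw [sum_const, card_nthRootsFinset_one, nsmul_one]
  · obtain ⟨ζ, hζ⟩ := HasEnoughRootsOfUnity.exists_primitiveRoot L N
    have hζ1 : ζ ^ m ≠ 1 := fun hc => h (hζ.dvd_of_pow_eq_one m hc)
    have hζ0 : ζ ≠ 0 := hζ.ne_zero (NeZero.ne N)
    have hs : ∑ t ∈ nthRootsFinset N (1 : L), t ^ m =
        ζ ^ m * ∑ t ∈ nthRootsFinset N (1 : L), t ^ m := by
      rw [mul_sum]
      refine sum_bij' (fun t _ => ζ⁻¹ * t) (fun t _ => ζ * t) ?_ ?_ ?_ ?_ ?_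
      · intro t ht
        rw [mem_nthRootsFinset hN] at ht ⊢
        rw [mul_pow, ht, inv_pow, hζ.pow_eq_one, inv_one, one_mul]
      · intro t ht
        rw [mem_nthRootsFinset hN] at ht ⊢
        rw [mul_pow, ht, hζ.pow_eq_one, one_mul]
      · intro t _
        rw [mul_inv_cancel_left₀ hζ0]
      · intro t _
        rw [inv_mul_cancel_left₀ hζ0]
      · intro t _
        rw [← mul_pow, mul_inv_cancel_left₀ hζ0]
    have : (1 - ζ ^ m) * ∑ t ∈ nthRootsFinset N (1 : L), t ^ m = 0 := by
      rw [sub_mul, one_mul, ← hs, sub_self]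
    exact (mul_eq_zero.1 this).resolve_left (sub_ne_zero.2 hζ1.symm)

theorem eq_zero_of_sum_pow_mul_eq_zero (hN : (N : L) ≠ 0) {F : L → L}
    (h : ∀ j < N, ∑ t ∈ nthRootsFinset N (1 : L), t ^ j * F t = 0) {s : L}
    (hs : s ∈ nthRootsFinset N (1 : L)) : F s = 0 := by
  have hN0 := NeZero.pos N
  have hs0 := ne_zero_of_mem_nthRootsFinset hs
  have h1 : ∑ j ∈ range N, s⁻¹ ^ j * ∑ t ∈ nthRootsFinset N (1 : L), t ^ j * F t = 0 :=
    sum_eq_zero fun j hj => by rw [h j (mem_range.1 hj), mul_zero]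
  simp only [mul_sum] at h1
  rw [sum_comm, sum_eq_single s] at h1
  · have h2 : ∀ j, s⁻¹ ^ j * (s ^ j * F s) = F s := by
      intro j
      rw [← mul_assoc, ← mul_pow, inv_mul_cancel₀ hs0, one_pow, one_mul]
    simp only [h2, sum_const, card_range, nsmul_eq_mul] at h1
    exact (mul_eq_zero.1 h1).resolve_left hN
  · intro t ht hts
    have h3 : ∀ j, s⁻¹ ^ j * (t ^ j * F t) = (s⁻¹ * t) ^ j * F t := by
      intro j
      rw [← mul_assoc, ← mul_pow]
    simp only [h3, ← sum_mul]
    have h4 : s⁻¹ * t ≠ 1 := by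
      intro h
      exact hts ((inv_mul_eq_one₀ hs0).1 h).symm
    have h5 : (s⁻¹ * t) ^ N = 1 := by
      rw [mul_pow, inv_pow, (mem_nthRootsFinset hN0 1).1 hs,
        (mem_nthRootsFinset hN0 1).1 ht, inv_one, one_mul]
    rw [geom_sum_eq h4, h5, sub_self, zero_div, zero_mul]
  · exact fun hc => absurd hs hc

theorem sum_pow_mul_evalSeries [CompleteSpace L] [CompleteSpace K] {f : K⟦X⟧} (hf : Overconv f) (j : ℕ) :
    ∑ t ∈ nthRootsFinset N (1 : L), t ^ j * evalSeries f t =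
      N * algebraMap K L (∑' u : ℕ, if j ≤ N * u then PowerSeries.coeff (N * u - j) f else 0) := by
  have hN : 0 < N := NeZero.pos N
  have h1 : ∀ t : L, t ^ j * evalSeries f t = ∑' i, algebraMap K L (PowerSeries.coeff i f) * t ^ (i + j) := by
    intro t
    rw [evalSeries, ← tsum_mul_left]
    refine tsum_congr fun i => ?_
    ring
  have h2 : ∀ t ∈ nthRootsFinset N (1 : L),
      Summable fun i => algebraMap K L (PowerSeries.coeff i f) * t ^ (i + j) := by
    intro t ht
    refine (((hf.summable (norm_eq_one_of_mem_nthRootsFinset ht).le).of_norm).mul_right (t ^ j)).congr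
      fun i => ?_
    ring
  simp only [h1]
  rw [← Summable.tsum_finsetSum h2]
  simp only [← mul_sum, sum_nthRootsFinset_pow]
  rw [(algebraMap_isometry K L).isClosedEmbedding.map_tsum, ← tsum_mul_left]
  refine tsum_eq_tsum_of_ne_zero_bij (fun u => N * u.1 - j) ?_ ?_ ?_
  · intro u v h
    have hu := u.2
    have hv := v.2
    simp only [Function.mem_support, ne_eq, mul_eq_zero, not_or] at hu hv
    have hu' : j ≤ N * u.1 := by
      by_contra hc
      simp [hc] at hu
    have hv' : j ≤ N * v.1 := by
      by_contra hc
      simp [hc] at hv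
    exact Subtype.ext (Nat.eq_of_mul_eq_mul_left hN (by simp only at h; omega))
  · intro i hi
    rw [Function.mem_support] at hi
    have hd : N ∣ i + j := by
      by_contra hc
      simp [hc] at hi
    have hi0 : PowerSeries.coeff i f ≠ 0 := by
      intro hc
      simp [hc] at hi
    have hN0 : (N : L) ≠ 0 := by
      intro hc
      simp [hc] at hi
    obtain ⟨u, hu⟩ := hd
    have e : N * u - j = i := by omega
    refine ⟨⟨u, ?_⟩, e⟩
    rw [Function.mem_support, if_pos (by omega), e]
    exact mul_ne_zero hN0 (by simpa using hi0)
  · intro u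
    have hu := u.2
    rw [Function.mem_support] at hu
    have hu' : j ≤ N * u.1 := by
      by_contra hc
      simp [hc] at hu
    rw [Nat.sub_add_cancel hu', if_pos (dvd_mul_right _ _), if_pos hu', mul_comm]

end RootsOfUnity

variable [CompleteSpace K]

section Trace

open PowerSeries (coeff mk)

variable {L : Type*} [NormedField L] [NormedAlgebra K L] [CompleteSpace L]

theorem prime_pow_sub_one_pos (p : ℕ) [hp : Fact p.Prime] (r : ℕ) : 0 < p ^ (r + 1) - 1 := by
  have : 1 < p ^ (r + 1) := Nat.one_lt_pow (Nat.succ_ne_zero r) hp.out.one_lt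
  omega

instance neZero_prime_pow_sub_one (p : ℕ) [Fact p.Prime] (r : ℕ) : NeZero (p ^ (r + 1) - 1) :=
  ⟨(prime_pow_sub_one_pos p r).ne'⟩

theorem tsum_prod_eq_sum {α β E : Type*} [Fintype β] [AddCommGroup E] [TopologicalSpace E] [T2Space E]
    [IsTopologicalAddGroup E] {f : α × β → E} (hf : ∀ b, Summable fun a => f (a, b)) :
    ∑' x, f x = ∑ b, ∑' a, f (a, b) := by
  classical
  refine HasSum.tsum_eq ?_
  have h : ∀ b, HasSum (fun x : α × β => if x.2 = b then f x else 0) (∑' a, f (a, b)) := by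
    intro b
    have hinj : Function.Injective fun a : α => (a, b) := fun a a' h => (Prod.mk.inj h).1
    refine (hinj.hasSum_iff ?_).1 ?_
    · intro x hx
      rw [if_neg]
      rintro rfl
      exact hx ⟨x.1, rfl⟩
    · convert (hf b).hasSum using 2 with a
      simp
  refine (hasSum_sum fun b (_ : b ∈ univ) => h b).congr_fun fun x => ?_
  simp

theorem Overconv.summable_sub {f : K⟦X⟧} (hf : Overconv f) {N : ℕ} (hN : 0 < N) (j : ℕ) :
    Summable fun u : ℕ => if j ≤ N * u then coeff (N * u - j) f else 0 := by
  obtain ⟨ρ, c, h0, h1, hc, h⟩ := hf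
  rw [← summable_nat_add_iff j]
  refine Summable.of_norm_bounded ((summable_geometric_of_lt_one h0 h1).mul_left c) fun u => ?_
  have hle : u + j ≤ N * (u + j) := Nat.le_mul_of_pos_left _ hN
  rw [if_pos (by omega)]
  exact (h _).trans (mul_le_mul_of_nonneg_left (pow_le_pow_of_le_one h0 h1.le (by omega)) hc)

/-- The matrix of power series of the Frobenius operator. -/
def frobSeries (p : ℕ) (π : K) (n : ℕ) : Matrix (Fin n) (Fin n) K⟦X⟧ :=
  fun l j => mk fun i => frobMat p π n i l j

theorem map_coeff_frobSeries (π : K) (n i : ℕ) :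
    (frobSeries p π n).map (coeff i) = frobMat p π n i := by
  ext l j
  rw [map_apply, frobSeries, coeff_mk]

theorem overconv_frobSeries (hp17 : 17 ≤ p) (hπ : π ^ (p - 1) = -p) {n : ℕ} (hn : 0 < n) (l j : Fin n) :
    Overconv (frobSeries p π n l j) := by
  have hx0 : 0 ≤ ‖π‖ ^ (3 * n) := by positivity
  have hx1 : ‖π‖ ^ (3 * n) < 1 := pow_lt_one₀ (norm_nonneg _) (norm_uniformizer_lt_one hπ) (by omega)
  have ht0 : 0 ≤ (‖π‖ ^ (3 * n)) ^ ((p : ℝ)⁻¹) := by positivity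
  have ht1 : (‖π‖ ^ (3 * n)) ^ ((p : ℝ)⁻¹) < 1 := by
    refine Real.rpow_lt_one hx0 hx1 ?_
    have := hp.out.pos
    positivity
  obtain ⟨C, hC, h⟩ := exists_norm_frobMat_le hp17 hπ n ht0 ht1.le (Real.rpow_inv_natCast_pow hx0 hp.out.ne_zero)
  exact ⟨_, C, ht0, ht1, hC, fun s => by rw [frobSeries, coeff_mk]; exact h s l j⟩

theorem sum_pow_mul_trace_evalMat [IsAlgClosed L] [CharZero L] {ι : Type*} [Fintype ι]
    {G : Matrix ι ι K⟦X⟧} (hG : ∀ i j, Overconv (G i j)) (r j : ℕ) :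
    ∑ t ∈ nthRootsFinset (p ^ (r + 1) - 1) (1 : L),
        t ^ j * (evalMat (frobIter hp.out.ne_zero G r) t).trace =
      ((p ^ (r + 1) - 1 : ℕ) : L) * algebraMap K L (∑' x : ℕ × ι,
        kernelPow (frobKernel p fun i => G.map (coeff i)) r x (x.1 + j, x.2)) := by
  have hN := prime_pow_sub_one_pos p r
  have hO := overconv_frobIter hp.out.ne_zero hG r
  have hterm : ∀ x : ℕ × ι, kernelPow (frobKernel p fun i => G.map (coeff i)) r x (x.1 + j, x.2) =
      if j ≤ (p ^ (r + 1) - 1) * x.1 then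
        coeff ((p ^ (r + 1) - 1) * x.1 - j) (frobIter hp.out.ne_zero G r x.2 x.2) else 0 := by
    intro x
    rw [kernelPow_frobKernel hp.out.ne_zero]
    have hle : x.1 ≤ p ^ (r + 1) * x.1 := Nat.le_mul_of_pos_left _ (by omega)
    have : (p ^ (r + 1) - 1) * x.1 = p ^ (r + 1) * x.1 - x.1 := by rw [Nat.sub_mul, one_mul]
    rw [this]
    generalize p ^ (r + 1) * x.1 = A at *
    have e : A - (x.1 + j) = A - x.1 - j := by omega
    simp only [e]
    by_cases h : j ≤ A - x.1
    · rw [if_pos h, if_pos (by omega)]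
    · rw [if_neg h, if_neg (by omega)]
  rw [tsum_congr hterm, tsum_prod_eq_sum (f := fun x : ℕ × ι => if j ≤ (p ^ (r + 1) - 1) * x.1 then
      coeff ((p ^ (r + 1) - 1) * x.1 - j) (frobIter hp.out.ne_zero G r x.2 x.2) else 0)
      fun l => (hO l l).summable_sub hN j, map_sum, mul_sum]
  simp only [trace, Matrix.diag, mul_sum]
  rw [sum_comm]
  exact sum_congr rfl fun l _ => sum_pow_mul_evalSeries (hO l l) j

theorem frobMat_one (hp17 : 17 ≤ p) (hπ : π ^ (p - 1) = -p) (i : ℕ) (l j : Fin 1) :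
    frobMat p π 1 i l j = dworkCoeff p π i := by
  have hs : shiftMat K 1 = 0 := by
    ext a b
    fin_cases a
    fin_cases b
    simp [shiftMat]
  have hc : cornerMat K 1 = 1 := by
    ext a b
    fin_cases a
    fin_cases b
    simp [cornerMat]
  rw [Subsingleton.elim l 0, Subsingleton.elim j 0]
  induction i using Nat.strong_induction_on with
  | _ i ih =>
  rcases i with _ | i
  · rw [frobMat_zero_apply hp17 hπ 0 0 le_rfl, dworkCoeff_zero]
    simp
  · have h := congrFun (congrFun (frobMat_relation hp17 hπ 1 (i + 1)) 0) 0
    have hi : ((i + 1 : ℕ) : K) ≠ 0 := Nat.cast_ne_zero.2 (Nat.succ_ne_zero i)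
    have h2 := dworkCoeff_succ hπ i
    have hp1 := hp.out.one_lt
    rw [hs, hc] at h
    simp only [zero_mul, mul_zero, smul_zero, add_zero, one_mul, mul_one, pow_one,
      Nat.succ_ne_zero, if_false, Matrix.zero_apply, zero_add, Nat.add_sub_cancel, Matrix.add_apply, Matrix.smul_apply, smul_eq_mul] at h
    refine mul_left_cancel₀ hi ?_
    rw [ih i (by omega)] at h
    by_cases hpi : p ≤ i + 1
    · rw [if_pos hpi, ih (i + 1 - p) (by omega), show i + 1 - p = i - (p - 1) by omega] at h
      rw [if_pos (by omega)] at h2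
      push_cast at h h2 ⊢
      rw [h2, ← h]
      ring
    · rw [if_neg hpi, Matrix.zero_apply, mul_zero, add_zero] at h
      rw [if_neg (by omega), sub_zero] at h2
      push_cast at h h2 ⊢
      rw [h2, ← h]

/-- The Dwork exponential as a power series. -/
def dworkSeries (p : ℕ) (π : K) : K⟦X⟧ := mk (dworkCoeff p π)

/-- The additive character of the field with `p ^ r` elements, on Teichmüller representatives. -/
def dworkChar (p : ℕ) (π : K) (r : ℕ) (t : L) : L :=
  ∏ i ∈ range r, evalSeries (dworkSeries p π) (t ^ p ^ i)

/-- The hyper-Kloosterman sum in `n` variables over the field with `p ^ r` elements. -/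
def klSum (p : ℕ) (π : K) (n r : ℕ) (t : L) : L := by
  classical exact
  ∑ x ∈ (piFinset fun _ : Fin n => nthRootsFinset (p ^ r - 1) (1 : L)) with ∏ i, x i = t,
    ∏ i, dworkChar p π r (x i)

theorem trace_evalMat_one (hp17 : 17 ≤ p) (hπ : π ^ (p - 1) = -p) (r : ℕ) {t : L}
    (ht : ‖t‖ ≤ 1) :
    (evalMat (frobIter hp.out.ne_zero (frobSeries p π 1) r) t).trace = dworkChar p π (r + 1) t := by
  have h0 : ∀ t : L, evalMat (frobSeries p π 1) t 0 0 = evalSeries (dworkSeries p π) t := by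
    intro t
    rw [evalMat, map_apply]
    congr 1
    ext i
    rw [frobSeries, dworkSeries, coeff_mk, coeff_mk, frobMat_one hp17 hπ]
  rw [Matrix.trace_fin_one]
  induction r generalizing t with
  | zero => simp [frobIter, dworkChar, h0]
  | succ r ih =>
    rw [evalMat_frobIter_succ _ (overconv_frobSeries hp17 hπ one_pos) r ht, Matrix.mul_apply,
      Fin.sum_univ_one, h0, ih (by rw [norm_pow]; exact pow_le_one₀ (norm_nonneg _) ht), dworkChar, dworkChar,
      prod_range_succ' _ (r + 1), pow_zero, pow_one]
    simp only [← pow_mul, ← pow_succ']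

theorem trace_evalMat_frobSeries [IsAlgClosed L] [CharZero L] (hp17 : 17 ≤ p)
    (hπ : π ^ (p - 1) = -p) {n : ℕ} (hn : 0 < n) (hne : Even n) (r : ℕ) {t : L}
    (ht : t ∈ nthRootsFinset (p ^ (r + 1) - 1) (1 : L)) :
    (evalMat (frobIter hp.out.ne_zero (frobSeries p π n) r) t).trace = -klSum p π n (r + 1) t := by
  classical
  set M := nthRootsFinset (p ^ (r + 1) - 1) (1 : L) with hM
  have hN := prime_pow_sub_one_pos p r
  have hN0 : ((p ^ (r + 1) - 1 : ℕ) : L) ≠ 0 := Nat.cast_ne_zero.2 hN.ne'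
  rw [← add_eq_zero_iff_eq_neg]
  refine eq_zero_of_sum_pow_mul_eq_zero (F := fun t =>
    (evalMat (frobIter hp.out.ne_zero (frobSeries p π n) r) t).trace + klSum p π n (r + 1) t) hN0 ?_ ht
  intro j _
  simp only [mul_add, sum_add_distrib]
  have key := congrArg (algebraMap K L) (pow_tsum_kernelPow_add hp17 hπ hn r j)
  have hcast : algebraMap K L (1 - (p : K) ^ (r + 1)) = -((p ^ (r + 1) - 1 : ℕ) : L) := by
    rw [Nat.cast_sub (by omega)]
    simp
  have e : ∀ n, 0 < n → ∑ t ∈ M, t ^ j * (evalMat (frobIter hp.out.ne_zero (frobSeries p π n) r) t).trace =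
      ((p ^ (r + 1) - 1 : ℕ) : L) * algebraMap K L (∑' x : ℕ × Fin n,
        kernelPow (frobKernel p (frobMat p π n)) r x (x.1 + j, x.2)) := by
    intro n hn
    rw [sum_pow_mul_trace_evalMat (overconv_frobSeries hp17 hπ hn) r j]
    simp only [map_coeff_frobSeries]
  rw [map_pow, map_mul, map_mul, hcast, neg_mul, neg_mul, ← e n hn, ← e 1 one_pos, hne.neg_pow] at key
  rw [neg_eq_iff_eq_neg.1 key, neg_add_eq_zero, sum_congr rfl fun t ht => by
    rw [trace_evalMat_one hp17 hπ r (norm_eq_one_of_mem_nthRootsFinset ht).le]]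
  have h1 : (∑ t ∈ M, t ^ j * dworkChar p π (r + 1) t) ^ n =
      ∏ _i : Fin n, ∑ t ∈ M, t ^ j * dworkChar p π (r + 1) t := by simp
  rw [h1, prod_univ_sum]
  simp only [klSum, prod_mul_distrib, mul_sum, prod_pow]
  rw [← sum_fiberwise_of_maps_to (s := piFinset fun _ : Fin n => M) (t := M) (g := fun x => ∏ i, x i)]
  · refine sum_congr rfl fun t _ => sum_congr rfl fun x hx => ?_
    rw [(mem_filter.1 hx).2]
  · intro x hx
    rw [mem_piFinset] at hx
    rw [hM, mem_nthRootsFinset hN, ← prod_pow]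
    exact prod_eq_one fun i _ => (mem_nthRootsFinset hN 1).1 (hx i)

end Trace

section FormalIdentities

open PowerSeries

variable {K : Type*} [Field K]

theorem derivative_expand {m : ℕ} (hm : m ≠ 0) (f : K⟦X⟧) :
    derivative K (expand m hm f) = (m : K⟦X⟧) * X ^ (m - 1) * expand m hm (derivative K f) := by
  ext i
  rw [coeff_derivative, coeff_expand, mul_assoc, ← map_natCast (C (R := K)), coeff_C_mul, coeff_X_pow_mul',
    coeff_expand]
  by_cases h : m ∣ i + 1
  · obtain ⟨d, hd⟩ := h
    have hd0 : d ≠ 0 := by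
      rintro rfl
      omega
    obtain ⟨e, rfl⟩ := Nat.exists_eq_succ_of_ne_zero hd0
    have hi : i - (m - 1) = m * e := by
      rw [Nat.mul_succ] at hd
      omega
    have hi' : m - 1 ≤ i := by
      rw [Nat.mul_succ] at hd
      omega
    rw [hd, if_pos (dvd_mul_right _ _), if_pos hi', hi, if_pos (dvd_mul_right _ _),
      Nat.mul_div_cancel_left _ (Nat.pos_of_ne_zero hm), Nat.mul_div_cancel_left _ (Nat.pos_of_ne_zero hm),
      coeff_derivative]
    have : (i : K) + 1 = m * (e + 1) := by exact_mod_cast congrArg (Nat.cast (R := K)) hd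
    rw [this]
    ring
  · rw [if_neg h, zero_mul]
    split_ifs with h1 h2
    · exfalso
      apply h
      have : i + 1 = (i - (m - 1)) + m := by omega
      rw [this]
      exact dvd_add h2 dvd_rfl
    · simp
    · simp

theorem eq_one_of_derivative_eq_zero [CharZero K] {f : K⟦X⟧} (hf : derivative K f = 0)
    (h0 : constantCoeff f = 1) : f = 1 :=
  derivative.ext (by rw [hf, ← map_one (C (R := K)), derivative_C]) (by rw [h0, map_one])

/-- The series `exp(cX)`. -/
def expSeries (c : K) : K⟦X⟧ := mk fun i => c ^ i / i.factorial

theorem derivative_expSeries [CharZero K] (c : K) : derivative K (expSeries c) = C c * expSeries c := by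
  ext i
  rw [coeff_derivative, coeff_C_mul, expSeries, coeff_mk, coeff_mk, Nat.factorial_succ]
  have h1 : (i.factorial : K) ≠ 0 := Nat.cast_ne_zero.2 i.factorial_ne_zero
  have h2 : (i : K) + 1 ≠ 0 := Nat.cast_add_one_ne_zero i
  push_cast
  field_simp
  ring

theorem constantCoeff_expSeries (c : K) : constantCoeff (expSeries c) = 1 := by
  rw [← coeff_zero_eq_constantCoeff_apply, expSeries, coeff_mk]
  simp

theorem expSeries_mul_expSeries_neg [CharZero K] (c : K) : expSeries c * expSeries (-c) = 1 := by
  refine eq_one_of_derivative_eq_zero ?_ ?_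
  · rw [Derivation.leibniz, derivative_expSeries, derivative_expSeries, smul_eq_mul, smul_eq_mul, map_neg]
    ring
  · rw [map_mul, constantCoeff_expSeries, constantCoeff_expSeries, one_mul]

end FormalIdentities

section DworkSeries

open PowerSeries

theorem derivative_dworkSeries (hπ : π ^ (p - 1) = -p) :
    derivative K (dworkSeries p π) = (C π - C (p * π) * X ^ (p - 1)) * dworkSeries p π := by
  ext i
  rw [coeff_derivative, sub_mul, map_sub, mul_assoc, coeff_C_mul, coeff_C_mul, coeff_X_pow_mul', dworkSeries,
    coeff_mk, coeff_mk, coeff_mk, mul_comm]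
  have h := dworkCoeff_succ hπ i
  push_cast at h
  rw [h]
  split_ifs <;> simp

theorem constantCoeff_dworkSeries (π : K) : constantCoeff (dworkSeries p π) = 1 := by
  rw [← coeff_zero_eq_constantCoeff_apply, dworkSeries, coeff_mk, dworkCoeff_zero]

theorem dworkSeries_pow (hπ : π ^ (p - 1) = -p) :
    dworkSeries p π ^ p * expand p hp.out.ne_zero (expSeries (p * π)) * expSeries (-(p * π)) = 1 := by
  refine eq_one_of_derivative_eq_zero ?_ ?_
  · obtain ⟨m, hm⟩ : ∃ m, p = m + 1 := ⟨p - 1, by have := hp.out.pos; omega⟩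
    have hpow : dworkSeries p π ^ p = dworkSeries p π ^ (p - 1) * dworkSeries p π := by
      rw [← pow_succ]
      congr 1
      omega
    rw [Derivation.leibniz, Derivation.leibniz, derivative_expand, derivative_expSeries, derivative_expSeries,
      Derivation.leibniz_pow, derivative_dworkSeries hπ, map_mul (expand p hp.out.ne_zero), expand_C, map_neg,
      map_mul (C (R := K)), map_natCast]
    simp only [smul_eq_mul, nsmul_eq_mul]
    rw [hpow]
    ring
  · rw [map_mul, map_mul, map_pow, constantCoeff_dworkSeries, constantCoeff_expand, constantCoeff_expSeries,
      constantCoeff_expSeries, one_pow, one_mul, one_mul]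

theorem overconv_dworkSeries (hp17 : 17 ≤ p) (hπ : π ^ (p - 1) = -p) :
    Overconv (dworkSeries p π) := by
  convert overconv_frobSeries hp17 hπ one_pos 0 0 using 1
  ext i
  rw [dworkSeries, frobSeries, coeff_mk, coeff_mk, frobMat_one hp17 hπ]

theorem overconv_expSeries (hπ : π ^ (p - 1) = -p) {c : K} (hc : ‖c‖ ≤ ‖(p : K) * π‖) :
    Overconv (expSeries c) := by
  have h0 := norm_pos_of_uniformizer hπ
  refine ⟨(p : ℝ)⁻¹, 1, by positivity, inv_lt_one_of_one_lt₀ (by exact_mod_cast hp.out.one_lt), zero_le_one,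
    fun i => ?_⟩
  have hf : 0 < ‖(i.factorial : K)‖ := norm_pos_iff.2 (Nat.cast_ne_zero.2 i.factorial_ne_zero)
  rw [expSeries, coeff_mk, norm_div, norm_pow, one_mul, div_le_iff₀ hf]
  calc ‖c‖ ^ i ≤ ‖(p : K) * π‖ ^ i := pow_le_pow_left₀ (norm_nonneg _) hc _
    _ = (p : ℝ)⁻¹ ^ i * ‖π‖ ^ i := by rw [norm_mul, norm_prime_eq, mul_pow]
    _ ≤ _ := mul_le_mul_of_nonneg_left (norm_uniformizer_pow_le_factorial hπ i) (by positivity)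

variable {L : Type*} [NormedField L] [NormedAlgebra K L] [CompleteSpace L]

theorem evalSeries_pow {f : K⟦X⟧} (hf : Overconv f) (m : ℕ) {t : L} (ht : ‖t‖ ≤ 1) :
    evalSeries (f ^ m) t = evalSeries f t ^ m := by
  rw [← Fin.prod_const, evalSeries_prod _ (fun _ => hf) ht, Fin.prod_const]

theorem Overconv.pow {f : K⟦X⟧} (hf : Overconv f) (m : ℕ) : Overconv (f ^ m) := by
  rw [← Fin.prod_const]
  exact Overconv.prod _ fun _ => hf

theorem dworkChar_pow (hp17 : 17 ≤ p) (hπ : π ^ (p - 1) = -p) (r : ℕ) {t : L}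
    (ht : ‖t‖ ≤ 1) (htr : t ^ p ^ r = t) : dworkChar p π r t ^ p = 1 := by
  have hO := overconv_dworkSeries hp17 hπ
  have hE := overconv_expSeries hπ (le_refl ‖(p : K) * π‖)
  have hE' := overconv_expSeries hπ (norm_neg ((p : K) * π)).le
  have h1 : ∀ s : L, ‖s‖ ≤ 1 → evalSeries (dworkSeries p π) s ^ p *
      evalSeries (expSeries ((p : K) * π)) (s ^ p) = evalSeries (expSeries ((p : K) * π)) s := by
    intro s hs
    have e1 := congrArg (fun f => evalSeries f s) (dworkSeries_pow hπ)
    have e2 := congrArg (fun f => evalSeries f s) (expSeries_mul_expSeries_neg ((p : K) * π))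
    simp only [evalSeries_one] at e1 e2
    rw [evalSeries_mul ((hO.pow p).mul (hE.expand hp.out.ne_zero)) hE' hs,
      evalSeries_mul (hO.pow p) (hE.expand hp.out.ne_zero) hs, evalSeries_pow hO p hs, evalSeries_expand] at e1
    rw [evalSeries_mul hE hE' hs] at e2
    exact mul_right_cancel₀ (right_ne_zero_of_mul_eq_one e2) (e1.trans e2.symm)
  have h2 : ∀ m, dworkChar p π m t ^ p * evalSeries (expSeries ((p : K) * π)) (t ^ p ^ m) =
      evalSeries (expSeries ((p : K) * π)) t := by
    intro m
    induction m with
    | zero => simp [dworkChar]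
    | succ m ih =>
      rw [dworkChar, prod_range_succ, mul_pow, mul_assoc, pow_succ p m, pow_mul, h1 _ ?_]
      · exact ih
      · rw [norm_pow]
        exact pow_le_one₀ (norm_nonneg _) ht
  have h3 := h2 r
  have e2 := congrArg (fun f => evalSeries f t) (expSeries_mul_expSeries_neg ((p : K) * π))
  simp only [evalSeries_one] at e2
  rw [evalSeries_mul hE hE' ht] at e2
  rw [htr] at h3
  exact mul_right_cancel₀ (left_ne_zero_of_mul_eq_one e2) (h3.trans (one_mul _).symm)

theorem dworkChar_mul_of_pow_eq (r d : ℕ) (π : K) {t : L} (htr : t ^ p ^ r = t) :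
    dworkChar p π (r * d) t = dworkChar p π r t ^ d := by
  have hper : ∀ d, t ^ p ^ (r * d) = t := by
    intro d
    induction d with
    | zero => simp
    | succ d ih => rw [Nat.mul_succ, pow_add, pow_mul, ih, htr]
  induction d with
  | zero => simp [dworkChar]
  | succ d ih =>
    rw [pow_succ, ← ih, dworkChar, Nat.mul_succ, prod_range_add]
    congr 1
    refine prod_congr rfl fun i _ => ?_
    rw [pow_add, pow_mul, hper]

variable [IsUltrametricDist L]

theorem norm_evalSeries_dworkSeries_sub_le (hp17 : 17 ≤ p) (hπ : π ^ (p - 1) = -p) {t : L}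
    (ht : ‖t‖ ≤ 1) :
    ‖evalSeries (dworkSeries p π) t - (1 + algebraMap K L π * t)‖ ≤ ‖π‖ ^ 2 := by
  have hs := ((overconv_dworkSeries hp17 hπ).summable ht).of_norm
  rw [evalSeries, ← hs.sum_add_tsum_nat_add 2]
  have e : ∑ i ∈ range 2, algebraMap K L (coeff i (dworkSeries p π)) * t ^ i = 1 + algebraMap K L π * t := by
    rw [sum_range_succ, sum_range_one, dworkSeries, coeff_mk, coeff_mk, dworkCoeff_zero,
      dworkCoeff_one (by omega)]
    simp
  rw [e, add_sub_cancel_left]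
  refine norm_tsum_le_of_forall_le_of_nonneg (by positivity) fun i => ?_
  rw [norm_mul, norm_algebraMap', norm_pow, dworkSeries, coeff_mk]
  exact (mul_le_of_le_one_right (norm_nonneg _) (pow_le_one₀ (norm_nonneg _) ht)).trans
    (norm_dworkCoeff_le_sq (by omega) hπ (by omega))

theorem eq_one_of_pow_eq_one_of_norm_sub_lt (hπ : π ^ (p - 1) = -p) {η : L} (hη : η ^ p = 1)
    (h : ‖η - 1‖ < ‖π‖) : η = 1 := by
  by_contra hne
  obtain ⟨m, hm⟩ : ∃ m, p = m + 1 := ⟨p - 1, by have := hp.out.pos; omega⟩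
  have hm0 : m ≠ 0 := by
    have := hp.out.one_lt
    omega
  have hprim : IsPrimitiveRoot η (m + 1) := by
    rw [← hm]
    exact IsPrimitiveRoot.iff_orderOf.2 (orderOf_eq_prime hη hne)
  have hprod := congrArg norm hprim.prod_one_sub_pow_eq_order
  have hη1 : ‖η‖ = 1 := (pow_eq_one_iff_of_nonneg (norm_nonneg η) hp.out.ne_zero).1 (by rw [← norm_pow, hη, norm_one])
  have hle : ∀ k, ‖1 - η ^ (k + 1)‖ ≤ ‖η - 1‖ := by
    intro k
    rw [← norm_neg, neg_sub, ← geom_sum_mul, norm_mul]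
    refine mul_le_of_le_one_left (norm_nonneg _) (norm_sum_le_of_forall_le_of_nonneg zero_le_one ?_)
    intro i _
    rw [norm_pow, hη1, one_pow]
  have hcast : ((m : L) + 1) = algebraMap K L (p : K) := by
    rw [hm]
    simp
  rw [hcast, norm_algebraMap', norm_prime_eq_pow hπ, norm_prod, show p - 1 = m by omega] at hprod
  have : ‖π‖ ^ m ≤ ‖η - 1‖ ^ m := by
    rw [← hprod]
    calc _ ≤ ∏ _k ∈ range m, ‖η - 1‖ := prod_le_prod (fun _ _ => norm_nonneg _) fun k _ => hle k
      _ = _ := by simp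
  exact absurd this (not_le.2 (pow_lt_pow_left₀ h (norm_nonneg _) hm0))

theorem isPrimitiveRoot_evalSeries_dworkSeries (hp17 : 17 ≤ p) (hπ : π ^ (p - 1) = -p) :
    IsPrimitiveRoot (evalSeries (dworkSeries p π) (1 : L)) p := by
  have hπ0 := norm_pos_of_uniformizer hπ
  have hπ1 := norm_uniformizer_lt_one hπ
  refine IsPrimitiveRoot.iff_orderOf.2 (orderOf_eq_prime ?_ ?_)
  · simpa [dworkChar] using dworkChar_pow hp17 hπ 1 (t := (1 : L)) (by simp) (by simp)
  · intro h
    have h1 := norm_evalSeries_dworkSeries_sub_le (L := L) hp17 hπ (t := 1) (by simp)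
    rw [h, mul_one, sub_add_cancel_left, norm_neg, norm_algebraMap'] at h1
    nlinarith

end DworkSeries

section Gauge

open PowerSeries

variable {K : Type*} [Field K]

/-- The formal solution at infinity of the Kloosterman equation. -/
def gaugeSeq (K : Type*) [Field K] (n : ℕ) : ℕ → ℕ → K
  | 0 => fun _ => 1
  | i + 1 => fun l =>
    (n : K)⁻¹ * ∑ l' ∈ range l, ((l' : K) - ((n : K) - 1) / 2 - i) * gaugeSeq K n i l' +
      ((n : K) * (i + 1))⁻¹ * ∑ l ∈ range n, ((l : K) - ((n : K) - 1) / 2 - (i + 1)) *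
        ((n : K)⁻¹ * ∑ l' ∈ range l, ((l' : K) - ((n : K) - 1) / 2 - i) * gaugeSeq K n i l')

theorem gaugeSeq_succ_sub [CharZero K] {n : ℕ} (hn : 0 < n) (i l : ℕ) :
    (n : K) * (gaugeSeq K n (i + 1) (l + 1) - gaugeSeq K n (i + 1) l) =
      ((l : K) - ((n : K) - 1) / 2 - i) * gaugeSeq K n i l := by
  have hn0 : (n : K) ≠ 0 := Nat.cast_ne_zero.2 hn.ne'
  simp only [gaugeSeq, sum_range_succ _ l]
  rw [add_sub_add_right_eq_sub, ← mul_sub, add_sub_cancel_left, mul_inv_cancel_left₀ hn0]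

theorem sum_range_sub_half [CharZero K] (n : ℕ) : ∑ l ∈ range n, ((l : K) - ((n : K) - 1) / 2) = 0 := by
  rw [sum_sub_distrib, sum_const, card_range, nsmul_eq_mul]
  have h := congrArg (Nat.cast (R := K)) (sum_range_id_mul_two n)
  rcases n with _ | n
  · simp
  · push_cast [Nat.add_sub_cancel] at h ⊢
    linear_combination h / 2

theorem sum_gaugeSeq [CharZero K] {n : ℕ} (hn : 0 < n) (i : ℕ) :
    ∑ l ∈ range n, ((l : K) - ((n : K) - 1) / 2 - i) * gaugeSeq K n i l = 0 := by
  have hn0 : (n : K) ≠ 0 := Nat.cast_ne_zero.2 hn.ne'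
  rcases i with _ | i
  · simpa [gaugeSeq] using sum_range_sub_half (K := K) n
  · have hi : (i : K) + 1 ≠ 0 := Nat.cast_add_one_ne_zero i
    have e : ∑ l ∈ range n, ((l : K) - ((n : K) - 1) / 2 - (i + 1)) = -(n * (i + 1)) := by
      rw [sum_sub_distrib, sum_range_sub_half, sum_const, card_range, nsmul_eq_mul, zero_sub]
    rw [gaugeSeq]
    push_cast
    simp only [mul_add, sum_add_distrib]
    rw [← sum_mul]
    simp only [← mul_add]
    rw [e]
    generalize ∑ l ∈ range n, ((l : K) - ((n : K) - 1) / 2 - (i + 1)) *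
        ((n : K)⁻¹ * ∑ l' ∈ range l, ((l' : K) - ((n : K) - 1) / 2 - i) * gaugeSeq K n i l') = S
    field_simp
    ring

theorem gaugeSeq_period [CharZero K] {n : ℕ} (hn : 0 < n) (i : ℕ) : gaugeSeq K n i n = gaugeSeq K n i 0 := by
  rcases i with _ | i
  · rfl
  · simp only [gaugeSeq, sum_gaugeSeq hn, sum_range_zero]

/-- The twist of the formal solution by a root of unity. -/
def gaugeSeries (n : ℕ) (κ : K) (l : ℕ) : K⟦X⟧ :=
  mk fun i => κ ^ l * κ⁻¹ ^ i * gaugeSeq K n i l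

theorem gaugeSeries_relation [CharZero K] {n : ℕ} [NeZero n] {κ : K} (hκ : κ ^ n = 1) (l : Fin n) :
    C (n : K) * (gaugeSeries n κ (l + 1 : Fin n) - C κ * gaugeSeries n κ l) =
      X * (C ((l : K) - ((n : K) - 1) / 2) * gaugeSeries n κ l) -
        X * (X * derivative K (gaugeSeries n κ l)) := by
  have hn := NeZero.pos n
  have hκ0 : κ ≠ 0 := by
    rintro rfl
    rw [zero_pow hn.ne'] at hκ
    exact zero_ne_one hκ
  have hwrap : gaugeSeries n κ (l + 1 : Fin n) = gaugeSeries n κ ((l : ℕ) + 1) := by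
    have hval : ((l + 1 : Fin n) : ℕ) = ((l : ℕ) + 1) % n := by
      rw [Fin.val_add, Fin.coe_ofNat_eq_mod, Nat.add_mod_mod]
    rw [hval]
    rcases Nat.lt_or_ge ((l : ℕ) + 1) n with h | h
    · rw [Nat.mod_eq_of_lt h]
    · have h' : (l : ℕ) + 1 = n := le_antisymm l.2 h
      rw [h', Nat.mod_self]
      ext i
      rw [gaugeSeries, gaugeSeries, coeff_mk, coeff_mk, gaugeSeq_period hn, hκ, pow_zero]
  rw [hwrap]
  ext i
  rcases i with _ | i
  · simp [gaugeSeries, gaugeSeq, pow_succ']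
  · rw [coeff_C_mul, map_sub, map_sub, coeff_C_mul, coeff_succ_X_mul, coeff_succ_X_mul, coeff_C_mul]
    have hX : coeff i (X * derivative K (gaugeSeries n κ l)) = i * coeff i (gaugeSeries n κ l) := by
      rcases i with _ | i
      · simp
      · rw [coeff_succ_X_mul, coeff_derivative]
        push_cast
        ring
    rw [hX]
    simp only [gaugeSeries, coeff_mk]
    have h := gaugeSeq_succ_sub (K := K) hn i l
    have hk : κ ^ ((l : ℕ) + 1) * κ⁻¹ ^ (i + 1) = κ ^ (l : ℕ) * κ⁻¹ ^ i := by
      rw [pow_succ, pow_succ]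
      field_simp
    have hk' : κ * (κ ^ (l : ℕ) * κ⁻¹ ^ (i + 1) * gaugeSeq K n (i + 1) l) =
        κ ^ (l : ℕ) * κ⁻¹ ^ i * gaugeSeq K n (i + 1) l := by
      rw [← hk]
      ring
    rw [hk', hk]
    linear_combination (κ ^ (l : ℕ) * κ⁻¹ ^ i) * h

theorem derivative_finset_prod {H : Type*} [DecidableEq H] (s : Finset H) (f : H → K⟦X⟧) :
    derivative K (∏ h ∈ s, f h) = ∑ h ∈ s, (∏ h' ∈ s.erase h, f h') * derivative K (f h) := by
  induction s using Finset.induction_on with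
  | empty => simp
  | insert a s ha ih =>
    rw [prod_insert ha, Derivation.leibniz, ih, sum_insert ha, erase_insert ha, smul_eq_mul,
      smul_eq_mul, mul_sum, add_comm]
    congr 1
    refine sum_congr rfl fun h hh => ?_
    have hah : a ≠ h := fun e => ha (e ▸ hh)
    rw [erase_insert_of_ne hah, prod_insert (fun hm => ha (mem_of_mem_erase hm)), mul_assoc]

variable {H : Type*} [Fintype H]

/-- The formal solution at infinity of a tensor power. -/
def gaugeProd (n : ℕ) (κ : H → K) (l : H → Fin n) : K⟦X⟧ :=
  ∏ h, gaugeSeries n (κ h) (l h)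

theorem gaugeProd_relation [DecidableEq H] [CharZero K] {n : ℕ} [NeZero n] {κ : H → K} (hκ : ∀ h, κ h ^ n = 1)
    (l : H → Fin n) :
    C (n : K) * (∑ h, gaugeProd n κ (l + Pi.single h 1) - C (∑ h, κ h) * gaugeProd n κ l) =
      X * (C (∑ h, ((l h : ℕ) : K) - Fintype.card H * (((n : K) - 1) / 2)) * gaugeProd n κ l) -
        X * (X * derivative K (gaugeProd n κ l)) := by
  have hder : derivative K (gaugeProd n κ l) = ∑ h, (∏ h' ∈ univ.erase h, gaugeSeries n (κ h') (l h')) *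
      derivative K (gaugeSeries n (κ h) (l h)) := by
    exact derivative_finset_prod _ _
  have hup : ∀ h, gaugeProd n κ (l + Pi.single h 1) =
      (∏ h' ∈ univ.erase h, gaugeSeries n (κ h') (l h')) * gaugeSeries n (κ h) (l h + 1 : Fin n) := by
    intro h
    rw [gaugeProd, ← prod_erase_mul _ _ (mem_univ h)]
    congr 1
    · refine prod_congr rfl fun h' hh => ?_
      rw [Pi.add_apply, Pi.single_eq_of_ne (ne_of_mem_erase hh), add_zero]
    · rw [Pi.add_apply, Pi.single_eq_same]
  have hsame : ∀ h, gaugeProd n κ l =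
      (∏ h' ∈ univ.erase h, gaugeSeries n (κ h') (l h')) * gaugeSeries n (κ h) (l h) := fun h =>
    (prod_erase_mul _ _ (mem_univ h)).symm
  have hcard : (Fintype.card H : K) * (((n : K) - 1) / 2) = ∑ _h : H, (((n : K) - 1) / 2) := by simp
  rw [hder, hcard, ← sum_sub_distrib, map_sum, map_sum, sum_mul, sum_mul,
    ← sum_sub_distrib, mul_sum, mul_sum, mul_sum, mul_sum,
    ← sum_sub_distrib]
  refine sum_congr rfl fun h _ => ?_
  rw [hup, hsame h]
  linear_combination (∏ h' ∈ univ.erase h, gaugeSeries n (κ h') (l h')) * gaugeSeries_relation (hκ h) (l h)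

end Gauge

section Rigidity

open PowerSeries (coeff coeff_C_mul)

theorem norm_sub_le_max' {K : Type*} [NontriviallyNormedField K] [IsUltrametricDist K] (a b : K) :
    ‖a - b‖ ≤ max ‖a‖ ‖b‖ := by
  rw [sub_eq_add_neg, ← norm_neg b]
  exact norm_add_le_max _ _

theorem norm_eq_one_of_root {n : ℕ} (hn : 0 < n) {κ : K} (hκ : κ ^ n = 1) : ‖κ‖ = 1 :=
  (pow_eq_one_iff_of_nonneg (norm_nonneg κ) hn.ne').1 (by rw [← norm_pow, hκ, norm_one])

theorem norm_half_le (hp2 : 2 < p) (n l i : ℕ) : ‖(l : K) - ((n : K) - 1) / 2 - i‖ ≤ 1 := by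
  have h2 : ‖(2 : K)‖ = 1 := by
    have := norm_natCast_eq_one (K := K) p (m := 2) (fun h => by have := Nat.le_of_dvd (by norm_num) h; omega)
    exact_mod_cast this
  have hl := norm_natCast_le_one' p (K := K) l
  have hi := norm_natCast_le_one' p (K := K) i
  have hn := norm_natCast_le_one' p (K := K) n
  have h3 : ‖((n : K) - 1) / 2‖ ≤ 1 := by
    rw [norm_div, h2, div_one]
    exact (norm_sub_le_max' _ _).trans (max_le hn norm_one.le)
  exact (norm_sub_le_max' _ _).trans
    (max_le ((norm_sub_le_max' _ _).trans (max_le hl h3)) hi)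

theorem norm_gaugeSeq_le (hp2 : 2 < p) {n : ℕ} (hn : ¬ p ∣ n) (i : ℕ) :
    ∀ l, ‖gaugeSeq K n i l‖ ≤ ‖(i.factorial : K)‖⁻¹ := by
  induction i with
  | zero => simp [gaugeSeq]
  | succ i ih =>
    intro l
    have hn1 := norm_natCast_eq_one (K := K) p hn
    have hS : ∀ l, ‖(n : K)⁻¹ * ∑ l' ∈ range l, ((l' : K) - ((n : K) - 1) / 2 - i) * gaugeSeq K n i l'‖ ≤
        ‖(i.factorial : K)‖⁻¹ := by
      intro l
      rw [norm_mul, norm_inv, hn1, inv_one, one_mul]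
      refine norm_sum_le_of_forall (by positivity) fun l' _ => ?_
      rw [norm_mul]
      exact (mul_le_mul (norm_half_le hp2 n l' i) (ih l') (norm_nonneg _) zero_le_one).trans (one_mul _).le
    have hf : ‖((i + 1).factorial : K)‖⁻¹ = ‖((i + 1 : ℕ) : K)‖⁻¹ * ‖(i.factorial : K)‖⁻¹ := by
      rw [Nat.factorial_succ, Nat.cast_mul, norm_mul, mul_inv]
    have h1 : 1 ≤ ‖((i + 1 : ℕ) : K)‖⁻¹ :=
      (one_le_inv₀ (norm_pos_iff.2 (Nat.cast_ne_zero.2 i.succ_ne_zero))).2 (norm_natCast_le_one' p _)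
    rw [hf]
    have h2 := inv_nonneg.2 (norm_nonneg (i.factorial : K))
    simp only [gaugeSeq]
    refine (norm_add_le_max _ _).trans (max_le ?_ ?_)
    · exact (hS l).trans (le_mul_of_one_le_left h2 h1)
    · rw [norm_mul, norm_inv, norm_mul, hn1, one_mul, Nat.cast_succ]
      refine mul_le_mul_of_nonneg_left (norm_sum_le_of_forall h2 fun l' _ => ?_) (by positivity)
      rw [norm_mul]
      have h3 := norm_half_le (K := K) hp2 n l' (i + 1)
      rw [Nat.cast_succ] at h3
      exact (mul_le_mul h3 (hS l') (norm_nonneg _) zero_le_one).trans (one_mul _).le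

theorem growthLE_gaugeProd {H : Type*} [Fintype H] (hp2 : 2 < p) (hπ : π ^ (p - 1) = -p) {n : ℕ} [NeZero n]
    (hn : ¬ p ∣ n) {κ : H → K} (hκ : ∀ h, κ h ^ n = 1) (l : H → Fin n) :
    GrowthLE ‖π‖⁻¹ 1 (gaugeProd n κ l) := by
  have h : ∀ h ∈ (univ : Finset H), GrowthLE ‖π‖⁻¹ ((fun _ => 1 : H → ℝ) h) (gaugeSeries n (κ h) (l h)) := by
    intro h _ i
    have h1 := norm_eq_one_of_root (NeZero.pos n) (hκ h)
    rw [gaugeSeries, coeff_mk, norm_mul, norm_mul, norm_pow, norm_pow, norm_inv, h1]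
    simp only [inv_one, one_pow, one_mul]
    refine (norm_gaugeSeq_le hp2 hn i _).trans ?_
    rw [inv_pow]
    exact inv_anti₀ (pow_pos (norm_pos_of_uniformizer hπ) i) (norm_uniformizer_pow_le_factorial hπ i)
  simpa [gaugeProd] using GrowthLE.prod (by positivity) (fun _ => zero_le_one) h

theorem norm_sum_pow_sub_le {H : Type*} (s : Finset H) (f : ℕ) {κ : H → K} (hκ : ∀ h, ‖κ h‖ ≤ 1) :
    ‖(∑ h ∈ s, κ h) ^ p ^ f - ∑ h ∈ s, κ h ^ p ^ f‖ ≤ ‖(p : K)‖ := by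
  classical
  induction s using Finset.induction_on with
  | empty => rw [sum_empty, sum_empty, zero_pow (pow_pos hp.out.pos f).ne', sub_zero, norm_zero]; exact norm_nonneg _
  | insert a s ha ih =>
    have hs : ‖∑ h ∈ s, κ h‖ ≤ 1 := norm_sum_le_of_forall zero_le_one fun h _ => hκ h
    rw [sum_insert ha, sum_insert ha, add_pow_prime_pow_eq hp.out]
    generalize hS : ∑ k ∈ Ioo 0 (p ^ f), κ a ^ (k - 1) * (∑ x ∈ s, κ x) ^ (p ^ f - k - 1) * ((p ^ f).choose k / p : ℕ) = S
    have hS1 : ‖S‖ ≤ 1 := by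
      rw [← hS]
      refine norm_sum_le_of_forall zero_le_one fun k _ => ?_
      rw [norm_mul, norm_mul, norm_pow, norm_pow]
      exact mul_le_one₀ (mul_le_one₀ (pow_le_one₀ (norm_nonneg _) (hκ a)) (by positivity)
        (pow_le_one₀ (norm_nonneg _) hs)) (norm_nonneg _) (norm_natCast_le_one' p _)
    have e : κ a ^ p ^ f + (∑ x ∈ s, κ x) ^ p ^ f + p * κ a * (∑ x ∈ s, κ x) * S -
        (κ a ^ p ^ f + ∑ x ∈ s, κ x ^ p ^ f) =
        p * (κ a * (∑ x ∈ s, κ x) * S) + ((∑ x ∈ s, κ x) ^ p ^ f - ∑ x ∈ s, κ x ^ p ^ f) := by ring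
    rw [e]
    refine (norm_add_le_max _ _).trans (max_le ?_ ih)
    rw [norm_mul, norm_mul, norm_mul]
    exact mul_le_of_le_one_right (norm_nonneg _) (mul_le_one₀ (mul_le_one₀ (hκ a) (norm_nonneg _) hs) (norm_nonneg _) hS1)

theorem norm_sum_root_le {H : Type*} [Fintype H] {n : ℕ} (hn0 : 0 < n) (hn : ¬ p ∣ n) {κ : H → K}
    (hκ : ∀ h, κ h ^ n = 1) (h1 : ‖∑ h, κ h‖ < 1) : ‖∑ h, κ h‖ ≤ ‖(p : K)‖ := by
  have h2 : ∀ h, κ h ^ p ^ n.totient = κ h := by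
    intro h
    have h3 : p ^ n.totient ≡ 1 [MOD n] := Nat.ModEq.pow_totient ((Nat.Prime.coprime_iff_not_dvd hp.out).2 hn)
    have h4 := pow_eq_pow_of_modEq h3 (hκ h)
    rwa [pow_one] at h4
  have h3 := norm_sum_pow_sub_le (p := p) univ n.totient fun h => (norm_eq_one_of_root hn0 (hκ h)).le
  simp only [h2] at h3
  rcases eq_or_ne (∑ h, κ h) 0 with h0 | h0
  · rw [h0, norm_zero]
    exact norm_nonneg _
  · have h4 : ‖(∑ h, κ h) ^ p ^ n.totient‖ < ‖∑ h, κ h‖ := by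
      rw [norm_pow]
      exact pow_lt_self_of_lt_one₀ (norm_pos_iff.2 h0) h1
        (Nat.one_lt_pow (Nat.totient_pos.2 hn0).ne' hp.out.one_lt)
    have h5 := norm_sub_le_max' ((∑ h, κ h) ^ p ^ n.totient) ((∑ h, κ h) ^ p ^ n.totient - ∑ h, κ h)
    rw [sub_sub_cancel] at h5
    rcases le_max_iff.1 h5 with h6 | h6
    · exact absurd h4 h6.not_gt
    · exact h6.trans h3

theorem sum_root_orthogonality {n : ℕ} [NeZero n] {ω : K} (hω : IsPrimitiveRoot ω n) (a b : Fin n) :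
    ∑ j : Fin n, (ω ^ (j : ℕ)) ^ (a : ℕ) * ((ω ^ (j : ℕ)) ^ (b : ℕ))⁻¹ = if a = b then (n : K) else 0 := by
  have hω0 : ω ≠ 0 := hω.ne_zero (NeZero.ne n)
  have h : ∀ j : Fin n, (ω ^ (j : ℕ)) ^ (a : ℕ) * ((ω ^ (j : ℕ)) ^ (b : ℕ))⁻¹ =
      (ω ^ (a : ℕ) * (ω ^ (b : ℕ))⁻¹) ^ (j : ℕ) := by
    intro j
    rw [mul_pow, inv_pow, pow_right_comm, pow_right_comm ω (j : ℕ) b]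
  simp only [h]
  rw [Fin.sum_univ_eq_sum_range (fun j => (ω ^ (a : ℕ) * (ω ^ (b : ℕ))⁻¹) ^ j)]
  split_ifs with hab
  · rw [hab, mul_inv_cancel₀ (pow_ne_zero _ hω0)]
    simp
  · have h1 : ω ^ (a : ℕ) * (ω ^ (b : ℕ))⁻¹ - 1 ≠ 0 := by
      intro h2
      rw [sub_eq_zero, mul_inv_eq_one₀ (pow_ne_zero _ hω0)] at h2
      exact hab (Fin.ext (hω.pow_inj a.2 b.2 h2))
    have h2 := geom_sum_mul (ω ^ (a : ℕ) * (ω ^ (b : ℕ))⁻¹) n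
    rw [mul_pow, inv_pow, pow_right_comm, pow_right_comm ω (b : ℕ) n, hω.pow_eq_one, one_pow, one_pow, inv_one,
      mul_one, sub_self] at h2
    exact (mul_eq_zero.1 h2).resolve_right h1

theorem norm_le_of_fourier {H : Type*} [Fintype H] [DecidableEq H] {n : ℕ} [NeZero n] (hn : ¬ p ∣ n) {ω : K}
    (hω : IsPrimitiveRoot ω n) (x : (H → Fin n) → K) {A : ℝ}
    (hx : ∀ j : H → Fin n, ‖∑ l : H → Fin n, (∏ h, (ω ^ (j h : ℕ)) ^ (l h : ℕ)) * x l‖ ≤ A) (l : H → Fin n) :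
    ‖x l‖ ≤ A := by
  have hA : 0 ≤ A := (norm_nonneg _).trans (hx 0)
  have hort : ∀ l' : H → Fin n, ∑ j : H → Fin n, ∏ h, (((ω ^ (j h : ℕ)) ^ (l h : ℕ))⁻¹ * (ω ^ (j h : ℕ)) ^ (l' h : ℕ)) =
      if l' = l then (n : K) ^ Fintype.card H else 0 := by
    intro l'
    have h0 := prod_univ_sum (fun _ : H => (univ : Finset (Fin n)))
      (fun h j => ((ω ^ (j : ℕ)) ^ (l h : ℕ))⁻¹ * (ω ^ (j : ℕ)) ^ (l' h : ℕ))
    rw [piFinset_univ] at h0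
    rw [← h0]
    have h1 : ∀ h, ∑ j : Fin n, ((ω ^ (j : ℕ)) ^ (l h : ℕ))⁻¹ * (ω ^ (j : ℕ)) ^ (l' h : ℕ) =
        if l' h = l h then (n : K) else 0 := by
      intro h
      rw [← sum_root_orthogonality hω]
      exact sum_congr rfl fun j _ => mul_comm _ _
    simp only [h1]
    split_ifs with hl
    · simp [hl]
    · obtain ⟨h, hh⟩ := Function.ne_iff.1 hl
      exact prod_eq_zero (mem_univ h) (if_neg hh)
  have h1 : ∑ j : H → Fin n, (∏ h, ((ω ^ (j h : ℕ)) ^ (l h : ℕ))⁻¹) *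
      ∑ l' : H → Fin n, (∏ h, (ω ^ (j h : ℕ)) ^ (l' h : ℕ)) * x l' = (n : K) ^ Fintype.card H * x l := by
    simp only [mul_sum]
    rw [sum_comm, sum_eq_single l]
    · simp only [← mul_assoc, ← prod_mul_distrib]
      rw [← sum_mul, hort, if_pos rfl]
    · intro l' _ hl
      simp only [← mul_assoc, ← prod_mul_distrib]
      rw [← sum_mul, hort, if_neg hl, zero_mul]
    · simp
  have h2 := congrArg norm h1
  rw [norm_mul, norm_pow, norm_natCast_eq_one p hn, one_pow, one_mul] at h2
  rw [← h2]
  refine norm_sum_le_of_forall hA fun j _ => ?_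
  rw [norm_mul, norm_prod, prod_eq_one, one_mul]
  · exact hx j
  · intro h _
    have h3 := norm_eq_one_of_root (NeZero.pos n) hω.pow_eq_one
    rw [norm_inv, norm_pow, norm_pow, h3, one_pow, one_pow, inv_one]

variable {H : Type*} [Fintype H] [DecidableEq H] {n : ℕ} [NeZero n]

/-- The pairing of a sequence with the formal solution at infinity. -/
def gaugePair (κ : H → K) (χ : ℕ → (H → Fin n) → K) (d : ℕ) : K :=
  ∑' i, ∑ l, coeff i (gaugeProd n κ l) * χ (d + i) l

variable {κ : H → K} {χ : ℕ → (H → Fin n) → K} {A : ℝ} {c : ℕ}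

theorem norm_gaugePair_term_le (hp2 : 2 < p) (hπ : π ^ (p - 1) = -p) (hn : ¬ p ∣ n) (hκ : ∀ h, κ h ^ n = 1)
    (hA : 0 ≤ A) (hχ : ∀ d l, ‖χ d l‖ ≤ A * (‖π‖ ^ 2) ^ d) (d i : ℕ) (w : (H → Fin n) → K) (hw : ∀ l, ‖w l‖ ≤ 1) :
    ‖∑ l, w l * (coeff i (gaugeProd n κ l) * χ (d + i) l)‖ ≤ A * (‖π‖ ^ 2) ^ d * ‖π‖ ^ i := by
  have hπ0 := norm_pos_of_uniformizer hπ
  refine norm_sum_le_of_forall (by positivity) fun l _ => ?_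
  rw [norm_mul, norm_mul]
  refine (mul_le_of_le_one_left (by positivity) (hw l)).trans ?_
  refine (mul_le_mul (growthLE_gaugeProd hp2 hπ hn hκ l i) (hχ (d + i) l) (norm_nonneg _) (by positivity)).trans ?_
  apply le_of_eq
  rw [pow_add, ← pow_mul ‖π‖ 2 i, one_mul, mul_comm 2 i, pow_mul ‖π‖ i 2, inv_pow]
  field_simp

theorem gaugePair_succ (hp2 : 2 < p) (hπ : π ^ (p - 1) = -p) (hn : ¬ p ∣ n)
    (hκ : ∀ h, κ h ^ n = 1) (hA : 0 ≤ A) (hχ : ∀ d l, ‖χ d l‖ ≤ A * (‖π‖ ^ 2) ^ d)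
    (hc : 2 * c = Fintype.card H * (n - 1))
    (hrec : ∀ (d : ℕ) l, ((d : K) - ∑ h, ((l h : ℕ) : K)) * χ (d + 1) l = -n * ∑ h, χ d (l - Pi.single h 1)) (d : ℕ) :
    ((d : K) - c) * gaugePair κ χ (d + 1) = -(n * ∑ h, κ h) * gaugePair κ χ d := by
  have hπ1 := norm_uniformizer_lt_one hπ
  have hck : (Fintype.card H : K) * (((n : K) - 1) / 2) = c := by
    have h := congrArg (Nat.cast (R := K)) hc
    rw [Nat.cast_mul, Nat.cast_mul, Nat.cast_sub (NeZero.one_le)] at h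
    push_cast at h
    linear_combination -h / 2
  have hsum : ∀ (d : ℕ) (w : ℕ → (H → Fin n) → K), (∀ i l, ‖w i l‖ ≤ 1) →
      Summable fun i => ∑ l, w i l * (coeff i (gaugeProd n κ l) * χ (d + i) l) := by
    intro d w hw
    refine Summable.of_norm_bounded (g := fun i => A * (‖π‖ ^ 2) ^ d * ‖π‖ ^ i)
      ((summable_geometric_of_lt_one (norm_nonneg π) hπ1).mul_left _) fun i => ?_
    exact norm_gaugePair_term_le hp2 hπ hn hκ hA hχ d i (w i) (hw i)
  have hnat : ∀ a b e : ℕ, ‖(a : K) - b - e‖ ≤ 1 := fun a b e =>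
    (norm_sub_le_max' _ _).trans (max_le ((norm_sub_le_max' _ _).trans
      (max_le (norm_natCast_le_one' p a) (norm_natCast_le_one' p b))) (norm_natCast_le_one' p e))
  let u : ℕ → K := fun i => ∑ l, (((∑ h, (l h : ℕ) : ℕ) : K) - (c : ℕ) - (i : ℕ)) *
    (coeff i (gaugeProd n κ l) * χ (d + 1 + i) l)
  let w : ℕ → K := fun i => ∑ l, (((d + i : ℕ) : K) - (∑ h, (l h : ℕ) : ℕ) - (0 : ℕ)) *
    (coeff i (gaugeProd n κ l) * χ (d + 1 + i) l)
  let u' : ℕ → K := fun i => if i = 0 then 0 else u (i - 1)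
  have hu : Summable u := hsum (d + 1) _ fun i l => hnat _ _ _
  have hw : Summable w := hsum (d + 1) _ fun i l => hnat _ _ _
  have hu' : Summable u' := by
    rw [← summable_nat_add_iff 1]
    exact hu
  have huu : ∑' i, u' i = ∑' i, u i := by
    rw [hu'.tsum_eq_zero_add]
    simp [u']
  have hL : ((d : K) - c) * gaugePair κ χ (d + 1) = ∑' i, w i + ∑' i, u i := by
    rw [gaugePair, ← tsum_mul_left, ← hw.tsum_add hu]
    refine tsum_congr fun i => ?_
    rw [mul_sum, ← sum_add_distrib]
    refine sum_congr rfl fun l _ => ?_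
    push_cast
    ring
  rw [hL, ← huu, gaugePair, ← tsum_mul_left, ← hw.tsum_add hu']
  refine tsum_congr fun i => ?_
  have hrel : ∀ l, -(n * ∑ h, κ h) * (coeff i (gaugeProd n κ l) * χ (d + i) l) =
      -n * ∑ h, coeff i (gaugeProd n κ (l + Pi.single h 1)) * χ (d + i) l +
      if i = 0 then 0 else (((∑ h, (l h : ℕ) : ℕ) : K) - c - (i - 1 : ℕ)) *
        (coeff (i - 1) (gaugeProd n κ l) * χ (d + 1 + (i - 1)) l) := by
    intro l
    have h := congrArg (coeff i) (gaugeProd_relation hκ l)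
    rw [hck] at h
    generalize ∑ h, κ h = s at h ⊢
    generalize ht : ∑ h, ((l h : ℕ) : K) - c = t at h
    rcases i with _ | i
    · rw [if_pos rfl, ← sum_mul]
      simp only [coeff_C_mul, map_sub, map_sum, PowerSeries.coeff_zero_X_mul, sub_self] at h
      linear_combination χ (d + 0) l * h
    · rw [if_neg i.succ_ne_zero, ← sum_mul]
      have hX : coeff i (PowerSeries.X * PowerSeries.derivative K (gaugeProd n κ l)) =
          i * coeff i (gaugeProd n κ l) := by
        rcases i with _ | i
        · simp
        · rw [coeff_succ_X_mul, PowerSeries.coeff_derivative]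
          push_cast
          ring
      simp only [coeff_C_mul, map_sub, map_sum, coeff_succ_X_mul, hX] at h
      rw [Nat.add_sub_cancel, show d + 1 + i = d + (i + 1) by ring]
      push_cast
      rw [ht]
      linear_combination χ (d + (i + 1)) l * h
  rw [mul_sum, sum_congr rfl fun l _ => hrel l, sum_add_distrib]
  congr 1
  · simp only [w, ← mul_sum]
    rw [sum_comm]
    have e : ∀ h : H, ∑ l, coeff i (gaugeProd n κ (l + Pi.single h 1)) * χ (d + i) l =
        ∑ l, coeff i (gaugeProd n κ l) * χ (d + i) (l - Pi.single h 1) := by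
      intro h
      exact Fintype.sum_equiv (Equiv.addRight (Pi.single h (1 : Fin n))) _ _ fun l => by simp
    simp only [e]
    rw [sum_comm, mul_sum]
    refine sum_congr rfl fun l _ => ?_
    have h := hrec (d + i) l
    rw [show d + i + 1 = d + 1 + i by ring] at h
    rw [← mul_sum]
    push_cast at h ⊢
    linear_combination coeff i (gaugeProd n κ l) * h
  · simp only [u', u]
    split_ifs
    · simp
    · rfl

theorem factorial_mul_gaugePair (hp2 : 2 < p) (hπ : π ^ (p - 1) = -p) (hn : ¬ p ∣ n)
    (hκ : ∀ h, κ h ^ n = 1) (hA : 0 ≤ A) (hχ : ∀ d l, ‖χ d l‖ ≤ A * (‖π‖ ^ 2) ^ d)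
    (hc : 2 * c = Fintype.card H * (n - 1))
    (hrec : ∀ (d : ℕ) l, ((d : K) - ∑ h, ((l h : ℕ) : K)) * χ (d + 1) l = -n * ∑ h, χ d (l - Pi.single h 1)) (i : ℕ) :
    (i.factorial : K) * gaugePair κ χ (c + 1 + i) = (-(n * ∑ h, κ h)) ^ i * gaugePair κ χ (c + 1) := by
  induction i with
  | zero => simp
  | succ i ih =>
    have h := gaugePair_succ hp2 hπ hn hκ hA hχ hc hrec (c + 1 + i)
    rw [pow_succ', mul_assoc, ← ih, Nat.factorial_succ]
    push_cast at h ⊢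
    rw [← add_assoc]
    linear_combination (i.factorial : K) * h

theorem norm_gaugePair_sub_le (hp2 : 2 < p) (hπ : π ^ (p - 1) = -p) (hn : ¬ p ∣ n)
    (hκ : ∀ h, κ h ^ n = 1) (hA : 0 ≤ A) (hχ : ∀ d l, ‖χ d l‖ ≤ A * (‖π‖ ^ 2) ^ d) (d : ℕ) :
    ‖gaugePair κ χ d - ∑ l, (∏ h, κ h ^ (l h : ℕ)) * χ d l‖ ≤ A * ‖π‖ * (‖π‖ ^ 2) ^ d := by
  have hπ1 := norm_uniformizer_lt_one hπ
  have hb : ∀ i, ‖∑ l, coeff i (gaugeProd n κ l) * χ (d + i) l‖ ≤ A * (‖π‖ ^ 2) ^ d * ‖π‖ ^ i := by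
    intro i
    simpa using norm_gaugePair_term_le hp2 hπ hn hκ hA hχ d i (fun _ => 1) (by simp)
  have hs : Summable fun i => ∑ l, coeff i (gaugeProd n κ l) * χ (d + i) l :=
    Summable.of_norm_bounded ((summable_geometric_of_lt_one (norm_nonneg π) hπ1).mul_left _) hb
  have h0 : ∀ l : H → Fin n, coeff 0 (gaugeProd n κ l) = ∏ h, κ h ^ (l h : ℕ) := by
    intro l
    simp [gaugeProd, gaugeSeries, gaugeSeq, PowerSeries.coeff_zero_eq_constantCoeff, map_prod]
  rw [gaugePair, hs.tsum_eq_zero_add]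
  simp only [h0, add_zero, add_sub_cancel_left]
  refine norm_tsum_le_of_forall (by positivity) fun i => (hb (i + 1)).trans ?_
  rw [mul_right_comm A]
  gcongr
  exact (pow_le_pow_of_le_one (norm_nonneg π) hπ1.le (show 1 ≤ i + 1 by omega)).trans_eq (pow_one _)

theorem norm_gaugePair_le (hp4 : 4 ≤ p) (hπ : π ^ (p - 1) = -p) (hn : ¬ p ∣ n)
    (hκ : ∀ h, κ h ^ n = 1) (hA : 0 ≤ A) (hχ : ∀ d l, ‖χ d l‖ ≤ A * (‖π‖ ^ 2) ^ d)
    (hc : 2 * c = Fintype.card H * (n - 1))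
    (hrec : ∀ (d : ℕ) l, ((d : K) - ∑ h, ((l h : ℕ) : K)) * χ (d + 1) l = -n * ∑ h, χ d (l - Pi.single h 1))
    (hvan : ∀ l, χ (c + 1) l = 0) (d : ℕ) : ‖gaugePair κ χ (d + 1)‖ ≤ A * ‖π‖ * (‖π‖ ^ 2) ^ (d + 1) := by
  have hp2 : 2 < p := by omega
  have hπ0 := norm_pos_of_uniformizer hπ
  have hπ1 := norm_uniformizer_lt_one hπ
  have hn1 := norm_natCast_eq_one (K := K) p hn
  have hn0 : (n : K) ≠ 0 := Nat.cast_ne_zero.2 (NeZero.ne n)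
  have hc1 : ‖gaugePair κ χ (c + 1)‖ ≤ A * ‖π‖ * (‖π‖ ^ 2) ^ (c + 1) := by
    have h := norm_gaugePair_sub_le hp2 hπ hn hκ hA hχ (c + 1)
    simpa [hvan] using h
  rcases lt_or_ge d c with hd | hd
  · have hzero : gaugePair κ χ (d + 1) = 0 := by
      rcases eq_or_ne (∑ h, κ h) 0 with h0 | h0
      · have h := gaugePair_succ hp2 hπ hn hκ hA hχ hc hrec d
        rw [h0, mul_zero, neg_zero, zero_mul] at h
        refine (mul_eq_zero.1 h).resolve_left ?_
        rw [sub_eq_zero]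
        exact_mod_cast hd.ne
      · have hdesc : ∀ j ≤ c, gaugePair κ χ (c - j) = 0 := by
          intro j
          induction j with
          | zero =>
            intro _
            have h := gaugePair_succ hp2 hπ hn hκ hA hχ hc hrec c
            rw [sub_self, zero_mul] at h
            exact (mul_eq_zero.1 h.symm).resolve_left (neg_ne_zero.2 (mul_ne_zero hn0 h0))
          | succ j ih =>
            intro hj
            have h := gaugePair_succ hp2 hπ hn hκ hA hχ hc hrec (c - (j + 1))
            rw [show c - (j + 1) + 1 = c - j by omega, ih (by omega), mul_zero] at h
            exact (mul_eq_zero.1 h.symm).resolve_left (neg_ne_zero.2 (mul_ne_zero hn0 h0))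
        have h := hdesc (c - (d + 1)) (by omega)
        rwa [show c - (c - (d + 1)) = d + 1 by omega] at h
    rw [hzero, norm_zero]
    positivity
  · obtain ⟨i, rfl⟩ := Nat.exists_eq_add_of_le hd
    rw [show c + i + 1 = c + 1 + i by ring]
    have hfac : ∀ i, ‖(i.factorial : K)‖ * ‖gaugePair κ χ (c + 1 + i)‖ =
        ‖∑ h, κ h‖ ^ i * ‖gaugePair κ χ (c + 1)‖ := by
      intro i
      have h := congrArg norm (factorial_mul_gaugePair hp2 hπ hn hκ hA hχ hc hrec i)
      rwa [norm_mul, norm_mul, norm_pow, norm_neg, norm_mul, hn1, one_mul] at h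
    have hfpos : 0 < ‖(i.factorial : K)‖ := norm_pos_iff.2 (Nat.cast_ne_zero.2 i.factorial_ne_zero)
    have hκ1 : ‖∑ h, κ h‖ ≤ 1 :=
      norm_sum_le_of_forall zero_le_one fun h _ => (norm_eq_one_of_root (NeZero.pos n) (hκ h)).le
    rcases hκ1.lt_or_eq with hlt | heq
    · have hle := norm_sum_root_le (NeZero.pos n) hn hκ hlt
      rw [norm_prime_eq_pow hπ] at hle
      refine le_of_mul_le_mul_left ?_ hfpos
      rw [hfac]
      calc ‖∑ h, κ h‖ ^ i * ‖gaugePair κ χ (c + 1)‖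
          ≤ (‖π‖ ^ (p - 1)) ^ i * (A * ‖π‖ * (‖π‖ ^ 2) ^ (c + 1)) := by gcongr
        _ ≤ (‖π‖ ^ 3) ^ i * (A * ‖π‖ * (‖π‖ ^ 2) ^ (c + 1)) := by
          gcongr ?_ ^ i * _
          exact pow_le_pow_of_le_one hπ0.le hπ1.le (by omega)
        _ = ‖π‖ ^ i * (A * ‖π‖ * (‖π‖ ^ 2) ^ (c + 1 + i)) := by ring
        _ ≤ _ := by
          gcongr
          exact norm_uniformizer_pow_le_factorial hπ i
    · have hb : ∀ j, ‖gaugePair κ χ (c + 1)‖ ≤ A * (‖π‖ ^ 2) ^ j := by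
        intro j
        have h1 := hfac j
        rw [heq, one_pow, one_mul] at h1
        rw [← h1]
        have h2 : ‖gaugePair κ χ (c + 1 + j)‖ ≤ A * (‖π‖ ^ 2) ^ (c + 1 + j) := by
          refine norm_tsum_le_of_forall (by positivity) fun i => ?_
          have h3 := norm_gaugePair_term_le hp2 hπ hn hκ hA hχ (c + 1 + j) i (fun _ => 1) (by simp)
          simp only [one_mul] at h3
          exact h3.trans (mul_le_of_le_one_right (by positivity) (pow_le_one₀ hπ0.le hπ1.le))
        refine (mul_le_of_le_one_left (norm_nonneg _) (norm_natCast_le_one' p _)).trans (h2.trans ?_)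
        refine mul_le_mul_of_nonneg_left (pow_le_pow_of_le_one (by positivity) (pow_le_one₀ hπ0.le hπ1.le) ?_) hA
        omega
      have hlim : Tendsto (fun j => A * (‖π‖ ^ 2) ^ j) atTop (nhds (A * 0)) :=
        (tendsto_pow_atTop_nhds_zero_of_lt_one (by positivity) (pow_lt_one₀ hπ0.le hπ1 two_ne_zero)).const_mul A
      have h0 : ‖gaugePair κ χ (c + 1)‖ ≤ 0 := by
        have := ge_of_tendsto' hlim hb
        rwa [mul_zero] at this
      have h1 := hfac i
      rw [le_antisymm h0 (norm_nonneg _), mul_zero] at h1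
      rw [(mul_eq_zero.1 h1).resolve_left hfpos.ne']
      positivity

/-- A convergent solution of the recursion is determined by its value in the critical degree. -/
theorem eq_zero_of_critical_eq_zero (hp4 : 4 ≤ p) (hπ : π ^ (p - 1) = -p) (hn : ¬ p ∣ n)
    {ω : K} (hω : IsPrimitiveRoot ω n) (hχ : ∀ d l, ‖χ d l‖ ≤ A * (‖π‖ ^ 2) ^ d)
    (hc : 2 * c = Fintype.card H * (n - 1)) (hχ0 : ∀ l, χ 0 l = 0)
    (hrec : ∀ (d : ℕ) l, ((d : K) - ∑ h, ((l h : ℕ) : K)) * χ (d + 1) l = -n * ∑ h, χ d (l - Pi.single h 1))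
    (hvan : ∀ l, χ (c + 1) l = 0) (d : ℕ) (l : H → Fin n) : χ d l = 0 := by
  have hA : 0 ≤ A := by simpa using (norm_nonneg _).trans (hχ 0 0)
  have hπ0 := norm_pos_of_uniformizer hπ
  have hπ1 := norm_uniformizer_lt_one hπ
  have hstep : ∀ B, 0 ≤ B → (∀ d l, ‖χ d l‖ ≤ B * (‖π‖ ^ 2) ^ d) → ∀ d l, ‖χ d l‖ ≤ B * ‖π‖ * (‖π‖ ^ 2) ^ d := by
    intro B hB hχB d
    rcases d with _ | d
    · intro l
      rw [hχ0, norm_zero]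
      positivity
    · refine norm_le_of_fourier hn hω _ fun j => ?_
      have hκ : ∀ h : H, (ω ^ (j h : ℕ)) ^ n = 1 := fun h => by rw [pow_right_comm, hω.pow_eq_one, one_pow]
      have h1 := norm_gaugePair_le hp4 hπ hn hκ hB hχB hc hrec hvan d
      have h2 := norm_gaugePair_sub_le (by omega) hπ hn hκ hB hχB (d + 1)
      have h3 := norm_sub_le_max' (gaugePair (fun h => ω ^ (j h : ℕ)) χ (d + 1)) (gaugePair (fun h => ω ^ (j h : ℕ)) χ (d + 1) -
        ∑ l, (∏ h, (ω ^ (j h : ℕ)) ^ (l h : ℕ)) * χ (d + 1) l)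
      rw [sub_sub_cancel] at h3
      exact h3.trans (max_le h1 h2)
  have hiter : ∀ N : ℕ, ∀ d l, ‖χ d l‖ ≤ A * ‖π‖ ^ N * (‖π‖ ^ 2) ^ d := by
    intro N
    induction N with
    | zero => simpa using hχ
    | succ N ih =>
      intro d l
      refine (hstep _ (by positivity) ih d l).trans_eq ?_
      ring
  have hlim : Tendsto (fun N => A * ‖π‖ ^ N * (‖π‖ ^ 2) ^ d) atTop (nhds (A * 0 * (‖π‖ ^ 2) ^ d)) :=
    ((tendsto_pow_atTop_nhds_zero_of_lt_one hπ0.le hπ1).const_mul A).mul_const _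
  have h0 := ge_of_tendsto' hlim fun N => hiter N d l
  rw [mul_zero, zero_mul] at h0
  exact norm_le_zero_iff.1 h0

end Rigidity

section Decimation

open PowerSeries

variable {K : Type*} [Field K]

/-- The power series formed by the coefficients of degree divisible by `p`. -/
def decimate (p : ℕ) : K⟦X⟧ →ₗ[K] K⟦X⟧ where
  toFun f := PowerSeries.mk fun u => coeff (p * u) f
  map_add' f g := by ext; simp
  map_smul' a f := by ext; simp

theorem coeff_decimate (p u : ℕ) (f : K⟦X⟧) : coeff u (decimate p f) = coeff (p * u) f :=
  coeff_mk u fun u => coeff (p * u) f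

theorem coeff_X_mul_derivative (i : ℕ) (f : K⟦X⟧) : coeff i (X * derivative K f) = i * coeff i f := by
  rcases i with _ | i
  · simp
  · rw [coeff_succ_X_mul, coeff_derivative]
    push_cast
    ring

theorem decimate_X_mul_derivative (p : ℕ) (f : K⟦X⟧) :
    decimate p (X * derivative K f) = C (p : K) * (X * derivative K (decimate p f)) := by
  ext u
  rw [coeff_decimate, coeff_C_mul, coeff_X_mul_derivative, coeff_X_mul_derivative, coeff_decimate]
  push_cast
  ring

theorem decimate_C_mul (p : ℕ) (a : K) (f : K⟦X⟧) : decimate p (C a * f) = C a * decimate p f := by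
  ext u
  rw [coeff_decimate, coeff_C_mul, coeff_C_mul, coeff_decimate]

theorem decimate_X_pow_mul {p : ℕ} (hp : p ≠ 0) (f : K⟦X⟧) : decimate p (X ^ p * f) = X * decimate p f := by
  ext u
  rw [coeff_decimate]
  rcases u with _ | u
  · simp [hp]
  · rw [coeff_succ_X_mul, coeff_decimate, mul_add, mul_one, coeff_X_pow_mul]

end Decimation

section Connection

open PowerSeries

variable {K : Type*} [Field K] {n : ℕ} [NeZero n] {H : Type*} [Fintype H] [DecidableEq H]

/-- The entries of the companion matrix of the Kloosterman connection. -/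
def connCoeff (a : K) (s : ℕ) (l : Fin n) : K⟦X⟧ := if l = 0 then C a * X ^ s else 1

/-- The tensor power of the Kloosterman connection. -/
def nabla (a : K) : ((H → Fin n) → K⟦X⟧) →ₗ[K] ((H → Fin n) → K⟦X⟧) where
  toFun x l := X * derivative K (x l) + ∑ h, connCoeff a 1 (l h) * x (l - Pi.single h 1)
  map_add' x y := by
    funext l
    simp only [Pi.add_apply, map_add, mul_add, sum_add_distrib]
    abel
  map_smul' c x := by
    funext l
    simp only [Pi.smul_apply, Derivation.map_smul, mul_smul_comm, RingHom.id_apply, smul_add, Finset.smul_sum]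

theorem nabla_apply (a : K) (x : (H → Fin n) → K⟦X⟧) (l : H → Fin n) :
    nabla a x l = X * derivative K (x l) + ∑ h, connCoeff a 1 (l h) * x (l - Pi.single h 1) := rfl

/-- The Frobenius operator attached to a matrix of power series. -/
def frobAct {ι : Type*} [Fintype ι] (p : ℕ) (G : Matrix ι ι K⟦X⟧) :
    (ι → K⟦X⟧) →ₗ[K] (ι → K⟦X⟧) where
  toFun x l := decimate p (∑ l', G l l' * x l')
  map_add' x y := by
    funext l
    simp only [Pi.add_apply, mul_add, sum_add_distrib, map_add]
  map_smul' c x := by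
    funext l
    simp only [Pi.smul_apply, mul_smul_comm, RingHom.id_apply, ← Finset.smul_sum, map_smul]

theorem frobAct_apply {ι : Type*} [Fintype ι] (p : ℕ) (G : Matrix ι ι K⟦X⟧) (x : ι → K⟦X⟧) (l : ι) :
    frobAct p G x l = decimate p (∑ l', G l l' * x l') := rfl

theorem frobAct_nabla {p : ℕ} (hp : p ≠ 0) (a : K) {G : Matrix (H → Fin n) (H → Fin n) K⟦X⟧}
    (hG : ∀ l j, X * derivative K (G l j) + C (p : K) * ∑ h, connCoeff a p (l h) * G (l - Pi.single h 1) j =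
      ∑ h, connCoeff a 1 (j h + 1) * G l (j + Pi.single h 1)) (x : (H → Fin n) → K⟦X⟧) :
    frobAct p G (nabla a x) = (p : K) • nabla a (frobAct p G x) := by
  funext l
  rw [frobAct_apply, Pi.smul_apply, nabla_apply, smul_eq_C_mul, mul_add, frobAct_apply, ← decimate_X_mul_derivative]
  have h1 : ∑ l', G l l' * nabla a x l' = X * derivative K (∑ l', G l l' * x l') +
      C (p : K) * ∑ h, connCoeff a p (l h) * ∑ l', G (l - Pi.single h 1) l' * x l' := by
    have e1 : ∑ l', G l l' * nabla a x l' = ∑ l', G l l' * (X * derivative K (x l')) +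
        ∑ l', (∑ h, connCoeff a 1 (l' h + 1) * G l (l' + Pi.single h 1)) * x l' := by
      simp only [nabla_apply, mul_add, sum_add_distrib]
      congr 1
      simp only [mul_sum, sum_mul]
      rw [sum_comm, sum_comm (s := (univ : Finset (H → Fin n)))]
      refine sum_congr rfl fun h _ => ?_
      refine (Fintype.sum_equiv (Equiv.addRight (Pi.single h (1 : Fin n))) _ _ fun l' => ?_).symm
      simp only [Equiv.coe_addRight, add_sub_cancel_right, Pi.add_apply, Pi.single_eq_same]
      ring
    rw [e1]
    simp only [← hG]
    rw [map_sum, mul_sum]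
    simp only [Derivation.leibniz, smul_eq_mul, mul_sum, sum_mul, add_mul]
    rw [sum_add_distrib, sum_comm (s := (univ : Finset H)), ← add_assoc,
      ← sum_add_distrib]
    congr 1
    · refine sum_congr rfl fun l' _ => ?_
      ring
    · refine sum_congr rfl fun l' _ => sum_congr rfl fun h _ => ?_
      ring
  rw [h1, map_add, decimate_C_mul]
  congr 2
  rw [map_sum]
  refine sum_congr rfl fun h _ => ?_
  rw [frobAct_apply]
  generalize (∑ l', G (l - Pi.single h 1) l' * x l') = f
  rw [connCoeff, connCoeff]
  split_ifs
  · rw [mul_assoc, decimate_C_mul, decimate_X_pow_mul hp, pow_one, mul_assoc]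
  · rw [one_mul, one_mul]

end Connection

theorem fin_val_add_one {n : ℕ} [NeZero n] (l : Fin n) :
    ((l + 1 : Fin n) : ℕ) = if (l : ℕ) + 1 < n then (l : ℕ) + 1 else 0 := by
  rw [Fin.val_add, Fin.coe_ofNat_eq_mod, Nat.add_mod_mod]
  split_ifs with h
  · exact Nat.mod_eq_of_lt h
  · rw [show (l : ℕ) + 1 = n by omega, Nat.mod_self]

theorem fin_val_sub_one {n : ℕ} [NeZero n] (l : Fin n) :
    ((l - 1 : Fin n) : ℕ) = if l = 0 then n - 1 else (l : ℕ) - 1 := by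
  have h := fin_val_add_one (l - 1)
  rw [sub_add_cancel] at h
  have h1 := (l - 1).2
  have h0 : l = 0 ↔ (l : ℕ) = 0 := by rw [Fin.ext_iff, Fin.val_zero]
  simp only [h0]
  split_ifs at h ⊢ <;> omega

section Tensor

open PowerSeries

variable {H : Type*} [Fintype H] [DecidableEq H] {n : ℕ} [NeZero n]

theorem frobSeries_relation (hp17 : 17 ≤ p) (hπ : π ^ (p - 1) = -p) (l j : Fin n) :
    X * derivative K (frobSeries p π n l j) + C (p : K) * (connCoeff (π ^ n) p l * frobSeries p π n (l - 1) j) =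
      connCoeff (π ^ n) 1 (j + 1) * frobSeries p π n l (j + 1) := by
  have hn := NeZero.pos n
  ext i
  have h := congrFun (congrFun (frobMat_relation hp17 hπ n i) l) j
  simp only [Matrix.add_apply, Matrix.smul_apply, smul_eq_mul] at h
  rw [shiftMat_mul_apply, cornerMat_mul_apply, mul_shiftMat_apply, mul_cornerMat_apply] at h
  have hG : ∀ i l j, coeff i (frobSeries p π n l j) = frobMat p π n i l j := fun i l j =>
    coeff_mk i fun i => frobMat p π n i l j
  rw [map_add, coeff_X_mul_derivative, coeff_C_mul, hG]
  have hL : coeff i (connCoeff (π ^ n) p l * frobSeries p π n (l - 1) j) =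
      (if h : (l : ℕ) = 0 then 0 else frobMat p π n i ⟨l - 1, by omega⟩ j) + π ^ n *
        (if (l : ℕ) = 0 then (if p ≤ i then frobMat p π n (i - p) else 0) ⟨n - 1, by omega⟩ j else 0) := by
    have hl := fin_val_sub_one l
    rw [connCoeff]
    by_cases h0 : l = 0
    · have h0' : (l : ℕ) = 0 := by rw [h0, Fin.val_zero]
      rw [if_pos h0] at hl
      rw [if_pos h0, dif_pos h0', if_pos h0', zero_add, mul_assoc, coeff_C_mul, coeff_X_pow_mul',
        show l - 1 = ⟨n - 1, by omega⟩ from Fin.ext hl]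
      split_ifs <;> simp [hG]
    · have h0' : (l : ℕ) ≠ 0 := fun e => h0 (Fin.ext (by rw [e, Fin.val_zero]))
      rw [if_neg h0] at hl
      rw [if_neg h0, dif_neg h0', if_neg h0', mul_zero, add_zero, one_mul, hG,
        show l - 1 = ⟨(l : ℕ) - 1, by omega⟩ from Fin.ext hl]
  have hR : coeff i (connCoeff (π ^ n) 1 (j + 1) * frobSeries p π n l (j + 1)) =
      (if h : (j : ℕ) + 1 < n then frobMat p π n i l ⟨j + 1, h⟩ else 0) + π ^ n *
        (if (j : ℕ) + 1 = n then (if i = 0 then 0 else frobMat p π n (i - 1)) l ⟨0, by omega⟩ else 0) := by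
    have hj := fin_val_add_one j
    have hjn := j.2
    rw [connCoeff]
    by_cases h0 : (j : ℕ) + 1 < n
    · rw [if_pos h0] at hj
      have h1 : j + 1 ≠ 0 := fun e => by rw [e, Fin.val_zero] at hj; omega
      rw [if_neg h1, dif_pos h0, if_neg h0.ne, mul_zero, add_zero, one_mul, hG,
        show j + 1 = ⟨(j : ℕ) + 1, h0⟩ from Fin.ext hj]
    · rw [if_neg h0] at hj
      have h1 : j + 1 = 0 := Fin.ext (by rw [hj, Fin.val_zero])
      rw [if_pos h1, dif_neg h0, if_pos (by omega), zero_add, mul_assoc, coeff_C_mul, coeff_X_pow_mul',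
        show j + 1 = ⟨0, by omega⟩ from Fin.ext hj]
      rcases i with _ | i <;> simp [hG]
  rw [hL, hR]
  linear_combination h

/-- The tensor power of a matrix, indexed by functions. -/
def tensorMat {R : Type*} [CommMonoid R] {α : Type*} (H : Type*) [Fintype H] (A : Matrix α α R) : Matrix (H → α) (H → α) R :=
  fun l j => ∏ h, A (l h) (j h)

theorem tensorMat_mul {R : Type*} [CommRing R] {α : Type*} [Fintype α] (A B : Matrix α α R) :
    tensorMat H (A * B) = tensorMat H A * tensorMat H B := by
  ext l j
  rw [Matrix.mul_apply]
  simp only [tensorMat, Matrix.mul_apply]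
  rw [prod_univ_sum, piFinset_univ]
  simp only [prod_mul_distrib]

theorem trace_tensorMat {R : Type*} [CommRing R] {α : Type*} [Fintype α] (A : Matrix α α R) :
    (tensorMat H A).trace = A.trace ^ Fintype.card H := by
  have h := prod_univ_sum (fun _ : H => (univ : Finset α)) (fun _ a => A a a)
  rw [piFinset_univ, prod_const, card_univ] at h
  exact h.symm

theorem frobIter_tensorMat {α : Type*} [Fintype α] {q : ℕ} (hq : q ≠ 0) (G : Matrix α α K⟦X⟧) (r : ℕ) :
    frobIter hq (tensorMat H G) r = tensorMat H (frobIter hq G r) := by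
  induction r with
  | zero => rfl
  | succ r ih =>
    rw [frobIter, frobIter, ih, tensorMat_mul]
    congr 1
    ext1 l j
    rw [map_apply, tensorMat, tensorMat, map_prod]
    rfl

theorem overconv_tensorMat {α : Type*} {G : Matrix α α K⟦X⟧} (hG : ∀ i j, Overconv (G i j)) (l j : H → α) :
    Overconv (tensorMat H G l j) :=
  Overconv.prod _ fun h => hG (l h) (j h)

theorem evalMat_tensorMat {L : Type*} [NormedField L] [NormedAlgebra K L] [CompleteSpace L] {α : Type*}
    {G : Matrix α α K⟦X⟧} (hG : ∀ i j, Overconv (G i j)) {t : L} (ht : ‖t‖ ≤ 1) :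
    evalMat (tensorMat H G) t = tensorMat H (evalMat G t) := by
  ext l j
  exact evalSeries_prod univ (fun h => hG (l h) (j h)) ht

theorem tensorMat_frobSeries_relation (hp17 : 17 ≤ p) (hπ : π ^ (p - 1) = -p) (l j : H → Fin n) :
    X * derivative K (tensorMat H (frobSeries p π n) l j) + C (p : K) * ∑ h, connCoeff (π ^ n) p (l h) *
        tensorMat H (frobSeries p π n) (l - Pi.single h 1) j =
      ∑ h, connCoeff (π ^ n) 1 (j h + 1) * tensorMat H (frobSeries p π n) l (j + Pi.single h 1) := by
  have hup : ∀ h, tensorMat H (frobSeries p π n) l (j + Pi.single h 1) =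
      (∏ h' ∈ univ.erase h, frobSeries p π n (l h') (j h')) * frobSeries p π n (l h) (j h + 1) := by
    intro h
    rw [tensorMat, ← prod_erase_mul _ _ (mem_univ h)]
    congr 1
    · refine prod_congr rfl fun h' hh => ?_
      rw [Pi.add_apply, Pi.single_eq_of_ne (ne_of_mem_erase hh), add_zero]
    · rw [Pi.add_apply, Pi.single_eq_same]
  have hdown : ∀ h, tensorMat H (frobSeries p π n) (l - Pi.single h 1) j =
      (∏ h' ∈ univ.erase h, frobSeries p π n (l h') (j h')) * frobSeries p π n (l h - 1) (j h) := by
    intro h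
    rw [tensorMat, ← prod_erase_mul _ _ (mem_univ h)]
    congr 1
    · refine prod_congr rfl fun h' hh => ?_
      rw [Pi.sub_apply, Pi.single_eq_of_ne (ne_of_mem_erase hh), sub_zero]
    · rw [Pi.sub_apply, Pi.single_eq_same]
  rw [show tensorMat H (frobSeries p π n) l j = ∏ h, frobSeries p π n (l h) (j h) from rfl, derivative_finset_prod,
    mul_sum, mul_sum, ← sum_add_distrib]
  refine sum_congr rfl fun h _ => ?_
  rw [hup, hdown]
  linear_combination (∏ h' ∈ univ.erase h, frobSeries p π n (l h') (j h')) *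
    frobSeries_relation hp17 hπ (l h) (j h)

theorem exists_growthLE_tensorMat (hp17 : 17 ≤ p) (hπ : π ^ (p - 1) = -p) {t : ℝ} (ht0 : 0 ≤ t) (ht1 : t ≤ 1)
    (ht : t ^ p = ‖π‖ ^ (3 * n)) : ∃ C, 0 ≤ C ∧ ∀ l j, GrowthLE t C (tensorMat H (frobSeries p π n) l j) := by
  obtain ⟨C, hC, h⟩ := exists_norm_frobMat_le hp17 hπ n ht0 ht1 ht
  refine ⟨C ^ Fintype.card H, by positivity, fun l j => ?_⟩
  have h1 := GrowthLE.prod (s := (univ : Finset H)) (c := fun _ => C) ht0 (fun _ => hC)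
    (f := fun h => frobSeries p π n (l h) (j h)) (fun h' _ i => by
      rw [frobSeries, coeff_mk]
      exact h i (l h') (j h'))
  rwa [prod_const, card_univ] at h1

/-- Frobenius is triangular on constant terms. -/
theorem coeff_zero_tensorMat (hp17 : 17 ≤ p) (hπ : π ^ (p - 1) = -p) (l j : H → Fin n)
    (hlj : ∑ h, (l h : ℕ) ≤ ∑ h, (j h : ℕ)) :
    coeff 0 (tensorMat H (frobSeries p π n) l j) = if l = j then (p : K) ^ ∑ h, (l h : ℕ) else 0 := by
  rw [tensorMat, coeff_zero_eq_constantCoeff, map_prod]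
  have hG : ∀ h, constantCoeff (frobSeries p π n (l h) (j h)) = frobMat p π n 0 (l h) (j h) := fun h => by
    rw [← coeff_zero_eq_constantCoeff_apply]
    exact coeff_mk 0 fun i => frobMat p π n i (l h) (j h)
  simp only [hG]
  split_ifs with h
  · subst h
    rw [← prod_pow_eq_pow_sum]
    refine prod_congr rfl fun h _ => ?_
    rw [frobMat_zero_apply hp17 hπ _ _ le_rfl, if_pos rfl]
  · have : ∃ h, l h < j h := by
      by_contra! hc
      refine h (funext fun h' => ?_)
      have h1 : ∀ h ∈ (univ : Finset H), (j h : ℕ) ≤ l h := fun h _ => hc h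
      have h2 := le_antisymm (sum_le_sum h1) hlj
      exact (Fin.ext ((sum_eq_sum_iff_of_le h1).1 h2 h' (mem_univ h'))).symm
    obtain ⟨h', hh⟩ := this
    refine prod_eq_zero (mem_univ h') ?_
    rw [frobMat_zero_apply hp17 hπ _ _ hh.le, if_neg hh.ne]

theorem sum_val_sub_single_of_ne {l : H → Fin n} {h : H} (hl : l h ≠ 0) :
    ∑ h', ((l - Pi.single h 1 : H → Fin n) h' : ℕ) + 1 = ∑ h', (l h' : ℕ) := by
  rw [← sum_erase_add _ _ (mem_univ h), ← sum_erase_add _ (fun h' => (l h' : ℕ)) (mem_univ h),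
    Pi.sub_apply, Pi.single_eq_same, fin_val_sub_one, if_neg hl]
  have h0 : (l h : ℕ) ≠ 0 := fun e => hl (Fin.ext (by rw [e, Fin.val_zero]))
  have : ∑ h' ∈ univ.erase h, ((l - Pi.single h 1 : H → Fin n) h' : ℕ) = ∑ h' ∈ univ.erase h, (l h' : ℕ) :=
    sum_congr rfl fun h' hh => by
      rw [Pi.sub_apply, Pi.single_eq_of_ne (ne_of_mem_erase hh), sub_zero]
  omega

theorem sum_val_sub_single_of_eq {l : H → Fin n} {h : H} (hl : l h = 0) :
    ∑ h', ((l - Pi.single h 1 : H → Fin n) h' : ℕ) + 1 = ∑ h', (l h' : ℕ) + n := by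
  have hn := NeZero.pos n
  rw [← sum_erase_add _ _ (mem_univ h), ← sum_erase_add _ (fun h' => (l h' : ℕ)) (mem_univ h),
    Pi.sub_apply, Pi.single_eq_same, fin_val_sub_one, if_pos hl, hl, Fin.val_zero]
  have : ∑ h' ∈ univ.erase h, ((l - Pi.single h 1 : H → Fin n) h' : ℕ) = ∑ h' ∈ univ.erase h, (l h' : ℕ) :=
    sum_congr rfl fun h' hh => by
      rw [Pi.sub_apply, Pi.single_eq_of_ne (ne_of_mem_erase hh), sub_zero]
  omega

/-- The coefficients of a vector of power series, ordered by total degree. -/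
def degreeSeq (π : K) (x : (H → Fin n) → K⟦X⟧) (d : ℕ) (l : H → Fin n) : K :=
  if d = n * ((d - 1 - ∑ h, (l h : ℕ)) / n) + ∑ h, (l h : ℕ) + 1 then
    (π ^ (n * ((d - 1 - ∑ h, (l h : ℕ)) / n)))⁻¹ * coeff ((d - 1 - ∑ h, (l h : ℕ)) / n) (x l) else 0

theorem degreeSeq_of_eq {x : (H → Fin n) → K⟦X⟧} {d u : ℕ} {l : H → Fin n}
    (h : d = n * u + ∑ h, (l h : ℕ) + 1) : degreeSeq π x d l = (π ^ (n * u))⁻¹ * coeff u (x l) := by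
  have h1 : (d - 1 - ∑ h, (l h : ℕ)) / n = u := by
    rw [show d - 1 - ∑ h, (l h : ℕ) = n * u by omega, Nat.mul_div_cancel_left _ (NeZero.pos n)]
  rw [degreeSeq, h1, if_pos h]

theorem degreeSeq_of_ne {x : (H → Fin n) → K⟦X⟧} {d : ℕ} {l : H → Fin n}
    (h : ∀ u, d ≠ n * u + ∑ h, (l h : ℕ) + 1) : degreeSeq π x d l = 0 := if_neg (h _)

theorem degreeSeq_zero (x : (H → Fin n) → K⟦X⟧) (l : H → Fin n) : degreeSeq π x 0 l = 0 :=
  degreeSeq_of_ne fun u => by omega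

theorem degreeSeq_recurrence (hπ0 : π ≠ 0) {x : (H → Fin n) → K⟦X⟧} (hx : nabla (π ^ n) x = 0) (d : ℕ) (l : H → Fin n) :
    ((d : K) - ∑ h, ((l h : ℕ) : K)) * degreeSeq π x (d + 1) l = -n * ∑ h, degreeSeq π x d (l - Pi.single h 1) := by
  by_cases hd : ∃ u, d = n * u + ∑ h, (l h : ℕ)
  · obtain ⟨u, rfl⟩ := hd
    rw [degreeSeq_of_eq rfl]
    have h1 := congrArg (coeff u) (congrFun hx l)
    rw [nabla_apply, map_add, coeff_X_mul_derivative, map_sum, Pi.zero_apply, map_zero] at h1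
    have h2 : ∀ h, degreeSeq π x (n * u + ∑ h, (l h : ℕ)) (l - Pi.single h 1) =
        (π ^ (n * u))⁻¹ * coeff u (connCoeff (π ^ n) 1 (l h) * x (l - Pi.single h 1)) := by
      intro h
      rw [connCoeff]
      by_cases hl : l h = 0
      · have h3 := sum_val_sub_single_of_eq hl
        rw [if_pos hl, pow_one, mul_assoc, coeff_C_mul]
        rcases u with _ | u
        · rw [degreeSeq_of_ne, coeff_zero_X_mul, mul_zero, mul_zero, mul_zero]
          intro v
          have := NeZero.pos n
          omega
        · rw [degreeSeq_of_eq (u := u) (by rw [mul_add]; omega), coeff_succ_X_mul, mul_add, mul_one, pow_add]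
          field_simp
      · have h3 := sum_val_sub_single_of_ne hl
        rw [if_neg hl, one_mul, degreeSeq_of_eq (u := u) (by omega)]
    rw [sum_congr rfl fun h _ => h2 h, ← mul_sum]
    push_cast
    linear_combination (n * (π ^ (n * u))⁻¹) * h1
  · have h0 : degreeSeq π x (d + 1) l = 0 := degreeSeq_of_ne fun u hu => hd ⟨u, by omega⟩
    have hS : ∑ h, degreeSeq π x d (l - Pi.single h 1) = 0 := by
      refine sum_eq_zero fun h _ => ?_
      refine degreeSeq_of_ne fun u hu => hd ?_
      by_cases hl : l h = 0
      · have h3 := sum_val_sub_single_of_eq hl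
        exact ⟨u + 1, by rw [mul_add]; omega⟩
      · have h3 := sum_val_sub_single_of_ne hl
        exact ⟨u, by omega⟩
    rw [h0, hS, mul_zero, mul_zero]

theorem norm_degreeSeq_le (hπ : π ^ (p - 1) = -p) {x : (H → Fin n) → K⟦X⟧} {A : ℝ} (hA : 0 ≤ A)
    (hx : ∀ l u, ‖coeff u (x l)‖ ≤ A * (‖π‖ ^ (3 * n)) ^ u) (d : ℕ) (l : H → Fin n) :
    ‖degreeSeq π x d l‖ ≤ A * ((‖π‖ ^ 2) ^ (Fintype.card H * n + 1))⁻¹ * (‖π‖ ^ 2) ^ d := by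
  have hπ0 := norm_pos_of_uniformizer hπ
  have hπ1 := norm_uniformizer_lt_one hπ
  by_cases hd : ∃ u, d = n * u + ∑ h, (l h : ℕ) + 1
  · obtain ⟨u, hu⟩ := hd
    rw [degreeSeq_of_eq hu, norm_mul, norm_inv, norm_pow]
    have hl : ∑ h, (l h : ℕ) ≤ Fintype.card H * n :=
      (sum_le_card_nsmul _ _ n fun h _ => (l h).2.le).trans (by rw [card_univ, smul_eq_mul])
    have h1 : (‖π‖ ^ 2) ^ (n * u + (Fintype.card H * n + 1)) ≤ (‖π‖ ^ 2) ^ d :=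
      pow_le_pow_of_le_one (by positivity) (pow_le_one₀ hπ0.le hπ1.le) (by omega)
    calc (‖π‖ ^ (n * u))⁻¹ * ‖coeff u (x l)‖ ≤ (‖π‖ ^ (n * u))⁻¹ * (A * (‖π‖ ^ (3 * n)) ^ u) := by gcongr; exact hx l u
      _ = A * ((‖π‖ ^ 2) ^ (Fintype.card H * n + 1))⁻¹ * (‖π‖ ^ 2) ^ (n * u + (Fintype.card H * n + 1)) := by
          rw [← pow_mul, pow_add _ (n * u), ← pow_mul _ 2 (n * u), show 3 * n * u = n * u + 2 * (n * u) by ring, pow_add]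
          field_simp
      _ ≤ _ := by gcongr
  · rw [degreeSeq_of_ne fun u hu => hd ⟨u, hu⟩, norm_zero]
    positivity

theorem eq_zero_of_nabla_eq_zero (hp4 : 4 ≤ p) (hπ : π ^ (p - 1) = -p) (hn : ¬ p ∣ n)
    {ω : K} (hω : IsPrimitiveRoot ω n) {c : ℕ} (hc : 2 * c = Fintype.card H * (n - 1))
    {x : (H → Fin n) → K⟦X⟧} (hx : nabla (π ^ n) x = 0) {A : ℝ}
    (hA : ∀ l u, ‖coeff u (x l)‖ ≤ A * (‖π‖ ^ (3 * n)) ^ u)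
    (hx0 : ∀ l, ∑ h, (l h : ℕ) ≤ c → coeff 0 (x l) = 0) : x = 0 := by
  have hπ0 := uniformizer_ne_zero hπ
  have hA0 : 0 ≤ A := by simpa using (norm_nonneg _).trans (hA 0 0)
  have hlow : ∀ d ≤ c + 1, ∀ l, degreeSeq π x d l = 0 := by
    intro d
    induction d with
    | zero => exact fun _ l => degreeSeq_zero x l
    | succ d ih =>
      intro hd l
      have h1 := degreeSeq_recurrence hπ0 hx d l
      rw [sum_eq_zero fun h _ => ih (by omega) _, mul_zero] at h1
      rcases mul_eq_zero.1 h1 with h2 | h2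
      · have h3 : d = ∑ h, (l h : ℕ) := by
          have := sub_eq_zero.1 h2
          exact_mod_cast this
        rw [degreeSeq_of_eq (u := 0) (by omega), hx0 l (by omega), mul_zero]
      · exact h2
  have h0 := eq_zero_of_critical_eq_zero hp4 hπ hn hω (norm_degreeSeq_le hπ hA0 hA) hc (degreeSeq_zero x)
    (degreeSeq_recurrence hπ0 hx) (hlow (c + 1) le_rfl)
  funext l
  ext u
  have h1 := h0 (n * u + ∑ h, (l h : ℕ) + 1) l
  rw [degreeSeq_of_eq rfl] at h1
  simpa [hπ0] using h1

end Tensor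

section Scaling

open PowerSeries

variable {K : Type*} [NontriviallyNormedField K] {ι : Type*} [Fintype ι]

/-- Conjugation of an infinite matrix by a diagonal one. -/
def scaleKernel (w : ℕ → K) (Φ : ℕ × ι → ℕ × ι → K) (x y : ℕ × ι) : K :=
  (w x.1)⁻¹ * Φ x y * w y.1

variable {w : ℕ → K}

theorem kernelPow_scaleKernel (hw : ∀ u, w u ≠ 0) (Φ : ℕ × ι → ℕ × ι → K) (r : ℕ) (x y : ℕ × ι) :
    kernelPow (scaleKernel w Φ) r x y = (w x.1)⁻¹ * kernelPow Φ r x y * w y.1 := by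
  induction r generalizing y with
  | zero => rfl
  | succ r ih =>
    rw [kernelPow_succ, kernelPow_succ, ← tsum_mul_left, ← tsum_mul_right]
    refine tsum_congr fun l => ?_
    rw [ih, scaleKernel]
    have := hw l.1
    field_simp

theorem kernelTrace_scaleKernel (hw : ∀ u, w u ≠ 0) (Φ : ℕ × ι → ℕ × ι → K) (r : ℕ) :
    kernelTrace (scaleKernel w Φ) r = kernelTrace Φ r := by
  rw [kernelTrace, kernelTrace]
  refine tsum_congr fun x => ?_
  rw [kernelPow_scaleKernel hw]
  have := hw x.1
  field_simp

/-- The vector of power series with prescribed rescaled coefficients. -/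
def toSeries (w : ℕ → K) : (ℕ × ι → K) →ₗ[K] (ι → K⟦X⟧) where
  toFun y l := PowerSeries.mk fun u => w u * y (u, l)
  map_add' x y := by
    funext l
    ext u
    simp [mul_add]
  map_smul' c x := by
    funext l
    ext u
    simp [mul_left_comm]

theorem coeff_toSeries (y : ℕ × ι → K) (u : ℕ) (l : ι) : coeff u (toSeries w y l) = w u * y (u, l) :=
  coeff_mk u fun u => w u * y (u, l)

/-- The rescaled coefficients of a vector of power series. -/
def ofSeries (w : ℕ → K) : (ι → K⟦X⟧) →ₗ[K] (ℕ × ι → K) where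
  toFun x i := (w i.1)⁻¹ * coeff i.1 (x i.2)
  map_add' x y := by
    funext l
    simp [mul_add]
  map_smul' c x := by
    funext l
    simp [mul_left_comm]

theorem ofSeries_apply (x : ι → K⟦X⟧) (i : ℕ × ι) : ofSeries w x i = (w i.1)⁻¹ * coeff i.1 (x i.2) := rfl

theorem toSeries_ofSeries (hw : ∀ u, w u ≠ 0) (x : ι → K⟦X⟧) : toSeries w (ofSeries w x) = x := by
  funext l
  ext u
  rw [coeff_toSeries, ofSeries_apply, mul_inv_cancel_left₀ (hw u)]

theorem ofSeries_toSeries (hw : ∀ u, w u ≠ 0) (y : ℕ × ι → K) : ofSeries w (toSeries w y) = y := by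
  funext i
  rw [ofSeries_apply, coeff_toSeries, inv_mul_cancel_left₀ (hw _)]

theorem kernelMul_scaleKernel_frobKernel (p : ℕ) (G : Matrix ι ι K⟦X⟧) (y : ℕ × ι → K) :
    kernelMul (scaleKernel w (frobKernel p fun i => G.map (coeff i))) y = ofSeries w (frobAct p G (toSeries w y)) := by
  funext i
  rw [kernelMul, ofSeries_apply, frobAct_apply, coeff_decimate, map_sum, mul_sum, tsum_prod_eq_sum]
  · refine sum_congr rfl fun l' _ => ?_
    rw [coeff_mul, Nat.sum_antidiagonal_eq_sum_range_succ_mk, mul_sum, ← sum_range_reflect,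
      tsum_eq_sum (s := range (p * i.1 + 1))]
    · refine sum_congr rfl fun v hv => ?_
      have hv' : v ≤ p * i.1 := Nat.lt_succ_iff.1 (mem_range.1 hv)
      rw [scaleKernel, frobKernel, if_pos hv', coeff_toSeries, map_apply,
        show p * i.1 + 1 - 1 - v = p * i.1 - v by omega, show p * i.1 - (p * i.1 - v) = v by omega]
      ring
    · intro v hv
      rw [scaleKernel, frobKernel, if_neg (by simpa [Nat.lt_succ_iff] using hv)]
      ring
  · intro l'
    refine summable_of_ne_finset_zero (s := range (p * i.1 + 1)) fun v hv => ?_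
    rw [scaleKernel, frobKernel, if_neg (by simpa [Nat.lt_succ_iff] using hv)]
    ring

end Scaling

section Reverse

open Polynomial

variable {R : Type*} [CommRing R] [IsDomain R]

theorem reverse_X_sub_C (a : R) : (X - C a : R[X]).reverse = 1 - C a * X := by
  rw [reverse, natDegree_X_sub_C, reflect_sub, reflect_C, pow_one, ← pow_one (X : R[X]),
    reflect_monomial, revAt_le le_rfl, Nat.sub_self, pow_zero]

theorem reverse_prod (s : Finset ℕ) (f : ℕ → R[X]) : (∏ i ∈ s, f i).reverse = ∏ i ∈ s, (f i).reverse := by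
  induction s using Finset.induction_on with
  | empty => simp [reverse]
  | insert a s ha ih => rw [prod_insert ha, prod_insert ha, reverse_mul_of_domain, ih]

theorem reverse_pow (f : R[X]) (e : ℕ) : (f ^ e).reverse = f.reverse ^ e := by
  induction e with
  | zero => simp [reverse]
  | succ e ih => rw [pow_succ, pow_succ, reverse_mul_of_domain, ih]

theorem charpolyRev_dvd_of_aeval_eq_zero {κ : Type*} [Fintype κ] [DecidableEq κ] (m : Matrix κ κ R) (s : Finset ℕ) (a : ℕ → R)
    (h : aeval m (X * ∏ j ∈ s, (X - C (a j))) = 0) :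
    m.charpolyRev ∣ (∏ j ∈ s, (1 - C (a j) * X)) ^ Fintype.card κ := by
  obtain ⟨Q, hQ⟩ := charpoly_dvd_pow_of_aeval_eq_zero m _ h
  refine ⟨Q.reverse, ?_⟩
  have h1 := congrArg reverse hQ
  rw [reverse_mul_of_domain, reverse_charpoly, reverse_pow, reverse_mul_of_domain, reverse_prod] at h1
  simp only [reverse_X_sub_C] at h1
  rw [← h1]
  congr 1
  have : (X : R[X]).reverse = 1 := by simpa using reverse_X_sub_C (0 : R)
  rw [this, one_mul]

end Reverse

theorem exists_growthLE_polynomial {k : Type*} [NormedField k] (P : Polynomial k) {ε : ℝ} (hε : 0 < ε) :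
    ∃ c, 0 ≤ c ∧ GrowthLE ε c (P : k⟦X⟧) := by
  refine ⟨∑ i ∈ range (P.natDegree + 1), ‖P.coeff i‖ * (ε ^ i)⁻¹, by positivity, fun s => ?_⟩
  rw [Polynomial.coeff_coe]
  by_cases hs : s ≤ P.natDegree
  · calc ‖P.coeff s‖ = ‖P.coeff s‖ * (ε ^ s)⁻¹ * ε ^ s := by field_simp
      _ ≤ _ := by
        gcongr
        exact single_le_sum (f := fun i => ‖P.coeff i‖ * (ε ^ i)⁻¹) (fun i _ => by positivity)
          (mem_range.2 (by omega))
  · rw [coeff_eq_zero_of_natDegree_lt (by omega), norm_zero]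
    positivity

section Annihilation

open PowerSeries

variable {H : Type*} [Fintype H] [DecidableEq H] {n : ℕ} [NeZero n]

theorem coeff_zero_frobAct (hp17 : 17 ≤ p) (hπ : π ^ (p - 1) = -p) {d : ℕ}
    {x : (H → Fin n) → K⟦X⟧} (hx : ∀ l, ∑ h, (l h : ℕ) < d → coeff 0 (x l) = 0) {l : H → Fin n}
    (hl : ∑ h, (l h : ℕ) ≤ d) :
    coeff 0 (frobAct p (tensorMat H (frobSeries p π n)) x l) = (p : K) ^ (∑ h, (l h : ℕ)) * coeff 0 (x l) := by
  have h0 : ∀ f g : K⟦X⟧, coeff 0 (f * g) = coeff 0 f * coeff 0 g := fun f g => by simp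
  rw [frobAct_apply, coeff_decimate, mul_zero, map_sum, sum_eq_single l]
  · rw [h0, coeff_zero_tensorMat hp17 hπ _ _ le_rfl, if_pos rfl]
  · intro l' _ hl'
    rw [h0]
    by_cases h : ∑ h, (l' h : ℕ) < d
    · rw [hx l' h, mul_zero]
    · rw [coeff_zero_tensorMat hp17 hπ _ _ (by omega), if_neg (Ne.symm hl'), zero_mul]
  · exact fun h => absurd (mem_univ l) h

theorem coeff_zero_of_product (hp17 : 17 ≤ p) (hπ : π ^ (p - 1) = -p) {e : ℕ}
    {m : Matrix (Fin e) (Fin e) K} {s : (Fin e → K) →ₗ[K] ((H → Fin n) → K⟦X⟧)}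
    (hs : ∀ x, (p : K) • frobAct p (tensorMat H (frobSeries p π n)) (s x) = s (m.mulVec x)) (d : ℕ) (x : Fin e → K)
    {l : H → Fin n} (hl : ∑ h, (l h : ℕ) < d) :
    coeff 0 (s ((Polynomial.aeval m (∏ j ∈ range d, (Polynomial.X - Polynomial.C ((p : K) ^ (j + 1))))).mulVec x) l) = 0 := by
  induction d generalizing l with
  | zero => omega
  | succ d ih =>
    rw [prod_range_succ, mul_comm, map_mul, ← mulVec_mulVec]
    generalize (Polynomial.aeval m (∏ j ∈ range d, (Polynomial.X - Polynomial.C ((p : K) ^ (j + 1))))).mulVec x = y at ih ⊢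
    rw [map_sub, aeval_X, Polynomial.aeval_C, Matrix.sub_mulVec, map_sub, ← hs, Pi.sub_apply, map_sub,
      Algebra.algebraMap_eq_smul_one, Matrix.smul_mulVec, one_mulVec, map_smul, Pi.smul_apply, Pi.smul_apply, map_smul,
      map_smul, coeff_zero_frobAct hp17 hπ (d := d) (fun l hl => ih hl) (by omega)]
    rcases Nat.lt_succ_iff_lt_or_eq.1 hl with h | h
    · rw [ih h]
      simp
    · rw [h, smul_eq_mul, smul_eq_mul, pow_succ]
      ring

theorem norm_coeff_frobAct_le {ι : Type*} [Fintype ι] {t C A : ℝ} (ht : 0 ≤ t) (hC : 0 ≤ C) (hA : 0 ≤ A)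
    {G : Matrix ι ι K⟦X⟧} (hG : ∀ l j, GrowthLE t C (G l j)) {x : ι → K⟦X⟧} (hx : ∀ l, GrowthLE t A (x l))
    (l : ι) (u : ℕ) : ‖coeff u (frobAct p G x l)‖ ≤ C * A * (t ^ p) ^ u := by
  rw [frobAct_apply, coeff_decimate, ← pow_mul]
  exact GrowthLE.sum ht (by positivity) (fun l' _ => (hG l l').mul ht hC hA (hx l')) (p * u)

theorem aeval_eq_zero_of_horizontal (hp17 : 17 ≤ p) (hπ : π ^ (p - 1) = -p) (hn : ¬ p ∣ n)
    {ω : K} (hω : IsPrimitiveRoot ω n) {c : ℕ} (hc : 2 * c = Fintype.card H * (n - 1)) {t : ℝ} (ht0 : 0 ≤ t) (ht1 : t ≤ 1)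
    (ht : t ^ p = ‖π‖ ^ (3 * n)) {e : ℕ} {m : Matrix (Fin e) (Fin e) K}
    {s : (Fin e → K) →ₗ[K] ((H → Fin n) → K⟦X⟧)}
    (hs : ∀ x, (p : K) • frobAct p (tensorMat H (frobSeries p π n)) (s x) = s (m.mulVec x))
    (hinj : ∀ x, s x = 0 → x = 0) (hflat : ∀ x, nabla (π ^ n) (s x) = 0)
    (hgr : ∀ x, ∃ A, 0 ≤ A ∧ ∀ l, GrowthLE t A (s x l)) :
    Polynomial.aeval m (Polynomial.X * ∏ j ∈ range (c + 1), (Polynomial.X - Polynomial.C ((p : K) ^ (j + 1)))) = 0 := by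
  have key : ∀ x, (Polynomial.aeval m (Polynomial.X * ∏ j ∈ range (c + 1),
      (Polynomial.X - Polynomial.C ((p : K) ^ (j + 1))))).mulVec x = 0 := by
    intro x
    apply hinj
    have h1 := fun l hl => coeff_zero_of_product hp17 hπ hs (c + 1) x (l := l) hl
    rw [map_mul, ← mulVec_mulVec, aeval_X]
    generalize (Polynomial.aeval m (∏ j ∈ range (c + 1),
      (Polynomial.X - Polynomial.C ((p : K) ^ (j + 1))))).mulVec x = y at h1 ⊢
    obtain ⟨C, hC, hG⟩ := exists_growthLE_tensorMat (H := H) (n := n) hp17 hπ ht0 ht1 ht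
    obtain ⟨A, hA, hy⟩ := hgr y
    refine eq_zero_of_nabla_eq_zero (by omega) hπ hn hω hc (hflat _) (A := ‖(p : K)‖ * (C * A)) ?_ ?_
    · intro l u
      rw [← hs, Pi.smul_apply, map_smul, norm_smul, ← ht, mul_assoc]
      exact mul_le_mul_of_nonneg_left (norm_coeff_frobAct_le ht0 hC hA hG hy l u) (norm_nonneg _)
    · intro l hl
      rw [← hs, Pi.smul_apply, map_smul, coeff_zero_frobAct hp17 hπ (d := c + 1) h1 (by omega),
        h1 l (by omega), mul_zero, smul_zero]
  ext i j
  have h := congrFun (key (Pi.single j 1)) i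
  rwa [mulVec_single_one] at h

theorem fredholm_scaleKernel {ι : Type*} [Fintype ι] {w : ℕ → K} (hw : ∀ u, w u ≠ 0) (Φ : ℕ × ι → ℕ × ι → K) :
    fredholm (scaleKernel w Φ) = fredholm Φ := by
  rw [fredholm, fredholm, show kernelTrace (scaleKernel w Φ) = kernelTrace Φ from
    funext fun r => kernelTrace_scaleKernel hw Φ r]

theorem kernelBound_scaleKernel {ι : Type*} [Fintype ι] {τ : K} (hp3 : 3 ≤ p) (hτ0 : τ ≠ 0) (hτ1 : ‖τ‖ < 1)
    {C : ℝ} (hC : 0 ≤ C) {G : Matrix ι ι K⟦X⟧} (hG : ∀ l j, GrowthLE ‖τ‖ C (G l j)) :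
    KernelBound C ‖τ‖ (scaleKernel (fun u => (τ ^ 2) ^ u) (frobKernel p fun i => G.map (coeff i))) := by
  have hτ : 0 < ‖τ‖ := norm_pos_iff.2 hτ0
  refine ⟨hC, hτ, hτ1, fun x y => ?_⟩
  rw [scaleKernel, frobKernel]
  split_ifs with h
  · rw [norm_mul, norm_mul, norm_inv, norm_pow, norm_pow, norm_pow, norm_pow, map_apply]
    have h1 : p * x.1 - y.1 + 2 * y.1 = (p - 3) * x.1 + (x.1 + y.1) + 2 * x.1 := by
      obtain ⟨s, rfl⟩ := Nat.exists_eq_add_of_le hp3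
      rw [Nat.add_sub_cancel_left]
      have : (3 + s) * x.1 = 3 * x.1 + s * x.1 := by ring
      omega
    calc ((‖τ‖ ^ 2) ^ x.1)⁻¹ * ‖coeff (p * x.1 - y.1) (G x.2 y.2)‖ * (‖τ‖ ^ 2) ^ y.1
        ≤ ((‖τ‖ ^ 2) ^ x.1)⁻¹ * (C * ‖τ‖ ^ (p * x.1 - y.1)) * (‖τ‖ ^ 2) ^ y.1 := by
          gcongr
          exact hG x.2 y.2 _
      _ = C * ‖τ‖ ^ ((p - 3) * x.1 + (x.1 + y.1)) := by
          have h2 : ‖τ‖ ^ (p * x.1 - y.1) * (‖τ‖ ^ 2) ^ y.1 = ‖τ‖ ^ ((p - 3) * x.1 + (x.1 + y.1)) * (‖τ‖ ^ 2) ^ x.1 := by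
            rw [← pow_mul, ← pow_mul, ← pow_add, ← pow_add, h1]
          rw [mul_assoc, mul_assoc C, h2]
          field_simp
      _ ≤ C * ‖τ‖ ^ (x.1 + y.1) := by
          gcongr C * ?_
          exact pow_le_pow_of_le_one hτ.le hτ1.le (by omega)
  · rw [mul_zero, zero_mul, norm_zero]
    positivity

theorem norm_ofSeries_nabla_le {σ : K} (hσ : σ ≠ 0) (a : K) {y : ℕ × (H → Fin n) → K} {B : ℝ} (hy : ∀ i, ‖y i‖ ≤ B)
    (i : ℕ × (H → Fin n)) :
    ‖ofSeries (fun u => σ ^ u) (nabla a (toSeries (fun u => σ ^ u) y)) i‖ ≤ B * max 1 (‖a‖ * ‖σ‖⁻¹) := by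
  have hB : 0 ≤ B := (norm_nonneg _).trans (hy i)
  have hle : B ≤ B * max 1 (‖a‖ * ‖σ‖⁻¹) := le_mul_of_one_le_right hB (le_max_left _ _)
  have hB' : 0 ≤ B * max 1 (‖a‖ * ‖σ‖⁻¹) := hB.trans hle
  rw [ofSeries_apply, nabla_apply, map_add, coeff_X_mul_derivative, map_sum, mul_add, mul_sum]
  refine (norm_add_le_max _ _).trans (max_le ?_ ?_)
  · rw [coeff_toSeries]
    have h1 : (σ ^ i.1)⁻¹ * (i.1 * (σ ^ i.1 * y (i.1, i.2))) = i.1 * y i := by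
      field_simp
    rw [h1, norm_mul]
    exact (mul_le_mul (norm_natCast_le_one K i.1) (hy i) (norm_nonneg _) zero_le_one).trans (by rwa [one_mul])
  · refine norm_sum_le_of_forall hB' fun h _ => ?_
    rw [connCoeff]
    split_ifs
    · rw [pow_one, mul_assoc, coeff_C_mul]
      rcases hi : i.1 with _ | u
      · rw [coeff_zero_X_mul, mul_zero, mul_zero, norm_zero]
        exact hB'
      · rw [coeff_succ_X_mul, coeff_toSeries, pow_succ]
        have h1 : (σ ^ u * σ)⁻¹ * (a * (σ ^ u * y (u, i.2 - Pi.single h 1))) = a * σ⁻¹ * y (u, i.2 - Pi.single h 1) := by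
          field_simp
        rw [h1, norm_mul, norm_mul, norm_inv, mul_comm B]
        exact mul_le_mul (le_max_right _ _) (hy _) (norm_nonneg _) (zero_le_one.trans (le_max_left _ _))
    · rw [one_mul, coeff_toSeries]
      have h1 : (σ ^ i.1)⁻¹ * (σ ^ i.1 * y (i.1, i.2 - Pi.single h 1)) = y (i.1, i.2 - Pi.single h 1) := by
        field_simp
      rw [h1]
      exact (hy _).trans hle

theorem exists_growthLE_of_fredholm [ProperSpace K] (hp17 : 17 ≤ p) (hπ : π ^ (p - 1) = -p) (hn : ¬ p ∣ n)
    {ω : K} (hω : IsPrimitiveRoot ω n) {c : ℕ} (hc : 2 * c = Fintype.card H * (n - 1)) {τ : K} (hτ : τ ^ p = π ^ (3 * n))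
    {Λ : K⟦X⟧}
    (hΛ : Λ * rescale (p : K) (fredholm (frobKernel p fun i => (tensorMat H (frobSeries p π n)).map (coeff i))) =
      fredholm (frobKernel p fun i => (tensorMat H (frobSeries p π n)).map (coeff i)))
    {ε : ℝ} (hε : 0 < ε) :
    ∃ (e : ℕ) (C' : ℝ), 0 ≤ C' ∧ GrowthLE ε C' (Λ * (((∏ j ∈ range (c + 1),
      (1 - Polynomial.C ((p : K) ^ (j + 1)) * Polynomial.X)) ^ e : Polynomial K) : K⟦X⟧)) := by
  have hπ0 := norm_pos_of_uniformizer hπ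
  have hπ1 := norm_uniformizer_lt_one hπ
  have ht : ‖τ‖ ^ p = ‖π‖ ^ (3 * n) := by rw [← norm_pow, hτ, norm_pow]
  have hn0 := NeZero.pos n
  have hτ0 : τ ≠ 0 := by
    rintro rfl
    rw [norm_zero, zero_pow (by omega)] at ht
    exact (pow_pos hπ0 _).ne ht
  have hτ1 : ‖τ‖ < 1 := by
    by_contra! h
    have h1 := one_le_pow₀ h (n := p)
    rw [ht] at h1
    exact (pow_lt_one₀ hπ0.le hπ1 (by omega)).not_ge h1
  have hσ : τ ^ 2 ≠ 0 := pow_ne_zero 2 hτ0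
  have hw : ∀ u, (τ ^ 2) ^ u ≠ 0 := fun u => pow_ne_zero u hσ
  obtain ⟨C, hC, hG⟩ := exists_growthLE_tensorMat (H := H) (n := n) hp17 hπ (norm_nonneg τ) hτ1.le ht
  have hb := kernelBound_scaleKernel (p := p) (by omega) hτ0 hτ1 hC hG
  rw [← fredholm_scaleKernel hw] at hΛ
  obtain ⟨e, b, m, B, C₁, hbB, hinj, hact, hflat, hC₁, hgr⟩ := hb.exists_horizontal_subspace (p : K)
    (ofSeries (fun u => (τ ^ 2) ^ u) ∘ₗ nabla (π ^ n) ∘ₗ toSeries (fun u => (τ ^ 2) ^ u))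
    (fun y B hy => ⟨_, norm_ofSeries_nabla_le hσ (π ^ n) hy⟩)
    (fun y B _ => by
      simp only [kernelMul_scaleKernel_frobKernel, LinearMap.comp_apply]
      rw [toSeries_ofSeries hw, toSeries_ofSeries hw,
        frobAct_nabla hp.out.ne_zero _ (tensorMat_frobSeries_relation hp17 hπ), map_smul]) hΛ hε
  have hz := aeval_eq_zero_of_horizontal hp17 hπ hn hω hc (norm_nonneg τ) hτ1.le ht (m := m)
    (s := toSeries (fun u => (τ ^ 2) ^ u) ∘ₗ Matrix.mulVecLin b) (fun x => by
      have h1 := congrArg (toSeries (fun u => (τ ^ 2) ^ u)) (hact x)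
      rw [kernelMul_scaleKernel_frobKernel, map_smul, toSeries_ofSeries hw] at h1
      exact h1)
    (fun x hx => hinj x (by
      have h1 := congrArg (ofSeries (fun u => (τ ^ 2) ^ u)) hx
      rwa [LinearMap.comp_apply, ofSeries_toSeries hw, map_zero, mulVecLin_apply] at h1))
    (fun x => by
      have h1 := congrArg (toSeries (fun u => (τ ^ 2) ^ u)) (hflat x)
      rwa [LinearMap.comp_apply, toSeries_ofSeries hw, map_zero] at h1)
    (fun x => by
      obtain ⟨D, hD⟩ : ∃ D, 0 ≤ D ∧ ∀ i, ‖b.mulVec x i‖ ≤ D := by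
        refine ⟨|B| * ∑ j, ‖x j‖, by positivity, fun i => ?_⟩
        rw [mulVec, dotProduct, mul_sum]
        refine (norm_sum_le _ _).trans (sum_le_sum fun j _ => ?_)
        rw [norm_mul]
        gcongr
        exact (hbB i j).trans (le_abs_self B)
      refine ⟨D, hD.1, fun l u => ?_⟩
      rw [LinearMap.comp_apply, mulVecLin_apply, coeff_toSeries, norm_mul, mul_comm, norm_pow, norm_pow, ← pow_mul]
      have h1 := hD.1
      have h2 := hD.2 (u, l)
      refine mul_le_mul h2 ?_ (by positivity) h1
      exact pow_le_pow_of_le_one (norm_nonneg τ) hτ1.le (by omega))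
  obtain ⟨Q, hQ⟩ := charpolyRev_dvd_of_aeval_eq_zero m _ _ hz
  obtain ⟨C₂, hC₂, hQg⟩ := exists_growthLE_polynomial Q hε
  refine ⟨Fintype.card (Fin e), C₁ * C₂, by positivity, ?_⟩
  rw [hQ, Polynomial.coe_mul, ← mul_assoc]
  exact hgr.mul hε.le hC₁ hC₂ hQg

end Annihilation

section Newton

open PowerSeries

variable {k : Type*} [Field k] [CharZero k]

theorem eq_newtonSeq {f τ : ℕ → k} (h0 : f 0 = 1)
    (hf : ∀ s : ℕ, (s : k) * f s = -∑ r ∈ range s, τ r * f (s - 1 - r)) : f = newtonSeq τ :=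
  eq_of_newton (h0.trans (newtonSeq_zero τ).symm) hf (nat_mul_newtonSeq τ)

theorem newtonSeq_congr {τ τ' : ℕ → k} {s : ℕ} (h : ∀ r < s, τ r = τ' r) : newtonSeq τ s = newtonSeq τ' s := by
  induction s using Nat.strong_induction_on with
  | _ s ih =>
    rcases Nat.eq_zero_or_pos s with rfl | hs
    · rw [newtonSeq_zero, newtonSeq_zero]
    have hs0 : (s : k) ≠ 0 := Nat.cast_ne_zero.2 hs.ne'
    apply mul_left_cancel₀ hs0
    rw [nat_mul_newtonSeq, nat_mul_newtonSeq]
    congr 1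
    refine sum_congr rfl fun r hr => ?_
    have hr := mem_range.1 hr
    rw [h r hr, ih _ (by omega) fun r' hr' => h r' (by omega)]

theorem map_newtonSeq {k' : Type*} [Field k'] [CharZero k'] (φ : k →+* k') (τ : ℕ → k) (s : ℕ) :
    φ (newtonSeq τ s) = newtonSeq (fun r => φ (τ r)) s := by
  refine congrFun (eq_newtonSeq (f := fun s => φ (newtonSeq τ s)) (by rw [newtonSeq_zero, map_one]) fun s => ?_) s
  have h := congrArg φ (nat_mul_newtonSeq τ s)
  simpa using h

theorem coeff_charpolyRev_eq_newtonSeq {ι : Type*} [Fintype ι] [DecidableEq ι] (A : Matrix ι ι k) (s : ℕ) :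
    A.charpolyRev.coeff s = newtonSeq (fun r => (A ^ (r + 1)).trace) s :=
  congrFun (eq_newtonSeq (f := fun s => A.charpolyRev.coeff s) (charpolyRev_coeff_zero A) (nat_mul_coeff_charpolyRev A)) s

theorem derivative_mk_newtonSeq (τ : ℕ → k) :
    derivative k (mk (newtonSeq τ)) = -(mk τ * mk (newtonSeq τ)) := by
  ext s
  have h := nat_mul_newtonSeq τ (s + 1)
  rw [coeff_derivative, map_neg, coeff_mul, Nat.sum_antidiagonal_eq_sum_range_succ_mk, coeff_mk, mul_comm]
  simp only [coeff_mk]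
  push_cast at h
  exact h

theorem mk_newtonSeq_add (τ τ' : ℕ → k) :
    mk (newtonSeq fun r => τ r + τ' r) = mk (newtonSeq τ) * mk (newtonSeq τ') := by
  have h : (fun s => coeff s (mk (newtonSeq τ) * mk (newtonSeq τ'))) = newtonSeq fun r => τ r + τ' r := by
    refine eq_newtonSeq ?_ fun s => ?_
    · simp [newtonSeq_zero]
    · rcases s with _ | s
      · simp
      have e := congrArg (coeff s) (Derivation.leibniz (derivative k) (mk (newtonSeq τ)) (mk (newtonSeq τ')))
      rw [derivative_mk_newtonSeq, derivative_mk_newtonSeq, smul_eq_mul, smul_eq_mul, coeff_derivative] at e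
      rw [mul_comm]
      push_cast
      rw [e, show mk (newtonSeq τ) * -(mk τ' * mk (newtonSeq τ')) + mk (newtonSeq τ') * -(mk τ * mk (newtonSeq τ)) =
        -(mk (fun r => τ r + τ' r) * (mk (newtonSeq τ) * mk (newtonSeq τ'))) by
          rw [show mk (fun r => τ r + τ' r) = mk τ + mk τ' from by ext; simp]; ring, map_neg,
        coeff_mul, Nat.sum_antidiagonal_eq_sum_range_succ_mk]
      simp only [coeff_mk, Nat.add_sub_cancel]
  ext s
  rw [coeff_mk, ← h]

theorem rescale_mk_newtonSeq (c : k) (τ : ℕ → k) :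
    rescale c (mk (newtonSeq τ)) = mk (newtonSeq fun r => c ^ (r + 1) * τ r) := by
  ext s
  rw [coeff_rescale, coeff_mk, coeff_mk]
  refine congrFun (eq_newtonSeq (f := fun s => c ^ s * newtonSeq τ s) (by simp [newtonSeq_zero]) fun s => ?_) s
  rw [mul_left_comm, nat_mul_newtonSeq, mul_neg, mul_sum]
  congr 1
  refine sum_congr rfl fun r hr => ?_
  have hr := mem_range.1 hr
  obtain ⟨d, rfl⟩ : ∃ d, s = r + 1 + d := ⟨s - (r + 1), by omega⟩
  rw [show r + 1 + d - 1 - r = d by omega, pow_add]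
  ring

end Newton

section DworkTrace

variable {L : Type*} [NormedField L] [NormedAlgebra K L] [CompleteSpace L] [IsUltrametricDist L]

theorem norm_prod_sub_le {α : Type*} (s : Finset α) {P : L} {ρ : ℝ} (hρ : ρ ≤ 1) (hP : ‖P‖ = ρ) {y u : α → L}
    (hu : ∀ i ∈ s, ‖u i‖ ≤ 1) (h : ∀ i ∈ s, ‖y i - (1 + P * u i)‖ ≤ ρ ^ 2) :
    ‖∏ i ∈ s, y i - (1 + P * ∑ i ∈ s, u i)‖ ≤ ρ ^ 2 := by
  classical
  have hρ0 : 0 ≤ ρ := hP ▸ norm_nonneg P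
  induction s using Finset.induction_on with
  | empty => simpa using sq_nonneg ρ
  | insert a s ha ih =>
    have hu' := fun i hi => hu i (mem_insert_of_mem hi)
    have ih := ih hu' fun i hi => h i (mem_insert_of_mem hi)
    have ha1 := hu a (mem_insert_self _ _)
    have ha2 := h a (mem_insert_self _ _)
    have hs : ‖∑ i ∈ s, u i‖ ≤ 1 := norm_sum_le_of_forall_le_of_nonneg zero_le_one hu'
    rw [prod_insert ha, sum_insert ha]
    generalize ∏ i ∈ s, y i = Y at *
    generalize ∑ i ∈ s, u i = U at *
    have e : y a * Y - (1 + P * (u a + U)) = (y a - (1 + P * u a)) * ((Y - (1 + P * U)) + (1 + P * U)) +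
        ((1 + P * u a) * (Y - (1 + P * U)) + P * P * (u a * U)) := by ring
    have h1 : ∀ v : L, ‖v‖ ≤ 1 → ‖1 + P * v‖ ≤ 1 := fun v hv =>
      (norm_add_le_max _ _).trans (max_le norm_one.le (by
        rw [norm_mul, hP]; exact mul_le_one₀ hρ (norm_nonneg _) hv))
    rw [e]
    refine (norm_add_le_max _ _).trans (max_le ?_
      ((norm_add_le_max _ _).trans (max_le ?_ ?_)))
    · rw [norm_mul]
      exact (mul_le_of_le_one_right (norm_nonneg _) ((norm_add_le_max _ _).trans
        (max_le (ih.trans (pow_le_one₀ hρ0 hρ)) (h1 U hs)))).trans ha2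
    · rw [norm_mul]
      exact (mul_le_of_le_one_left (norm_nonneg _) (h1 _ ha1)).trans ih
    · rw [norm_mul, norm_mul, norm_mul, hP, ← sq]
      exact mul_le_of_le_one_right (sq_nonneg ρ) (mul_le_one₀ ha1 (norm_nonneg _) hs)

theorem dworkChar_mul_eq_pow (hp17 : 17 ≤ p) (hπ : π ^ (p - 1) = -p) (r : ℕ) {x j : L}
    (hx : ‖x‖ ≤ 1) (hxr : x ^ p ^ r = x) (hj : j ^ (p - 1) = 1) {b : ℕ} (hb : ‖j - b‖ < 1) :
    dworkChar p π r (j * x) = dworkChar p π r x ^ b := by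
  have hπ0 := norm_pos_of_uniformizer hπ
  have hπ1 := norm_uniformizer_lt_one hπ
  have hj1 : ‖j‖ = 1 := (pow_eq_one_iff_of_nonneg (norm_nonneg j) (show p - 1 ≠ 0 by omega)).1
    (by rw [← norm_pow, hj, norm_one])
  have hjp : j ^ p = j := by rw [← pow_sub_one_mul hp.out.ne_zero j, hj, one_mul]
  have hjpi : ∀ i, j ^ p ^ i = j := by
    intro i
    induction i with
    | zero => simp
    | succ i ih => rw [pow_succ, pow_mul, ih, hjp]
  set P : L := algebraMap K L π
  have hPn : ‖P‖ = ‖π‖ := norm_algebraMap' L π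
  have hc : ∀ y : L, ‖y‖ ≤ 1 → ‖dworkChar p π r y - (1 + P * ∑ i ∈ range r, y ^ p ^ i)‖ ≤ ‖π‖ ^ 2 := by
    intro y hy
    have hyi : ∀ i, ‖y ^ p ^ i‖ ≤ 1 := fun i => by
      rw [norm_pow]
      exact pow_le_one₀ (norm_nonneg _) hy
    exact norm_prod_sub_le _ hπ1.le hPn (fun i _ => hyi i) fun i _ => norm_evalSeries_dworkSeries_sub_le hp17 hπ (hyi i)
  have hjx : ‖j * x‖ ≤ 1 := by rw [norm_mul, hj1, one_mul]; exact hx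
  have h1 := hc _ hjx
  simp only [mul_pow, hjpi, ← mul_sum] at h1
  have hT : ‖∑ i ∈ range r, x ^ p ^ i‖ ≤ 1 := norm_sum_le_of_forall_le_of_nonneg zero_le_one
    fun i _ => by rw [norm_pow]; exact pow_le_one₀ (norm_nonneg _) hx
  have h2 := norm_prod_sub_le (range b) hπ1.le hPn (fun _ _ => hT) fun _ _ => hc x hx
  simp only [prod_const, sum_const, card_range, nsmul_eq_mul] at h2
  have hxp := dworkChar_pow hp17 hπ r hx hxr
  have hjxp := dworkChar_pow hp17 hπ r hjx (by rw [mul_pow, hjpi, hxr])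
  generalize dworkChar p π r (j * x) = A at *
  generalize dworkChar p π r x = B at *
  generalize ∑ i ∈ range r, x ^ p ^ i = T at *
  have hB1 : ‖B‖ = 1 := (pow_eq_one_iff_of_nonneg (norm_nonneg B) hp.out.ne_zero).1 (by rw [← norm_pow, hxp, norm_one])
  have hB0 : B ^ b ≠ 0 := pow_ne_zero _ (by rw [← norm_ne_zero_iff, hB1]; exact one_ne_zero)
  have hsq : ‖π‖ ^ 2 < ‖π‖ := by nlinarith
  refine (div_eq_one_iff_eq hB0).1 (eq_one_of_pow_eq_one_of_norm_sub_lt hπ ?_ ?_)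
  · rw [div_pow, hjxp, ← pow_mul, mul_comm, pow_mul, hxp, one_pow, div_one]
  · rw [div_sub_one hB0, norm_div, norm_pow, hB1, one_pow, div_one]
    have e : A - B ^ b = (A - (1 + P * (j * T))) + (-(B ^ b - (1 + P * (b * T))) + P * ((j - b) * T)) := by ring
    rw [e]
    refine (norm_add_le_max _ _).trans_lt (max_lt (h1.trans_lt hsq) ?_)
    refine (norm_add_le_max _ _).trans_lt (max_lt ?_ ?_)
    · rw [norm_neg]
      exact h2.trans_lt hsq
    · rw [norm_mul, norm_mul, hPn]
      exact mul_lt_of_lt_one_right hπ0 ((mul_le_of_le_one_right (norm_nonneg _) hT).trans_lt hb)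

theorem dworkChar_pow_prime (r : ℕ) (π : K) {x : L} (hxr : x ^ p ^ r = x) :
    dworkChar p π r (x ^ p) = dworkChar p π r x := by
  rcases r with _ | r
  · simp [dworkChar]
  rw [dworkChar, dworkChar, prod_range_succ, prod_range_succ', pow_zero, pow_one, ← pow_mul, ← pow_succ', hxr]
  simp only [← pow_mul, ← pow_succ']

/-- The absolute trace of the field with `p ^ r` elements, on Teichmüller representatives. -/
def dworkTrace (p : ℕ) [Fact p.Prime] (π : K) (r : ℕ) (x : L) : ZMod p :=
  Classical.epsilon fun a : ZMod p => evalSeries (dworkSeries p π) (1 : L) ^ a.val = dworkChar p π r x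

theorem pow_val_dworkTrace (hp17 : 17 ≤ p) (hπ : π ^ (p - 1) = -p) (r : ℕ) {x : L}
    (hx : ‖x‖ ≤ 1) (hxr : x ^ p ^ r = x) :
    evalSeries (dworkSeries p π) (1 : L) ^ (dworkTrace p π r x).val = dworkChar p π r x := by
  obtain ⟨i, hi, h⟩ := (isPrimitiveRoot_evalSeries_dworkSeries (L := L) hp17 hπ).eq_pow_of_pow_eq_one
    (dworkChar_pow hp17 hπ r hx hxr)
  exact Classical.epsilon_spec (p := fun a : ZMod p => evalSeries (dworkSeries p π) (1 : L) ^ a.val = dworkChar p π r x)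
    ⟨(i : ZMod p), by rw [ZMod.val_cast_of_lt hi, h]⟩

theorem dworkTrace_eq_of_pow (hp17 : 17 ≤ p) (hπ : π ^ (p - 1) = -p) (r : ℕ) {x : L}
    (hx : ‖x‖ ≤ 1) (hxr : x ^ p ^ r = x) {b : ℕ}
    (h : dworkChar p π r x = evalSeries (dworkSeries p π) (1 : L) ^ b) : dworkTrace p π r x = b := by
  have hζ := isPrimitiveRoot_evalSeries_dworkSeries (L := L) hp17 hπ
  rw [← pow_val_dworkTrace hp17 hπ r hx hxr, ← pow_mod_orderOf _ b, ← hζ.eq_orderOf] at h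
  have h' := hζ.pow_inj (ZMod.val_lt _) (Nat.mod_lt _ hp.out.pos) h
  rw [← ZMod.natCast_zmod_val (dworkTrace p π r x), h', ZMod.natCast_mod]

theorem dworkTrace_mul (hp17 : 17 ≤ p) (hπ : π ^ (p - 1) = -p) (r : ℕ) {x j : L}
    (hx : ‖x‖ ≤ 1) (hxr : x ^ p ^ r = x) (hj : j ^ (p - 1) = 1) {b : ℕ} (hb : ‖j - b‖ < 1) :
    dworkTrace p π r (j * x) = b * dworkTrace p π r x := by
  have hj1 : ‖j‖ = 1 := (pow_eq_one_iff_of_nonneg (norm_nonneg j) (show p - 1 ≠ 0 by omega)).1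
    (by rw [← norm_pow, hj, norm_one])
  have hjpi : j ^ p ^ r = j := by
    have hjp : j ^ p = j := by rw [← pow_sub_one_mul hp.out.ne_zero j, hj, one_mul]
    exact (congrFun (pow_iterate p r) j).symm.trans (Function.iterate_fixed hjp r)
  rw [dworkTrace_eq_of_pow hp17 hπ r (b := b * (dworkTrace p π r x).val)
    (by rw [norm_mul, hj1, one_mul]; exact hx) (by rw [mul_pow, hjpi, hxr])]
  · simp
  · rw [dworkChar_mul_eq_pow hp17 hπ r hx hxr hj hb, mul_comm, pow_mul, pow_val_dworkTrace hp17 hπ r hx hxr]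

theorem dworkTrace_mul_of_pow_eq (hp17 : 17 ≤ p) (hπ : π ^ (p - 1) = -p) (r d : ℕ) {x : L}
    (hx : ‖x‖ ≤ 1) (hxr : x ^ p ^ r = x) : dworkTrace p π (r * d) x = d * dworkTrace p π r x := by
  have hper : x ^ p ^ (r * d) = x := by
    rw [pow_mul]
    exact (congrFun (pow_iterate (p ^ r) d) x).symm.trans (Function.iterate_fixed hxr d)
  rw [dworkTrace_eq_of_pow hp17 hπ (r * d) (b := d * (dworkTrace p π r x).val) hx hper]
  · simp
  · rw [dworkChar_mul_of_pow_eq r d π hxr, mul_comm, pow_mul, pow_val_dworkTrace hp17 hπ r hx hxr]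

theorem dworkTrace_pow_prime (r : ℕ) (π : K) {x : L} (hxr : x ^ p ^ r = x) :
    dworkTrace p π r (x ^ p) = dworkTrace p π r x := by
  rw [dworkTrace, dworkTrace, dworkChar_pow_prime r π hxr]

end DworkTrace

section Rationality

open PowerSeries (coeff_one mk)

variable {Z : Type*}

theorem sum_addChar_eq_ratCast (X : Finset Z) (w : Z → ZMod p)
    (hX : ∀ b : ZMod p, b ≠ 0 → ∃ m : Z → Z, Set.InjOn m X ∧ (∀ z ∈ X, m z ∈ X) ∧ ∀ z ∈ X, w (m z) = b * w z)
    {F : Type*} [Field F] [CharZero F] {φ : AddChar (ZMod p) F} (hφ : φ.IsPrimitive) :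
    ∑ z ∈ X, φ (w z) = (((p * #{z ∈ X | w z = 0} - #X) / (p - 1) : ℚ) : F) := by
  have hb : ∀ b : ZMod p, b ≠ 0 → ∑ z ∈ X, φ (b * w z) = ∑ z ∈ X, φ (w z) := by
    intro b hb0
    obtain ⟨m, hinj, hmaps, hw⟩ := hX b hb0
    refine sum_bij (fun z _ => m z) hmaps (fun a ha b hb h => hinj ha hb h) (fun z hz => ?_)
      fun z hz => by rw [hw z hz]
    obtain ⟨y, hy, h⟩ := surjOn_of_injOn_of_card_le m hmaps hinj le_rfl hz
    exact ⟨y, hy, h⟩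
  have h1 : ∑ b : ZMod p, ∑ z ∈ X, φ (b * w z) = (p : F) * #{z ∈ X | w z = 0} := by
    rw [sum_comm]
    simp_rw [AddChar.sum_mulShift _ hφ, ZMod.card]
    rw [card_filter, Nat.cast_sum, mul_sum]
    exact sum_congr rfl fun z _ => by split_ifs <;> simp
  rw [← add_sum_erase _ _ (mem_univ (0 : ZMod p)), sum_congr rfl fun b hb' =>
    hb b (ne_of_mem_erase hb'), sum_const, card_erase_of_mem (mem_univ _),
    card_univ, ZMod.card] at h1
  have h2 : (p : F) - 1 ≠ 0 := sub_ne_zero.2 (by exact_mod_cast hp.out.one_lt.ne')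
  simp only [zero_mul, AddChar.map_zero_eq_one, sum_const, nsmul_eq_mul, mul_one] at h1
  rw [Nat.cast_sub hp.out.one_le, Nat.cast_one] at h1
  push_cast
  rw [eq_div_iff h2, ← h1]
  ring

theorem isIntegral_coeff_charpolyRev {ι : Type*} [Fintype ι] [DecidableEq ι] {A : Matrix ι ι ℂ}
    (hA : ∀ i j, IsIntegral ℤ (A i j)) (s : ℕ) : IsIntegral ℤ (A.charpolyRev.coeff s) := by
  let B : Matrix ι ι (integralClosure ℤ ℂ) := fun i j => ⟨A i j, hA i j⟩
  have hB : A = B.map (algebraMap (integralClosure ℤ ℂ) ℂ) := rfl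
  rw [← reverse_charpoly, Polynomial.coeff_reverse, hB, Matrix.charpoly_map, Polynomial.coeff_map]
  exact (B.charpoly.coeff _).2

theorem pow_cycleMatrix {Y : Type*} [Fintype Y] [DecidableEq Y] {F : Y → Y} {v : Y → ℂ} (hv : ∀ y, v (F y) = v y)
    (r : ℕ) : (of fun y y' => if F y = y' then v y else 0) ^ r =
      of fun y y' => if F^[r] y = y' then v y ^ r else 0 := by
  induction r with
  | zero =>
    ext y y'
    simp [Matrix.one_apply]
  | succ r ih =>
    rw [pow_succ', ih]
    ext y y'
    rw [Matrix.mul_apply]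
    simp only [of_apply, ite_mul, zero_mul, sum_ite_eq, mem_univ, if_true, hv,
      Function.iterate_succ_apply]
    rw [mul_ite, mul_zero, pow_succ']
    congr

theorem isIntegral_newtonSeq {F : Z → Z} {P : Z → Prop} (hF : ∀ z, P z → P (F z)) {X : ℕ → Finset Z}
    (hX : ∀ r, 0 < r → ∀ z, z ∈ X r ↔ P z ∧ F^[r] z = z) {w : ℕ → Z → ZMod p}
    (hw : ∀ r d, 0 < r → ∀ z ∈ X r, w (r * d) z = d * w r z)
    (hwF : ∀ r, 0 < r → ∀ z ∈ X r, w r (F z) = w r z) (φ : AddChar (ZMod p) ℂ) (s : ℕ) :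
    IsIntegral ℤ (newtonSeq (fun r => ∑ z ∈ X (r + 1), φ (w (r + 1) z)) s) := by
  classical
  have hN := s.factorial_pos
  have hmem := hX _ hN
  let Y := {z // z ∈ X s.factorial}
  let FY : Y → Y := fun z => ⟨F z.1, (hmem _).2 ⟨hF _ ((hmem _).1 z.2).1, by
    rw [← Function.iterate_succ_apply, Function.iterate_succ_apply', ((hmem _).1 z.2).2]⟩⟩
  have hFY : ∀ (r : ℕ) (y : Y), ((FY^[r] y : Y) : Z) = F^[r] y := by
    intro r y
    induction r with
    | zero => rfl
    | succ r ih => rw [Function.iterate_succ_apply', Function.iterate_succ_apply', ← ih]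
  let d : Y → ℕ := fun y => Function.minimalPeriod F y.1
  have hper : ∀ y : Y, y.1 ∈ Function.periodicPts F := fun y => ⟨_, hN, ((hmem _).1 y.2).2⟩
  have hd : ∀ y, 0 < d y := fun y => Function.minimalPeriod_pos_of_mem_periodicPts (hper y)
  have hdX : ∀ y : Y, y.1 ∈ X (d y) := fun y =>
    (hX _ (hd y) _).2 ⟨((hmem _).1 y.2).1, Function.iterate_minimalPeriod⟩
  have hdF : ∀ y, d (FY y) = d y := fun y => Function.minimalPeriod_apply (hper y)
  let v : Y → ℂ := fun y => φ (w (d y) y.1) ^ ((d y : ℂ)⁻¹)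
  have hvd : ∀ y, v y ^ d y = φ (w (d y) y.1) := fun y => Complex.cpow_nat_inv_pow _ (hd y).ne'
  have hvF : ∀ y, v (FY y) = v y := fun y => by
    change φ (w (d (FY y)) (F y.1)) ^ ((d (FY y) : ℂ)⁻¹) = _
    rw [hdF, hwF _ (hd y) _ (hdX y)]
  have hvI : ∀ y, IsIntegral ℤ (v y) := fun y => by
    refine IsIntegral.of_pow (hd y) ?_
    rw [hvd]
    refine IsIntegral.of_pow hp.out.pos ?_
    rw [← AddChar.map_nsmul_eq_pow]
    simp [isIntegral_one]
  let A : Matrix Y Y ℂ := of fun y y' => if FY y = y' then v y else 0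
  have key : ∀ r < s, (A ^ (r + 1)).trace = ∑ z ∈ X (r + 1), φ (w (r + 1) z) := by
    intro r hr
    have hsub : ∀ z ∈ X (r + 1), z ∈ X s.factorial := by
      intro z hz
      obtain ⟨e, he⟩ := Nat.dvd_factorial (Nat.succ_pos r) (Nat.succ_le_of_lt hr)
      obtain ⟨h1, h2⟩ := (hX _ (Nat.succ_pos r) z).1 hz
      refine (hmem _).2 ⟨h1, ?_⟩
      rw [he, Function.iterate_mul]
      exact Function.iterate_fixed h2 e
    rw [pow_cycleMatrix hvF, trace]
    simp only [Matrix.diag_apply, of_apply]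
    rw [← sum_filter]
    refine sum_bij (fun y _ => y.1) ?_ (fun a _ b _ h => Subtype.ext h) ?_ ?_
    · intro y hy
      refine (hX _ (Nat.succ_pos r) _).2 ⟨((hmem _).1 y.2).1, ?_⟩
      rw [← hFY, (mem_filter.1 hy).2]
    · intro z hz
      refine ⟨⟨z, hsub z hz⟩, mem_filter.2 ⟨mem_univ _, Subtype.ext ?_⟩, rfl⟩
      rw [hFY]
      exact ((hX _ (Nat.succ_pos r) z).1 hz).2
    · intro y hy
      have h1 : Function.IsPeriodicPt F (r + 1) y.1 := by
        change F^[r + 1] y.1 = y.1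
        rw [← hFY, (mem_filter.1 hy).2]
      obtain ⟨e, he⟩ := h1.minimalPeriod_dvd
      change r + 1 = d y * e at he
      rw [he, pow_mul, hvd, hw _ e (hd y) _ (hdX y), ← nsmul_eq_mul, AddChar.map_nsmul_eq_pow]
  rw [← newtonSeq_congr key, ← coeff_charpolyRev_eq_newtonSeq]
  refine isIntegral_coeff_charpolyRev (fun y y' => ?_) s
  change IsIntegral ℤ (if FY y = y' then v y else 0)
  split_ifs
  · exact hvI y
  · exact isIntegral_zero

theorem exists_int_newtonSeq_neg {S : ℕ → ℚ} (hS : ∀ s, IsIntegral ℤ (newtonSeq (fun r => (S r : ℂ)) s)) (s : ℕ) :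
    ∃ m : ℤ, newtonSeq (fun r => -S r) s = m := by
  have h1 : ∀ s, ∃ m : ℤ, newtonSeq S s = m := by
    intro s
    have h := hS s
    have e : newtonSeq (fun r => (S r : ℂ)) s = algebraMap ℚ ℂ (newtonSeq S s) :=
      (map_newtonSeq (algebraMap ℚ ℂ) S s).symm
    rw [e, isIntegral_algebraMap_iff (algebraMap ℚ ℂ).injective] at h
    obtain ⟨m, hm⟩ := IsIntegrallyClosed.isIntegral_iff.1 h
    exact ⟨m, by rw [← hm]; simp⟩
  have hmul : mk (newtonSeq S) * mk (newtonSeq fun r => -S r) = 1 := by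
    rw [← mk_newtonSeq_add]
    ext s
    rw [coeff_mk, coeff_one]
    refine (congrFun (eq_newtonSeq (f := fun s => if s = 0 then (1 : ℚ) else 0) (if_pos rfl) fun s => ?_) s).symm
    simp
  induction s using Nat.strong_induction_on with
  | _ s ih =>
    rcases Nat.eq_zero_or_pos s with rfl | hs
    · exact ⟨1, by rw [newtonSeq_zero]; simp⟩
    have h := congrArg (PowerSeries.coeff s) hmul
    rw [PowerSeries.coeff_mul, coeff_one, if_neg hs.ne', Nat.sum_antidiagonal_eq_sum_range_succ_mk,
      sum_range_succ'] at h
    simp only [coeff_mk, newtonSeq_zero, one_mul, Nat.sub_zero] at h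
    choose f hf using h1
    choose! g hg using ih
    refine ⟨-∑ r ∈ range s, f (r + 1) * g (s - (r + 1)), ?_⟩
    rw [eq_neg_of_add_eq_zero_right h, Int.cast_neg, Int.cast_sum]
    congr 1
    refine sum_congr rfl fun r hr => ?_
    have hr := mem_range.1 hr
    rw [hf, hg _ (by omega), Int.cast_mul]

end Rationality

section RealGrowth

open PowerSeries

variable {R : ℝ}

theorem exists_growthLE_mul_one_sub (hR : 1 ≤ R) (a : ℝ) {f : PowerSeries ℝ} (hf : ∃ D, GrowthLE R D f) :
    ∃ D, GrowthLE R D (f * (1 - C a * X)) := by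
  obtain ⟨c, hc⟩ := hf
  have hc0 : 0 ≤ c := by simpa using (norm_nonneg _).trans (hc 0)
  refine ⟨c * (1 + |a|), fun s => ?_⟩
  rw [mul_sub, mul_one, map_sub, show f * (C a * X) = C a * (f * X) by ring, coeff_C_mul]
  have h1 := hc s
  have h2 : ‖coeff s (f * X)‖ ≤ c * R ^ s := by
    rcases s with _ | s
    · simpa using hc0
    · rw [coeff_succ_mul_X]
      exact (hc s).trans (mul_le_mul_of_nonneg_left (pow_le_pow_right₀ hR s.le_succ) hc0)
  calc _ ≤ c * R ^ s + |a| * (c * R ^ s) := by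
        refine (norm_sub_le _ _).trans (add_le_add h1 ?_)
        rw [norm_mul, Real.norm_eq_abs a]
        exact mul_le_mul_of_nonneg_left h2 (abs_nonneg a)
    _ = _ := by ring

theorem exists_growthLE_of_mul_one_sub {a : ℝ} (ha : 0 ≤ a) (haR : a < R) {f : PowerSeries ℝ}
    (hf : ∃ D, GrowthLE R D (f * (1 - C a * X))) : ∃ D, GrowthLE R D f := by
  obtain ⟨c, hc⟩ := hf
  have hR : 0 < R := ha.trans_lt haR
  have hq : 0 < 1 - a / R := by rw [sub_pos, div_lt_one hR]; exact haR
  have hc0 : 0 ≤ c := by simpa using (norm_nonneg _).trans (hc 0)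
  have hle : c ≤ c / (1 - a / R) := by
    rw [le_div_iff₀ hq]
    exact mul_le_of_le_one_right hc0 (by rw [sub_le_self_iff]; positivity)
  refine ⟨c / (1 - a / R), fun s => ?_⟩
  have hs := hc s
  rw [mul_sub, mul_one, map_sub, show f * (C a * X) = C a * (f * X) by ring, coeff_C_mul] at hs
  induction s with
  | zero =>
    rw [coeff_zero_mul_X, mul_zero, sub_zero] at hs
    exact hs.trans (by simpa using hle)
  | succ s ih =>
    have ih := ih (by
      have h := hc s
      rwa [mul_sub, mul_one, map_sub, show f * (C a * X) = C a * (f * X) by ring, coeff_C_mul] at h)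
    rw [coeff_succ_mul_X] at hs
    have h1 : ‖coeff (s + 1) f‖ ≤ c * R ^ (s + 1) + a * (c / (1 - a / R) * R ^ s) := by
      rw [← sub_add_cancel (coeff (s + 1) f) (a * coeff s f)]
      refine (norm_add_le _ _).trans (add_le_add hs ?_)
      rw [norm_mul, Real.norm_of_nonneg ha]
      exact mul_le_mul_of_nonneg_left ih ha
    refine h1.trans (le_of_eq ?_)
    have hR' := hR.ne'
    have hq' : R - a ≠ 0 := (sub_pos.2 haR).ne'
    have hq'' : (1 - a / R) ≠ 0 := hq.ne'
    rw [show 1 - a / R = (R - a) / R by field_simp]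
    field_simp
    ring

theorem exists_growthLE_iff_mul_prod {α : Type*} (s : Finset α) {a : α → ℝ} (hR : 1 ≤ R) (ha : ∀ i ∈ s, 0 ≤ a i ∧ a i < R)
    (e : ℕ) (f : PowerSeries ℝ) : (∃ D, GrowthLE R D (f * (∏ i ∈ s, (1 - C (a i) * X)) ^ e)) ↔ ∃ D, GrowthLE R D f := by
  classical
  rw [← prod_pow]
  induction s using Finset.induction_on generalizing f with
  | empty => simp
  | insert i s hi ih =>
    obtain ⟨h0, h1⟩ := ha i (mem_insert_self _ _)
    rw [prod_insert hi, ← mul_assoc, ih (fun j hj => ha j (mem_insert_of_mem hj))]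
    clear ih
    induction e generalizing f with
    | zero => simp
    | succ e ih =>
      rw [pow_succ', ← mul_assoc, ih]
      exact ⟨exists_growthLE_of_mul_one_sub h0 h1, exists_growthLE_mul_one_sub hR _⟩

end RealGrowth

section IntegerGrowth

variable {K : Type*} [NontriviallyNormedField K] [CharZero K] [IsUltrametricDist K]

theorem one_le_abs_mul_norm_intCast (p : ℕ) [hp : Fact p.Prime] [NormedAlgebra ℚ_[p] K] {m : ℤ} (hm : m ≠ 0) : 1 ≤ |(m : ℝ)| * ‖(m : K)‖ := by
  have hn : m.natAbs ≠ 0 := Int.natAbs_ne_zero.2 hm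
  obtain ⟨v, u, hu, h⟩ := Nat.exists_eq_pow_mul_and_not_dvd hn p hp.out.ne_one
  have h1 : ‖(m : K)‖ = ‖((m.natAbs : ℕ) : K)‖ := by
    rcases Int.natAbs_eq m with h | h <;> rw [h] <;> simp
  have h2 : |(m : ℝ)| = (m.natAbs : ℝ) := by rw [Nat.cast_natAbs]; simp
  have hu0 : (1 : ℝ) ≤ u := by
    have : u ≠ 0 := by rintro rfl; simp at hu
    exact_mod_cast Nat.one_le_iff_ne_zero.2 this
  have hp0 : (0 : ℝ) < p := by exact_mod_cast hp.out.pos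
  rw [h1, h2, h]
  push_cast
  rw [norm_mul, norm_pow, norm_prime_eq, norm_natCast_eq_one p hu, mul_one, inv_pow,
    mul_comm, ← mul_assoc, inv_mul_cancel₀ (pow_pos hp0 v).ne', one_mul]
  exact hu0

open PowerSeries in
theorem exists_growthLE_of_padic_growth (p : ℕ) [hp : Fact p.Prime] [NormedAlgebra ℚ_[p] K] {h : ℕ → ℤ} {B : ℝ} {c : ℕ} (hB : (p : ℝ) ^ (c + 1) < B)
    (hh : ∀ s, |(h s : ℝ)| ≤ B ^ s)
    (hK : ∀ ε : ℝ, 0 < ε → ∃ (e : ℕ) (C' : ℝ), 0 ≤ C' ∧ GrowthLE ε C' ((mk fun s => (h s : K)) *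
      (((∏ j ∈ range (c + 1), (1 - Polynomial.C ((p : K) ^ (j + 1)) * Polynomial.X)) ^ e : Polynomial K) :
        K⟦X⟧)))
    {R : ℝ} (hR : (p : ℝ) ^ (c + 1) < R) : ∃ C, ∀ s, |(h s : ℝ)| ≤ C * R ^ s := by
  have hp1 : (1 : ℝ) ≤ p := by exact_mod_cast hp.out.one_le
  have hB1 : 1 ≤ B := (one_le_pow₀ hp1).trans hB.le
  have hR1 : 1 ≤ R := (one_le_pow₀ hp1).trans hR.le
  have ha : ∀ R : ℝ, (p : ℝ) ^ (c + 1) < R → ∀ j ∈ range (c + 1), 0 ≤ (p : ℝ) ^ (j + 1) ∧ (p : ℝ) ^ (j + 1) < R :=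
    fun R hR j hj => ⟨by positivity, (pow_le_pow_right₀ hp1 (by have := mem_range.1 hj; omega)).trans_lt hR⟩
  obtain ⟨e, C', hC', hg⟩ := hK (1 / (2 * B)) (by positivity)
  let E : PowerSeries ℤ := mk h * (∏ j ∈ range (c + 1), (1 - C ((p : ℤ) ^ (j + 1)) * X)) ^ e
  have hEK : (mk fun s => (h s : K)) * (((∏ j ∈ range (c + 1),
      (1 - Polynomial.C ((p : K) ^ (j + 1)) * Polynomial.X)) ^ e : Polynomial K) : K⟦X⟧) =
      E.map (Int.castRingHom K) := by
    have h1 : (mk fun s => (h s : K)) = (mk h).map (Int.castRingHom K) := by ext; simp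
    rw [h1]
    rw [map_mul, map_pow, map_prod, ← coeToPowerSeries.ringHom_apply, map_pow, map_prod]
    congr 2
    exact prod_congr rfl fun j _ => by
      simp only [map_sub, map_one, map_mul, coeToPowerSeries.ringHom_apply, Polynomial.coe_C,
        Polynomial.coe_X, PowerSeries.map_X, map_pow, map_natCast]
  have hER : (mk fun s => (h s : ℝ)) * (∏ j ∈ range (c + 1), (1 - C ((p : ℝ) ^ (j + 1)) * X)) ^ e =
      E.map (Int.castRingHom ℝ) := by
    have h1 : (mk fun s => (h s : ℝ)) = (mk h).map (Int.castRingHom ℝ) := by ext; simp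
    rw [h1]
    simp [E, map_prod]
  rw [hEK] at hg
  obtain ⟨D, hD⟩ := (exists_growthLE_iff_mul_prod (range (c + 1)) hB1 (ha B hB) e (mk fun s => (h s : ℝ))).2
    ⟨1, fun s => by rw [coeff_mk, one_mul]; exact hh s⟩
  rw [hER] at hD
  have hfin : ∀ᶠ s in atTop, coeff s E = 0 := by
    have hlim : Tendsto (fun s : ℕ => D * C' * (1 / 2 : ℝ) ^ s) atTop (nhds 0) := by
      simpa using (tendsto_pow_atTop_nhds_zero_of_lt_one (by norm_num) (by norm_num : (1 / 2 : ℝ) < 1)).const_mul (D * C')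
    filter_upwards [hlim.eventually (gt_mem_nhds one_pos)] with s hs
    by_contra hne
    refine absurd (one_le_abs_mul_norm_intCast p (K := K) hne) (not_le.2 (lt_of_le_of_lt ?_ hs))
    have h1 := hD s
    have h2 := hg s
    rw [coeff_map, eq_intCast, Real.norm_eq_abs] at h1
    rw [coeff_map, eq_intCast] at h2
    calc _ ≤ (D * B ^ s) * (C' * (1 / (2 * B)) ^ s) :=
          mul_le_mul h1 h2 (norm_nonneg _) ((abs_nonneg _).trans h1)
      _ = D * C' * (B * (1 / (2 * B))) ^ s := by rw [mul_pow]; ring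
      _ = _ := by rw [show B * (1 / (2 * B)) = 1 / 2 by field_simp]
  obtain ⟨s₀, hs₀⟩ := eventually_atTop.1 hfin
  have hfinal : ∃ C, GrowthLE R C (E.map (Int.castRingHom ℝ)) := by
    refine ⟨∑ i ∈ range s₀, |((coeff i E : ℤ) : ℝ)|, fun s => ?_⟩
    rw [coeff_map, eq_intCast, Real.norm_eq_abs]
    by_cases hs : s < s₀
    · have h1 := single_le_sum (f := fun i => |((coeff i E : ℤ) : ℝ)|) (fun i _ => abs_nonneg _)
        (mem_range.2 hs)
      exact h1.trans (le_mul_of_one_le_right (sum_nonneg fun i _ => abs_nonneg _) (one_le_pow₀ hR1))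
    · rw [hs₀ s (not_lt.1 hs), Int.cast_zero, abs_zero]
      exact mul_nonneg (sum_nonneg fun i _ => abs_nonneg _) (by positivity)
  rw [← hER] at hfinal
  obtain ⟨D', hD'⟩ := (exists_growthLE_iff_mul_prod _ hR1 (ha R hR) e _).1 hfinal
  exact ⟨D', fun s => by simpa using hD' s⟩

theorem powerSum_le_of_padic_growth (p : ℕ) [hp : Fact p.Prime] [NormedAlgebra ℚ_[p] K] {S : ℕ → ℚ} (hS0 : ∀ r, 0 ≤ S r) {B : ℝ} {c : ℕ} (hB : (p : ℝ) ^ (c + 1) < B)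
    (hSB : ∀ r, (S r : ℝ) ≤ B ^ (r + 1)) (hInt : ∀ s, ∃ m : ℤ, newtonSeq (fun r => -S r) s = m)
    (hK : ∀ ε : ℝ, 0 < ε → ∃ (e : ℕ) (C' : ℝ), 0 ≤ C' ∧ GrowthLE ε C' (PowerSeries.mk (newtonSeq fun r => -(S r : K)) *
      (((∏ j ∈ range (c + 1), (1 - Polynomial.C ((p : K) ^ (j + 1)) * Polynomial.X)) ^ e : Polynomial K) :
        K⟦X⟧)))
    {R : ℝ} (hR : (p : ℝ) ^ (c + 1) < R) : ∃ C, ∀ r, (S r : ℝ) ≤ (r + 1) * (C * R ^ (r + 1)) := by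
  choose h hh using hInt
  have hp1 : (1 : ℝ) ≤ p := by exact_mod_cast hp.out.one_le
  have hB0 : 0 ≤ B := zero_le_one.trans ((one_le_pow₀ hp1).trans hB.le)
  have hnewton : ∀ s : ℕ, (s : ℝ) * h s = ∑ r ∈ range s, S r * (h (s - 1 - r) : ℝ) := by
    intro s
    have e := nat_mul_newtonSeq (fun r => -S r) s
    simp only [hh, neg_mul, sum_neg_distrib, neg_neg] at e
    exact_mod_cast congrArg (Rat.cast (K := ℝ)) e
  have hh0 : h 0 = 1 := by
    have := hh 0
    rw [newtonSeq_zero] at this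
    exact_mod_cast this.symm
  have hSR : ∀ r, (0 : ℝ) ≤ S r := fun r => by exact_mod_cast hS0 r
  have hbd : ∀ s, 0 ≤ (h s : ℝ) ∧ (h s : ℝ) ≤ B ^ s := by
    intro s
    induction s using Nat.strong_induction_on with
    | _ s ih =>
      rcases Nat.eq_zero_or_pos s with rfl | hs
      · simp [hh0]
      have hs' : (0 : ℝ) < s := by exact_mod_cast hs
      have e := hnewton s
      constructor
      · refine nonneg_of_mul_nonneg_right ?_ hs'
        rw [e]
        exact sum_nonneg fun r hr => mul_nonneg (hSR r) (ih _ (by omega)).1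
      · refine le_of_mul_le_mul_left ?_ hs'
        rw [e]
        calc _ ≤ ∑ _r ∈ range s, B ^ s := sum_le_sum fun r hr => ?_
          _ = _ := by simp
        have hr := mem_range.1 hr
        obtain ⟨i1, i2⟩ := ih (s - 1 - r) (by omega)
        calc _ ≤ B ^ (r + 1) * B ^ (s - 1 - r) := mul_le_mul (hSB r) i2 i1 (by positivity)
          _ = _ := by rw [← pow_add]; congr 1; omega
  have hcast : (newtonSeq fun r => -(S r : K)) = fun s => (h s : K) := by
    funext s
    have e := map_newtonSeq (algebraMap ℚ K) (fun r => -S r) s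
    rw [hh] at e
    simpa using e.symm
  rw [hcast] at hK
  obtain ⟨C, hC⟩ := exists_growthLE_of_padic_growth p (K := K) hB
    (fun s => by rw [abs_of_nonneg (hbd s).1]; exact (hbd s).2) hK hR
  refine ⟨C, fun r => ?_⟩
  have e := hnewton (r + 1)
  have h1 := single_le_sum (f := fun i => S i * (h (r + 1 - 1 - i) : ℝ))
    (fun i _ => mul_nonneg (hSR i) (hbd _).1) (self_mem_range_succ r)
  simp only [Nat.add_sub_cancel, Nat.sub_self, hh0, Int.cast_one, mul_one] at h1 e
  rw [← e] at h1
  refine h1.trans ?_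
  push_cast
  exact mul_le_mul_of_nonneg_left ((le_abs_self _).trans (hC (r + 1))) (by positivity)

end IntegerGrowth

section Points

variable {L : Type*} [NormedField L] [NormedAlgebra K L] [CompleteSpace L]

theorem mem_nthRootsFinset_iff_frobenius {r : ℕ} (hr : 0 < r) {x : L} :
    x ∈ nthRootsFinset (p ^ r - 1) (1 : L) ↔ x ≠ 0 ∧ x ^ p ^ r = x := by
  have h1 : 1 < p ^ r := Nat.one_lt_pow hr.ne' hp.out.one_lt
  rw [mem_nthRootsFinset (by omega)]
  have e : x ^ p ^ r = x ^ (p ^ r - 1) * x := by rw [← pow_succ, Nat.sub_add_cancel h1.le]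
  refine ⟨fun h => ⟨?_, by rw [e, h, one_mul]⟩, fun ⟨h, h'⟩ => ?_⟩
  · rintro rfl
    rw [zero_pow (by omega)] at h
    exact zero_ne_one h
  · exact mul_right_cancel₀ h (by rw [← e, h', one_mul])

theorem norm_le_one_of_mem_nthRootsFinset {r : ℕ} (hr : 0 < r) {x : L}
    (hx : x ∈ nthRootsFinset (p ^ r - 1) (1 : L)) : ‖x‖ ≤ 1 := by
  have h1 : 1 < p ^ r := Nat.one_lt_pow hr.ne' hp.out.one_lt
  have : NeZero (p ^ r - 1) := ⟨by omega⟩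
  exact (norm_eq_one_of_mem_nthRootsFinset hx).le

open scoped Classical in
/-- The hyper-Kloosterman sum with values in an arbitrary field, over the field with `p ^ r` elements. -/
def charSum {F : Type*} [Field F] (π : K) (n : ℕ) (φ : AddChar (ZMod p) F) (r : ℕ) (t : L) : F :=
  ∑ x ∈ (piFinset fun _ : Fin n => nthRootsFinset (p ^ r - 1) (1 : L)) with ∏ i, x i = t,
    ∏ i, φ (dworkTrace p π r (x i))

/-- Tuples of points of the torus over the field with `p ^ r` elements with the same product. -/
def pointSet (L : Type*) [NormedField L] (p n : ℕ) (H : Type*) [Fintype H] [DecidableEq H] (r : ℕ) :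
    Finset (L × (H → Fin n → L)) := by
  classical exact
  (nthRootsFinset (p ^ r - 1) (1 : L) ×ˢ piFinset fun _ : H => piFinset fun _ : Fin n =>
    nthRootsFinset (p ^ r - 1) (1 : L)).filter fun z => ∀ h, ∏ i, z.2 h i = z.1

/-- The sum of the traces of the coordinates. -/
def pointTrace {n : ℕ} {H : Type*} [Fintype H] (π : K) (r : ℕ) (z : L × (H → Fin n → L)) : ZMod p :=
  ∑ h, ∑ i, dworkTrace p π r (z.2 h i)

variable {n : ℕ} {H : Type*} [Fintype H] [DecidableEq H]

theorem mem_pointSet {r : ℕ} {z : L × (H → Fin n → L)} :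
    z ∈ pointSet L p n H r ↔ (z.1 ∈ nthRootsFinset (p ^ r - 1) (1 : L) ∧
      ∀ h i, z.2 h i ∈ nthRootsFinset (p ^ r - 1) (1 : L)) ∧ ∀ h, ∏ i, z.2 h i = z.1 := by
  classical
  simp [pointSet, mem_piFinset]

theorem addChar_sum {A F ι : Type*} [AddCommMonoid A] [CommMonoid F] (φ : AddChar A F) (s : Finset ι) (f : ι → A) :
    φ (∑ i ∈ s, f i) = ∏ i ∈ s, φ (f i) :=
  map_prod φ.toMonoidHom (fun i => Multiplicative.ofAdd (f i)) s

theorem sum_charSum_pow {F : Type*} [Field F] (π : K) (φ : AddChar (ZMod p) F) (r : ℕ) :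
    ∑ t ∈ nthRootsFinset (p ^ r - 1) (1 : L), charSum π n φ r t ^ Fintype.card H =
      ∑ z ∈ pointSet L p n H r, φ (pointTrace π r z) := by
  classical
  rw [pointSet, sum_filter, sum_product]
  refine sum_congr rfl fun t _ => ?_
  rw [← sum_filter, charSum, ← card_univ, ← prod_const, prod_univ_sum]
  refine sum_congr ?_ fun x _ => ?_
  · ext x
    simp only [mem_piFinset, mem_filter]
    exact forall_and
  · simp only [pointTrace, addChar_sum]

theorem klSum_eq_charSum [IsUltrametricDist L] (hp17 : 17 ≤ p) (hπ : π ^ (p - 1) = -p) (n : ℕ) {r : ℕ}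
    (hr : 0 < r) {φ : AddChar (ZMod p) L} (hφ : ∀ a, φ a = evalSeries (dworkSeries p π) (1 : L) ^ a.val) (t : L) :
    klSum p π n r t = charSum π n φ r t := by
  classical
  rw [klSum, charSum]
  refine sum_congr rfl fun x hx => ?_
  have hx' := mem_piFinset.1 (mem_filter.1 hx).1
  refine prod_congr rfl fun i _ => ?_
  rw [hφ, pow_val_dworkTrace hp17 hπ r (norm_le_one_of_mem_nthRootsFinset hr (hx' i))
    ((mem_nthRootsFinset_iff_frobenius hr).1 (hx' i)).2]

theorem exists_teichmuller [IsAlgClosed L] [CharZero L] [IsUltrametricDist L] (K : Type*) [NontriviallyNormedField K]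
    [NormedAlgebra ℚ_[p] K] [NormedAlgebra K L] [IsUltrametricDist K] [CharZero K] {b : ℕ} (hb : ¬ p ∣ b) :
    ∃ j : L, j ^ (p - 1) = 1 ∧ ‖j - b‖ < 1 := by
  have hp1 : 0 < p - 1 := Nat.sub_pos_of_lt hp.out.one_lt
  have : NeZero (p - 1) := ⟨hp1.ne'⟩
  obtain ⟨ζ, hζ⟩ := HasEnoughRootsOfUnity.exists_primitiveRoot L (p - 1)
  have h1 := congrArg (eval (b : L)) (Polynomial.X_pow_sub_one_eq_prod hp1 hζ)
  simp only [eval_sub, Polynomial.eval_pow, eval_X, eval_one, eval_prod,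
    eval_C] at h1
  by_contra! hcon
  have h2 : ‖(b : L) ^ (p - 1) - 1‖ < 1 := by
    have hmod : p ∣ b ^ (p - 1) - 1 := (Nat.modEq_iff_dvd' (Nat.one_le_iff_ne_zero.2 (pow_ne_zero _ (by
      rintro rfl; simp at hb)))).1 (by
        have := Nat.ModEq.pow_totient ((Nat.Prime.coprime_iff_not_dvd hp.out).2 hb).symm
        rw [Nat.totient_prime hp.out] at this
        exact this.symm)
    obtain ⟨c, hc⟩ := hmod
    have e : (b : L) ^ (p - 1) - 1 = ((p * c : ℕ) : L) := by
      rw [← hc, Nat.cast_sub (Nat.one_le_iff_ne_zero.2 (pow_ne_zero _ (by rintro rfl; simp at hb)))]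
      simp
    have hpL : ‖(p : L)‖ = (p : ℝ)⁻¹ := by
      rw [← map_natCast (algebraMap K L), norm_algebraMap', norm_prime_eq]
    rw [e, Nat.cast_mul, norm_mul, hpL]
    exact (mul_le_of_le_one_right (by positivity) (norm_natCast_le_one L c)).trans_lt
      (inv_lt_one_of_one_lt₀ (by exact_mod_cast hp.out.one_lt))
  rw [h1, norm_prod] at h2
  refine absurd h2 (not_lt.2 ?_)
  calc (1 : ℝ) = ∏ s ∈ nthRootsFinset (p - 1) (1 : L), 1 := by simp
    _ ≤ _ := prod_le_prod (fun _ _ => zero_le_one) fun s hs => by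
      rw [← norm_neg, neg_sub]
      exact hcon s ((mem_nthRootsFinset hp1 1).1 hs)

theorem mul_mem_nthRootsFinset_of_pow {j : L} (hj : j ^ (p - 1) = 1) {r : ℕ} (hr : 0 < r) {x : L}
    (hx : x ∈ nthRootsFinset (p ^ r - 1) (1 : L)) : j * x ∈ nthRootsFinset (p ^ r - 1) (1 : L) := by
  have h1 : 1 < p ^ r := Nat.one_lt_pow hr.ne' hp.out.one_lt
  have h2 : j ^ (p ^ r - 1) = 1 := by
    obtain ⟨d, hd⟩ := Nat.sub_dvd_pow_sub_pow p 1 r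
    rw [one_pow] at hd
    rw [hd, pow_mul, hj, one_pow]
  rw [mem_nthRootsFinset (by omega)] at hx ⊢
  rw [mul_pow, h2, hx, one_mul]

variable [IsAlgClosed L] [CharZero L] [IsUltrametricDist L]

theorem sum_pointSet_eq_ratCast (hp17 : 17 ≤ p) (hπ : π ^ (p - 1) = -p) {r : ℕ} (hr : 0 < r)
    {F : Type*} [Field F] [CharZero F] {φ : AddChar (ZMod p) F} (hφ : φ.IsPrimitive) :
    ∑ z ∈ pointSet L p n H r, φ (pointTrace π r z) =
      (((p * #{z ∈ pointSet L p n H r | pointTrace (p := p) π r z = 0} - #(pointSet L p n H r)) / (p - 1) : ℚ) : F) := by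
  refine sum_addChar_eq_ratCast _ _ (fun b hb => ?_) hφ
  have hbp : ¬ p ∣ b.val := fun h => hb (by
    rw [← ZMod.natCast_zmod_val b]
    exact (ZMod.natCast_eq_zero_iff _ _).2 h)
  obtain ⟨j, hj, hjb⟩ := exists_teichmuller (L := L) K hbp
  have hj0 : j ≠ 0 := by
    rintro rfl
    rw [zero_pow (by omega)] at hj
    exact zero_ne_one hj
  refine ⟨fun z => (j ^ n * z.1, fun h i => j * z.2 h i), fun a _ b _ h => ?_, fun z hz => ?_, fun z hz => ?_⟩
  · simp only [Prod.mk.injEq, mul_right_inj' (pow_ne_zero n hj0)] at h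
    refine Prod.ext h.1 (funext fun h' => funext fun i => ?_)
    exact mul_left_cancel₀ hj0 (congrFun (congrFun h.2 h') i)
  · obtain ⟨⟨h1, h2⟩, h3⟩ := mem_pointSet.1 hz
    refine mem_pointSet.2 ⟨⟨mul_mem_nthRootsFinset_of_pow (by rw [← pow_mul, mul_comm, pow_mul, hj, one_pow]) hr h1,
      fun h i => mul_mem_nthRootsFinset_of_pow hj hr (h2 h i)⟩, fun h => ?_⟩
    simp only [prod_mul_distrib, prod_const, card_univ, Fintype.card_fin, h3]
  · obtain ⟨⟨h1, h2⟩, h3⟩ := mem_pointSet.1 hz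
    simp only [pointTrace, mul_sum]
    refine sum_congr rfl fun h _ => sum_congr rfl fun i _ => ?_
    rw [dworkTrace_mul hp17 hπ r (norm_le_one_of_mem_nthRootsFinset hr (h2 h i))
      ((mem_nthRootsFinset_iff_frobenius hr).1 (h2 h i)).2 hj hjb, ZMod.natCast_zmod_val]

theorem isIntegral_newtonSeq_pointSet (hp17 : 17 ≤ p) (hπ : π ^ (p - 1) = -p)
    (φ : AddChar (ZMod p) ℂ) (s : ℕ) :
    IsIntegral ℤ (newtonSeq (fun r => ∑ z ∈ pointSet L p n H (r + 1), φ (pointTrace π (r + 1) z)) s) := by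
  let F : L × (H → Fin n → L) → L × (H → Fin n → L) := fun z => (z.1 ^ p, fun h i => z.2 h i ^ p)
  have hFr : ∀ r z, F^[r] z = (z.1 ^ p ^ r, fun h i => z.2 h i ^ p ^ r) := by
    intro r z
    induction r with
    | zero => simp
    | succ r ih => simp only [Function.iterate_succ_apply', ih, F, ← pow_mul, pow_succ]
  refine isIntegral_newtonSeq (F := F) (P := fun z => (z.1 ≠ 0 ∧ ∀ h i, z.2 h i ≠ 0) ∧ ∀ h, ∏ i, z.2 h i = z.1)
    (fun z hz => ⟨⟨pow_ne_zero _ hz.1.1, fun h i => pow_ne_zero _ (hz.1.2 h i)⟩, fun h => ?_⟩) (fun r hr z => ?_)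
    (fun r d hr z hz => ?_) (fun r hr z hz => ?_) φ s
  · simp only [F, prod_pow, hz.2]
  · rw [mem_pointSet, hFr, Prod.ext_iff]
    simp only [mem_nthRootsFinset_iff_frobenius hr, funext_iff]
    constructor
    · rintro ⟨⟨h1, h2⟩, h3⟩
      exact ⟨⟨⟨h1.1, fun h i => (h2 h i).1⟩, h3⟩, h1.2, fun h i => (h2 h i).2⟩
    · rintro ⟨⟨⟨h1, h2⟩, h3⟩, h4, h5⟩
      exact ⟨⟨⟨h1, h4⟩, fun h i => ⟨h2 h i, h5 h i⟩⟩, h3⟩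
  · obtain ⟨⟨h1, h2⟩, h3⟩ := mem_pointSet.1 hz
    simp only [pointTrace, mul_sum]
    refine sum_congr rfl fun h _ => sum_congr rfl fun i _ => ?_
    exact dworkTrace_mul_of_pow_eq hp17 hπ r d (norm_le_one_of_mem_nthRootsFinset hr (h2 h i))
      ((mem_nthRootsFinset_iff_frobenius hr).1 (h2 h i)).2
  · obtain ⟨⟨h1, h2⟩, h3⟩ := mem_pointSet.1 hz
    refine sum_congr rfl fun h _ => sum_congr rfl fun i _ => ?_
    exact dworkTrace_pow_prime r π ((mem_nthRootsFinset_iff_frobenius hr).1 (h2 h i)).2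

theorem card_pointSet_le (r : ℕ) :
    (#(pointSet L p n H (r + 1)) : ℝ) ≤ ((p : ℝ) ^ (Fintype.card H * n + 1)) ^ (r + 1) := by
  classical
  have hN := prime_pow_sub_one_pos p r
  have : NeZero (p ^ (r + 1) - 1) := ⟨hN.ne'⟩
  have h1 : #(pointSet L p n H (r + 1)) ≤ (p ^ (r + 1)) * ((p ^ (r + 1)) ^ n) ^ Fintype.card H := by
    rw [pointSet]
    refine (card_filter_le _ _).trans ?_
    rw [card_product, Fintype.card_piFinset]
    simp only [Fintype.card_piFinset, card_nthRootsFinset_one, prod_const, card_univ, Fintype.card_fin]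
    gcongr <;> omega
  refine (Nat.cast_le.2 h1).trans (le_of_eq ?_)
  push_cast
  rw [← pow_mul, ← pow_mul, ← pow_mul, ← pow_add]
  congr 1
  ring

theorem conj_charSum (hp17 : 17 ≤ p) (hπ : π ^ (p - 1) = -p) (hne : _root_.Even n)
    (φ : AddChar (ZMod p) ℂ) {r : ℕ} (hr : 0 < r) (t : L) :
    (starRingEnd ℂ) (charSum π n φ r t) = charSum π n φ r t := by
  classical
  have hj : (-1 : L) ^ (p - 1) = 1 :=
    (hp.out.even_sub_one (by omega)).neg_one_pow
  have hjb : ‖(-1 : L) - (p - 1 : ℕ)‖ < 1 := by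
    rw [Nat.cast_sub hp.out.one_le, Nat.cast_one, sub_sub_eq_add_sub, neg_add_cancel, zero_sub, norm_neg,
      ← map_natCast (algebraMap K L), norm_algebraMap', norm_prime_eq]
    exact inv_lt_one_of_one_lt₀ (by exact_mod_cast hp.out.one_lt)
  have hb : ((p - 1 : ℕ) : ZMod p) = -1 := by
    rw [Nat.cast_sub hp.out.one_le]
    simp
  have hmem : ∀ x : Fin n → L, x ∈ (piFinset fun _ : Fin n => nthRootsFinset (p ^ r - 1) (1 : L)).filter
      (fun x => ∏ i, x i = t) → (fun i => -x i) ∈ (piFinset fun _ : Fin n =>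
        nthRootsFinset (p ^ r - 1) (1 : L)).filter (fun x => ∏ i, x i = t) := by
    intro x hx
    rw [mem_filter, mem_piFinset] at hx ⊢
    refine ⟨fun i => ?_, ?_⟩
    · rw [← neg_one_mul]
      exact mul_mem_nthRootsFinset_of_pow hj hr (hx.1 i)
    · rw [prod_neg, card_univ, Fintype.card_fin, hne.neg_one_pow, one_mul, hx.2]
  rw [charSum, map_sum]
  refine sum_nbij' (fun x i => -x i) (fun x i => -x i) hmem hmem (by simp) (by simp) fun x hx => ?_
  rw [map_prod]
  refine prod_congr rfl fun i _ => ?_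
  beta_reduce
  have hx' := mem_piFinset.1 (mem_filter.1 hx).1 i
  rw [← neg_one_mul, dworkTrace_mul hp17 hπ r (norm_le_one_of_mem_nthRootsFinset hr hx')
    ((mem_nthRootsFinset_iff_frobenius hr).1 hx').2 hj hjb, hb, neg_one_mul, AddChar.map_neg_eq_conj]

theorem exists_norm_charSum_pow_le [ProperSpace K] [NeZero n] (hp17 : 17 ≤ p) (hπ : π ^ (p - 1) = -p)
    (hne : _root_.Even n) (hn : ¬ p ∣ n) {ω : K} (hω : IsPrimitiveRoot ω n) {τ : K} (hτ : τ ^ p = π ^ (3 * n))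
    {φ : AddChar (ZMod p) ℂ} (hφ : φ.IsPrimitive) (m : ℕ) {R : ℝ} (hR : (p : ℝ) ^ (m * (n - 1) + 1) < R) :
    ∃ C : ℝ, ∀ r : ℕ, ∀ t ∈ nthRootsFinset (p ^ (r + 1) - 1) (1 : L),
      ‖charSum π n φ (r + 1) t‖ ^ (2 * m) ≤ (r + 1) * (C * R ^ (r + 1)) := by
  have hp1 : (1 : ℝ) < p := by exact_mod_cast hp.out.one_lt
  have hcard : Fintype.card (Fin (2 * m)) = 2 * m := Fintype.card_fin _
  let S : ℕ → ℚ := fun r => (p * #{z ∈ pointSet L p n (Fin (2 * m)) (r + 1) | pointTrace (p := p) π (r + 1) z = 0} -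
    #(pointSet L p n (Fin (2 * m)) (r + 1))) / (p - 1)
  have hS : ∀ r, ∑ z ∈ pointSet L p n (Fin (2 * m)) (r + 1), φ (pointTrace π (r + 1) z) = (S r : ℂ) :=
    fun r => sum_pointSet_eq_ratCast hp17 hπ r.succ_pos hφ
  have hreal : ∀ r (t : L), charSum π n φ (r + 1) t ^ (2 * m) = ((‖charSum π n φ (r + 1) t‖ ^ (2 * m) : ℝ) : ℂ) := by
    intro r t
    obtain ⟨x, hx⟩ := Complex.conj_eq_iff_real.1 (conj_charSum hp17 hπ hne φ r.succ_pos t)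
    rw [hx, Complex.norm_real, Real.norm_eq_abs, (even_two_mul m).pow_abs]
    push_cast
    rfl
  have hSC : ∀ r, (S r : ℝ) = ∑ t ∈ nthRootsFinset (p ^ (r + 1) - 1) (1 : L),
      ‖charSum π n φ (r + 1) t‖ ^ (2 * m) := by
    intro r
    have h := sum_charSum_pow (L := L) (n := n) (H := Fin (2 * m)) π φ (r + 1)
    rw [hS, hcard, sum_congr rfl fun t _ => hreal r t] at h
    exact_mod_cast h.symm
  have hS0 : ∀ r, 0 ≤ S r := fun r => by
    have : (0 : ℝ) ≤ S r := by
      rw [hSC]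
      positivity
    exact_mod_cast this
  have hSB : ∀ r, (S r : ℝ) ≤ ((p : ℝ) ^ (2 * m * n + 1 + (m * (n - 1) + 1))) ^ (r + 1) := by
    intro r
    have h1 : (S r : ℝ) ≤ #(pointSet L p n (Fin (2 * m)) (r + 1)) := by
      have h2 : (#{z ∈ pointSet L p n (Fin (2 * m)) (r + 1) | pointTrace (p := p) π (r + 1) z = 0} : ℝ) ≤
          #(pointSet L p n (Fin (2 * m)) (r + 1)) := Nat.cast_le.2 (card_filter_le _ _)
      simp only [S]
      push_cast
      rw [div_le_iff₀ (by linarith)]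
      nlinarith
    refine h1.trans ((card_pointSet_le r).trans ?_)
    rw [hcard]
    exact pow_le_pow_left₀ (by positivity) (pow_le_pow_right₀ hp1.le (by omega)) _
  have hInt : ∀ s, ∃ N : ℤ, newtonSeq (fun r => -S r) s = N := exists_int_newtonSeq_neg fun s => by
    simp only [← hS]
    exact isIntegral_newtonSeq_pointSet hp17 hπ φ s
  have hn0 := NeZero.pos n
  have hζ := isPrimitiveRoot_evalSeries_dworkSeries (L := L) hp17 hπ
  let φL : AddChar (ZMod p) L := AddChar.zmodChar p hζ.pow_eq_one
  have hO := overconv_frobSeries hp17 hπ hn0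
  have htr : ∀ r, ((p : K) ^ (r + 1) - 1) * kernelTrace (frobKernel p fun i =>
      (tensorMat (Fin (2 * m)) (frobSeries p π n)).map (PowerSeries.coeff i)) r = (S r : K) := by
    intro r
    have hSL : ∑ z ∈ pointSet L p n (Fin (2 * m)) (r + 1), φL (pointTrace π (r + 1) z) = (S r : L) :=
      sum_pointSet_eq_ratCast hp17 hπ r.succ_pos (AddChar.zmodChar_primitive_of_primitive_root p hζ)
    refine (algebraMap K L).injective ?_
    have h1 := sum_pow_mul_trace_evalMat (L := L) (p := p) (overconv_tensorMat (H := Fin (2 * m)) hO) r 0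
    have h2 : algebraMap K L ((p : K) ^ (r + 1) - 1) = ((p ^ (r + 1) - 1 : ℕ) : L) := by
      rw [Nat.cast_sub (Nat.one_le_pow _ _ hp.out.pos)]
      simp
    simp only [add_zero] at h1
    rw [map_mul, h2, kernelTrace, ← h1, map_ratCast,
      ← hSL, ← sum_charSum_pow]
    refine sum_congr rfl fun t ht => ?_
    rw [pow_zero, one_mul, frobIter_tensorMat, evalMat_tensorMat (overconv_frobIter _ hO r)
      (norm_le_one_of_mem_nthRootsFinset r.succ_pos ht), trace_tensorMat, trace_evalMat_frobSeries hp17 hπ hn0 hne r ht,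
      klSum_eq_charSum hp17 hπ n r.succ_pos (φ := φL) (fun a => AddChar.zmodChar_apply _ _), hcard,
      (even_two_mul m).neg_pow]
  have hΛ : PowerSeries.mk (newtonSeq fun r => -(S r : K)) * rescale (p : K) (fredholm (frobKernel p fun i =>
      (tensorMat (Fin (2 * m)) (frobSeries p π n)).map (PowerSeries.coeff i))) = fredholm (frobKernel p fun i =>
      (tensorMat (Fin (2 * m)) (frobSeries p π n)).map (PowerSeries.coeff i)) := by
    rw [fredholm, rescale_mk_newtonSeq, ← mk_newtonSeq_add]
    congr 2
    funext r
    rw [← htr]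
    ring
  obtain ⟨C, hC⟩ := powerSum_le_of_padic_growth (K := K) p hS0 (c := m * (n - 1))
    (pow_lt_pow_right₀ hp1 (by omega)) hSB hInt (fun ε hε => exists_growthLE_of_fredholm hp17 hπ hn hω
      (by rw [hcard]; ring) hτ hΛ hε) hR
  refine ⟨C, fun r t ht => le_trans ?_ (hC r)⟩
  rw [hSC]
  exact single_le_sum (f := fun t => ‖charSum π n φ (r + 1) t‖ ^ (2 * m)) (fun _ _ => by positivity) ht

end Points

section PowerSums

variable {k : Type*} [Field k] [CharZero k]

theorem newtonSeq_injective : Function.Injective (newtonSeq : (ℕ → k) → ℕ → k) := by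
  intro τ τ' h
  have h1 := derivative_mk_newtonSeq τ
  rw [h, derivative_mk_newtonSeq τ', neg_inj] at h1
  have h0 : PowerSeries.mk (newtonSeq τ') ≠ 0 := fun h => by
    have := congrArg (PowerSeries.coeff 0) h
    simp [newtonSeq_zero] at this
  have h2 := mul_right_cancel₀ h0 h1
  funext r
  simpa using (congrArg (PowerSeries.coeff r) h2).symm

theorem exists_powerSum_of_newtonSeq_eq_zero [IsAlgClosed k] {β : ℕ → k} {n : ℕ} (hβ : ∀ s, n < s → newtonSeq β s = 0) :
    ∃ d ≤ n, ∃ α : Fin d → k, ∀ r, β r = ∑ i, α i ^ (r + 1) := by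
  set f : Polynomial k := ∑ s ∈ range (n + 1), Polynomial.monomial s (newtonSeq β s) with hf
  have hcoeff : ∀ s, f.coeff s = newtonSeq β s := by
    intro s
    rw [hf, finsetSum_coeff]
    simp only [Polynomial.coeff_monomial, sum_ite_eq', mem_range]
    split_ifs with h
    · rfl
    · exact (hβ s (by omega)).symm
  have hf0 : f.eval 0 = 1 := by rw [← coeff_zero_eq_eval_zero, hcoeff, newtonSeq_zero]
  obtain ⟨d, z, hd⟩ : ∃ d, ∃ z : Fin d → k, f.roots = (univ : Finset (Fin d)).val.map z :=
    ⟨_, f.roots.toList.get, by rw [Fin.univ_val_map, List.ofFn_get, Multiset.coe_toList]⟩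
  have hz : ∀ i, z i ≠ 0 := by
    intro i h0
    have h : z i ∈ f.roots := hd ▸ Multiset.mem_map_of_mem z (mem_univ_val i)
    rw [h0] at h
    rw [(Polynomial.mem_roots'.1 h).2] at hf0
    exact zero_ne_one hf0
  have hprod : f = ∏ i, (1 - Polynomial.C (z i)⁻¹ * Polynomial.X) := by
    have h1 : f = Polynomial.C f.leadingCoeff * ∏ i, (Polynomial.X - Polynomial.C (z i)) := by
      conv_lhs => rw [(IsAlgClosed.splits f).eq_prod_roots, hd, Multiset.map_map]
      rfl
    have h2 : ∀ i, Polynomial.X - Polynomial.C (z i) =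
        Polynomial.C (-z i) * (1 - Polynomial.C (z i)⁻¹ * Polynomial.X) := fun i => by
      rw [mul_sub, ← mul_assoc, ← C_mul, neg_mul, mul_inv_cancel₀ (hz i)]
      simp only [map_neg, map_one]
      ring
    rw [prod_congr rfl fun i _ => h2 i, prod_mul_distrib, ← map_prod, ← mul_assoc, ← C_mul] at h1
    have h3 := congrArg (eval 0) h1
    rw [hf0, eval_mul, eval_C, eval_prod] at h3
    simp only [eval_sub, eval_one, eval_mul, eval_X, mul_zero, sub_zero,
      prod_const_one, mul_one] at h3
    rwa [← h3, Polynomial.C_1, one_mul] at h1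
  let A : Matrix (Fin d) (Fin d) k := diagonal fun i => (z i)⁻¹
  have hA : A.charpolyRev = f := by
    have h1 : (1 - (Polynomial.X : Polynomial k) • A.map Polynomial.C) =
        diagonal fun i => 1 - Polynomial.C (z i)⁻¹ * Polynomial.X := by
      rw [Matrix.diagonal_map (map_zero _), ← Matrix.diagonal_one, ← Matrix.diagonal_smul, Matrix.diagonal_sub]
      congr 1
      funext i
      change 1 - Polynomial.X * Polynomial.C (z i)⁻¹ = _
      rw [mul_comm]
    rw [charpolyRev, h1, det_diagonal, ← hprod]
  refine ⟨d, ?_, fun i => (z i)⁻¹, fun r => ?_⟩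
  · have h := Polynomial.card_roots' f
    rw [hd, Multiset.card_map, card_val, card_univ, Fintype.card_fin] at h
    exact h.trans (Polynomial.natDegree_le_iff_coeff_eq_zero.2 fun s hs => by rw [hcoeff, hβ s hs])
  · have h : newtonSeq β = newtonSeq fun r => (A ^ (r + 1)).trace := by
      funext s
      rw [← coeff_charpolyRev_eq_newtonSeq, hA, hcoeff]
    rw [congrFun (newtonSeq_injective h) r, Matrix.diagonal_pow, Matrix.trace_diagonal]
    rfl

theorem norm_le_of_powerSum_le {β : ℕ → ℂ} {d : ℕ} {α : Fin d → ℂ} (hβ : ∀ r, β r = ∑ i, α i ^ (r + 1)) {M : ℕ}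
    (hM : M ≠ 0) {C R : ℝ} (hR : 0 ≤ R) (hC : ∀ r : ℕ, ‖β r‖ ^ M ≤ (r + 1) * (C * R ^ (r + 1))) (j : Fin d) :
    ‖α j‖ ^ M ≤ R := by
  classical
  by_contra! hlt
  obtain ⟨z, hz⟩ : ∃ z, α j = z := ⟨_, rfl⟩
  rw [hz] at hlt
  have hz0 : z ≠ 0 := by
    rintro rfl
    rw [norm_zero, zero_pow hM] at hlt
    exact absurd hR (not_le.2 hlt)
  have hzM : 0 < ‖z‖ ^ M := by positivity
  have hlim : Tendsto (fun r => β r / z ^ (r + 1)) atTop (nhds 0) := by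
    have h1 : Tendsto (fun r => ‖β r / z ^ (r + 1)‖ ^ M) atTop (nhds 0) := by
      have h2 := ((tendsto_self_mul_const_pow_of_lt_one (div_nonneg hR hzM.le) ((div_lt_one hzM).2 hlt)).comp
        (tendsto_add_atTop_nat 1)).const_mul C
      rw [mul_zero] at h2
      refine squeeze_zero (fun _ => by positivity) (fun r => ?_) h2
      rw [norm_div, norm_pow, div_pow, ← pow_mul, mul_comm (r + 1) M, pow_mul, div_le_iff₀ (by positivity)]
      refine (hC r).trans (le_of_eq ?_)
      simp only [Function.comp_apply]
      push_cast
      rw [div_pow]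
      field_simp
    have h3 := h1.rpow_const (p := (M : ℝ)⁻¹) (Or.inr (by positivity))
    rw [Real.zero_rpow (by positivity)] at h3
    refine tendsto_zero_iff_norm_tendsto_zero.2 (h3.congr fun r => ?_)
    exact Real.pow_rpow_inv_natCast (norm_nonneg _) hM
  let P : Polynomial ℂ := ∏ w ∈ (univ.image α).erase z, (Polynomial.X - Polynomial.C w)
  have hP : ∀ i, α i ≠ z → P.eval (α i) = 0 := fun i hne => by
    rw [eval_prod]
    exact prod_eq_zero (mem_erase.2 ⟨hne, mem_image_of_mem α (mem_univ i)⟩) (by simp)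
  have hPz : P.eval z ≠ 0 := by
    rw [eval_prod]
    refine prod_ne_zero_iff.2 fun w hw => ?_
    simpa [sub_eq_zero] using (ne_of_mem_erase hw).symm
  have hkey : ∀ r, ∑ e ∈ range (P.natDegree + 1), P.coeff e * z ^ e * (β (r + e) / z ^ (r + e + 1)) =
      #{i | α i = z} * P.eval z := by
    intro r
    have h1 : ∀ e, P.coeff e * z ^ e * (β (r + e) / z ^ (r + e + 1)) =
        ∑ i, P.coeff e * α i ^ e * (α i ^ (r + 1) / z ^ (r + 1)) := by
      intro e
      rw [hβ, sum_div, mul_sum]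
      refine sum_congr rfl fun i _ => ?_
      field_simp
      ring
    rw [sum_congr rfl fun i _ => h1 i, sum_comm, card_filter, Nat.cast_sum, sum_mul]
    refine sum_congr rfl fun i _ => ?_
    rw [← sum_mul, ← Polynomial.eval_eq_sum_range]
    split_ifs with h
    · rw [h, div_self (pow_ne_zero _ hz0), Nat.cast_one, one_mul, mul_one]
    · rw [hP i h, zero_mul, Nat.cast_zero, zero_mul]
  have hlim2 := tendsto_finsetSum (range (P.natDegree + 1)) fun i _ =>
    ((hlim.comp (tendsto_add_atTop_nat i)).const_mul (P.coeff i * z ^ i))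
  simp only [Function.comp_apply, hkey, mul_zero, sum_const_zero] at hlim2
  have h4 := tendsto_nhds_unique tendsto_const_nhds hlim2
  rcases mul_eq_zero.1 h4 with h5 | h5
  · exact (card_pos.2 ⟨j, mem_filter.2 ⟨mem_univ j, hz⟩⟩).ne' (Nat.cast_eq_zero.1 h5)
  · exact hPz h5

end PowerSums

section Bound

variable {L : Type*} [NormedField L] [NormedAlgebra K L] [CompleteSpace L]
  [IsAlgClosed L] [CharZero L] [IsUltrametricDist L] {n : ℕ}

theorem map_charSum {F F' : Type*} [Field F] [Field F'] (f : F →+* F') {φ : AddChar (ZMod p) F} {φ' : AddChar (ZMod p) F'}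
    (h : ∀ a, f (φ a) = φ' a) (r : ℕ) (t : L) : f (charSum π n φ r t) = charSum π n φ' r t := by
  simp only [charSum, map_sum, map_prod, h]

theorem eval₂_cyclotomic_eq_zero {F : Type*} [Field F] [CharZero F] {z : F} (hz : IsPrimitiveRoot z p) :
    Polynomial.eval₂ (algebraMap ℚ F) z (cyclotomic p ℚ) = 0 := by
  rw [← Polynomial.eval_map, Polynomial.map_cyclotomic]
  exact hz.isRoot_cyclotomic hp.out.pos

theorem mem_nthRootsFinset_of_pow {a : L} (ha : a ^ (p - 1) = 1) (r : ℕ) :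
    a ∈ nthRootsFinset (p ^ (r + 1) - 1) (1 : L) := by
  rw [← mul_one a]
  exact mul_mem_nthRootsFinset_of_pow ha r.succ_pos
    ((mem_nthRootsFinset (prime_pow_sub_one_pos p r) 1).2 (one_pow _))

theorem newtonSeq_charSum_eq_zero (hp17 : 17 ≤ p) (hπ : π ^ (p - 1) = -p) (hn : 0 < n)
    (hne : _root_.Even n) {ξ : ℂ} (hξ : IsPrimitiveRoot ξ p) {a : L} (ha : a ^ (p - 1) = 1) {s : ℕ} (hs : n < s) :
    newtonSeq (fun r => -charSum π n (AddChar.zmodChar p hξ.pow_eq_one) (r + 1) a) s = 0 := by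
  have hζ := isPrimitiveRoot_evalSeries_dworkSeries (L := L) hp17 hπ
  have : Fact (Irreducible (cyclotomic p ℚ)) := ⟨cyclotomic.irreducible_rat hp.out.pos⟩
  let E := AdjoinRoot (cyclotomic p ℚ)
  let f : E →+* L := AdjoinRoot.lift (algebraMap ℚ L) _ (eval₂_cyclotomic_eq_zero hζ)
  have hf : f (AdjoinRoot.root _) = evalSeries (dworkSeries p π) (1 : L) := AdjoinRoot.lift_root _
  let g : E →+* ℂ := AdjoinRoot.lift (algebraMap ℚ ℂ) ξ (eval₂_cyclotomic_eq_zero hξ)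
  have hg : g (AdjoinRoot.root _) = ξ := AdjoinRoot.lift_root _
  have hE : (AdjoinRoot.root (cyclotomic p ℚ)) ^ p = 1 := g.injective (by
    rw [map_pow, hg, hξ.pow_eq_one, map_one])
  let φ : AddChar (ZMod p) E := AddChar.zmodChar p hE
  have hgφ := map_charSum (L := L) (π := π) (n := n) g (φ := φ) (φ' := AddChar.zmodChar p hξ.pow_eq_one) fun a => by
    rw [AddChar.zmodChar_apply, AddChar.zmodChar_apply, map_pow, hg]
  have hfφ := map_charSum (L := L) (π := π) (n := n) f (φ := φ) (φ' := AddChar.zmodChar p hζ.pow_eq_one) fun a => by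
    rw [AddChar.zmodChar_apply, AddChar.zmodChar_apply, map_pow, hf]
  have hp1 : p - 1 ≠ 0 := by omega
  have ha1 : ‖a‖ ≤ 1 := (pow_eq_one_iff_of_nonneg (norm_nonneg a) hp1).1 (by rw [← norm_pow, ha, norm_one]) |>.le
  have hap : a ^ p = a := by rw [← Nat.sub_add_cancel hp.out.one_le, pow_succ, ha, one_mul]
  have hO := overconv_frobSeries hp17 hπ hn
  have hiter : ∀ r, evalMat (frobIter hp.out.ne_zero (frobSeries p π n) r) a = evalMat (frobSeries p π n) a ^ (r + 1) := by
    intro r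
    induction r with
    | zero => rw [zero_add, pow_one]; rfl
    | succ r ih => rw [evalMat_frobIter_succ hp.out.ne_zero hO r ha1, hap, ih, ← pow_succ]
  have h1 : newtonSeq (fun r => -charSum π n (AddChar.zmodChar p hζ.pow_eq_one) (r + 1) a) s = 0 := by
    have h2 := coeff_charpolyRev_eq_newtonSeq (evalMat (frobSeries p π n) a) s
    rw [coeff_eq_zero_of_natDegree_lt] at h2
    · rw [h2]
      congr 1
      funext r
      rw [← hiter, trace_evalMat_frobSeries hp17 hπ hn hne r (mem_nthRootsFinset_of_pow ha r),
        klSum_eq_charSum hp17 hπ n r.succ_pos fun a => AddChar.zmodChar_apply hζ.pow_eq_one a]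
    · rw [← reverse_charpoly]
      refine (Polynomial.reverse_natDegree_le _).trans_lt ?_
      rwa [charpoly_natDegree_eq_dim, Fintype.card_fin]
  have h2 : newtonSeq (fun r => -charSum π n φ (r + 1) a) s = 0 := f.injective (by
    rw [map_newtonSeq, map_zero]
    simpa only [map_neg, hfφ] using h1)
  have h3 := congrArg g h2
  rw [map_newtonSeq, map_zero] at h3
  simpa only [map_neg, hgφ] using h3

theorem norm_charSum_le [ProperSpace K] [NeZero n] (hp17 : 17 ≤ p) (hπ : π ^ (p - 1) = -p)
    (hne : _root_.Even n) (hn : ¬ p ∣ n) {ω : K} (hω : IsPrimitiveRoot ω n) {τ : K} (hτ : τ ^ p = π ^ (3 * n))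
    {ξ : ℂ} (hξ : IsPrimitiveRoot ξ p) {a : L} (ha : a ^ (p - 1) = 1) :
    ‖charSum π n (AddChar.zmodChar p hξ.pow_eq_one) 1 a‖ ≤ n * (p : ℝ) ^ (((n : ℝ) - 1) / 2) := by
  have hp1 : (1 : ℝ) < p := by exact_mod_cast hp.out.one_lt
  have hn0 := NeZero.pos n
  obtain ⟨d, hd, α, hα⟩ := exists_powerSum_of_newtonSeq_eq_zero fun s => newtonSeq_charSum_eq_zero hp17 hπ hn0 hne hξ ha (s := s)
  have hm : ∀ m : ℕ, ‖charSum π n (AddChar.zmodChar p hξ.pow_eq_one) 1 a‖ ≤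
      n * (p : ℝ) ^ (((n : ℝ) - 1) / 2 + 1 / ((m : ℝ) + 1)) := by
    intro m
    obtain ⟨C, hC⟩ := exists_norm_charSum_pow_le (L := L) hp17 hπ hne hn hω hτ
      (AddChar.zmodChar_primitive_of_primitive_root p hξ) (m + 1)
      (pow_lt_pow_right₀ hp1 (Nat.lt_succ_self ((m + 1) * (n - 1) + 1)))
    have h1 : ∀ i, ‖α i‖ ≤ (p : ℝ) ^ (((n : ℝ) - 1) / 2 + 1 / ((m : ℝ) + 1)) := by
      intro i
      have h2 := norm_le_of_powerSum_le (R := (p : ℝ) ^ ((m + 1) * (n - 1) + 2)) hα (show 2 * (m + 1) ≠ 0 by omega) (by positivity) (fun r => by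
        rw [norm_neg]
        exact hC r a (mem_nthRootsFinset_of_pow ha r)) i
      refine le_of_pow_le_pow_left₀ (show 2 * (m + 1) ≠ 0 by omega) (by positivity) (h2.trans (le_of_eq ?_))
      rw [← Real.rpow_natCast, ← Real.rpow_natCast, ← Real.rpow_mul (by positivity)]
      congr 1
      push_cast [Nat.cast_sub (show 1 ≤ n from hn0)]
      field_simp
    have h3 := hα 0
    simp only [zero_add, pow_one] at h3
    rw [← norm_neg, h3]
    refine (norm_sum_le_of_le _ fun i _ => h1 i).trans ?_
    rw [sum_const, card_univ, Fintype.card_fin, nsmul_eq_mul]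
    gcongr
  have hlim : Tendsto (fun m : ℕ => (n : ℝ) * (p : ℝ) ^ (((n : ℝ) - 1) / 2 + 1 / ((m : ℝ) + 1))) atTop
      (nhds (n * (p : ℝ) ^ (((n : ℝ) - 1) / 2 + 0))) :=
    ((Real.continuousAt_const_rpow (by positivity)).tendsto.comp
      (tendsto_one_div_add_atTop_nhds_zero_nat.const_add _)).const_mul _
  rw [add_zero] at hlim
  exact ge_of_tendsto' hlim hm

end Bound

section Teichmuller

variable {L : Type*} [NormedField L] [NormedAlgebra K L] [CompleteSpace L] [IsAlgClosed L]
  [CharZero L] [IsUltrametricDist L]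

open scoped Classical in
/-- The Teichmüller lift of the units modulo `p`, characterized through the trace. -/
theorem exists_teichmuller_hom (hp17 : 17 ≤ p) (hπ : π ^ (p - 1) = -p) :
    ∃ T : (ZMod p)ˣ →* L, Function.Injective T ∧ univ.image T = nthRootsFinset (p ^ 1 - 1) (1 : L) ∧
      ∀ u, dworkTrace p π 1 (T u) = u := by
  have hu : ∀ u : (ZMod p)ˣ, ¬ p ∣ (u : ZMod p).val := fun u h => u.ne_zero <| by
    rw [← ZMod.natCast_zmod_val (u : ZMod p), (ZMod.natCast_eq_zero_iff _ _).2 h]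
  choose T hT hTb using fun u => exists_teichmuller (L := L) K (hu u)
  have hmem : ∀ u, T u ∈ nthRootsFinset (p ^ 1 - 1) (1 : L) := fun u => mem_nthRootsFinset_of_pow (hT u) 0
  have h1 : dworkTrace p π 1 (1 : L) = 1 := by
    have := dworkTrace_eq_of_pow (b := 1) hp17 hπ 1 (x := (1 : L)) (by simp) (by simp) (by simp [dworkChar])
    simpa using this
  have htr : ∀ u, dworkTrace p π 1 (T u) = u := fun u => by
    have := dworkTrace_mul hp17 hπ 1 (x := (1 : L)) (by simp) (by simp) (hT u) (hTb u)
    simpa [h1] using this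
  have hmul : ∀ u v, dworkTrace p π 1 (T u * T v) = (u * v : (ZMod p)ˣ) := fun u v => by
    have := dworkTrace_mul hp17 hπ 1 (norm_le_one_of_mem_nthRootsFinset one_pos (hmem v))
      ((mem_nthRootsFinset_iff_frobenius one_pos).1 (hmem v)).2 (hT u) (hTb u)
    simpa [htr] using this
  have hinj : Function.Injective T := fun u v h => Units.ext (by rw [← htr u, h, htr])
  have himg : univ.image T = nthRootsFinset (p ^ 1 - 1) (1 : L) := by
    have : NeZero (p ^ 1 - 1) := ⟨by rw [pow_one]; omega⟩
    refine eq_of_subset_of_card_le (fun x hx => ?_) ?_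
    · obtain ⟨u, -, rfl⟩ := mem_image.1 hx
      exact hmem u
    · rw [card_nthRootsFinset_one, card_image_of_injective _ hinj, card_univ, ZMod.card_units, pow_one]
  have hTmul : ∀ u v, T (u * v) = T u * T v := fun u v => by
    have h : T u * T v ∈ univ.image T := by
      rw [himg]
      exact mul_mem_nthRootsFinset_of_pow (hT u) one_pos (hmem v)
    obtain ⟨w, -, hw⟩ := mem_image.1 h
    rw [← hw, show u * v = w from Units.ext (by rw [← hmul, ← hw, htr])]
  refine ⟨{ toFun := T, map_mul' := hTmul, map_one' := ?_ }, hinj, himg, htr⟩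
  have h0 : T 1 ≠ 0 := ((mem_nthRootsFinset_iff_frobenius one_pos).1 (hmem 1)).1
  exact mul_left_cancel₀ h0 (by rw [← hTmul, mul_one, mul_one])

theorem exists_charSum_eq (hp17 : 17 ≤ p) (hπ : π ^ (p - 1) = -p) {F : Type*} [Field F]
    (φ : AddChar (ZMod p) F) (n : ℕ) (b : (ZMod p)ˣ) :
    ∃ a : L, a ^ (p - 1) = 1 ∧
      charSum π n φ 1 a = ∑ x : Fin n → (ZMod p)ˣ with ∏ i, x i = b, ∏ i, φ (x i) := by
  classical
  obtain ⟨T, hinj, himg, htr⟩ := exists_teichmuller_hom (L := L) hp17 hπ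
  refine ⟨T b, by rw [← map_pow, ZMod.units_pow_card_sub_one_eq_one, map_one], ?_⟩
  symm
  refine sum_bij (fun x _ i => T (x i)) (fun x hx => ?_) (fun x _ y _ h => ?_) (fun y hy => ?_) fun x _ => ?_
  · simp only [mem_filter, mem_univ, true_and, mem_piFinset, ← himg] at hx ⊢
    exact ⟨fun i => mem_image_of_mem _ (mem_univ _), by rw [← map_prod, hx]⟩
  · exact funext fun i => hinj (congrFun h i)
  · simp only [mem_filter, mem_piFinset, ← himg, mem_image, mem_univ, true_and] at hy
    choose x hx using hy.1
    refine ⟨x, ?_, funext hx⟩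
    rw [mem_filter]
    exact ⟨mem_univ _, hinj (by rw [map_prod, ← hy.2, prod_congr rfl fun i _ => hx i])⟩
  · simp only [htr]

end Teichmuller

/-- Deligne's bound for hyper-Kloosterman sums in an even number of variables. -/
theorem norm_hyperKloosterman_le (hp17 : 17 ≤ p) {n : ℕ} (hn0 : 0 < n) (hne : _root_.Even n) (hn : ¬ p ∣ n)
    {ξ : ℂ} (hξ : IsPrimitiveRoot ξ p) (b : (ZMod p)ˣ) :
    ‖∑ x : Fin n → (ZMod p)ˣ with ∏ i, x i = b, ∏ i, AddChar.zmodChar p hξ.pow_eq_one (x i)‖ ≤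
      n * (p : ℝ) ^ (((n : ℝ) - 1) / 2) := by
  have : NeZero n := ⟨hn0.ne'⟩
  obtain ⟨ω₀, hω₀⟩ := HasEnoughRootsOfUnity.exists_primitiveRoot (PadicAlgCl p) n
  obtain ⟨ϖ₀, hϖ₀⟩ := IsAlgClosed.exists_pow_nat_eq (-(p : PadicAlgCl p))
    (show 0 < p * (p - 1) from Nat.mul_pos hp.out.pos (by omega))
  let E := IntermediateField.adjoin ℚ_[p] ({ω₀, ϖ₀} : Set (PadicAlgCl p))
  have : FiniteDimensional ℚ_[p] E := IntermediateField.finiteDimensional_adjoin fun x _ =>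
    (Algebra.IsAlgebraic.isAlgebraic (R := ℚ_[p]) x).isIntegral
  let ω : E := ⟨ω₀, IntermediateField.subset_adjoin _ _ (by simp)⟩
  let ϖ : E := ⟨ϖ₀, IntermediateField.subset_adjoin _ _ (by simp)⟩
  have hϖ : ϖ ^ (p * (p - 1)) = -(p : E) := Subtype.ext (by simpa [ϖ] using hϖ₀)
  have hω : IsPrimitiveRoot ω n := IsPrimitiveRoot.of_map_of_injective (f := algebraMap E (PadicAlgCl p)) hω₀
    (algebraMap E (PadicAlgCl p)).injective
  let : NontriviallyNormedField E :=
    { (inferInstance : NormedField E) with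
      non_trivial := by
        obtain ⟨x, hx⟩ := NontriviallyNormedField.non_trivial (α := ℚ_[p])
        exact ⟨algebraMap ℚ_[p] E x, by rwa [norm_algebraMap']⟩ }
  let : NormedAlgebra E (PadicAlgCl p) :=
    { (inferInstance : Algebra E (PadicAlgCl p)) with
      norm_smul_le := fun a b => (norm_mul (a : PadicAlgCl p) b).le }
  let : NormedAlgebra E ℂ_[p] := NormedAlgebra.restrictScalars E (PadicAlgCl p) ℂ_[p]
  have : ProperSpace E := FiniteDimensional.proper ℚ_[p] E
  have hπ : (ϖ ^ p) ^ (p - 1) = -(p : E) := by rw [← pow_mul, hϖ]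
  obtain ⟨a, ha, h⟩ := exists_charSum_eq (L := ℂ_[p]) hp17 hπ (AddChar.zmodChar p hξ.pow_eq_one) n b
  rw [← h]
  exact norm_charSum_le hp17 hπ hne hn hω (τ := ϖ ^ (3 * n)) (by rw [← pow_mul, ← pow_mul, mul_comm]) hξ ha

end Dwork

section RootNumber

theorem eFun_eq_stdAddChar {N : ℕ} [NeZero N] (a : ZMod N) : eFun ((a.val : ℝ) / N) = ZMod.stdAddChar a := by
  have := ZMod.stdAddChar_coe (N := N) (a.val : ℤ)
  rw [Int.cast_natCast, ZMod.natCast_zmod_val] at this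
  rw [this, eFun]
  push_cast
  ring_nf

theorem epsChar_eq_gaussSum {N : ℕ} [NeZero N] (χ : DirichletCharacter ℂ N) :
    epsChar χ = (Real.sqrt N : ℂ)⁻¹ * gaussSum χ ZMod.stdAddChar := by
  simp only [epsChar, gaussSum, eFun_eq_stdAddChar]

theorem norm_gaussSum_sq {N : ℕ} [NeZero N] {χ : DirichletCharacter ℂ N} (hχ : χ.IsPrimitive) :
    ‖gaussSum χ ZMod.stdAddChar‖ ^ 2 = N := by
  have h := congrFun (ZMod.dft_dft (χ : ZMod N → ℂ)) (-1)
  rw [neg_neg, map_one, smul_eq_mul, mul_one] at h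
  have h1 : ZMod.dft (χ : ZMod N → ℂ) = fun k => χ⁻¹ (-k) * gaussSum χ ZMod.stdAddChar :=
    funext fun k => hχ.fourierTransform_eq_inv_mul_gaussSum k
  rw [h1, ZMod.dft_apply] at h
  have h2 : ((‖gaussSum χ ZMod.stdAddChar‖ ^ 2 : ℝ) : ℂ) = N := by
    rw [← h]
    push_cast
    rw [← Complex.conj_mul', ← Complex.star_def, star_gaussSum_eq, gaussSum, sum_mul]
    refine Fintype.sum_equiv (Equiv.neg _) _ _ fun x => ?_
    simp [mul_comm, mul_assoc, AddChar.map_neg_eq_inv]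
  exact_mod_cast h2

theorem norm_epsChar_of_isPrimitive {N : ℕ} [NeZero N] {χ : DirichletCharacter ℂ N} (hχ : χ.IsPrimitive) :
    ‖epsChar χ‖ = 1 := by
  have h0 : 0 < Real.sqrt N := Real.sqrt_pos.2 (by exact_mod_cast NeZero.pos N)
  have h : ‖gaussSum χ ZMod.stdAddChar‖ = Real.sqrt N := by
    rw [← norm_gaussSum_sq hχ, Real.sqrt_sq (norm_nonneg _)]
  rw [epsChar_eq_gaussSum, norm_mul, norm_inv, Complex.norm_real, h, Real.norm_of_nonneg h0.le,
    inv_mul_cancel₀ h0.ne']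

theorem epsChar_prodChar {q D : ℕ} [NeZero q] [NeZero D] (hqD : q.Coprime D) (χ : DirichletCharacter ℂ q)
    (ψ : DirichletCharacter ℂ D) :
    epsChar (prodChar χ ψ) = χ D * (ψ q * epsChar ψ) * epsChar χ := by
  have hq0 : (q : ℂ) ≠ 0 := by exact_mod_cast NeZero.ne q
  have hD0 : (D : ℂ) ≠ 0 := by exact_mod_cast NeZero.ne D
  let f : ZMod q × ZMod D → ZMod (q * D) := fun z => ((D * z.1.val + q * z.2.val : ℕ) : ZMod (q * D))
  have hfq : ∀ z, (f z).cast = (D : ZMod q) * z.1 := fun z => by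
    simp only [f]
    rw [ZMod.cast_natCast (dvd_mul_right q D)]
    simp
  have hfD : ∀ z, (f z).cast = (q : ZMod D) * z.2 := fun z => by
    simp only [f]
    rw [ZMod.cast_natCast (dvd_mul_left D q)]
    simp
  have hDu : IsUnit (D : ZMod q) := (ZMod.isUnit_iff_coprime _ _).2 hqD.symm
  have hqu : IsUnit (q : ZMod D) := (ZMod.isUnit_iff_coprime _ _).2 hqD
  have hf : Function.Bijective f := by
    refine (Fintype.bijective_iff_injective_and_card f).2 ⟨fun z w h => Prod.ext ?_ ?_, by simp [ZMod.card]⟩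
    · exact hDu.mul_left_cancel (by rw [← hfq, h, hfq])
    · exact hqu.mul_left_cancel (by rw [← hfD, h, hfD])
  have hval : ∀ z, prodChar χ ψ (f z) = χ (D * z.1) * ψ (q * z.2) := fun z => by
    have h1 : ∀ m : ℕ, prodChar χ ψ m = χ m * ψ m := fun m => by
      by_cases hm : m.Coprime (q * D)
      · have hm' : IsCoprime (m : ℤ) (q * D : ℕ) := Nat.isCoprime_iff_coprime.2 hm
        have hχ := changeLevel_eq_cast_of_dvd' χ (dvd_mul_right q D) hm'
        have hψ := changeLevel_eq_cast_of_dvd' ψ (dvd_mul_left D q) hm'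
        rw [prodChar, MulChar.mul_apply]
        simpa using congrArg₂ (· * ·) hχ hψ
      · rw [MulChar.map_nonunit _ (mt (ZMod.isUnit_iff_coprime _ _).1 hm)]
        rw [Nat.coprime_mul_iff_right, not_and_or] at hm
        rcases hm with hm | hm
        · rw [MulChar.map_nonunit χ (mt (ZMod.isUnit_iff_coprime _ _).1 hm), zero_mul]
        · rw [MulChar.map_nonunit ψ (mt (ZMod.isUnit_iff_coprime _ _).1 hm), mul_zero]
    rw [h1, ← hfq, ← hfD, ZMod.cast_natCast (dvd_mul_right q D), ZMod.cast_natCast (dvd_mul_left D q)]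
  have hadd : ∀ z, ZMod.stdAddChar (f z) = ZMod.stdAddChar z.1 * ZMod.stdAddChar z.2 := fun z => by
    rw [← eFun_eq_stdAddChar z.1, ← eFun_eq_stdAddChar z.2]
    have := ZMod.stdAddChar_coe (N := q * D) (D * z.1.val + q * z.2.val : ℕ)
    rw [Int.cast_natCast] at this
    rw [this, eFun, eFun, ← Complex.exp_add]
    congr 1
    push_cast
    field_simp
  rw [epsChar_eq_gaussSum, epsChar_eq_gaussSum, epsChar_eq_gaussSum, gaussSum, ← hf.sum_comp]
  simp only [hval, hadd, map_mul]
  rw [Fintype.sum_prod_type, gaussSum, gaussSum, Nat.cast_mul, Real.sqrt_mul (Nat.cast_nonneg q), Complex.ofReal_mul,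
    mul_inv]
  simp only [mul_sum, sum_mul]
  exact sum_congr rfl fun y _ => sum_congr rfl fun x _ => by ring

theorem isPrimitive_iff_ne_one_of_prime {q : ℕ} (hq : q.Prime) (χ : DirichletCharacter ℂ q) : χ.IsPrimitive ↔ χ ≠ 1 := by
  have : NeZero q := ⟨hq.ne_zero⟩
  rw [isPrimitive_def, Ne, eq_one_iff_conductor_eq_one]
  have := (Nat.dvd_prime hq).1 χ.conductor_dvd_level
  have := hq.one_lt
  omega

end RootNumber

section CharacterSums

variable {q : ℕ} [hq : Fact q.Prime]

theorem gaussSum_eq_sum_units (χ : DirichletCharacter ℂ q) (φ : AddChar (ZMod q) ℂ) :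
    gaussSum χ φ = ∑ x : (ZMod q)ˣ, χ x * φ x := by
  rw [gaussSum, ← sum_subset (subset_univ (univ.map ⟨Units.val, Units.val_injective⟩))]
  · rw [sum_map]
    rfl
  · intro x _ hx
    have : ¬ IsUnit x := fun h => hx (mem_map.2 ⟨h.unit, mem_univ _, rfl⟩)
    rw [MulChar.map_nonunit _ this, zero_mul]

theorem sum_apply_mul_gaussSum_pow (φ : AddChar (ZMod q) ℂ) (n : ℕ) (u : (ZMod q)ˣ) :
    ∑ χ : DirichletCharacter ℂ q, χ u * gaussSum χ φ ^ n =
      q.totient * ∑ x : Fin n → (ZMod q)ˣ with ∏ i, x i = u⁻¹, ∏ i, φ (x i) := by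
  have h : ∀ χ : DirichletCharacter ℂ q, χ u * gaussSum χ φ ^ n =
      ∑ x : Fin n → (ZMod q)ˣ, χ ((u * ∏ i, x i : (ZMod q)ˣ) : ZMod q) * ∏ i, φ (x i) := fun χ => by
    rw [gaussSum_eq_sum_units, ← Fin.prod_const, prod_univ_sum, mul_sum, piFinset_univ]
    refine sum_congr rfl fun x _ => ?_
    rw [prod_mul_distrib, Units.val_mul, map_mul, Units.coe_prod, map_prod, mul_assoc]
  simp only [h]
  rw [sum_comm, mul_sum, sum_filter]
  refine sum_congr rfl fun x _ => ?_
  rw [← sum_mul, sum_characters_eq, ite_mul, zero_mul]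
  simp only [Units.val_eq_one, mul_comm u, mul_eq_one_iff_eq_inv]

theorem norm_sum_apply_mul_gaussSum_pow_le (hq17 : 17 ≤ q) {n : ℕ} (hn0 : 0 < n) (hne : _root_.Even n) (hn : ¬ q ∣ n)
    (u : (ZMod q)ˣ) : ‖∑ χ : DirichletCharacter ℂ q, χ u * gaussSum χ ZMod.stdAddChar ^ n‖ ≤
      q.totient * (n * (q : ℝ) ^ (((n : ℝ) - 1) / 2)) := by
  have hξ : IsPrimitiveRoot (ZMod.stdAddChar (1 : ZMod q)) q := by
    have hpow : ∀ l : ℕ, ZMod.stdAddChar (1 : ZMod q) ^ l = ZMod.stdAddChar (l : ZMod q) := fun l => by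
      rw [← AddChar.map_nsmul_eq_pow, nsmul_one]
    refine ⟨by rw [hpow, ZMod.natCast_self, AddChar.map_zero_eq_one], fun l hl => ?_⟩
    rw [hpow, ← AddChar.map_zero_eq_one (ZMod.stdAddChar (N := q))] at hl
    exact (ZMod.natCast_eq_zero_iff _ _).1 (ZMod.injective_stdAddChar hl)
  have he : AddChar.zmodChar q hξ.pow_eq_one = ZMod.stdAddChar := by
    ext x
    rw [AddChar.zmodChar_apply, ← AddChar.map_nsmul_eq_pow, nsmul_one, ZMod.natCast_zmod_val]
  rw [sum_apply_mul_gaussSum_pow, norm_mul, Complex.norm_natCast, ← he]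
  exact mul_le_mul_of_nonneg_left (norm_hyperKloosterman_le hq17 hn0 hne hn hξ u⁻¹) (Nat.cast_nonneg _)

theorem two_mul_sum_even (f : DirichletCharacter ℂ q → ℂ) [DecidablePred fun χ : DirichletCharacter ℂ q => χ (-1) = 1] :
    2 * ∑ χ : DirichletCharacter ℂ q with χ (-1) = 1, f χ = ∑ χ, f χ + ∑ χ, χ (-1) * f χ := by
  rw [← sum_add_distrib, mul_sum, sum_filter]
  refine sum_congr rfl fun χ _ => ?_
  rcases χ.even_or_odd with h | h
  · have h1 : χ (-1) = 1 := h
    rw [if_pos h1, h1]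
    ring
  · have h1 : χ (-1) = -1 := h
    rw [if_neg (by rw [h1]; norm_num), h1]
    ring

theorem card_even_mul_sqrt_le {k : ℕ} (hk : 0 < k) (hqk : q ≤ 16 * k ^ 2)
    [DecidablePred fun χ : DirichletCharacter ℂ q => χ (-1) = 1] :
    ((univ.filter fun χ : DirichletCharacter ℂ q => χ (-1) = 1).card : ℝ) * Real.sqrt q ≤ 2 * k * q.totient := by
  have hk1 : (1 : ℝ) ≤ k := by exact_mod_cast hk
  have hφ : (0 : ℝ) ≤ q.totient := Nat.cast_nonneg _
  rcases hq.out.eq_two_or_odd' with h2 | h2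
  · have h : ((univ.filter fun χ : DirichletCharacter ℂ q => χ (-1) = 1).card : ℝ) ≤ q.totient := by
      have := card_eq_totient_of_hasEnoughRootsOfUnity ℂ q
      rw [Nat.card_eq_fintype_card] at this
      exact_mod_cast this ▸ card_le_univ _
    have hs : Real.sqrt q ≤ 2 * k := Real.sqrt_le_iff.2 ⟨by linarith, by rw [h2]; push_cast; nlinarith⟩
    calc _ ≤ (q.totient : ℝ) * (2 * k) := mul_le_mul h hs (Real.sqrt_nonneg _) hφ
      _ = _ := by ring
  · have h := two_mul_sum_even (q := q) fun _ => 1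
    have hne : (-1 : ZMod q) ≠ 1 := by
      have : Fact (2 < q) := ⟨by have := hq.out.two_le; rcases h2 with ⟨m, rfl⟩; omega⟩
      exact ZMod.neg_one_ne_one
    have hc : (Fintype.card (DirichletCharacter ℂ q) : ℂ) = q.totient := by
      rw [← Nat.card_eq_fintype_card, card_eq_totient_of_hasEnoughRootsOfUnity]
    simp only [mul_one, sum_characters_eq_zero ℂ hne, sum_const, nsmul_eq_mul, card_univ, hc, add_zero] at h
    have h' : 2 * ((univ.filter fun χ : DirichletCharacter ℂ q => χ (-1) = 1).card : ℝ) = q.totient := by exact_mod_cast h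
    have hs : Real.sqrt q ≤ 4 * k := Real.sqrt_le_iff.2 ⟨by linarith, by
      have : (q : ℝ) ≤ 16 * k ^ 2 := by exact_mod_cast hqk
      nlinarith⟩
    rw [← h']
    nlinarith [mul_le_mul_of_nonneg_left hs (Nat.cast_nonneg (α := ℝ)
      (univ.filter fun χ : DirichletCharacter ℂ q => χ (-1) = 1).card)]

end CharacterSums

end HyperKloosterman

end

open HyperKloosterman

open scoped Classical in
/-- `|Σ⁺_{χ mod q} (ε(χ)ε(χψ))^k| ≤ 1/q^k + 2k·φ(q)/q^{1/2}`, where the sum runs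
over primitive even characters mod `q`. -/
theorem abs_sum_eps_pow_le (k : ℕ) (hk : 0 < k)
    (D : ℕ) [NeZero D] (hD : 1 < D) (hDsf : Squarefree D) (hD4 : D % 4 = 1)
    (ψ : DirichletCharacter ℂ D) (hψprim : ψ.IsPrimitive) (hψquad : ψ ^ 2 = 1) (hψ1 : ψ ≠ 1)
    (q : ℕ) [NeZero q] (hq : q.Prime) (hqD : ¬ q ∣ D) :
    ‖∑ χ ∈ Finset.univ.filter
        (fun χ : DirichletCharacter ℂ q => χ.IsPrimitive ∧ χ (-1) = 1),
        (epsChar χ * epsChar (prodChar χ ψ)) ^ k‖ ≤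
      1 / (q : ℝ) ^ k + 2 * k * (Nat.totient q) / Real.sqrt q := by
  have : Fact q.Prime := ⟨hq⟩
  have hq0 : (0 : ℝ) < q := by exact_mod_cast hq.pos
  have hsq : 0 < Real.sqrt q := Real.sqrt_pos.2 hq0
  have hcop : q.Coprime D := (Nat.Prime.coprime_iff_not_dvd hq).2 hqD
  set c := ψ q * epsChar ψ with hc
  have hc1 : ‖c‖ ≤ 1 := by
    rw [hc, norm_mul, norm_epsChar_of_isPrimitive hψprim, mul_one]
    exact ψ.norm_le_one _
  have hterm : ∀ χ : DirichletCharacter ℂ q, epsChar χ * epsChar (prodChar χ ψ) = c * (χ D * epsChar χ ^ 2) := fun χ => by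
    rw [epsChar_prodChar hcop, hc]
    ring
  simp only [hterm]
  have hS : (univ.filter fun χ : DirichletCharacter ℂ q => χ.IsPrimitive ∧ χ (-1) = 1) =
      (univ.filter fun χ : DirichletCharacter ℂ q => χ (-1) = 1).erase 1 := by
    ext χ
    simp [isPrimitive_iff_ne_one_of_prime hq]
  by_cases hqk : q ≤ 16 * k ^ 2
  · have h1 : ‖∑ χ ∈ Finset.univ.filter (fun χ : DirichletCharacter ℂ q => χ.IsPrimitive ∧ χ (-1) = 1),
        (c * (χ D * epsChar χ ^ 2)) ^ k‖ ≤
        ((univ.filter fun χ : DirichletCharacter ℂ q => χ (-1) = 1).card : ℝ) := by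
      refine (norm_sum_le _ _).trans ((Finset.sum_le_card_nsmul _ _ 1 fun χ hχ => ?_).trans ?_)
      · rw [norm_pow, norm_mul, norm_mul (χ _), norm_pow, norm_epsChar_of_isPrimitive (Finset.mem_filter.1 hχ).2.1, one_pow, mul_one]
        exact pow_le_one₀ (by positivity) (mul_le_one₀ hc1 (norm_nonneg _) (χ.norm_le_one _))
      · rw [nsmul_one, hS]
        exact_mod_cast Finset.card_erase_le
    have h2 := (le_div_iff₀ hsq).2 (card_even_mul_sqrt_le (q := q) hk hqk)
    have h3 : 0 < 1 / (q : ℝ) ^ k := by positivity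
    linarith
  · push Not at hqk
    have hk2 : 1 ≤ k ^ 2 := Nat.one_le_pow _ _ hk
    have hDu : IsUnit (D : ZMod q) := (ZMod.isUnit_iff_coprime _ _).2 hcop.symm
    let g : DirichletCharacter ℂ q → ℂ := fun χ => χ ((hDu.unit ^ k : (ZMod q)ˣ) : ZMod q) * gaussSum χ ZMod.stdAddChar ^ (2 * k)
    have hg : ∀ χ : DirichletCharacter ℂ q, (c * (χ D * epsChar χ ^ 2)) ^ k = c ^ k * ((q : ℂ) ^ k)⁻¹ * g χ := fun χ => by
      have : ((Real.sqrt q : ℂ)⁻¹) ^ 2 = (q : ℂ)⁻¹ := by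
        rw [inv_pow, ← Complex.ofReal_pow, Real.sq_sqrt hq0.le, Complex.ofReal_natCast]
      simp only [g]
      rw [epsChar_eq_gaussSum, mul_pow _ (gaussSum _ _), this, Units.val_pow_eq_pow_val, IsUnit.unit_spec, map_pow, pow_mul]
      ring
    have hn : ¬ q ∣ 2 * k := fun h => by
      have := Nat.le_of_dvd (by omega) h
      nlinarith
    have hB := norm_sum_apply_mul_gaussSum_pow_le (q := q) (by omega) (n := 2 * k) (by omega) (even_two_mul k) hn
    have h1 := hB (hDu.unit ^ k)
    have h2 := hB (-(hDu.unit ^ k))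
    have hg1 : g 1 = 1 := by
      have : (ZMod.stdAddChar : AddChar (ZMod q) ℂ) ≠ 1 := fun h =>
        one_ne_zero (α := ZMod q) (ZMod.injective_stdAddChar (by rw [h, AddChar.one_apply, AddChar.one_apply]))
      simp only [g]
      rw [gaussSum_one_left this, MulChar.one_apply_coe]
      simp
    have hE := two_mul_sum_even (q := q) g
    have hneg : ∑ χ : DirichletCharacter ℂ q, χ (-1) * g χ = ∑ χ : DirichletCharacter ℂ q,
        χ ((-(hDu.unit ^ k) : (ZMod q)ˣ) : ZMod q) * gaussSum χ ZMod.stdAddChar ^ (2 * k) :=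
      Finset.sum_congr rfl fun χ _ => by
        rw [Units.val_neg, neg_eq_neg_one_mul (Units.val _), map_mul, mul_assoc]
    set B := (q.totient : ℝ) * (((2 * k : ℕ) : ℝ) * (q : ℝ) ^ ((((2 * k : ℕ) : ℝ) - 1) / 2)) with hBdef
    have hEB : ‖∑ χ : DirichletCharacter ℂ q with χ (-1) = 1, g χ‖ ≤ B := by
      have := congrArg norm hE
      rw [norm_mul, Complex.norm_ofNat, hneg] at this
      linarith [norm_add_le (∑ χ, g χ) (∑ χ : DirichletCharacter ℂ q,
        χ ((-(hDu.unit ^ k) : (ZMod q)ˣ) : ZMod q) * gaussSum χ ZMod.stdAddChar ^ (2 * k))]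
    have hBeq : ((q : ℝ) ^ k)⁻¹ * B = 2 * k * q.totient / Real.sqrt q := by
      rw [hBdef, show ((((2 * k : ℕ) : ℝ) - 1) / 2) = (k : ℝ) - 1 / 2 by push_cast; ring, Real.rpow_sub hq0,
        Real.rpow_natCast, ← Real.sqrt_eq_rpow]
      push_cast
      field_simp
    have h1E : (1 : DirichletCharacter ℂ q) ∈ univ.filter fun χ : DirichletCharacter ℂ q => χ (-1) = 1 :=
      Finset.mem_filter.2 ⟨Finset.mem_univ _, MulChar.one_apply isUnit_one.neg⟩
    simp only [hg]
    rw [← Finset.mul_sum, hS, Finset.sum_erase_eq_sub h1E, hg1, norm_mul, norm_mul, norm_pow, norm_inv, norm_pow,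
      Complex.norm_natCast, ← hBeq]
    calc _ ≤ 1 * ((q : ℝ) ^ k)⁻¹ * (B + 1) := by
          refine mul_le_mul (mul_le_mul_of_nonneg_right (pow_le_one₀ (norm_nonneg _) hc1) (by positivity)) ?_
            (norm_nonneg _) (by positivity)
          exact (norm_sub_le _ _).trans (by rw [norm_one]; linarith)
      _ = _ := by ring
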